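/- Let G be a connected affine algebraic group over ℂ with Lie algebra 𝔤, let G_red be a Levi subgroup of G with Lie algebra 𝔤_red, and let 𝔞 be a finite-dimensional algebraic G-module. Then for every p ≥ 0 there is an isomorphism H^p_alg(G, 𝔞) ≅ H^p(𝔤, 𝔤_red, 𝔞) between the algebraic group cohomology of G with coefficients in 𝔞 and the relative Lie algebra cohomology of the pair (𝔤, 𝔤_red) with coefficients in 𝔞. -/

import Mathlib

noncomputable section

open MvPolynomial

/-- Points of affine `n`-space over `ℂ`. -/
abbrev Pt (n : ℕ) : Type := Fin n → ℂ

/-- A subset of `ℂ^n` is an (affine) algebraic set if it is the common zero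
locus of a set of polynomials. -/
def IsAlgebraicSet {n : ℕ} (V : Set (Pt n)) : Prop :=
  ∃ S : Set (MvPolynomial (Fin n) ℂ), V = {x : Pt n | ∀ p ∈ S, eval x p = 0}

/-- A map `ℂ^n → ℂ^m` is regular (polynomial) on a subset `V ⊆ ℂ^n`. -/
def IsRegularOn {n m : ℕ} (V : Set (Pt n)) (f : Pt n → Pt m) : Prop :=
  ∃ P : Fin m → MvPolynomial (Fin n) ℂ, ∀ x ∈ V, ∀ i, f x i = eval x (P i)

def Pt.left {n m : ℕ} (z : Pt (n + m)) : Pt n := fun i => z (Fin.castAdd m i)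
def Pt.right {n m : ℕ} (z : Pt (n + m)) : Pt m := fun i => z (Fin.natAdd n i)

/-- An affine algebraic group over `ℂ`, realized as an algebraic subset of some
`ℂ^n`, with polynomial multiplication and inversion. -/
structure AffAlgGroup : Type where
  n : ℕ
  carrier : Set (Pt n)
  isAlgebraic : IsAlgebraicSet carrier
  one : Pt n
  one_mem : one ∈ carrier
  mul : Pt n → Pt n → Pt n
  inv : Pt n → Pt n
  mul_mem : ∀ {x y : Pt n}, x ∈ carrier → y ∈ carrier → mul x y ∈ carrier
  inv_mem : ∀ {x : Pt n}, x ∈ carrier → inv x ∈ carrier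
  mul_assoc' : ∀ {x y z : Pt n}, x ∈ carrier → y ∈ carrier → z ∈ carrier →
    mul (mul x y) z = mul x (mul y z)
  one_mul' : ∀ {x : Pt n}, x ∈ carrier → mul one x = x
  mul_one' : ∀ {x : Pt n}, x ∈ carrier → mul x one = x
  inv_mul' : ∀ {x : Pt n}, x ∈ carrier → mul (inv x) x = one
  mul_regular : IsRegularOn
    {z : Pt (n + n) | Pt.left z ∈ carrier ∧ Pt.right z ∈ carrier}
    (fun z => mul (Pt.left z) (Pt.right z))
  inv_regular : IsRegularOn carrier inv

namespace AffAlgGroup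

/-- The group of `ℂ`-points of `G`, as a bundled group. -/
def Gp (G : AffAlgGroup) : Type := {x : Pt G.n // x ∈ G.carrier}

instance (G : AffAlgGroup) : Group G.Gp where
  mul x y := ⟨G.mul x.1 y.1, G.mul_mem x.2 y.2⟩
  one := ⟨G.one, G.one_mem⟩
  inv x := ⟨G.inv x.1, G.inv_mem x.2⟩
  mul_assoc a b c := Subtype.ext (G.mul_assoc' a.2 b.2 c.2)
  one_mul a := Subtype.ext (G.one_mul' a.2)
  mul_one a := Subtype.ext (G.mul_one' a.2)
  inv_mul_cancel a := Subtype.ext (G.inv_mul' a.2)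

/-- The Euclidean (classical) topology on the points of `G`. -/
instance (G : AffAlgGroup) : TopologicalSpace G.Gp :=
  instTopologicalSpaceSubtype

/-- Connectedness of an affine algebraic group: the carrier cannot be divided
into two disjoint relatively (Zariski-)closed pieces. -/
def IsConnected (G : AffAlgGroup) : Prop :=
  ∀ V W : Set (Pt G.n), IsAlgebraicSet V → IsAlgebraicSet W →
    G.carrier ⊆ V ∪ W → G.carrier ∩ (V ∩ W) = ∅ →
    G.carrier ⊆ V ∨ G.carrier ⊆ W

def IsAbelianGrp (G : AffAlgGroup) : Prop :=
  ∀ x ∈ G.carrier, ∀ y ∈ G.carrier, G.mul x y = G.mul y x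

/-- `G` is a torus: it is isomorphic, as an algebraic group, to `(ℂ*)^k`;
the isomorphism and its inverse are required to be given by (Laurent)
polynomials. -/
def IsTorus (G : AffAlgGroup) : Prop :=
  ∃ (k : ℕ) (φ : (Fin k → ℂˣ) → Pt G.n),
    (∀ u, φ u ∈ G.carrier) ∧
    Function.Injective φ ∧
    (∀ x ∈ G.carrier, ∃ u, φ u = x) ∧
    φ (fun _ => 1) = G.one ∧
    (∀ u v, φ (u * v) = G.mul (φ u) (φ v)) ∧
    (∀ i : Fin G.n, ∃ P : MvPolynomial (Fin k ⊕ Fin k) ℂ,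
      ∀ u, φ u i = eval (Sum.elim (fun j => (u j : ℂ)) (fun j => ((u j)⁻¹ : ℂˣ))) P) ∧
    (∀ j : Fin k, ∃ Q : MvPolynomial (Fin G.n) ℂ, ∀ u, (u j : ℂ) = eval (φ u) Q)

end AffAlgGroup

/-- matrix entry access for a point of `ℂ^{m·m}` viewed as an `m × m` matrix -/
def matEntry {m : ℕ} (x : Pt (m * m)) (i j : Fin m) : ℂ := x (finProdFinEquiv (i, j))

/-- matrix multiplication on points of `ℂ^{m·m}` -/
def matMulPt (m : ℕ) (x y : Pt (m * m)) : Pt (m * m) :=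
  fun idx => ∑ k : Fin m,
    matEntry x (finProdFinEquiv.symm idx).1 k * matEntry y k (finProdFinEquiv.symm idx).2

/-- the identity matrix as a point of `ℂ^{m·m}` -/
def idMatPt (m : ℕ) : Pt (m * m) :=
  fun idx => if (finProdFinEquiv.symm idx).1 = (finProdFinEquiv.symm idx).2 then 1 else 0

/-- an upper triangular matrix with `1`'s on the diagonal -/
def IsUnitriangular (m : ℕ) (x : Pt (m * m)) : Prop :=
  (∀ i : Fin m, matEntry x i i = 1) ∧ (∀ i j : Fin m, j < i → matEntry x i j = 0)

/-- `G` is unipotent: it admits a faithful polynomial representation by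
upper triangular unipotent matrices. -/
def AffAlgGroup.IsUnipotent (G : AffAlgGroup) : Prop :=
  ∃ (m : ℕ) (φ : Pt G.n → Pt (m * m)),
    IsRegularOn G.carrier φ ∧
    Set.InjOn φ G.carrier ∧
    (∀ x ∈ G.carrier, IsUnitriangular m (φ x)) ∧
    (∀ x ∈ G.carrier, ∀ y ∈ G.carrier, φ (G.mul x y) = matMulPt m (φ x) (φ y))

/-- A homomorphism of affine algebraic groups: a polynomial map which is
multiplicative on points. -/
structure AlgGroupHom (G H : AffAlgGroup) : Type where
  toFun : Pt G.n → Pt H.n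
  maps_to : ∀ {x : Pt G.n}, x ∈ G.carrier → toFun x ∈ H.carrier
  map_mul : ∀ {x y : Pt G.n}, x ∈ G.carrier → y ∈ G.carrier →
    toFun (G.mul x y) = H.mul (toFun x) (toFun y)
  regular : IsRegularOn G.carrier toFun

/-- An algebraic action of `G` on `A` by group automorphisms. -/
structure AlgAction (G A : AffAlgGroup) : Type where
  act : Pt G.n → Pt A.n → Pt A.n
  maps_to : ∀ {g : Pt G.n} {a : Pt A.n}, g ∈ G.carrier → a ∈ A.carrier →
    act g a ∈ A.carrier
  act_one : ∀ {a : Pt A.n}, a ∈ A.carrier → act G.one a = a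
  act_mul : ∀ {g h : Pt G.n} {a : Pt A.n}, g ∈ G.carrier → h ∈ G.carrier →
    a ∈ A.carrier → act (G.mul g h) a = act g (act h a)
  act_map_mul : ∀ {g : Pt G.n} {a b : Pt A.n}, g ∈ G.carrier → a ∈ A.carrier →
    b ∈ A.carrier → act g (A.mul a b) = A.mul (act g a) (act g b)
  act_bij : ∀ {g : Pt G.n}, g ∈ G.carrier → ∀ a ∈ A.carrier, ∃ b ∈ A.carrier, act g b = a
  regular : IsRegularOn
    {z : Pt (G.n + A.n) | Pt.left z ∈ G.carrier ∧ Pt.right z ∈ A.carrier}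
    (fun z => act (Pt.left z) (Pt.right z))

/-- the trivial action of `G` on `A` -/
def AlgAction.IsTrivial {G A : AffAlgGroup} (ρ : AlgAction G A) : Prop :=
  ∀ g ∈ G.carrier, ∀ a ∈ A.carrier, ρ.act g a = a

/-- An extension `1 → A → E → G → 1` of affine algebraic groups inducing
(via conjugation in `E`) the action `ρ` of `G` on `A`. -/
structure AlgExtension (G A : AffAlgGroup) (ρ : AlgAction G A) : Type where
  E : AffAlgGroup
  i : AlgGroupHom A E
  q : AlgGroupHom E G
  i_inj : Set.InjOn i.toFun A.carrier
  q_surj : ∀ g ∈ G.carrier, ∃ x ∈ E.carrier, q.toFun x = g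
  exact : ∀ x ∈ E.carrier, (q.toFun x = G.one ↔ ∃ a ∈ A.carrier, i.toFun a = x)
  conj_compat : ∀ x ∈ E.carrier, ∀ a ∈ A.carrier,
    E.mul x (E.mul (i.toFun a) (E.inv x)) = i.toFun (ρ.act (q.toFun x) a)

namespace AlgExtension

variable {G A : AffAlgGroup} {ρ : AlgAction G A}

/-- An extension splits if the quotient map admits an algebraic group
theoretic section. -/
def Splits (e : AlgExtension G A ρ) : Prop :=
  ∃ σ : AlgGroupHom G e.E, ∀ g ∈ G.carrier, e.q.toFun (σ.toFun g) = g

/-- Equivalence of extensions (via a morphism over `G` and under `A`;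
such a morphism is automatically an isomorphism). -/
def Equiv (e₁ e₂ : AlgExtension G A ρ) : Prop :=
  ∃ f : AlgGroupHom e₁.E e₂.E,
    (∀ a ∈ A.carrier, f.toFun (e₁.i.toFun a) = e₂.i.toFun a) ∧
    (∀ x ∈ e₁.E.carrier, e₂.q.toFun (f.toFun x) = e₁.q.toFun x)

/-- `e₃` is a Baer sum of `e₁` and `e₂`: there is a regular map from the fiber
product `E₁ ×_G E₂` to `E₃` which is multiplicative, lies over `G` and
restricts to the multiplication `A × A → A` on the kernels.  (This
characterizes the Baer sum up to equivalence.) -/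
def IsBaerSum (e₁ e₂ e₃ : AlgExtension G A ρ) : Prop :=
  ∃ h : Pt (e₁.E.n + e₂.E.n) → Pt e₃.E.n,
    IsRegularOn {z : Pt (e₁.E.n + e₂.E.n) | Pt.left z ∈ e₁.E.carrier ∧
      Pt.right z ∈ e₂.E.carrier ∧ e₁.q.toFun (Pt.left z) = e₂.q.toFun (Pt.right z)} h ∧
    (∀ x ∈ e₁.E.carrier, ∀ y ∈ e₂.E.carrier, e₁.q.toFun x = e₂.q.toFun y →
      h (Fin.append x y) ∈ e₃.E.carrier) ∧
    (∀ x x' y y', x ∈ e₁.E.carrier → x' ∈ e₁.E.carrier → y ∈ e₂.E.carrier →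
      y' ∈ e₂.E.carrier → e₁.q.toFun x = e₂.q.toFun y → e₁.q.toFun x' = e₂.q.toFun y' →
      h (Fin.append (e₁.E.mul x x') (e₂.E.mul y y')) =
        e₃.E.mul (h (Fin.append x y)) (h (Fin.append x' y'))) ∧
    (∀ x ∈ e₁.E.carrier, ∀ y ∈ e₂.E.carrier, e₁.q.toFun x = e₂.q.toFun y →
      e₃.q.toFun (h (Fin.append x y)) = e₁.q.toFun x) ∧
    (∀ a ∈ A.carrier, ∀ b ∈ A.carrier,
      h (Fin.append (e₁.i.toFun a) (e₂.i.toFun b)) = e₃.i.toFun (A.mul a b))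

end AlgExtension

/-- A realization of the abelian group `Ext_alg(G, A)` of equivalence classes
of extensions of `G` by `A` (inducing the action `ρ`), with addition given by
the Baer sum, and zero element the class of split extensions. -/
structure IsExtGroup (G A : AffAlgGroup) (ρ : AlgAction G A)
    (Ext : Type) [AddCommGroup Ext] : Prop where
  exists_cls : ∃ cls : AlgExtension G A ρ → Ext,
    Function.Surjective cls ∧
    (∀ e₁ e₂, cls e₁ = cls e₂ ↔ Relation.EqvGen AlgExtension.Equiv e₁ e₂) ∧
    (∀ e, cls e = 0 ↔ e.Splits) ∧
    (∀ e₁ e₂ e₃, AlgExtension.IsBaerSum e₁ e₂ e₃ → cls e₁ + cls e₂ = cls e₃)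

/-- The class map itself, when we need to name it. -/
structure ExtClassMap (G A : AffAlgGroup) (ρ : AlgAction G A)
    (Ext : Type) [AddCommGroup Ext] : Type where
  cls : AlgExtension G A ρ → Ext
  surj : Function.Surjective cls
  cls_eq_iff : ∀ e₁ e₂, cls e₁ = cls e₂ ↔ Relation.EqvGen AlgExtension.Equiv e₁ e₂
  cls_eq_zero_iff : ∀ e, cls e = 0 ↔ e.Splits
  cls_baer : ∀ e₁ e₂ e₃, AlgExtension.IsBaerSum e₁ e₂ e₃ → cls e₁ + cls e₂ = cls e₃

/-- An algebraic subgroup of `G`. -/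
structure AlgSubgroup (G : AffAlgGroup) : Type where
  carrier : Set (Pt G.n)
  subset : carrier ⊆ G.carrier
  isAlgebraic : IsAlgebraicSet carrier
  one_mem : G.one ∈ carrier
  mul_mem : ∀ {x y : Pt G.n}, x ∈ carrier → y ∈ carrier → G.mul x y ∈ carrier
  inv_mem : ∀ {x : Pt G.n}, x ∈ carrier → G.inv x ∈ carrier

namespace AlgSubgroup

variable {G : AffAlgGroup}

/-- An algebraic subgroup is itself an affine algebraic group. -/
def toGrp (H : AlgSubgroup G) : AffAlgGroup where
  n := G.n
  carrier := H.carrier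
  isAlgebraic := H.isAlgebraic
  one := G.one
  one_mem := H.one_mem
  mul := G.mul
  inv := G.inv
  mul_mem := H.mul_mem
  inv_mem := H.inv_mem
  mul_assoc' hx hy hz := G.mul_assoc' (H.subset hx) (H.subset hy) (H.subset hz)
  one_mul' hx := G.one_mul' (H.subset hx)
  mul_one' hx := G.mul_one' (H.subset hx)
  inv_mul' hx := G.inv_mul' (H.subset hx)
  mul_regular := by
    obtain ⟨P, hP⟩ := G.mul_regular
    exact ⟨P, fun z hz => hP z ⟨H.subset hz.1, H.subset hz.2⟩⟩
  inv_regular := by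
    obtain ⟨P, hP⟩ := G.inv_regular
    exact ⟨P, fun x hx => hP x (H.subset hx)⟩

def IsNormal (H : AlgSubgroup G) : Prop :=
  ∀ g ∈ G.carrier, ∀ x ∈ H.carrier, G.mul g (G.mul x (G.inv g)) ∈ H.carrier

/-- `H` is the unipotent radical of `G`: the largest connected normal
unipotent algebraic subgroup. -/
def IsUnipotentRadical (H : AlgSubgroup G) : Prop :=
  H.IsNormal ∧ H.toGrp.IsConnected ∧ H.toGrp.IsUnipotent ∧
    ∀ K : AlgSubgroup G, K.IsNormal → K.toGrp.IsConnected → K.toGrp.IsUnipotent →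
      K.carrier ⊆ H.carrier

/-- `G` is reductive: its unipotent radical is trivial. -/
def _root_.AffAlgGroup.IsReductive (G : AffAlgGroup) : Prop :=
  ∀ K : AlgSubgroup G, K.IsNormal → K.toGrp.IsConnected → K.toGrp.IsUnipotent →
    K.carrier = {G.one}

end AlgSubgroup

/-- A Levi decomposition `G = G_u ⋊ G_red` of `G`:  `Gu` is the unipotent
radical and `L` is a connected reductive algebraic subgroup with
`Gu ∩ L = 1` and `Gu · L = G`. -/
structure LeviDecomposition (G : AffAlgGroup) : Type where
  Gu : AlgSubgroup G
  L : AlgSubgroup G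
  Gu_radical : Gu.IsUnipotentRadical
  L_connected : L.toGrp.IsConnected
  L_reductive : L.toGrp.IsReductive
  inter : Gu.carrier ∩ L.carrier = {G.one}
  decomp : ∀ x ∈ G.carrier, ∃ u ∈ Gu.carrier, ∃ l ∈ L.carrier, x = G.mul u l

/-- The group homomorphism on point groups induced by a morphism of algebraic
groups. -/
def AlgGroupHom.toGpHom {G H : AffAlgGroup} (f : AlgGroupHom G H) : G.Gp →* H.Gp :=
  MonoidHom.mk' (fun x => ⟨f.toFun x.1, f.maps_to x.2⟩)
    (fun a b => Subtype.ext (f.map_mul a.2 b.2))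

/-- The subgroup of the point group underlying an algebraic subgroup. -/
def AlgSubgroup.toSubgroup {G : AffAlgGroup} (H : AlgSubgroup G) : Subgroup G.Gp where
  carrier := {x : G.Gp | x.1 ∈ H.carrier}
  one_mem' := H.one_mem
  mul_mem' := fun ha hb => H.mul_mem ha hb
  inv_mem' := fun ha => H.inv_mem ha

/-- Iterated product (powers) in an algebraic group. -/
def AffAlgGroup.pow (G : AffAlgGroup) (x : Pt G.n) : ℕ → Pt G.n
  | 0 => G.one
  | k + 1 => G.mul x (G.pow x k)

/-- The inclusion homomorphism of an algebraic subgroup. -/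
def AlgSubgroup.incl {A : AffAlgGroup} (H : AlgSubgroup A) : H.toGrp.Gp →* A.Gp :=
  MonoidHom.mk' (fun x => ⟨x.1, H.subset x.2⟩) (fun _ _ => rfl)
/-! ### Tangent spaces and Lie algebras -/

/-- The (Zariski) tangent space at `x₀` of a subset `V ⊆ ℂ^n`: the directions
annihilated by the differentials at `x₀` of all polynomials vanishing on `V`. -/
def tangentAt {n : ℕ} (V : Set (Pt n)) (x₀ : Pt n) : Submodule ℂ (Pt n) where
  carrier := {v | ∀ p : MvPolynomial (Fin n) ℂ, (∀ x ∈ V, eval x p = 0) →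
    ∑ j, v j * eval x₀ (pderiv j p) = 0}
  zero_mem' := by intro p hp; simp
  add_mem' := by
    intro a b ha hb p hp
    simp only [Pi.add_apply, add_mul, Finset.sum_add_distrib, ha p hp, hb p hp, add_zero]
  smul_mem' := by
    intro t a ha p hp
    simp only [Pi.smul_apply, smul_eq_mul, mul_assoc, ← Finset.mul_sum, ha p hp, mul_zero]

/-- A family of polynomials representing the commutator map
`(x, y) ↦ x y x⁻¹ y⁻¹` of `G` on `G × G`. -/
def IsCommutatorRep (G : AffAlgGroup) (F : Fin G.n → MvPolynomial (Fin (G.n + G.n)) ℂ) : Prop :=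
  ∀ x ∈ G.carrier, ∀ y ∈ G.carrier, ∀ i,
    G.mul (G.mul x y) (G.mul (G.inv x) (G.inv y)) i = eval (Fin.append x y) (F i)

/-- `𝔤` (an abstract complex Lie algebra) is the Lie algebra of `G`, via the
linear identification `e` of `𝔤` with the tangent space of `G` at the
identity; the Lie bracket corresponds to the mixed second-order term at the
identity of the commutator map of `G`. -/
structure IsLieAlgebraOf (G : AffAlgGroup) (𝔤 : Type) [LieRing 𝔤] [LieAlgebra ℂ 𝔤]
    (e : 𝔤 →ₗ[ℂ] Pt G.n) : Prop where
  inj : Function.Injective e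
  range_eq : ∀ v : Pt G.n, (∃ u : 𝔤, e u = v) ↔ v ∈ tangentAt G.carrier G.one
  bracket_eq : ∀ F, IsCommutatorRep G F → ∀ u v : 𝔤, ∀ i : Fin G.n,
    e ⁅u, v⁆ i = ∑ j, ∑ k, e u j * e v k *
      eval (Fin.append G.one G.one)
        (pderiv (Fin.castAdd G.n j) (pderiv (Fin.natAdd G.n k) (F i)))

/-- The Lie subalgebra `𝔥 ⊆ 𝔤` corresponds to the algebraic subgroup `H ⊆ G`
(under the identification `e` of `𝔤` with the tangent space of `G` at `1`). -/
def IsLieSubalgebraOf {G : AffAlgGroup} (H : AlgSubgroup G) {𝔤 : Type} [LieRing 𝔤]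
    [LieAlgebra ℂ 𝔤] (e : 𝔤 →ₗ[ℂ] Pt G.n) (𝔥 : LieSubalgebra ℂ 𝔤) : Prop :=
  ∀ u : 𝔤, u ∈ 𝔥 ↔ e u ∈ tangentAt H.carrier G.one

/-! ### The relative Chevalley–Eilenberg complex of a pair `(𝔤, 𝔥)` -/

section CE
set_option linter.unusedSectionVars false

variable {𝔤 : Type} [LieRing 𝔤] [LieAlgebra ℂ 𝔤]
variable {M : Type} [AddCommGroup M] [Module ℂ M] [LieRingModule 𝔤 M]

/-- `c` is an alternating `p`-multilinear map `𝔤^p → M`. -/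
def IsMultilinearAlt (p : ℕ) (c : (Fin p → 𝔤) → M) : Prop :=
  (∀ (v : Fin p → 𝔤) (i : Fin p) (x y : 𝔤),
    c (Function.update v i (x + y)) = c (Function.update v i x) + c (Function.update v i y)) ∧
  (∀ (v : Fin p → 𝔤) (i : Fin p) (t : ℂ) (x : 𝔤),
    c (Function.update v i (t • x)) = t • c (Function.update v i x)) ∧
  (∀ (v : Fin p → 𝔤) (i j : Fin p), i ≠ j → v i = v j → c v = 0)

/-- The Chevalley–Eilenberg differential (in the form valid on alternating
cochains). -/
def ceD (p : ℕ) (c : (Fin p → 𝔤) → M) : (Fin (p + 1) → 𝔤) → M := fun v =>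
  (∑ i : Fin (p + 1), ((-1 : ℤ) ^ (i : ℕ)) • ⁅v i, c (fun k => v (i.succAbove k))⁆) +
  ∑ i : Fin (p + 1), ∑ j : Fin (p + 1),
    if h : i < j then
      ((-1 : ℤ) ^ ((i : ℕ) + 1)) •
        c (Function.update (fun k => v (i.succAbove k))
            (j.pred (Fin.pos_iff_ne_zero.mp (lt_of_le_of_lt (Fin.zero_le i) h)))
            ⁅v i, v j⁆)
    else 0

lemma ceD_zero (p : ℕ) : ceD (M := M) (𝔤 := 𝔤) p 0 = 0 := by
  funext v
  simp [ceD]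

lemma ceD_add (p : ℕ) (c c' : (Fin p → 𝔤) → M) :
    ceD p (c + c') = ceD p c + ceD p c' := by
  funext v
  simp only [ceD, Pi.add_apply]
  have e1 : (∑ i : Fin (p + 1), ((-1 : ℤ) ^ (i : ℕ)) •
      ⁅v i, c (fun k => v (i.succAbove k)) + c' (fun k => v (i.succAbove k))⁆)
      = (∑ i : Fin (p + 1), ((-1 : ℤ) ^ (i : ℕ)) • ⁅v i, c (fun k => v (i.succAbove k))⁆)
      + ∑ i : Fin (p + 1), ((-1 : ℤ) ^ (i : ℕ)) • ⁅v i, c' (fun k => v (i.succAbove k))⁆ := by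
    rw [← Finset.sum_add_distrib]
    exact Finset.sum_congr rfl fun i _ => by rw [lie_add, smul_add]
  rw [e1]
  have e2 : ∀ i j : Fin (p + 1),
      (if h : i < j then ((-1 : ℤ) ^ ((i : ℕ) + 1)) •
        ((c (Function.update (fun k => v (i.succAbove k))
            (j.pred (Fin.pos_iff_ne_zero.mp (lt_of_le_of_lt (Fin.zero_le i) h))) ⁅v i, v j⁆))
         + (c' (Function.update (fun k => v (i.succAbove k))
            (j.pred (Fin.pos_iff_ne_zero.mp (lt_of_le_of_lt (Fin.zero_le i) h))) ⁅v i, v j⁆)))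
       else 0)
      = (if h : i < j then ((-1 : ℤ) ^ ((i : ℕ) + 1)) •
          (c (Function.update (fun k => v (i.succAbove k))
            (j.pred (Fin.pos_iff_ne_zero.mp (lt_of_le_of_lt (Fin.zero_le i) h))) ⁅v i, v j⁆))
         else 0)
      + (if h : i < j then ((-1 : ℤ) ^ ((i : ℕ) + 1)) •
          (c' (Function.update (fun k => v (i.succAbove k))
            (j.pred (Fin.pos_iff_ne_zero.mp (lt_of_le_of_lt (Fin.zero_le i) h))) ⁅v i, v j⁆))
         else 0) := by
    intro i j
    by_cases h : i < j <;> simp [h, smul_add]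
  simp only [e2, Finset.sum_add_distrib]
  try abel

lemma ceD_neg (p : ℕ) (c : (Fin p → 𝔤) → M) : ceD p (-c) = -(ceD p c) := by
  have h := ceD_add p c (-c)
  simp only [add_neg_cancel, ceD_zero] at h
  rw [eq_comm, neg_eq_iff_add_eq_zero, eq_comm, ← h]
  try rfl

/-- `c` is a relative `p`-cochain for the pair `(𝔤, 𝔥)`: alternating
multilinear, vanishing when one argument lies in `𝔥`, and `𝔥`-equivariant. -/
def IsRelCochain (𝔥 : LieSubalgebra ℂ 𝔤) (p : ℕ) (c : (Fin p → 𝔤) → M) : Prop :=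
  IsMultilinearAlt p c ∧
  (∀ v : Fin p → 𝔤, (∃ i, v i ∈ 𝔥) → c v = 0) ∧
  (∀ x : 𝔤, x ∈ 𝔥 → ∀ v : Fin p → 𝔤,
    ⁅x, c v⁆ = ∑ i, c (Function.update v i ⁅x, v i⁆))

lemma isRelCochain_zero (𝔥 : LieSubalgebra ℂ 𝔤) (p : ℕ) :
    IsRelCochain (M := M) 𝔥 p 0 := by
  refine ⟨⟨?_, ?_, ?_⟩, ?_, ?_⟩ <;> intros <;> simp

lemma isRelCochain_add (𝔥 : LieSubalgebra ℂ 𝔤) (p : ℕ) {c c' : (Fin p → 𝔤) → M}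
    (h : IsRelCochain 𝔥 p c) (h' : IsRelCochain 𝔥 p c') :
    IsRelCochain 𝔥 p (c + c') := by
  obtain ⟨⟨hm, hs, ha⟩, hv, he⟩ := h
  obtain ⟨⟨hm', hs', ha'⟩, hv', he'⟩ := h'
  refine ⟨⟨?_, ?_, ?_⟩, ?_, ?_⟩
  · intro v i x y
    simp only [Pi.add_apply, hm, hm']
    abel
  · intro v i t x
    simp only [Pi.add_apply, hs, hs', smul_add]
  · intro v i j hij hvv
    simp only [Pi.add_apply, ha v i j hij hvv, ha' v i j hij hvv, add_zero]
  · intro v hv₀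
    simp only [Pi.add_apply, hv v hv₀, hv' v hv₀, add_zero]
  · intro x hx v
    simp only [Pi.add_apply, lie_add, he x hx v, he' x hx v, Finset.sum_add_distrib]

lemma isRelCochain_neg (𝔥 : LieSubalgebra ℂ 𝔤) (p : ℕ) {c : (Fin p → 𝔤) → M}
    (h : IsRelCochain 𝔥 p c) : IsRelCochain 𝔥 p (-c) := by
  obtain ⟨⟨hm, hs, ha⟩, hv, he⟩ := h
  refine ⟨⟨?_, ?_, ?_⟩, ?_, ?_⟩
  · intro v i x y
    simp only [Pi.neg_apply, hm]
    abel
  · intro v i t x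
    simp only [Pi.neg_apply, hs, smul_neg]
  · intro v i j hij hvv
    simp only [Pi.neg_apply, ha v i j hij hvv, neg_zero]
  · intro v hv₀
    simp only [Pi.neg_apply, hv v hv₀, neg_zero]
  · intro x hx v
    simp only [Pi.neg_apply, lie_neg, he x hx v, Finset.sum_neg_distrib]

/-- The group of relative `p`-cocycles of the pair `(𝔤, 𝔥)` with values in `M`. -/
def relZ (𝔥 : LieSubalgebra ℂ 𝔤) (M : Type) [AddCommGroup M] [Module ℂ M]
    [LieRingModule 𝔤 M] (p : ℕ) : AddSubgroup ((Fin p → 𝔤) → M) where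
  carrier := {c | IsRelCochain 𝔥 p c ∧ ∀ v, ceD p c v = 0}
  zero_mem' := ⟨isRelCochain_zero 𝔥 p, fun v => by rw [ceD_zero]; rfl⟩
  add_mem' := by
    rintro c c' ⟨hc, hcz⟩ ⟨hc', hcz'⟩
    refine ⟨isRelCochain_add 𝔥 p hc hc', fun v => ?_⟩
    rw [ceD_add]
    simp [hcz v, hcz' v]
  neg_mem' := by
    rintro c ⟨hc, hcz⟩
    refine ⟨isRelCochain_neg 𝔥 p hc, fun v => ?_⟩
    rw [ceD_neg]
    simp [hcz v]

/-- The group of relative `(p+1)`-coboundaries of the pair `(𝔤, 𝔥)`. -/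
def relB (𝔥 : LieSubalgebra ℂ 𝔤) (M : Type) [AddCommGroup M] [Module ℂ M]
    [LieRingModule 𝔤 M] (p : ℕ) : AddSubgroup ((Fin (p + 1) → 𝔤) → M) where
  carrier := {c | ∃ f : (Fin p → 𝔤) → M, IsRelCochain 𝔥 p f ∧ c = ceD p f}
  zero_mem' := ⟨0, isRelCochain_zero 𝔥 p, (ceD_zero p).symm⟩
  add_mem' := by
    rintro c c' ⟨f, hf, rfl⟩ ⟨f', hf', rfl⟩
    exact ⟨f + f', isRelCochain_add 𝔥 p hf hf', (ceD_add p f f').symm⟩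
  neg_mem' := by
    rintro c ⟨f, hf, rfl⟩
    exact ⟨-f, isRelCochain_neg 𝔥 p hf, (ceD_neg p f).symm⟩

/-- The relative Lie algebra cohomology `H^p(𝔤, 𝔥, M)` of the pair `(𝔤, 𝔥)`
with coefficients in the `𝔤`-module `M`. -/
def relH (𝔥 : LieSubalgebra ℂ 𝔤) (M : Type) [AddCommGroup M] [Module ℂ M]
    [LieRingModule 𝔤 M] : ℕ → Type
  | 0 => ↥(relZ 𝔥 M 0)
  | (p + 1) => ↥(relZ 𝔥 M (p + 1)) ⧸ ((relB 𝔥 M p).addSubgroupOf (relZ 𝔥 M (p + 1)))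

instance relH.instAddCommGroup (𝔥 : LieSubalgebra ℂ 𝔤) (M : Type) [AddCommGroup M]
    [Module ℂ M] [LieRingModule 𝔤 M] (p : ℕ) : AddCommGroup (relH 𝔥 M p) :=
  match p with
  | 0 => inferInstanceAs (AddCommGroup ↥(relZ 𝔥 M 0))
  | (p + 1) => inferInstanceAs
      (AddCommGroup (↥(relZ 𝔥 M (p + 1)) ⧸ ((relB 𝔥 M p).addSubgroupOf (relZ 𝔥 M (p + 1)))))

/-- The class in `H^{p+1}(𝔤, 𝔥, M)` of a relative cocycle. -/
def relHClass (𝔥 : LieSubalgebra ℂ 𝔤) (M : Type) [AddCommGroup M] [Module ℂ M]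
    [LieRingModule 𝔤 M] (p : ℕ) (c : ↥(relZ 𝔥 M (p + 1))) : relH 𝔥 M (p + 1) :=
  QuotientAddGroup.mk c

end CE

/-- matrix-vector action on points -/
def matVec (m : ℕ) (a : Pt (m * m)) (w : Pt m) : Pt m :=
  fun i => ∑ k : Fin m, matEntry a i k * w k

/-- A finite-dimensional algebraic representation of `G` on `ℂ^m`, given by a
regular matrix-valued multiplicative map. -/
structure AlgRep (G : AffAlgGroup) (m : ℕ) : Type where
  ρ : Pt G.n → Pt (m * m)
  regular : IsRegularOn G.carrier ρ
  map_one : ρ G.one = idMatPt m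
  map_mul : ∀ {x y : Pt G.n}, x ∈ G.carrier → y ∈ G.carrier →
    ρ (G.mul x y) = matMulPt m (ρ x) (ρ y)

/-- The (abstract) `𝔤`-module structure on `ℂ^m` is the derived action of the
algebraic representation `r` of `G` (under the identification `e : 𝔤 ≅ L(G)`),
i.e. it is given by differentiating `r` at the identity. -/
def IsDerivedAction {G : AffAlgGroup} {m : ℕ} (r : AlgRep G m) {𝔤 : Type} [LieRing 𝔤]
    [LieAlgebra ℂ 𝔤] (e : 𝔤 →ₗ[ℂ] Pt G.n) [LieRingModule 𝔤 (Pt m)] : Prop :=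
  ∀ R : Fin (m * m) → MvPolynomial (Fin G.n) ℂ,
    (∀ x ∈ G.carrier, ∀ idx, r.ρ x idx = eval x (R idx)) →
    ∀ (u : 𝔤) (w : Pt m) (i : Fin m),
      ⁅u, w⁆ i = ∑ k : Fin m,
        (∑ j, e u j * eval G.one (pderiv j (R (finProdFinEquiv (i, k))))) * w k

/-- The `𝔤`-module structure on `M` (identified via `eA` with the Lie algebra
of `A`) is the derived action of the algebraic action `ρ` of `G` on `A`: the
bracket is the mixed second-order term of `ρ.act` at `(1, 1)`. -/
def IsDerivedActionOnLie {G A : AffAlgGroup} (ρ : AlgAction G A) {𝔤 M : Type}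
    [LieRing 𝔤] [LieAlgebra ℂ 𝔤] [AddCommGroup M] [Module ℂ M] [LieRingModule 𝔤 M]
    (e : 𝔤 →ₗ[ℂ] Pt G.n) (eA : M →ₗ[ℂ] Pt A.n) : Prop :=
  ∀ S : Fin A.n → MvPolynomial (Fin (G.n + A.n)) ℂ,
    (∀ g ∈ G.carrier, ∀ a ∈ A.carrier, ∀ i, ρ.act g a i = eval (Fin.append g a) (S i)) →
    ∀ (u : 𝔤) (w : M) (i : Fin A.n),
      eA ⁅u, w⁆ i = ∑ j, ∑ k, e u j * eA w k *
        eval (Fin.append G.one A.one)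
          (pderiv (Fin.castAdd A.n j) (pderiv (Fin.natAdd G.n k) (S i)))

/-! ### Algebraic group cohomology with coefficients in an algebraic module -/

section AlgCoh

variable {G : AffAlgGroup} {m : ℕ}

/-- `c : G^p → ℂ^m` is an algebraic cochain: on the carrier it is given by
polynomials. -/
def IsAlgCochain (G : AffAlgGroup) (m p : ℕ) (c : (Fin p → Pt G.n) → Pt m) : Prop :=
  ∃ P : Fin m → MvPolynomial (Fin p × Fin G.n) ℂ,
    ∀ g : Fin p → Pt G.n, (∀ a, g a ∈ G.carrier) →
      ∀ i, c g i = eval (fun s : Fin p × Fin G.n => g s.1 s.2) (P i)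

lemma isAlgCochain_zero (G : AffAlgGroup) (m p : ℕ) :
    IsAlgCochain G m p 0 :=
  ⟨fun _ => 0, fun g _ i => by simp⟩

lemma isAlgCochain_add {G : AffAlgGroup} {m p : ℕ} {c c' : (Fin p → Pt G.n) → Pt m}
    (h : IsAlgCochain G m p c) (h' : IsAlgCochain G m p c') :
    IsAlgCochain G m p (c + c') := by
  obtain ⟨P, hP⟩ := h
  obtain ⟨Q, hQ⟩ := h'
  exact ⟨fun i => P i + Q i, fun g hg i => by
    simp [hP g hg i, hQ g hg i]⟩

lemma isAlgCochain_neg {G : AffAlgGroup} {m p : ℕ} {c : (Fin p → Pt G.n) → Pt m}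
    (h : IsAlgCochain G m p c) : IsAlgCochain G m p (-c) := by
  obtain ⟨P, hP⟩ := h
  exact ⟨fun i => -(P i), fun g hg i => by simp [hP g hg i]⟩

/-- the `a`-th "multiply adjacent entries" tuple occurring in the group
cohomology differential -/
def mulInsert (G : AffAlgGroup) {p : ℕ} (g : Fin (p + 1) → Pt G.n) (a : Fin p) :
    Fin p → Pt G.n := fun k =>
  if (k : ℕ) < (a : ℕ) then g k.castSucc
  else if (k : ℕ) = (a : ℕ) then G.mul (g k.castSucc) (g k.succ)
  else g k.succ

lemma mulInsert_mem {p : ℕ} {g : Fin (p + 1) → Pt G.n} (hg : ∀ a, g a ∈ G.carrier)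
    (a : Fin p) : ∀ k, mulInsert G g a k ∈ G.carrier := by
  intro k
  unfold mulInsert
  split
  · exact hg _
  · split
    · exact G.mul_mem (hg _) (hg _)
    · exact hg _

/-- The inhomogeneous group cohomology differential
`(δf)(g₀,…,g_p) = g₀·f(g₁,…,g_p) + (−1)^{p+1} f(g₀,…,g_{p−1})
  + Σ_{a} (−1)^{a+1} f(g₀,…,g_a g_{a+1},…,g_p)`
for algebraic cochains with coefficients in the representation `r`. -/
def algD (r : AlgRep G m) (p : ℕ) (c : (Fin p → Pt G.n) → Pt m) :
    (Fin (p + 1) → Pt G.n) → Pt m := fun g =>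
  matVec m (r.ρ (g 0)) (c (fun a => g a.succ))
  + ((-1 : ℤ) ^ (p + 1)) • c (fun a => g a.castSucc)
  + ∑ a : Fin p, ((-1 : ℤ) ^ ((a : ℕ) + 1)) • c (mulInsert G g a)

lemma matVec_add {k : ℕ} (a : Pt (k * k)) (w w' : Pt k) :
    matVec k a (w + w') = matVec k a w + matVec k a w' := by
  funext i
  simp [matVec, mul_add, Finset.sum_add_distrib]

lemma matVec_zero {k : ℕ} (a : Pt (k * k)) : matVec k a 0 = 0 := by
  funext i
  simp [matVec]

lemma algD_zero (r : AlgRep G m) (p : ℕ) : algD r p 0 = 0 := by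
  funext g
  simp [algD, matVec_zero]

lemma algD_add (r : AlgRep G m) (p : ℕ) (c c' : (Fin p → Pt G.n) → Pt m) :
    algD r p (c + c') = algD r p c + algD r p c' := by
  funext g
  simp only [algD, Pi.add_apply, matVec_add, smul_add, Finset.sum_add_distrib]
  abel

lemma algD_neg (r : AlgRep G m) (p : ℕ) (c : (Fin p → Pt G.n) → Pt m) :
    algD r p (-c) = -(algD r p c) := by
  have h := algD_add r p c (-c)
  simp only [add_neg_cancel, algD_zero] at h
  rw [eq_comm, neg_eq_iff_add_eq_zero, eq_comm, ← h]
  try rfl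

/-- The group of algebraic `p`-cocycles of `G` with coefficients in `r`. -/
def algZ (r : AlgRep G m) (p : ℕ) : AddSubgroup ((Fin p → Pt G.n) → Pt m) where
  carrier := {c | IsAlgCochain G m p c ∧
    ∀ g : Fin (p + 1) → Pt G.n, (∀ a, g a ∈ G.carrier) → algD r p c g = 0}
  zero_mem' := ⟨isAlgCochain_zero G m p, fun g _ => by rw [algD_zero]; rfl⟩
  add_mem' := by
    rintro c c' ⟨hc, hcz⟩ ⟨hc', hcz'⟩
    refine ⟨isAlgCochain_add hc hc', fun g hg => ?_⟩
    rw [algD_add]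
    simp [hcz g hg, hcz' g hg]
  neg_mem' := by
    rintro c ⟨hc, hcz⟩
    refine ⟨isAlgCochain_neg hc, fun g hg => ?_⟩
    rw [algD_neg]
    simp [hcz g hg]

/-- The group of algebraic `(p+1)`-coboundaries of `G` with coefficients in
`r`. -/
def algB (r : AlgRep G m) (p : ℕ) : AddSubgroup ((Fin (p + 1) → Pt G.n) → Pt m) where
  carrier := {c | ∃ f : (Fin p → Pt G.n) → Pt m, IsAlgCochain G m p f ∧
    ∀ g : Fin (p + 1) → Pt G.n, (∀ a, g a ∈ G.carrier) → c g = algD r p f g}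
  zero_mem' := ⟨0, isAlgCochain_zero G m p, fun g _ => by rw [algD_zero]⟩
  add_mem' := by
    rintro c c' ⟨f, hf, hcf⟩ ⟨f', hf', hcf'⟩
    refine ⟨f + f', isAlgCochain_add hf hf', fun g hg => ?_⟩
    rw [algD_add]
    simp [hcf g hg, hcf' g hg]
  neg_mem' := by
    rintro c ⟨f, hf, hcf⟩
    refine ⟨-f, isAlgCochain_neg hf, fun g hg => ?_⟩
    rw [algD_neg]
    simp [hcf g hg]

/-- The algebraic group cohomology `H^p_alg(G, 𝔞)` of `G` with coefficients in
the finite-dimensional algebraic `G`-module given by `r`. -/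
def algH (r : AlgRep G m) : ℕ → Type
  | 0 => ↥(algZ r 0)
  | (p + 1) => ↥(algZ r (p + 1)) ⧸ ((algB r p).addSubgroupOf (algZ r (p + 1)))

instance algH.instAddCommGroup (r : AlgRep G m) (p : ℕ) : AddCommGroup (algH r p) :=
  match p with
  | 0 => inferInstanceAs (AddCommGroup ↥(algZ r 0))
  | (p + 1) => inferInstanceAs
      (AddCommGroup (↥(algZ r (p + 1)) ⧸ ((algB r p).addSubgroupOf (algZ r (p + 1)))))

end AlgCoh

/-! ### Regular functions -/

section RegFun

/-- The algebra of polynomial functions in a family of coordinates on a set. -/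
def regFun {X σ : Type} (κ : X → σ → ℂ) : Subalgebra ℂ (X → ℂ) :=
  (MvPolynomial.aeval (fun s x => κ x s) : MvPolynomial σ ℂ →ₐ[ℂ] (X → ℂ)).range

variable {X Y σ τ : Type} {κ : X → σ → ℂ} {κ' : Y → τ → ℂ}

lemma aeval_coord_apply (P : MvPolynomial σ ℂ) (x : X) :
    (MvPolynomial.aeval (fun s x => κ x s) P : X → ℂ) x = eval (κ x) P := by
  induction P using MvPolynomial.induction_on with
  | C a => simp
  | add p q hp hq => simp [hp, hq]
  | mul_X p s hp => simp [hp]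

lemma mem_regFun {f : X → ℂ} : f ∈ regFun κ ↔ ∃ P, ∀ x, f x = eval (κ x) P := by
  constructor
  · rintro ⟨P, rfl⟩
    exact ⟨P, fun x => aeval_coord_apply P x⟩
  · rintro ⟨P, hP⟩
    refine (AlgHom.mem_range _).2 ⟨P, ?_⟩
    funext x
    rw [hP x]
    exact aeval_coord_apply P x

lemma coord_mem_regFun (s : σ) : (fun x => κ x s) ∈ regFun κ :=
  mem_regFun.2 ⟨MvPolynomial.X s, fun x => by simp⟩

lemma const_mem_regFun (a : ℂ) : (fun _ => a) ∈ regFun κ :=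
  mem_regFun.2 ⟨C a, fun x => by simp⟩

lemma eval_mem_regFun (P : MvPolynomial τ ℂ) {u : X → τ → ℂ}
    (h : ∀ t, (fun x => u x t) ∈ regFun κ) : (fun x => eval (u x) P) ∈ regFun κ := by
  induction P using MvPolynomial.induction_on with
  | C a => simpa using const_mem_regFun a
  | add p q hp hq =>
    simp only [map_add]
    exact (regFun κ).add_mem hp hq
  | mul_X p s hp =>
    simp only [map_mul, eval_X]
    exact (regFun κ).mul_mem hp (h s)

lemma comp_mem_regFun {f : Y → ℂ} (hf : f ∈ regFun κ') {φ : X → Y}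
    (h : ∀ t, (fun x => κ' (φ x) t) ∈ regFun κ) : (fun x => f (φ x)) ∈ regFun κ := by
  obtain ⟨P, hP⟩ := mem_regFun.1 hf
  simp only [hP]
  exact eval_mem_regFun P h

/-- Coordinates on a product. -/
def prodCoord (κ : X → σ → ℂ) (κ' : Y → τ → ℂ) : X × Y → σ ⊕ τ → ℂ :=
  fun p => Sum.elim (κ p.1) (κ' p.2)

lemma exists_sum_of_mem_regFun_prod {f : X × Y → ℂ} (hf : f ∈ regFun (prodCoord κ κ')) :
    ∃ (k : ℕ) (a : Fin k → X → ℂ) (b : Fin k → Y → ℂ), (∀ i, a i ∈ regFun κ) ∧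
      (∀ i, b i ∈ regFun κ') ∧ ∀ x y, f (x, y) = ∑ i, a i x * b i y := by
  obtain ⟨P, hP⟩ := mem_regFun.1 hf
  simp only [hP]
  clear hP hf
  induction P using MvPolynomial.induction_on with
  | C c => exact ⟨1, fun _ _ => c, fun _ _ => 1, fun _ => const_mem_regFun c,
      fun _ => const_mem_regFun 1, fun x y => by simp⟩
  | add p q hp hq =>
    obtain ⟨k, a, b, ha, hb, h⟩ := hp
    obtain ⟨k', a', b', ha', hb', h'⟩ := hq
    refine ⟨k + k', Fin.append a a', Fin.append b b', ?_, ?_, ?_⟩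
    · intro i; refine Fin.addCases (fun j => ?_) (fun j => ?_) i <;> simp [ha, ha']
    · intro i; refine Fin.addCases (fun j => ?_) (fun j => ?_) i <;> simp [hb, hb']
    · intro x y; simp [h, h', Fin.sum_univ_add]
  | mul_X p s hp =>
    obtain ⟨k, a, b, ha, hb, h⟩ := hp
    cases s with
    | inl s =>
      refine ⟨k, fun i x => a i x * κ x s, b, fun i => (regFun κ).mul_mem (ha i)
        (coord_mem_regFun s), hb, fun x y => ?_⟩
      rw [map_mul, h, eval_X, Finset.sum_mul]
      simp only [prodCoord, Sum.elim_inl]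
      exact Finset.sum_congr rfl fun i _ => by ring
    | inr s =>
      refine ⟨k, a, fun i y => b i y * κ' y s, ha, fun i => (regFun κ').mul_mem (hb i)
        (coord_mem_regFun s), fun x y => ?_⟩
      rw [map_mul, h, eval_X, Finset.sum_mul]
      simp only [prodCoord, Sum.elim_inr]
      exact Finset.sum_congr rfl fun i _ => by ring

end RegFun

namespace AffAlgGroup

variable (H : AffAlgGroup)

/-- The coordinate algebra of an affine algebraic group. -/
def O : Subalgebra ℂ (H.Gp → ℂ) := regFun (fun g : H.Gp => g.1)

/-- The coordinate algebra of the square of an affine algebraic group. -/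
def O₂ : Subalgebra ℂ (H.Gp × H.Gp → ℂ) :=
  regFun (prodCoord (fun g : H.Gp => g.1) (fun g : H.Gp => g.1))

variable {H}

lemma mem_O {f : H.Gp → ℂ} : f ∈ H.O ↔ ∃ P, ∀ x, f x = eval x.1 P := mem_regFun

lemma coord_mem_O (i : Fin H.n) : (fun g : H.Gp => g.1 i) ∈ H.O :=
  coord_mem_regFun (κ := fun g : H.Gp => g.1) i

lemma const_mem_O (a : ℂ) : (fun _ => a) ∈ H.O := const_mem_regFun a

lemma mul_val (g h : H.Gp) : (g * h).1 = H.mul g.1 h.1 := rfl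

/-- Composition with a map into `H` with regular coordinates. -/
lemma O_comp {X σ : Type} {κ : X → σ → ℂ} {φ : X → H.Gp}
    (h : ∀ i, (fun x => (φ x).1 i) ∈ regFun κ) {f : H.Gp → ℂ} (hf : f ∈ H.O) :
    (fun x => f (φ x)) ∈ regFun κ :=
  comp_mem_regFun hf h

lemma mul_coord_mem {X σ : Type} {κ : X → σ → ℂ} {φ ψ : X → H.Gp}
    (hφ : ∀ i, (fun x => (φ x).1 i) ∈ regFun κ) (hψ : ∀ i, (fun x => (ψ x).1 i) ∈ regFun κ)
    (i : Fin H.n) : (fun x => (φ x * ψ x).1 i) ∈ regFun κ := by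
  obtain ⟨P, hP⟩ := H.mul_regular
  have e : ∀ x, (φ x * ψ x).1 i = eval (Fin.append (φ x).1 (ψ x).1) (P i) := by
    intro x
    have := hP (Fin.append (φ x).1 (ψ x).1) ⟨by
      have : Pt.left (Fin.append (φ x).1 (ψ x).1) = (φ x).1 := by
        funext j; exact Fin.append_left _ _ j
      rw [this]; exact (φ x).2, by
      have : Pt.right (Fin.append (φ x).1 (ψ x).1) = (ψ x).1 := by
        funext j; exact Fin.append_right _ _ j
      rw [this]; exact (ψ x).2⟩ i
    rw [← this, mul_val]
    congr 2
    · funext j; exact (Fin.append_left _ _ j).symm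
    · funext j; exact (Fin.append_right _ _ j).symm
  simp only [e]
  refine eval_mem_regFun (P i) fun t => ?_
  refine Fin.addCases (fun j => ?_) (fun j => ?_) t
  · simpa only [Fin.append_left] using hφ j
  · simpa only [Fin.append_right] using hψ j

lemma inv_coord_mem {X σ : Type} {κ : X → σ → ℂ} {φ : X → H.Gp}
    (hφ : ∀ i, (fun x => (φ x).1 i) ∈ regFun κ)
    (i : Fin H.n) : (fun x => ((φ x)⁻¹).1 i) ∈ regFun κ := by
  obtain ⟨P, hP⟩ := H.inv_regular
  have e : ∀ x, ((φ x)⁻¹).1 i = eval (φ x).1 (P i) := fun x => hP _ (φ x).2 i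
  simp only [e]
  exact eval_mem_regFun (P i) hφ

lemma const_coord_mem {X σ : Type} {κ : X → σ → ℂ} (g : H.Gp) (i : Fin H.n) :
    (fun _ : X => g.1 i) ∈ regFun κ := const_mem_regFun _

lemma O_mul_left {f : H.Gp → ℂ} (hf : f ∈ H.O) (g : H.Gp) : (fun h => f (g * h)) ∈ H.O :=
  O_comp (mul_coord_mem (const_coord_mem g) coord_mem_O) hf

lemma O_mul_right {f : H.Gp → ℂ} (hf : f ∈ H.O) (g : H.Gp) : (fun h => f (h * g)) ∈ H.O :=
  O_comp (mul_coord_mem coord_mem_O (const_coord_mem g)) hf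

lemma O_inv {f : H.Gp → ℂ} (hf : f ∈ H.O) : (fun h => f h⁻¹) ∈ H.O :=
  O_comp (inv_coord_mem coord_mem_O) hf

lemma fst_coord_mem (i : Fin H.n) : (fun p : H.Gp × H.Gp => p.1.1 i) ∈ H.O₂ :=
  coord_mem_regFun (κ := prodCoord (fun g : H.Gp => g.1) (fun g : H.Gp => g.1)) (Sum.inl i)

lemma snd_coord_mem (i : Fin H.n) : (fun p : H.Gp × H.Gp => p.2.1 i) ∈ H.O₂ :=
  coord_mem_regFun (κ := prodCoord (fun g : H.Gp => g.1) (fun g : H.Gp => g.1)) (Sum.inr i)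

lemma exists_sum_of_mem_O₂ {f : H.Gp × H.Gp → ℂ} (hf : f ∈ H.O₂) :
    ∃ (k : ℕ) (a b : Fin k → H.Gp → ℂ), (∀ i, a i ∈ H.O) ∧
      (∀ i, b i ∈ H.O) ∧ ∀ x y, f (x, y) = ∑ i, a i x * b i y :=
  exists_sum_of_mem_regFun_prod hf

lemma exists_mul_decomp {f : H.Gp → ℂ} (hf : f ∈ H.O) :
    ∃ (k : ℕ) (a b : Fin k → H.Gp → ℂ), (∀ i, a i ∈ H.O) ∧
      (∀ i, b i ∈ H.O) ∧ ∀ g h, f (g * h) = ∑ i, a i g * b i h :=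
  exists_sum_of_mem_O₂ (f := fun p => f (p.1 * p.2))
    (O_comp (mul_coord_mem fst_coord_mem snd_coord_mem) hf)

/-- Left-invariant operator attached to a functional on functions. -/
def linv (δ : (H.Gp → ℂ) →ₗ[ℂ] ℂ) : (H.Gp → ℂ) →ₗ[ℂ] (H.Gp → ℂ) where
  toFun f g := δ (fun h => f (g * h))
  map_add' f f' := by
    funext g
    exact δ.map_add (fun h => f (g * h)) (fun h => f' (g * h))
  map_smul' c f := by
    funext g
    exact δ.map_smul c (fun h => f (g * h))

lemma linv_apply (δ : (H.Gp → ℂ) →ₗ[ℂ] ℂ) (f : H.Gp → ℂ) (g : H.Gp) :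
    linv δ f g = δ (fun h => f (g * h)) := rfl

lemma linv_one (δ : (H.Gp → ℂ) →ₗ[ℂ] ℂ) (f : H.Gp → ℂ) : linv δ f 1 = δ f := by
  simp [linv_apply]

lemma linv_translate (δ : (H.Gp → ℂ) →ₗ[ℂ] ℂ) (f : H.Gp → ℂ) (g : H.Gp) :
    (fun h => linv δ f (g * h)) = linv δ (fun h => f (g * h)) := by
  funext h
  simp [linv_apply, mul_assoc]

lemma sum_smul_apply_eq {X : Type} {k : ℕ} (δ : (X → ℂ) →ₗ[ℂ] ℂ) (c : Fin k → ℂ)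
    (b : Fin k → X → ℂ) : δ (fun h => ∑ i, c i * b i h) = ∑ i, c i * δ (b i) := by
  have : (fun h => ∑ i, c i * b i h) = ∑ i, c i • b i := by
    funext h; simp
  rw [this]; simp

lemma functional_mem {f : H.Gp × H.Gp → ℂ} (hf : f ∈ H.O₂) (δ : (H.Gp → ℂ) →ₗ[ℂ] ℂ) :
    (fun x => δ (fun y => f (x, y))) ∈ H.O := by
  obtain ⟨k, a, b, ha, hb, h⟩ := exists_sum_of_mem_O₂ hf
  simp only [h, sum_smul_apply_eq]
  have : (fun x => ∑ i, a i x * δ (b i)) = ∑ i, δ (b i) • a i := by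
    funext x; simp [mul_comm]
  rw [this]
  exact H.O.sum_mem fun i _ => H.O.smul_mem (ha i) _

lemma functional_comm {f : H.Gp × H.Gp → ℂ} (hf : f ∈ H.O₂) (δ ε : (H.Gp → ℂ) →ₗ[ℂ] ℂ) :
    ε (fun x => δ (fun y => f (x, y))) = δ (fun y => ε (fun x => f (x, y))) := by
  obtain ⟨k, a, b, ha, hb, h⟩ := exists_sum_of_mem_O₂ hf
  have e1 : ∀ y, (fun x => f (x, y)) = fun x => ∑ i, b i y * a i x := fun y => by
    funext x; simp [h, mul_comm]
  simp only [e1, sum_smul_apply_eq]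
  have e2 : ∀ y, (∑ i, b i y * ε (a i)) = ∑ i, ε (a i) * b i y := fun y =>
    Finset.sum_congr rfl fun i _ => mul_comm _ _
  have e3 : ∀ x, (fun y => f (x, y)) = fun y => ∑ i, a i x * b i y := fun x => by
    funext y; simp [h]
  simp only [e2, e3, sum_smul_apply_eq]
  have e4 : ∀ x, (∑ i, a i x * δ (b i)) = ∑ i, δ (b i) * a i x := fun y =>
    Finset.sum_congr rfl fun i _ => mul_comm _ _
  simp only [e4, sum_smul_apply_eq]
  exact Finset.sum_congr rfl fun i _ => mul_comm _ _

lemma mul_comp_mem_O₂ {f : H.Gp → ℂ} (hf : f ∈ H.O) :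
    (fun p : H.Gp × H.Gp => f (p.1 * p.2)) ∈ H.O₂ :=
  O_comp (mul_coord_mem fst_coord_mem snd_coord_mem) hf

lemma linv_mem {f : H.Gp → ℂ} (hf : f ∈ H.O) (δ : (H.Gp → ℂ) →ₗ[ℂ] ℂ) : linv δ f ∈ H.O :=
  functional_mem (mul_comp_mem_O₂ hf) δ

/-- Point derivations at the identity. -/
def IsPointDer (δ : (H.Gp → ℂ) →ₗ[ℂ] ℂ) : Prop :=
  ∀ f ∈ H.O, ∀ f' ∈ H.O, δ (f * f') = f 1 * δ f' + f' 1 * δ f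

lemma IsPointDer.const {δ : (H.Gp → ℂ) →ₗ[ℂ] ℂ} (hδ : IsPointDer δ) (a : ℂ) :
    δ (fun _ => a) = 0 := by
  have h1 : δ (1 : H.Gp → ℂ) = 0 := by
    have := hδ 1 H.O.one_mem 1 H.O.one_mem
    simpa using this
  have : (fun _ : H.Gp => a) = a • (1 : H.Gp → ℂ) := by funext; simp
  rw [this, map_smul, h1, smul_zero]

lemma linv_mul {δ : (H.Gp → ℂ) →ₗ[ℂ] ℂ} (hδ : IsPointDer δ) {f f' : H.Gp → ℂ}
    (hf : f ∈ H.O) (hf' : f' ∈ H.O) : linv δ (f * f') = f * linv δ f' + f' * linv δ f := by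
  funext g
  have := hδ _ (O_mul_left hf g) _ (O_mul_left hf' g)
  simp only [mul_one] at this
  exact this

end AffAlgGroup

/-- A functional on polynomials satisfying the Leibniz rule at a point is determined by its
values on the variables. -/
lemma pointDer_eq_sum {σ : Type} [Fintype σ] (δ : MvPolynomial σ ℂ →ₗ[ℂ] ℂ) (a : σ → ℂ)
    (h : ∀ P Q, δ (P * Q) = eval a P * δ Q + eval a Q * δ P) (P : MvPolynomial σ ℂ) :
    δ P = ∑ j, δ (X j) * eval a (pderiv j P) := by
  classical
  have h1 : δ 1 = 0 := by simpa using h 1 1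
  induction P using MvPolynomial.induction_on with
  | C c =>
    have : (C c : MvPolynomial σ ℂ) = c • 1 := by rw [MvPolynomial.smul_eq_C_mul, mul_one]
    rw [this, map_smul, h1]; simp
  | add p q hp hq => simp [hp, hq, mul_add, Finset.sum_add_distrib]
  | mul_X p s hp =>
    rw [h, hp]
    simp only [pderiv_mul, pderiv_X, map_add, map_mul, eval_X, mul_add,
      Finset.sum_add_distrib, Finset.mul_sum]
    rw [add_comm]
    congr 1
    · exact Finset.sum_congr rfl fun i _ => by ring
    · rw [Finset.sum_eq_single s]
      · simp [mul_comm]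
      · intro b _ hb
        simp [hb.symm]
      · simp

namespace AffAlgGroup

variable {H : AffAlgGroup}

lemma exists_polySection (H : AffAlgGroup) :
    ∃ s : (H.Gp → ℂ) →ₗ[ℂ] MvPolynomial (Fin H.n) ℂ,
      ∀ f ∈ H.O, ∀ g : H.Gp, eval g.1 (s f) = f g := by
  let a : MvPolynomial (Fin H.n) ℂ →ₗ[ℂ] (H.Gp → ℂ) :=
    (MvPolynomial.aeval (fun s (x : H.Gp) => x.1 s)).toLinearMap
  obtain ⟨s, hs⟩ := LinearMap.exists_rightInverse_of_surjective a.rangeRestrict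
    (LinearMap.range_rangeRestrict a)
  obtain ⟨s', hs'⟩ := LinearMap.exists_extend s
  refine ⟨s', fun f hf g => ?_⟩
  obtain ⟨P, hP⟩ := mem_O.1 hf
  have hm : f ∈ LinearMap.range a := ⟨P, funext fun x => by
    rw [hP]; exact aeval_coord_apply (κ := fun g : H.Gp => g.1) P x⟩
  have h1 : s' f = s ⟨f, hm⟩ := LinearMap.congr_fun hs' ⟨f, hm⟩
  have h2 : a (s ⟨f, hm⟩) = f := congrArg Subtype.val (LinearMap.congr_fun hs ⟨f, hm⟩)
  rw [h1, ← aeval_coord_apply (κ := fun g : H.Gp => g.1)]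
  exact congrFun h2 g

/-- The directional derivative at a point of a polynomial, as a functional. -/
def dirDer {n : ℕ} (x₀ : Pt n) (v : Pt n) : MvPolynomial (Fin n) ℂ →ₗ[ℂ] ℂ where
  toFun P := ∑ j, v j * eval x₀ (pderiv j P)
  map_add' P Q := by simp [mul_add, Finset.sum_add_distrib]
  map_smul' c P := by
    simp only [Derivation.map_smul, smul_eval, RingHom.id_apply, smul_eq_mul, Finset.mul_sum]
    exact Finset.sum_congr rfl fun i _ => by ring

lemma dirDer_mul {n : ℕ} (x₀ v : Pt n) (P Q : MvPolynomial (Fin n) ℂ) :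
    dirDer x₀ v (P * Q) = eval x₀ P * dirDer x₀ v Q + eval x₀ Q * dirDer x₀ v P := by
  simp only [dirDer, LinearMap.coe_mk, AddHom.coe_mk, pderiv_mul, map_add, map_mul, mul_add,
    Finset.sum_add_distrib, Finset.mul_sum]
  rw [add_comm]
  congr 1 <;> exact Finset.sum_congr rfl fun i _ => by ring

lemma dirDer_X {n : ℕ} (x₀ v : Pt n) (i : Fin n) : dirDer x₀ v (X i) = v i := by
  classical
  simp only [dirDer, LinearMap.coe_mk, AddHom.coe_mk, pderiv_X]
  rw [Finset.sum_eq_single i]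
  · simp
  · intro b _ hb; simp [hb]
  · simp

/-- Derivatives at the identity of functions on an affine algebraic group. -/
def ptD (H : AffAlgGroup) : Pt H.n →ₗ[ℂ] (H.Gp → ℂ) →ₗ[ℂ] ℂ where
  toFun v := dirDer H.one v ∘ₗ H.exists_polySection.choose
  map_add' v w := by
    ext f; simp [dirDer, add_mul, Finset.sum_add_distrib]
  map_smul' c v := by
    ext f; simp [dirDer, mul_assoc, Finset.mul_sum]

lemma ptD_eval {v : Pt H.n} (hv : v ∈ tangentAt H.carrier H.one)
    (P : MvPolynomial (Fin H.n) ℂ) :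
    ptD H v (fun g => eval g.1 P) = dirDer H.one v P := by
  have hs := H.exists_polySection.choose_spec
  set s := H.exists_polySection.choose
  have hf : (fun g : H.Gp => eval g.1 P) ∈ H.O := mem_O.2 ⟨P, fun _ => rfl⟩
  change dirDer H.one v (s _) = _
  rw [← sub_eq_zero, ← map_sub]
  refine hv _ fun x hx => ?_
  rw [map_sub, sub_eq_zero]
  exact hs _ hf ⟨x, hx⟩

lemma ptD_isPointDer {v : Pt H.n} (hv : v ∈ tangentAt H.carrier H.one) :
    IsPointDer (ptD H v) := by
  intro f hf f' hf'
  obtain ⟨P, hP⟩ := mem_O.1 hf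
  obtain ⟨Q, hQ⟩ := mem_O.1 hf'
  obtain rfl : f = fun g => eval g.1 P := funext hP
  obtain rfl : f' = fun g => eval g.1 Q := funext hQ
  have : (fun g : H.Gp => eval g.1 P) * (fun g => eval g.1 Q) = fun g => eval g.1 (P * Q) := by
    funext g; simp
  rw [this, ptD_eval hv, ptD_eval hv, ptD_eval hv, dirDer_mul]
  rfl

lemma ptD_coord {v : Pt H.n} (hv : v ∈ tangentAt H.carrier H.one) (i : Fin H.n) :
    ptD H v (fun g => g.1 i) = v i := by
  have := ptD_eval hv (X i)
  rw [dirDer_X] at this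
  simpa using this

lemma pointDer_eq_dirDer {δ : (H.Gp → ℂ) →ₗ[ℂ] ℂ} (hδ : IsPointDer δ)
    (P : MvPolynomial (Fin H.n) ℂ) :
    δ (fun g => eval g.1 P) = dirDer H.one (fun i => δ (fun g => g.1 i)) P := by
  let δ' : MvPolynomial (Fin H.n) ℂ →ₗ[ℂ] ℂ :=
    { toFun := fun P => δ (fun g => eval g.1 P)
      map_add' := fun P Q => by
        simp only [map_add]; exact δ.map_add _ _
      map_smul' := fun c P => by
        simp only [smul_eval]; exact δ.map_smul c _ }
  have := pointDer_eq_sum δ' H.one (fun P Q => by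
    have := hδ (fun g => eval g.1 P) (mem_O.2 ⟨P, fun _ => rfl⟩) (fun g => eval g.1 Q)
      (mem_O.2 ⟨Q, fun _ => rfl⟩)
    simp only [δ', LinearMap.coe_mk, AddHom.coe_mk, map_mul]
    exact this) P
  simpa [δ', dirDer] using this

lemma pointDer_mem_tangent {δ : (H.Gp → ℂ) →ₗ[ℂ] ℂ} (hδ : IsPointDer δ) :
    (fun i => δ (fun g => g.1 i)) ∈ tangentAt H.carrier H.one := by
  intro P hP
  have h := pointDer_eq_dirDer hδ P
  have h0 : (fun g : H.Gp => eval g.1 P) = 0 := funext fun g => hP g.1 g.2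
  rw [h0, map_zero] at h
  exact h.symm

lemma pointDer_ext {δ ε : (H.Gp → ℂ) →ₗ[ℂ] ℂ} (hδ : IsPointDer δ) (hε : IsPointDer ε)
    (h : ∀ i, δ (fun g => g.1 i) = ε (fun g => g.1 i)) {f : H.Gp → ℂ} (hf : f ∈ H.O) :
    δ f = ε f := by
  obtain ⟨P, hP⟩ := mem_O.1 hf
  obtain rfl : f = fun g => eval g.1 P := funext hP
  rw [pointDer_eq_dirDer hδ, pointDer_eq_dirDer hε]
  simp only [h]

/-- The mixed second derivative at the identity of a polynomial function on `H × H`. -/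
lemma mixed_eval {u v : Pt H.n} (hu : u ∈ tangentAt H.carrier H.one)
    (hv : v ∈ tangentAt H.carrier H.one) (F : MvPolynomial (Fin (H.n + H.n)) ℂ) :
    ptD H u (fun x => ptD H v (fun y => eval (Fin.append x.1 y.1) F)) =
      ∑ j, ∑ k, u j * v k * eval (Fin.append H.one H.one)
        (pderiv (Fin.castAdd H.n j) (pderiv (Fin.natAdd H.n k) F)) := by
  have hmemy : ∀ (x : H.Gp) (F : MvPolynomial (Fin (H.n + H.n)) ℂ),
      (fun y : H.Gp => eval (Fin.append x.1 y.1) F) ∈ H.O := fun x F =>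
    eval_mem_regFun F fun t => by
      refine Fin.addCases (fun j => ?_) (fun j => ?_) t
      · simp only [Fin.append_left]; exact const_coord_mem x j
      · simp only [Fin.append_right]; exact coord_mem_O j
  have hmemx : ∀ (y : H.Gp) (F : MvPolynomial (Fin (H.n + H.n)) ℂ),
      (fun x : H.Gp => eval (Fin.append x.1 y.1) F) ∈ H.O := fun y F =>
    eval_mem_regFun F fun t => by
      refine Fin.addCases (fun j => ?_) (fun j => ?_) t
      · simp only [Fin.append_left]; exact coord_mem_O j
      · simp only [Fin.append_right]; exact const_coord_mem y j
  have hy : ∀ (x : H.Gp) (F : MvPolynomial (Fin (H.n + H.n)) ℂ),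
      ptD H v (fun y => eval (Fin.append x.1 y.1) F) =
        ∑ k, v k * eval (Fin.append x.1 H.one) (pderiv (Fin.natAdd H.n k) F) := by
    intro x F
    let δ' : MvPolynomial (Fin (H.n + H.n)) ℂ →ₗ[ℂ] ℂ :=
      { toFun := fun P => ptD H v (fun y => eval (Fin.append x.1 y.1) P)
        map_add' := fun P Q => by
          simp only [map_add]; exact (ptD H v).map_add _ _
        map_smul' := fun c P => by
          simp only [smul_eval]; exact (ptD H v).map_smul c _ }
    have := pointDer_eq_sum δ' (Fin.append x.1 H.one) (fun P Q => by
      have := ptD_isPointDer hv _ (hmemy x P) _ (hmemy x Q)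
      simp only [δ', LinearMap.coe_mk, AddHom.coe_mk, map_mul]
      exact this) F
    rw [Fin.sum_univ_add] at this
    simp only [δ', LinearMap.coe_mk, AddHom.coe_mk, eval_X, Fin.append_left, Fin.append_right,
      (ptD_isPointDer hv).const, ptD_coord hv, zero_mul, Finset.sum_const_zero, zero_add] at this
    exact this
  have hx : ∀ (F : MvPolynomial (Fin (H.n + H.n)) ℂ),
      ptD H u (fun x => eval (Fin.append x.1 H.one) F) =
        ∑ k, u k * eval (Fin.append H.one H.one) (pderiv (Fin.castAdd H.n k) F) := by
    intro F
    let δ' : MvPolynomial (Fin (H.n + H.n)) ℂ →ₗ[ℂ] ℂ :=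
      { toFun := fun P => ptD H u (fun y => eval (Fin.append y.1 H.one) P)
        map_add' := fun P Q => by
          simp only [map_add]; exact (ptD H u).map_add _ _
        map_smul' := fun c P => by
          simp only [smul_eval]; exact (ptD H u).map_smul c _ }
    have := pointDer_eq_sum δ' (Fin.append H.one H.one) (fun P Q => by
      have := ptD_isPointDer hu _ (hmemx 1 P) _ (hmemx 1 Q)
      simp only [δ', LinearMap.coe_mk, AddHom.coe_mk, map_mul]
      exact this) F
    rw [Fin.sum_univ_add] at this
    simp only [δ', LinearMap.coe_mk, AddHom.coe_mk, eval_X, Fin.append_left, Fin.append_right,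
      (ptD_isPointDer hu).const, ptD_coord hu, zero_mul, Finset.sum_const_zero, add_zero] at this
    exact this
  simp only [hy]
  rw [sum_smul_apply_eq (ptD H u) v
    (fun k x => eval (Fin.append x.1 H.one) (pderiv (Fin.natAdd H.n k) F))]
  simp only [hx, Finset.mul_sum]
  rw [Finset.sum_comm]
  exact Finset.sum_congr rfl fun i _ => Finset.sum_congr rfl fun j _ => by ring

/-- Identification of a Lie algebra with the point derivations at the identity. -/
structure LieDat (H : AffAlgGroup) (𝔩 : Type) [LieRing 𝔩] [LieAlgebra ℂ 𝔩] : Type where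
  D : 𝔩 →ₗ[ℂ] (H.Gp → ℂ) →ₗ[ℂ] ℂ
  leib : ∀ x, IsPointDer (D x)
  inj : ∀ x, (∀ f ∈ H.O, D x f = 0) → x = 0
  surj : ∀ δ : (H.Gp → ℂ) →ₗ[ℂ] ℂ, IsPointDer δ → ∃ x, ∀ f ∈ H.O, D x f = δ f
  bracket : ∀ x y, ∀ f ∈ H.O, D ⁅x, y⁆ f = D x (linv (D y) f) - D y (linv (D x) f)

/-- The commutator map as a map on pairs of points. -/
def commMap (p : H.Gp × H.Gp) : H.Gp := (p.1 * p.2) * (p.1⁻¹ * p.2⁻¹)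

lemma commMap_coord_mem (i : Fin H.n) : (fun p => (commMap p).1 i) ∈ H.O₂ :=
  mul_coord_mem (mul_coord_mem fst_coord_mem snd_coord_mem)
    (mul_coord_mem (inv_coord_mem fst_coord_mem) (inv_coord_mem snd_coord_mem)) i

lemma exists_commutatorRep (H : AffAlgGroup) : ∃ F, IsCommutatorRep H F := by
  have : ∀ i, ∃ F : MvPolynomial (Fin (H.n + H.n)) ℂ, ∀ x y : H.Gp,
      (commMap (x, y)).1 i = eval (Fin.append x.1 y.1) F := by
    intro i
    obtain ⟨P, hP⟩ := mem_regFun.1 (commMap_coord_mem (H := H) i)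
    refine ⟨rename finSumFinEquiv P, fun x y => ?_⟩
    rw [eval_rename]
    refine (hP (x, y)).trans ?_
    congr 2
    funext s
    cases s with
    | inl s => exact (Fin.append_left _ _ s).symm
    | inr s => exact (Fin.append_right _ _ s).symm
  choose F hF using this
  exact ⟨F, fun x hx y hy i => hF i ⟨x, hx⟩ ⟨y, hy⟩⟩

lemma IsCommutatorRep.mixed {F : Fin H.n → MvPolynomial (Fin (H.n + H.n)) ℂ}
    (hF : IsCommutatorRep H F) {u v : Pt H.n} (hu : u ∈ tangentAt H.carrier H.one)
    (hv : v ∈ tangentAt H.carrier H.one) (i : Fin H.n) :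
    ptD H u (fun x => ptD H v (fun y => (commMap (x, y)).1 i)) =
      ∑ j, ∑ k, u j * v k * eval (Fin.append H.one H.one)
        (pderiv (Fin.castAdd H.n j) (pderiv (Fin.natAdd H.n k) (F i))) := by
  rw [← mixed_eval hu hv]
  have : ∀ x y : H.Gp, (commMap (x, y)).1 i = eval (Fin.append x.1 y.1) (F i) :=
    fun x y => hF x.1 x.2 y.1 y.2 i
  simp only [this]

lemma commMap_one_left (y : H.Gp) : commMap (1, y) = 1 := by simp [commMap]

lemma commMap_one_right (x : H.Gp) : commMap (x, 1) = 1 := by simp [commMap]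

lemma commMap_comp_mem {f : H.Gp → ℂ} (hf : f ∈ H.O) :
    (fun p => f (commMap p)) ∈ H.O₂ := O_comp commMap_coord_mem hf

lemma O₂_left {f : H.Gp × H.Gp → ℂ} (hf : f ∈ H.O₂) (x : H.Gp) :
    (fun y => f (x, y)) ∈ H.O := by
  refine comp_mem_regFun hf fun t => ?_
  cases t with
  | inl s => exact const_coord_mem x s
  | inr s => exact coord_mem_O s

/-- The mixed derivative of a function along the commutator map. -/
def mixedComm (δ ε : (H.Gp → ℂ) →ₗ[ℂ] ℂ) : (H.Gp → ℂ) →ₗ[ℂ] ℂ where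
  toFun f := δ (fun x => ε (fun y => f (commMap (x, y))))
  map_add' f f' := by
    rw [← map_add]
    congr 1
    funext x
    exact ε.map_add _ _
  map_smul' c f := by
    rw [RingHom.id_apply, ← map_smul]
    congr 1
    funext x
    exact ε.map_smul c _

lemma mixedComm_isPointDer {δ ε : (H.Gp → ℂ) →ₗ[ℂ] ℂ} (hε : IsPointDer ε) :
    IsPointDer (mixedComm δ ε) := by
  intro f hf f' hf'
  have : ∀ x, ε (fun y => (f * f') (commMap (x, y))) =
      f 1 * ε (fun y => f' (commMap (x, y))) + f' 1 * ε (fun y => f (commMap (x, y))) := by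
    intro x
    have := hε _ (O₂_left (commMap_comp_mem hf) x) _ (O₂_left (commMap_comp_mem hf') x)
    simp only [commMap_one_right] at this
    exact this
  change δ (fun x => ε (fun y => (f * f') (commMap (x, y)))) = _
  simp only [this]
  rw [show (fun x => f 1 * ε (fun y => f' (commMap (x, y))) +
      f' 1 * ε (fun y => f (commMap (x, y)))) =
      f 1 • (fun x => ε (fun y => f' (commMap (x, y)))) +
      f' 1 • (fun x => ε (fun y => f (commMap (x, y)))) from rfl, map_add, map_smul, map_smul]
  rfl

lemma mixedComm_eq {δ ε : (H.Gp → ℂ) →ₗ[ℂ] ℂ} (hδ : IsPointDer δ) (hε : IsPointDer ε)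
    {f : H.Gp → ℂ} (hf : f ∈ H.O) :
    mixedComm δ ε f = δ (linv ε f) - ε (linv δ f) := by
  obtain ⟨k, a, b, ha, hb, hab⟩ := exists_mul_decomp hf
  have hyx : (fun p : H.Gp × H.Gp => f (p.2 * p.1)) ∈ H.O₂ :=
    O_comp (mul_coord_mem snd_coord_mem fst_coord_mem) hf
  have hyx' : ∀ i, (fun p : H.Gp × H.Gp => b i (p.2 * p.1)) ∈ H.O₂ := fun i =>
    O_comp (mul_coord_mem snd_coord_mem fst_coord_mem) (hb i)
  have key : ∀ x, linv ε f x = ε (fun y => f (y * x)) +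
      ∑ i, b i x * ε (fun y => a i (commMap (x, y))) := by
    intro x
    have h1 : (fun y => f (x * y)) =
        ∑ i, (fun y => a i (commMap (x, y))) * (fun y => b i (y * x)) := by
      funext y
      rw [show x * y = commMap (x, y) * (y * x) by simp [commMap, mul_assoc], hab]
      simp
    rw [linv_apply, h1, map_sum]
    have h2 : ∀ i, ε ((fun y => a i (commMap (x, y))) * (fun y => b i (y * x))) =
        a i 1 * ε (fun y => b i (y * x)) + b i x * ε (fun y => a i (commMap (x, y))) := by
      intro i
      have := hε _ (O₂_left (commMap_comp_mem (ha i)) x) _ (O₂_left (hyx' i) x)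
      simpa [commMap_one_right] using this
    simp only [h2, Finset.sum_add_distrib]
    congr 1
    rw [← sum_smul_apply_eq ε (fun i => a i 1) (fun i y => b i (y * x))]
    congr 1
    funext y
    rw [← hab, one_mul]
  have h3 : linv ε f = (fun x => ε (fun y => f (y * x))) +
      ∑ i, b i * (fun x => ε (fun y => a i (commMap (x, y)))) := by
    funext x; rw [key]; simp
  rw [h3, map_add, map_sum]
  have h4 : ∀ i, δ (b i * (fun x => ε (fun y => a i (commMap (x, y))))) =
      b i 1 * mixedComm δ ε (a i) := by
    intro i
    rw [hδ _ (hb i) _ (functional_mem (commMap_comp_mem (ha i)) ε)]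
    simp only [commMap_one_left, hε.const, zero_mul, add_zero]
    rfl
  have h5 : ∑ i, b i 1 * mixedComm δ ε (a i) = mixedComm δ ε f := by
    rw [← sum_smul_apply_eq]
    congr 1
    funext g
    rw [show f g = f (g * 1) by simp, hab]
    exact Finset.sum_congr rfl fun i _ => mul_comm _ _
  have h6 : δ (fun x => ε (fun y => f (y * x))) = ε (linv δ f) :=
    functional_comm hyx ε δ
  simp only [h4, h5, h6]
  ring

/-- The Lie algebra of an affine algebraic group acts by point derivations. -/
def _root_.IsLieAlgebraOf.lieDat {𝔩 : Type} [LieRing 𝔩] [LieAlgebra ℂ 𝔩] {e : 𝔩 →ₗ[ℂ] Pt H.n}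
    (h : IsLieAlgebraOf H 𝔩 e) : LieDat H 𝔩 where
  D := ptD H ∘ₗ e
  leib x := ptD_isPointDer ((h.range_eq _).1 ⟨x, rfl⟩)
  inj x hx := by
    apply h.inj
    rw [map_zero]
    funext i
    rw [← ptD_coord ((h.range_eq _).1 ⟨x, rfl⟩) i]
    exact hx _ (coord_mem_O i)
  surj δ hδ := by
    obtain ⟨x, hx⟩ := (h.range_eq _).2 (pointDer_mem_tangent hδ)
    refine ⟨x, fun f hf => pointDer_ext (ptD_isPointDer ((h.range_eq _).1 ⟨x, rfl⟩)) hδ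
      (fun i => ?_) hf⟩
    rw [ptD_coord ((h.range_eq _).1 ⟨x, rfl⟩) i, hx]
  bracket x y f hf := by
    have hx := (h.range_eq _).1 ⟨x, rfl⟩
    have hy := (h.range_eq _).1 ⟨y, rfl⟩
    have hxy := (h.range_eq _).1 ⟨⁅x, y⁆, rfl⟩
    simp only [LinearMap.comp_apply]
    rw [← mixedComm_eq (ptD_isPointDer hx) (ptD_isPointDer hy) hf]
    refine pointDer_ext (ptD_isPointDer hxy) (mixedComm_isPointDer (ptD_isPointDer hy))
      (fun i => ?_) hf
    obtain ⟨F, hF⟩ := H.exists_commutatorRep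
    rw [ptD_coord hxy, h.bracket_eq F hF]
    exact (IsCommutatorRep.mixed hF hx hy i).symm

end AffAlgGroup

namespace AlgSubgroup

open AffAlgGroup

variable {G : AffAlgGroup} (K : AlgSubgroup G)

lemma tangentAt_mono {n : ℕ} {V W : Set (Pt n)} (h : V ⊆ W) (x : Pt n) :
    tangentAt V x ≤ tangentAt W x := fun _ hv p hp => hv p fun y hy => hp y (h hy)

lemma isLieAlgebraOf {𝔤 : Type} [LieRing 𝔤] [LieAlgebra ℂ 𝔤] {e : 𝔤 →ₗ[ℂ] Pt G.n}
    (h : IsLieAlgebraOf G 𝔤 e) (𝔨 : LieSubalgebra ℂ 𝔤) (hk : IsLieSubalgebraOf K e 𝔨) :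
    IsLieAlgebraOf K.toGrp 𝔨 (e ∘ₗ 𝔨.toSubmodule.subtype) where
  inj x y hxy := Subtype.ext (h.inj hxy)
  range_eq v := by
    constructor
    · rintro ⟨u, rfl⟩
      exact (hk u).1 u.2
    · intro hv
      obtain ⟨u, rfl⟩ := (h.range_eq v).2 (tangentAt_mono K.subset _ hv)
      exact ⟨⟨u, (hk u).2 hv⟩, rfl⟩
  bracket_eq F hF u v i := by
    obtain ⟨F', hF'⟩ := G.exists_commutatorRep
    have hF'' : IsCommutatorRep K.toGrp F' := fun x hx y hy i =>
      hF' x (K.subset hx) y (K.subset hy) i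
    have hu : e u ∈ tangentAt K.toGrp.carrier K.toGrp.one := (hk u).1 u.2
    have hv : e v ∈ tangentAt K.toGrp.carrier K.toGrp.one := (hk v).1 v.2
    have h1 := IsCommutatorRep.mixed hF'' hu hv i
    have h2 := IsCommutatorRep.mixed hF hu hv i
    have h3 := h.bracket_eq F' hF' u v i
    exact h3.trans (h1.symm.trans h2)

end AlgSubgroup

/-! ### Regular maps into a vector space -/

section RegMaps

variable {X Y σ τ : Type} {κ : X → σ → ℂ} {κ' : Y → τ → ℂ}
variable {M N : Type} [AddCommGroup M] [Module ℂ M] [AddCommGroup N] [Module ℂ N]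

/-- Regular maps with values in a vector space of arbitrary dimension. -/
def regMaps (κ : X → σ → ℂ) (M : Type) [AddCommGroup M] [Module ℂ M] : Submodule ℂ (X → M) :=
  Submodule.span ℂ {F | ∃ f ∈ regFun κ, ∃ m : M, F = fun x => f x • m}

lemma smul_mem_regMaps {f : X → ℂ} (hf : f ∈ regFun κ) (m : M) :
    (fun x => f x • m) ∈ regMaps κ M :=
  Submodule.subset_span ⟨f, hf, m, rfl⟩

lemma const_mem_regMaps (m : M) : (fun _ => m) ∈ regMaps κ M := by
  simpa using smul_mem_regMaps (κ := κ) (const_mem_regFun 1) m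

lemma exists_decomp_of_mem_regMaps {F : X → M} (hF : F ∈ regMaps κ M) :
    ∃ (k : ℕ) (f : Fin k → X → ℂ) (m : Fin k → M), (∀ i, f i ∈ regFun κ) ∧
      ∀ x, F x = ∑ i, f i x • m i := by
  induction hF using Submodule.span_induction with
  | mem F h =>
    obtain ⟨f, hf, m, rfl⟩ := h
    exact ⟨1, fun _ => f, fun _ => m, fun _ => hf, fun x => by simp⟩
  | zero => exact ⟨0, Fin.elim0, Fin.elim0, fun i => i.elim0, fun x => by simp⟩
  | add F F' _ _ h h' =>
    obtain ⟨k, f, m, hf, h⟩ := h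
    obtain ⟨k', f', m', hf', h'⟩ := h'
    refine ⟨k + k', Fin.append f f', Fin.append m m', ?_, ?_⟩
    · intro i; refine Fin.addCases (fun j => ?_) (fun j => ?_) i <;> simp [hf, hf']
    · intro x; simp [h, h', Fin.sum_univ_add]
  | smul c F _ h =>
    obtain ⟨k, f, m, hf, h⟩ := h
    exact ⟨k, f, fun i => c • m i, hf, fun x => by
      simp only [Pi.smul_apply, h, Finset.smul_sum]
      exact Finset.sum_congr rfl fun i _ => smul_comm _ _ _⟩

lemma sum_mem_regMaps {k : ℕ} {f : Fin k → X → ℂ} (hf : ∀ i, f i ∈ regFun κ) (m : Fin k → M) :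
    (fun x => ∑ i, f i x • m i) ∈ regMaps κ M := by
  have : (fun x => ∑ i, f i x • m i) = ∑ i, fun x => f i x • m i := by
    funext x; simp
  rw [this]
  exact Submodule.sum_mem _ fun i _ => smul_mem_regMaps (hf i) _

lemma mem_regMaps_iff {F : X → M} : F ∈ regMaps κ M ↔
    ∃ (k : ℕ) (f : Fin k → X → ℂ) (m : Fin k → M), (∀ i, f i ∈ regFun κ) ∧
      ∀ x, F x = ∑ i, f i x • m i := by
  refine ⟨exists_decomp_of_mem_regMaps, ?_⟩
  rintro ⟨k, f, m, hf, h⟩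
  rw [show F = _ from funext h]
  exact sum_mem_regMaps hf m

lemma comp_linear_mem_regMaps {F : X → M} (hF : F ∈ regMaps κ M) (u : M →ₗ[ℂ] N) :
    (fun x => u (F x)) ∈ regMaps κ N := by
  obtain ⟨k, f, m, hf, h⟩ := exists_decomp_of_mem_regMaps hF
  refine mem_regMaps_iff.2 ⟨k, f, fun i => u (m i), hf, fun x => by simp [h]⟩

lemma mem_regMaps_complex {f : X → ℂ} : f ∈ regMaps κ ℂ ↔ f ∈ regFun κ := by
  constructor
  · intro hF
    obtain ⟨k, f, m, hf, h⟩ := exists_decomp_of_mem_regMaps hF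
    rename_i f'
    have : f' = ∑ i, m i • f i := by
      funext x; simp [h, mul_comm]
    rw [this]
    exact Subalgebra.sum_mem _ fun i _ => Subalgebra.smul_mem _ (hf i) _
  · intro hf
    simpa using smul_mem_regMaps (κ := κ) hf (1 : ℂ)

lemma functional_comp_mem_regFun {F : X → M} (hF : F ∈ regMaps κ M) (u : M →ₗ[ℂ] ℂ) :
    (fun x => u (F x)) ∈ regFun κ :=
  mem_regMaps_complex.1 (comp_linear_mem_regMaps hF u)

lemma comp_mem_regMaps {F : Y → M} (hF : F ∈ regMaps κ' M) {φ : X → Y}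
    (h : ∀ t, (fun x => κ' (φ x) t) ∈ regFun κ) : (fun x => F (φ x)) ∈ regMaps κ M := by
  obtain ⟨k, f, m, hf, e⟩ := exists_decomp_of_mem_regMaps hF
  exact mem_regMaps_iff.2 ⟨k, fun i x => f i (φ x), m, fun i => comp_mem_regFun (hf i) h,
    fun x => e _⟩

lemma regFun_smul_mem_regMaps {f : X → ℂ} (hf : f ∈ regFun κ) {F : X → M}
    (hF : F ∈ regMaps κ M) : (fun x => f x • F x) ∈ regMaps κ M := by
  obtain ⟨k, a, m, ha, e⟩ := exists_decomp_of_mem_regMaps hF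
  exact mem_regMaps_iff.2 ⟨k, fun i x => f x * a i x, m,
    fun i => (regFun κ).mul_mem hf (ha i), fun x => by
      simp [e, Finset.smul_sum, mul_smul]⟩

lemma exists_lift_regMaps {F : X → N} (hF : F ∈ regMaps κ N) {u : M →ₗ[ℂ] N}
    (hu : Function.Surjective u) : ∃ F' ∈ regMaps κ M, ∀ x, u (F' x) = F x := by
  obtain ⟨s, hs⟩ := u.exists_rightInverse_of_surjective (LinearMap.range_eq_top.2 hu)
  exact ⟨fun x => s (F x), comp_linear_mem_regMaps hF s, fun x => LinearMap.congr_fun hs _⟩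

lemma mem_regMaps_of_comp_injective {F : X → M} {u : M →ₗ[ℂ] N} (hu : Function.Injective u)
    (hF : (fun x => u (F x)) ∈ regMaps κ N) : F ∈ regMaps κ M := by
  obtain ⟨s, hs⟩ := u.exists_leftInverse_of_injective (LinearMap.ker_eq_bot.2 hu)
  have := comp_linear_mem_regMaps hF s
  have e : (fun x => s (u (F x))) = F := funext fun x => LinearMap.congr_fun hs _
  rwa [e] at this

/-- A regular map on a product, seen as a regular map with values in regular maps. -/
lemma exists_curry_regMaps {F : X × Y → M} (hF : F ∈ regMaps (prodCoord κ κ') M) :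
    ∃ K ∈ regMaps κ (regMaps κ' M), ∀ x y, (K x : Y → M) y = F (x, y) := by
  obtain ⟨k, f, m, hf, e⟩ := exists_decomp_of_mem_regMaps hF
  choose l a b ha hb hab using fun i => exists_sum_of_mem_regFun_prod (hf i)
  refine ⟨fun x => ∑ i, ∑ j, a i j x •
      (⟨fun y => b i j y • m i, smul_mem_regMaps (hb i j) _⟩ : regMaps κ' M), ?_, ?_⟩
  · have : ∀ i j, (fun x => a i j x •
      (⟨fun y => b i j y • m i, smul_mem_regMaps (hb i j) _⟩ : regMaps κ' M)) ∈
        regMaps κ (regMaps κ' M) := fun i j => smul_mem_regMaps (ha i j) _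
    have := Submodule.sum_mem (regMaps κ (regMaps κ' M)) (t := Finset.univ) fun i _ =>
      Submodule.sum_mem (regMaps κ (regMaps κ' M)) (t := Finset.univ) fun j _ => this i j
    convert this using 1
    funext x; simp [Finset.sum_apply]
  · intro x y
    simp only [e, hab, Submodule.coe_sum, Finset.sum_apply, Submodule.coe_smul, Pi.smul_apply,
      Finset.sum_smul, mul_smul]

/-- Application of a functional on functions to a regular map. -/
lemma exists_unique_apply (δ : (X → ℂ) →ₗ[ℂ] ℂ) {F : X → M} (hF : F ∈ regMaps κ M) :
    ∃! m : M, ∀ l : M →ₗ[ℂ] ℂ, l m = δ (fun x => l (F x)) := by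
  obtain ⟨k, f, m, hf, e⟩ := exists_decomp_of_mem_regMaps hF
  refine ⟨∑ i, δ (f i) • m i, fun l => ?_, fun y hy => ?_⟩
  · have : (fun x => l (F x)) = ∑ i, l (m i) • f i := by
      funext x; simp [e, mul_comm]
    rw [this]; simp [mul_comm]
  · rw [← sub_eq_zero, ← Module.forall_dual_apply_eq_zero_iff ℂ]
    intro l
    have : (fun x => l (F x)) = ∑ i, l (m i) • f i := by
      funext x; simp [e, mul_comm]
    rw [map_sub, hy, this]; simp [mul_comm]

lemma dual_ext {m m' : M} (h : ∀ l : M →ₗ[ℂ] ℂ, l m = l m') : m = m' := by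
  rw [← sub_eq_zero, ← Module.forall_dual_apply_eq_zero_iff ℂ]
  intro l
  rw [map_sub, h, sub_self]

/-- Application of a functional on functions to a regular map. -/
def regApply (δ : (X → ℂ) →ₗ[ℂ] ℂ) : regMaps κ M →ₗ[ℂ] M where
  toFun F := (exists_unique_apply δ F.2).choose
  map_add' F F' := dual_ext fun l => by
    rw [map_add, (exists_unique_apply δ (F + F').2).choose_spec.1,
      (exists_unique_apply δ F.2).choose_spec.1, (exists_unique_apply δ F'.2).choose_spec.1,
      ← map_add]
    congr 1; funext x; simp
  map_smul' c F := dual_ext fun l => by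
    rw [RingHom.id_apply, map_smul, (exists_unique_apply δ (c • F).2).choose_spec.1,
      (exists_unique_apply δ F.2).choose_spec.1, ← map_smul]
    congr 1; funext x; simp

lemma dual_regApply (δ : (X → ℂ) →ₗ[ℂ] ℂ) (F : regMaps κ M) (l : M →ₗ[ℂ] ℂ) :
    l (regApply δ F) = δ (fun x => l (F.1 x)) :=
  (exists_unique_apply δ F.2).choose_spec.1 l

end RegMaps

namespace AffAlgGroup

variable {H : AffAlgGroup} {𝔩 : Type} [LieRing 𝔩] [LieAlgebra ℂ 𝔩]
variable {M N : Type} [AddCommGroup M] [Module ℂ M] [LieRingModule 𝔩 M]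
  [AddCommGroup N] [Module ℂ N] [LieRingModule 𝔩 N]

/-- Regular maps from the group to a vector space. -/
abbrev OM (H : AffAlgGroup) (M : Type) [AddCommGroup M] [Module ℂ M] : Submodule ℂ (H.Gp → M) :=
  regMaps (fun g : H.Gp => g.1) M

/-- A rational module: a regular, locally finite representation together with its derived
action. -/
structure IsRat (d : LieDat H 𝔩) (ρ : Representation ℂ H.Gp M) : Prop where
  reg : ∀ m, (fun g => ρ g m) ∈ H.OM M
  der : ∀ (x : 𝔩) (m : M) (l : M →ₗ[ℂ] ℂ), l ⁅x, m⁆ = d.D x (fun g => l (ρ g m))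

variable {d : LieDat H 𝔩} {ρ : Representation ℂ H.Gp M} {ρ' : Representation ℂ H.Gp N}

lemma IsRat.coeff_mem (h : IsRat d ρ) (m : M) (l : M →ₗ[ℂ] ℂ) :
    (fun g => l (ρ g m)) ∈ H.O := functional_comp_mem_regFun (h.reg m) l

lemma IsRat.map_lie (h : IsRat d ρ) (h' : IsRat d ρ') (u : M →ₗ[ℂ] N)
    (hu : ∀ g m, u (ρ g m) = ρ' g (u m)) (x : 𝔩) (m : M) : u ⁅x, m⁆ = ⁅x, u m⁆ := by
  refine dual_ext fun l => ?_
  rw [h'.der, ← LinearMap.comp_apply, h.der]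
  simp [hu]

lemma IsRat.of_injective (h : IsRat d ρ') (u : M →ₗ[ℂ] N) (hu : Function.Injective u)
    (hρ : ∀ g m, u (ρ g m) = ρ' g (u m)) (hl : ∀ (x : 𝔩) m, u ⁅x, m⁆ = ⁅x, u m⁆) :
    IsRat d ρ where
  reg m := mem_regMaps_of_comp_injective hu (by simpa [hρ] using h.reg (u m))
  der x m l := by
    obtain ⟨s, hs⟩ := u.exists_leftInverse_of_injective (LinearMap.ker_eq_bot.2 hu)
    have hs' : ∀ m, s (u m) = m := fun m => LinearMap.congr_fun hs m
    have := h.der x (u m) (l ∘ₗ s)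
    simpa [← hl, ← hρ, hs'] using this

lemma IsRat.of_surjective (h : IsRat d ρ) (u : M →ₗ[ℂ] N) (hu : Function.Surjective u)
    (hρ : ∀ g m, u (ρ g m) = ρ' g (u m)) (hl : ∀ (x : 𝔩) m, u ⁅x, m⁆ = ⁅x, u m⁆) :
    IsRat d ρ' where
  reg n := by
    obtain ⟨m, rfl⟩ := hu n
    simpa [← hρ] using comp_linear_mem_regMaps (h.reg m) u
  der x n l := by
    obtain ⟨m, rfl⟩ := hu n
    have := h.der x m (l ∘ₗ u)
    simpa [hl, hρ] using this

/-- A group-stable subspace of a rational module is stable under the Lie algebra. -/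
lemma IsRat.lie_mem (h : IsRat d ρ) {W : Submodule ℂ M} (hW : ∀ g, ∀ m ∈ W, ρ g m ∈ W)
    (x : 𝔩) {m : M} (hm : m ∈ W) : ⁅x, m⁆ ∈ W := by
  by_contra hn
  obtain ⟨l, hl, hle⟩ := Submodule.exists_le_ker_of_notMem hn
  apply hl
  rw [h.der]
  have : (fun g => l (ρ g m)) = 0 := funext fun g => hle (hW g m hm)
  rw [this, map_zero]

lemma IsRat.exists_fd (h : IsRat d ρ) (m : M) : ∃ W : Submodule ℂ M, FiniteDimensional ℂ W ∧
    m ∈ W ∧ ∀ g, ∀ m ∈ W, ρ g m ∈ W := by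
  refine ⟨Submodule.span ℂ (Set.range fun g => ρ g m), ?_, ?_, ?_⟩
  · obtain ⟨k, f, n, hf, e⟩ := exists_decomp_of_mem_regMaps (h.reg m)
    have : FiniteDimensional ℂ (Submodule.span ℂ (Set.range n)) :=
      FiniteDimensional.span_of_finite ℂ (Set.finite_range n)
    refine Submodule.finiteDimensional_of_le (S₂ := Submodule.span ℂ (Set.range n)) ?_
    rw [Submodule.span_le]
    rintro _ ⟨g, rfl⟩
    simp only [SetLike.mem_coe, e]
    exact Submodule.sum_mem _ fun i _ => Submodule.smul_mem _ _ (Submodule.subset_span ⟨i, rfl⟩)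
  · exact Submodule.subset_span ⟨1, by simp⟩
  · intro g n hn
    induction hn using Submodule.span_induction with
    | mem n hn =>
      obtain ⟨g', rfl⟩ := hn
      exact Submodule.subset_span ⟨g * g', by simp⟩
    | zero => simp
    | add a b _ _ ha hb => rw [map_add]; exact Submodule.add_mem _ ha hb
    | smul c a _ ha => rw [map_smul]; exact Submodule.smul_mem _ _ ha

/-! ### The coinduced module -/

/-- Regular maps into `M`, with the group acting by right translations. -/
def Jmod (_d : LieDat H 𝔩) (M : Type) [AddCommGroup M] [Module ℂ M] : Type := H.OM M

section Jmod

variable (d) (M : Type) [AddCommGroup M] [Module ℂ M]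

instance : AddCommGroup (Jmod d M) := inferInstanceAs (AddCommGroup (H.OM M))
instance : Module ℂ (Jmod d M) := inferInstanceAs (Module ℂ (H.OM M))

/-- The underlying function of an element of the coinduced module. -/
def Jmod.val : Jmod d M →ₗ[ℂ] (H.Gp → M) := (H.OM M).subtype

variable {d M}

lemma Jmod.val_mem (F : Jmod d M) : Jmod.val d M F ∈ H.OM M := Subtype.property _

lemma Jmod.val_injective : Function.Injective (Jmod.val d M) := Subtype.val_injective

/-- Constructor for elements of the coinduced module. -/
def Jmod.mk (F : H.Gp → M) (h : F ∈ H.OM M) : Jmod d M := ⟨F, h⟩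

@[simp] lemma Jmod.val_mk (F : H.Gp → M) (h : F ∈ H.OM M) :
    Jmod.val d M (Jmod.mk F h) = F := rfl

lemma Jmod.ext {F F' : Jmod d M} (h : ∀ g, Jmod.val d M F g = Jmod.val d M F' g) : F = F' :=
  Jmod.val_injective (funext h)

/-- Evaluation at a point. -/
def Jmod.ev (g : H.Gp) : Jmod d M →ₗ[ℂ] M := LinearMap.proj g ∘ₗ Jmod.val d M

lemma Jmod.ev_apply (g : H.Gp) (F : Jmod d M) : Jmod.ev g F = Jmod.val d M F g := rfl

lemma OM_mul_right {F : H.Gp → M} (hF : F ∈ H.OM M) (g : H.Gp) :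
    (fun h => F (h * g)) ∈ H.OM M :=
  comp_mem_regMaps hF (mul_coord_mem coord_mem_O (const_coord_mem g))

lemma OM_mul_left {F : H.Gp → M} (hF : F ∈ H.OM M) (g : H.Gp) :
    (fun h => F (g * h)) ∈ H.OM M :=
  comp_mem_regMaps hF (mul_coord_mem (const_coord_mem g) coord_mem_O)

variable (d M) in
/-- Right translations on the coinduced module. -/
def Jmod.rep : Representation ℂ H.Gp (Jmod d M) where
  toFun h :=
    { toFun F := Jmod.mk (fun g => Jmod.val d M F (g * h)) (OM_mul_right F.val_mem h)
      map_add' F F' := Jmod.ext fun g => by simp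
      map_smul' c F := Jmod.ext fun g => by simp }
  map_one' := by
    refine LinearMap.ext fun F => Jmod.ext fun g => by simp
  map_mul' a b := by
    refine LinearMap.ext fun F => Jmod.ext fun g => by simp [mul_assoc]

lemma Jmod.rep_apply (h : H.Gp) (F : Jmod d M) (g : H.Gp) :
    Jmod.val d M (Jmod.rep d M h F) g = Jmod.val d M F (g * h) := rfl

lemma Jmod.rep_reg (F : Jmod d M) : (fun h => Jmod.rep d M h F) ∈ H.OM (Jmod d M) := by
  have hF : (fun p : H.Gp × H.Gp => Jmod.val d M F (p.2 * p.1)) ∈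
      regMaps (prodCoord (fun g : H.Gp => g.1) (fun g : H.Gp => g.1)) M :=
    comp_mem_regMaps F.val_mem (mul_coord_mem snd_coord_mem fst_coord_mem)
  obtain ⟨K, hK, e⟩ := exists_curry_regMaps hF
  have : (fun h => Jmod.rep d M h F) = K := by
    funext h
    exact Jmod.ext fun g => (e h g).symm
  rw [this]
  exact hK

/-- The infinitesimal right translation by `x`. -/
def Jmod.lie (x : 𝔩) (F : Jmod d M) : Jmod d M :=
  regApply (d.D x) ⟨_, Jmod.rep_reg F⟩

lemma Jmod.dual_lie (x : 𝔩) (F : Jmod d M) (l : Jmod d M →ₗ[ℂ] ℂ) :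
    l (Jmod.lie x F) = d.D x (fun h => l (Jmod.rep d M h F)) :=
  dual_regApply _ _ l

lemma Jmod.lie_val (x : 𝔩) (F : Jmod d M) (g : H.Gp) (l : M →ₗ[ℂ] ℂ) :
    l (Jmod.val d M (Jmod.lie x F) g) = linv (d.D x) (fun g => l (Jmod.val d M F g)) g :=
  Jmod.dual_lie x F (l ∘ₗ Jmod.ev g)

lemma Jmod.ext_dual {F F' : Jmod d M} (h : ∀ (l : M →ₗ[ℂ] ℂ) (g : H.Gp),
    l (Jmod.val d M F g) = l (Jmod.val d M F' g)) : F = F' :=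
  Jmod.ext fun g => dual_ext fun l => h l g

lemma Jmod.coeff_mem (F : Jmod d M) (l : M →ₗ[ℂ] ℂ) : (fun g => l (Jmod.val d M F g)) ∈ H.O :=
  functional_comp_mem_regFun F.val_mem l

lemma linv_D_lie (d : LieDat H 𝔩) (x y : 𝔩) {f : H.Gp → ℂ} (hf : f ∈ H.O) :
    linv (d.D ⁅x, y⁆) f = linv (d.D x) (linv (d.D y) f) - linv (d.D y) (linv (d.D x) f) := by
  funext g
  rw [linv_apply, d.bracket x y _ (O_mul_left hf g), ← linv_translate, ← linv_translate]
  rfl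

lemma linv_add_left (δ ε : (H.Gp → ℂ) →ₗ[ℂ] ℂ) (f : H.Gp → ℂ) :
    linv (δ + ε) f = linv δ f + linv ε f := rfl

lemma linv_smul_left (c : ℂ) (δ : (H.Gp → ℂ) →ₗ[ℂ] ℂ) (f : H.Gp → ℂ) :
    linv (c • δ) f = c • linv δ f := rfl

instance : LieRingModule 𝔩 (Jmod d M) where
  bracket x F := Jmod.lie x F
  add_lie x y F := Jmod.ext_dual fun l g => by
    simp only [map_add, Pi.add_apply, Jmod.lie_val, linv_add_left]
  lie_add x F F' := by
    show regApply (d.D x) _ = regApply (d.D x) _ + regApply (d.D x) _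
    rw [← map_add]
    congr 1
  leibniz_lie x y F := Jmod.ext_dual fun l g => by
    have e : ∀ (x y : 𝔩), l (Jmod.val d M (Jmod.lie x (Jmod.lie y F)) g) =
        linv (d.D x) (linv (d.D y) fun g => l (Jmod.val d M F g)) g := by
      intro x y
      rw [Jmod.lie_val]
      simp only [Jmod.lie_val]
    show l (Jmod.val d M (Jmod.lie x (Jmod.lie y F)) g) =
      l (Jmod.val d M (Jmod.lie ⁅x, y⁆ F + Jmod.lie y (Jmod.lie x F)) g)
    rw [map_add, Pi.add_apply, map_add, e, e, Jmod.lie_val, linv_D_lie d x y (F.coeff_mem l)]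
    simp

lemma Jmod.lie_def (x : 𝔩) (F : Jmod d M) : ⁅x, F⁆ = Jmod.lie x F := rfl

instance : LieModule ℂ 𝔩 (Jmod d M) where
  smul_lie c x F := Jmod.ext_dual fun l g => by
    simp only [Jmod.lie_def, map_smul, Pi.smul_apply, Jmod.lie_val, linv_smul_left]
  lie_smul c x F := by
    show regApply (d.D x) _ = c • regApply (d.D x) _
    rw [← map_smul]
    congr 1

lemma Jmod.isRat : IsRat d (Jmod.rep d M) where
  reg := Jmod.rep_reg
  der x F l := Jmod.dual_lie x F l

end Jmod

/-- The embedding of a rational module into the coinduced module. -/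
def IsRat.toJ (h : IsRat d ρ) : M →ₗ[ℂ] Jmod d M where
  toFun m := Jmod.mk (fun g => ρ g m) (h.reg m)
  map_add' m m' := Jmod.ext fun g => by simp
  map_smul' c m := Jmod.ext fun g => by simp

lemma IsRat.toJ_val (h : IsRat d ρ) (m : M) (g : H.Gp) :
    Jmod.val d M (h.toJ m) g = ρ g m := rfl

lemma IsRat.toJ_injective (h : IsRat d ρ) : Function.Injective h.toJ := fun m m' e => by
  have := congrArg (fun F => Jmod.val d M F 1) e
  simpa [IsRat.toJ_val] using this

lemma IsRat.toJ_rep (h : IsRat d ρ) (g : H.Gp) (m : M) :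
    h.toJ (ρ g m) = Jmod.rep d M g (h.toJ m) := Jmod.ext fun g' => by
  rw [Jmod.rep_apply, h.toJ_val, h.toJ_val, map_mul]; rfl

lemma IsRat.toJ_lie (h : IsRat d ρ) (x : 𝔩) (m : M) : h.toJ ⁅x, m⁆ = ⁅x, h.toJ m⁆ :=
  h.map_lie Jmod.isRat h.toJ h.toJ_rep x m

/-- Matrix coefficients. -/
def IsRat.coeff (h : IsRat d ρ) (l : M →ₗ[ℂ] ℂ) : M →ₗ[ℂ] Jmod d ℂ where
  toFun m := Jmod.mk (fun g => l (ρ g m)) (comp_linear_mem_regMaps (h.reg m) l)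
  map_add' m m' := Jmod.ext fun g => by simp
  map_smul' c m := Jmod.ext fun g => by simp

lemma IsRat.coeff_val (h : IsRat d ρ) (l : M →ₗ[ℂ] ℂ) (m : M) (g : H.Gp) :
    Jmod.val d ℂ (h.coeff l m) g = l (ρ g m) := rfl

lemma IsRat.coeff_lie (h : IsRat d ρ) (l : M →ₗ[ℂ] ℂ) (x : 𝔩) (m : M) :
    h.coeff l ⁅x, m⁆ = ⁅x, h.coeff l m⁆ :=
  h.map_lie Jmod.isRat (h.coeff l) (fun g m => Jmod.ext fun g' => by
    rw [Jmod.rep_apply, h.coeff_val, h.coeff_val, map_mul]; rfl) x m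

lemma IsRat.dual_lie_rep (h : IsRat d ρ) (l : M →ₗ[ℂ] ℂ) (x : 𝔩) (m : M) (g : H.Gp) :
    l (ρ g ⁅x, m⁆) = linv (d.D x) (fun g => l (ρ g m)) g := by
  have := h.der x m (l ∘ₗ ρ g)
  simpa [linv_apply, map_mul] using this

end AffAlgGroup

/-! ### Conjugate semisimple parts of locally finite operators -/

section ConjPart

variable {V : Type} [AddCommGroup V] [Module ℂ V]

/-- An operator is locally finite if every vector lies in a finite-dimensional stable subspace. -/
def LocFinite (T : Module.End ℂ V) : Prop :=
  ∀ v, ∃ W : Submodule ℂ V, FiniteDimensional ℂ W ∧ v ∈ W ∧ ∀ w ∈ W, T w ∈ W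

lemma maxGenEigenspace_map {V W : Type} [AddCommGroup V] [Module ℂ V] [AddCommGroup W]
    [Module ℂ W] {T : Module.End ℂ V} {S : Module.End ℂ W} {u : V →ₗ[ℂ] W}
    (h : ∀ v, u (T v) = S (u v)) {μ : ℂ} {v : V} (hv : v ∈ T.maxGenEigenspace μ) :
    u v ∈ S.maxGenEigenspace μ := by
  rw [Module.End.mem_maxGenEigenspace] at hv ⊢
  obtain ⟨k, hk⟩ := hv
  refine ⟨k, ?_⟩
  have : ∀ k v, ((S - μ • (1 : Module.End ℂ W)) ^ k) (u v) =
      u (((T - μ • (1 : Module.End ℂ V)) ^ k) v) := by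
    intro k
    induction k with
    | zero => simp
    | succ k ih =>
      intro v
      rw [pow_succ, pow_succ, Module.End.mul_apply, Module.End.mul_apply, ← ih]
      simp [h]
  rw [this, hk, map_zero]

lemma LocFinite.iSup_eq_top {T : Module.End ℂ V} (hT : LocFinite T) :
    ⨆ μ, T.maxGenEigenspace μ = ⊤ := by
  rw [eq_top_iff]
  rintro v -
  obtain ⟨W, hfd, hv, hW⟩ := hT v
  let R : Module.End ℂ W := T.restrict hW
  have h2 : (⟨v, hv⟩ : W) ∈ ⨆ μ, R.maxGenEigenspace μ :=
    Module.End.iSup_maxGenEigenspace_eq_top R ▸ Submodule.mem_top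
  have h3 : W.subtype ⟨v, hv⟩ ∈ (⨆ μ, R.maxGenEigenspace μ).map W.subtype :=
    Submodule.mem_map_of_mem h2
  rw [Submodule.map_iSup] at h3
  refine (show _ ≤ ⨆ μ, T.maxGenEigenspace μ from iSup_mono fun μ => ?_) h3
  rintro _ ⟨w, hw, rfl⟩
  exact maxGenEigenspace_map (S := T) (u := W.subtype) (fun v => rfl) hw

lemma isInternal_of_locFinite {T : Module.End ℂ V} (hT : LocFinite T) :
    DirectSum.IsInternal (fun μ => T.maxGenEigenspace μ) := by
  rw [DirectSum.isInternal_submodule_iff_iSupIndep_and_iSup_eq_top]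
  exact ⟨Module.End.independent_maxGenEigenspace T, hT.iSup_eq_top⟩

/-- The operator acting as `conj μ` on each generalized eigenspace for `μ`. -/
lemma exists_conjPart {T : Module.End ℂ V} (hT : LocFinite T) :
    ∃ K : Module.End ℂ V, ∀ μ, ∀ v ∈ T.maxGenEigenspace μ, K v = starRingEnd ℂ μ • v := by
  have hI := isInternal_of_locFinite hT
  let φ := LinearEquiv.ofBijective (DirectSum.coeLinearMap fun μ => T.maxGenEigenspace μ) hI
  refine ⟨(DirectSum.toModule ℂ ℂ V fun μ => starRingEnd ℂ μ •
    (T.maxGenEigenspace μ).subtype) ∘ₗ φ.symm.toLinearMap, fun μ v hv => ?_⟩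
  have : φ.symm v = DirectSum.lof ℂ ℂ (fun μ => T.maxGenEigenspace μ) μ ⟨v, hv⟩ := by
    rw [LinearEquiv.symm_apply_eq]
    exact (DirectSum.coeLinearMap_lof (fun μ => T.maxGenEigenspace μ) μ ⟨v, hv⟩).symm
  simp [this]

/-- Leibniz rule and generalized eigenvectors. -/
lemma pow_bilin_eq_zero {U V W : Type} [AddCommGroup U] [Module ℂ U] [AddCommGroup V]
    [Module ℂ V] [AddCommGroup W] [Module ℂ W] (B : U →ₗ[ℂ] V →ₗ[ℂ] W)
    (P : Module.End ℂ U) (Q : Module.End ℂ V) (S : Module.End ℂ W)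
    (h : ∀ u v, S (B u v) = B (P u) v + B u (Q v)) (n k l : ℕ) (hn : k + l ≤ n) (u : U) (v : V)
    (hu : (P ^ k) u = 0) (hv : (Q ^ l) v = 0) : (S ^ n) (B u v) = 0 := by
  induction n generalizing k l u v with
  | zero =>
    obtain rfl : k = 0 := by omega
    rw [pow_zero, Module.End.one_apply] at hu
    simp [hu]
  | succ n ih =>
    rcases k with _ | k
    · rw [pow_zero, Module.End.one_apply] at hu
      simp [hu]
    rcases l with _ | l
    · rw [pow_zero, Module.End.one_apply] at hv
      simp [hv]
    rw [pow_succ, Module.End.mul_apply, h, map_add,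
      ih k (l + 1) (by omega) (P u) v (by rwa [pow_succ] at hu) hv,
      ih (k + 1) l (by omega) u (Q v) hu (by rwa [pow_succ] at hv), add_zero]

end ConjPart

/-- Locally finite modules on which generalized eigenspaces of `x` are eigenspaces of `σ x`
for the conjugate eigenvalue. -/
structure IsGood {𝔩 : Type} [LieRing 𝔩] [LieAlgebra ℂ 𝔩] (σ : 𝔩 → 𝔩) (V : Type)
    [AddCommGroup V] [Module ℂ V] [LieRingModule 𝔩 V] [LieModule ℂ 𝔩 V] : Prop where
  locFin : ∀ v : V, ∃ W : Submodule ℂ V, FiniteDimensional ℂ W ∧ v ∈ W ∧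
    ∀ (x : 𝔩), ∀ w ∈ W, ⁅x, w⁆ ∈ W
  conj : ∀ (x : 𝔩) (μ : ℂ) (v : V), v ∈ (LieModule.toEnd ℂ 𝔩 V x).maxGenEigenspace μ →
    ⁅σ x, v⁆ = starRingEnd ℂ μ • v

namespace AffAlgGroup

variable {H : AffAlgGroup} {𝔩 : Type} [LieRing 𝔩] [LieAlgebra ℂ 𝔩]
variable {M : Type} [AddCommGroup M] [Module ℂ M]
variable {d : LieDat H 𝔩}

/-- Pointwise multiplication of regular maps by regular functions. -/
def Jmod.act : Jmod d ℂ →ₗ[ℂ] Jmod d M →ₗ[ℂ] Jmod d M :=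
  LinearMap.mk₂ ℂ (fun f F => Jmod.mk (fun g => Jmod.val d ℂ f g • Jmod.val d M F g)
      (regFun_smul_mem_regMaps (mem_regMaps_complex.1 f.val_mem) F.val_mem))
    (fun f f' F => Jmod.ext fun g => by simp [add_smul])
    (fun c f F => Jmod.ext fun g => by simp [mul_smul])
    (fun f F F' => Jmod.ext fun g => by simp)
    (fun c f F => Jmod.ext fun g => by
      simp only [Jmod.val_mk, map_smul, Pi.smul_apply]; exact smul_comm _ _ _)

lemma Jmod.act_val (f : Jmod d ℂ) (F : Jmod d M) (g : H.Gp) :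
    Jmod.val d M (Jmod.act f F) g = Jmod.val d ℂ f g • Jmod.val d M F g := rfl

lemma Jmod.val_mem_O (f : Jmod d ℂ) : Jmod.val d ℂ f ∈ H.O := mem_regMaps_complex.1 f.val_mem

lemma Jmod.lie_val_complex (x : 𝔩) (f : Jmod d ℂ) (g : H.Gp) :
    Jmod.val d ℂ ⁅x, f⁆ g = linv (d.D x) (Jmod.val d ℂ f) g :=
  Jmod.lie_val x f g LinearMap.id

lemma Jmod.lie_act (x : 𝔩) (f : Jmod d ℂ) (F : Jmod d M) :
    ⁅x, Jmod.act f F⁆ = Jmod.act ⁅x, f⁆ F + Jmod.act f ⁅x, F⁆ := Jmod.ext_dual fun l g => by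
  have h := congrFun (linv_mul (d.leib x) f.val_mem_O (F.coeff_mem l)) g
  have e : (fun g => l (Jmod.val d M (Jmod.act f F) g)) =
      Jmod.val d ℂ f * fun g => l (Jmod.val d M F g) := by
    funext g; simp [Jmod.act_val]
  rw [Jmod.lie_def, Jmod.lie_val, e, h, map_add (Jmod.val d M), Pi.add_apply, Pi.add_apply,
    map_add l, Jmod.act_val,
    Jmod.act_val, map_smul, map_smul, Jmod.lie_val_complex, Jmod.lie_def, Jmod.lie_val]
  simp only [Pi.mul_apply, smul_eq_mul]
  ring

lemma IsRat.locFinite {M : Type} [AddCommGroup M] [Module ℂ M] [LieRingModule 𝔩 M]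
    [LieModule ℂ 𝔩 M] {ρ : Representation ℂ H.Gp M} (h : IsRat d ρ) (x : 𝔩) :
    LocFinite (LieModule.toEnd ℂ 𝔩 M x) := fun m => by
  obtain ⟨W, hfd, hm, hW⟩ := h.exists_fd m
  exact ⟨W, hfd, hm, fun w hw => h.lie_mem hW x hw⟩

/-- Left translation by a group element. -/
def Jmod.left (g : H.Gp) : Jmod d M →ₗ[ℂ] Jmod d M where
  toFun F := Jmod.mk (fun h => Jmod.val d M F (g * h)) (OM_mul_left F.val_mem g)
  map_add' F F' := Jmod.ext fun g => by simp
  map_smul' c F := Jmod.ext fun g => by simp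

lemma Jmod.left_val (g h : H.Gp) (F : Jmod d M) :
    Jmod.val d M (Jmod.left g F) h = Jmod.val d M F (g * h) := rfl

lemma Jmod.left_lie (g : H.Gp) (x : 𝔩) (F : Jmod d M) :
    Jmod.left g ⁅x, F⁆ = ⁅x, Jmod.left g F⁆ :=
  Jmod.isRat.map_lie Jmod.isRat (Jmod.left g) (fun h m => Jmod.ext fun g' => by
    simp [Jmod.left_val, Jmod.rep_apply, mul_assoc]) x F

lemma LieDat.exists_conj (d : LieDat H 𝔩) (x : 𝔩) : ∃ y : 𝔩, ∀ (μ : ℂ) (f : Jmod d ℂ),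
    f ∈ (LieModule.toEnd ℂ 𝔩 (Jmod d ℂ) x).maxGenEigenspace μ → ⁅y, f⁆ = starRingEnd ℂ μ • f := by
  set T := LieModule.toEnd ℂ 𝔩 (Jmod d ℂ) x with hT
  have hlf : LocFinite T := (Jmod.isRat (d := d) (M := ℂ)).locFinite x
  obtain ⟨K, hK⟩ := exists_conjPart hlf
  have hspan : ∀ f : Jmod d ℂ, f ∈ ⨆ μ, T.maxGenEigenspace μ := fun f => by
    rw [hlf.iSup_eq_top]; trivial
  have hleft : ∀ g f, K (Jmod.left g f) = Jmod.left g (K f) := by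
    intro g f
    refine Submodule.iSup_induction _ (motive := fun f => K (Jmod.left g f) = Jmod.left g (K f))
      (hspan f) ?_ (by simp) (fun a b ha hb => by simp [ha, hb])
    intro μ f hf
    rw [hK μ f hf, hK μ _ (maxGenEigenspace_map (fun v => Jmod.left_lie g x v) hf), map_smul]
  have hder : ∀ f f' : Jmod d ℂ, K (Jmod.act f f') = Jmod.act (K f) f' + Jmod.act f (K f') := by
    intro f f'
    refine Submodule.iSup_induction _ (motive := fun f => K (Jmod.act f f') =
      Jmod.act (K f) f' + Jmod.act f (K f')) (hspan f) ?_ (by simp) ?_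
    · intro μ f hf
      refine Submodule.iSup_induction _ (motive := fun f' => K (Jmod.act f f') =
        Jmod.act (K f) f' + Jmod.act f (K f')) (hspan f') ?_ (by simp) ?_
      · intro ν f' hf'
        rw [hK μ f hf, hK ν f' hf', hK (μ + ν)]
        · simp [add_smul]
        · rw [Module.End.mem_maxGenEigenspace] at hf hf' ⊢
          obtain ⟨k, hk⟩ := hf
          obtain ⟨l, hl⟩ := hf'
          refine ⟨k + l, pow_bilin_eq_zero Jmod.act _ _ _ (fun u v => ?_) _ k l le_rfl _ _ hk hl⟩
          simp only [hT, LinearMap.sub_apply, LieModule.toEnd_apply_apply, Jmod.lie_act,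
            LinearMap.smul_apply, Module.End.one_apply, map_sub, map_smul, add_smul,
            LinearMap.add_apply]
          abel
      · intro a b ha hb
        simp only [map_add, ha, hb]; abel
    · intro a b ha hb
      simp only [map_add, LinearMap.add_apply, ha, hb]; abel
  obtain ⟨δ, hδ⟩ := LinearMap.exists_extend (p := H.OM ℂ) (Jmod.ev (d := d) 1 ∘ₗ K)
  have hδ' : ∀ f : Jmod d ℂ, δ (Jmod.val d ℂ f) = Jmod.val d ℂ (K f) 1 := fun f =>
    LinearMap.congr_fun hδ f
  have hpd : IsPointDer δ := by
    intro f hf f' hf'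
    have := hδ' (Jmod.act (Jmod.mk f (mem_regMaps_complex.2 hf))
      (Jmod.mk f' (mem_regMaps_complex.2 hf')))
    rw [hder] at this
    have e1 := hδ' (Jmod.mk f (mem_regMaps_complex.2 hf))
    have e2 := hδ' (Jmod.mk f' (mem_regMaps_complex.2 hf'))
    simp only [map_add, Pi.add_apply, Jmod.act_val, ← e1, ← e2, Jmod.val_mk, smul_eq_mul] at this
    rw [show f * f' = Jmod.val d ℂ (Jmod.act (Jmod.mk f (mem_regMaps_complex.2 hf))
      (Jmod.mk f' (mem_regMaps_complex.2 hf'))) from rfl, this]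
    ring
  obtain ⟨y, hy⟩ := d.surj δ hpd
  refine ⟨y, fun μ f hf => ?_⟩
  rw [← hK μ f hf]
  refine Jmod.ext fun g => ?_
  rw [Jmod.lie_val_complex, linv_apply, hy _ (O_mul_left f.val_mem_O g)]
  have := hδ' (Jmod.left g f)
  rw [hleft] at this
  rw [Jmod.left_val, mul_one] at this
  exact this

/-- The conjugate of an element of the Lie algebra of an algebraic group. -/
def LieDat.sig (d : LieDat H 𝔩) (x : 𝔩) : 𝔩 := (d.exists_conj x).choose

lemma IsRat.isGood {M : Type} [AddCommGroup M] [Module ℂ M] [LieRingModule 𝔩 M]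
    [LieModule ℂ 𝔩 M] {ρ : Representation ℂ H.Gp M} (h : IsRat d ρ) : IsGood d.sig M where
  locFin m := by
    obtain ⟨W, hfd, hm, hW⟩ := h.exists_fd m
    exact ⟨W, hfd, hm, fun x w hw => h.lie_mem hW x hw⟩
  conj x μ m hm := by
    refine dual_ext fun l => ?_
    have := (d.exists_conj x).choose_spec μ (h.coeff l m)
      (maxGenEigenspace_map (fun v => h.coeff_lie l x v) hm)
    have e := congrArg (fun f => Jmod.val d ℂ f 1) this
    change Jmod.val d ℂ ⁅d.sig x, h.coeff l m⁆ 1 = _ at e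
    rw [← h.coeff_lie] at e
    simpa [IsRat.coeff_val] using e

end AffAlgGroup

/-! ### Good modules and the Casimir operator -/

section Good

variable {𝔩 : Type} [LieRing 𝔩] [LieAlgebra ℂ 𝔩] {σ : 𝔩 → 𝔩}
variable {V : Type} [AddCommGroup V] [Module ℂ V] [LieRingModule 𝔩 V] [LieModule ℂ 𝔩 V]
variable {W : Type} [AddCommGroup W] [Module ℂ W] [LieRingModule 𝔩 W] [LieModule ℂ 𝔩 W]

lemma IsGood.of_injective (h : IsGood σ W) (u : V →ₗ[ℂ] W) (hu : Function.Injective u)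
    (hl : ∀ (x : 𝔩) v, u ⁅x, v⁆ = ⁅x, u v⁆) : IsGood σ V where
  locFin v := by
    obtain ⟨E, hfd, hv, hE⟩ := h.locFin (u v)
    refine ⟨E.comap u, ?_, hv, fun x w hw => ?_⟩
    · have hinj : Function.Injective (u.restrict (p := E.comap u) (q := E) fun x hx => hx) := by
        intro a b hab
        exact Subtype.ext (hu (congrArg Subtype.val hab))
      exact FiniteDimensional.of_injective _ hinj
    · rw [Submodule.mem_comap, hl]
      exact hE x _ hw
  conj x μ v hv := hu (by
    rw [hl, map_smul, h.conj x μ (u v) (maxGenEigenspace_map (fun v => hl x v) hv)])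

lemma IsGood.locFinite (h : IsGood σ V) (x : 𝔩) : LocFinite (LieModule.toEnd ℂ 𝔩 V x) := fun v => by
  obtain ⟨E, h1, h2, h3⟩ := h.locFin v
  exact ⟨E, h1, h2, h3 x⟩

lemma IsGood.of_surjective (h : IsGood σ V) (u : V →ₗ[ℂ] W) (hu : Function.Surjective u)
    (hl : ∀ (x : 𝔩) v, u ⁅x, v⁆ = ⁅x, u v⁆) : IsGood σ W where
  locFin w := by
    obtain ⟨v, rfl⟩ := hu w
    obtain ⟨E, hfd, hv, hE⟩ := h.locFin v
    refine ⟨E.map u, inferInstance, ⟨v, hv, rfl⟩, ?_⟩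
    rintro x _ ⟨w, hw, rfl⟩
    exact ⟨_, hE x w hw, hl x w⟩
  conj x μ w hw := by
    obtain ⟨K, hK⟩ := exists_conjPart (T := LieModule.toEnd ℂ 𝔩 W x) (fun w => by
      obtain ⟨v, rfl⟩ := hu w
      obtain ⟨E, hfd, hv, hE⟩ := h.locFin v
      refine ⟨E.map u, inferInstance, ⟨v, hv, rfl⟩, ?_⟩
      rintro _ ⟨w, hw, rfl⟩
      exact ⟨_, hE x w hw, hl x w⟩)
    rw [← hK μ w hw]
    obtain ⟨v, rfl⟩ := hu w
    have hv : v ∈ ⨆ μ, (LieModule.toEnd ℂ 𝔩 V x).maxGenEigenspace μ := by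
      rw [(h.locFinite x).iSup_eq_top]; trivial
    refine Submodule.iSup_induction _ (motive := fun v => ⁅σ x, u v⁆ = K (u v)) hv ?_ (by simp)
      (fun a b ha hb => by simp [ha, hb])
    intro μ v hv
    rw [hK μ _ (maxGenEigenspace_map (fun v => hl x v) hv), ← hl, h.conj x μ v hv, map_smul]

lemma IsGood.lie_sigma_eq_zero (h : IsGood σ V) {x : 𝔩}
    (hx : IsNilpotent (LieModule.toEnd ℂ 𝔩 V x)) (v : V) : ⁅σ x, v⁆ = 0 := by
  rw [h.conj x 0 v, map_zero, zero_smul]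
  rw [Module.End.mem_maxGenEigenspace]
  obtain ⟨k, hk⟩ := hx
  exact ⟨k, by simp [hk]⟩

lemma IsGood.isNilpotent_of_trace_eq_zero [FiniteDimensional ℂ V] (h : IsGood σ V) {x : 𝔩}
    (hx : LieModule.traceForm ℂ 𝔩 V x (σ x) = 0) : IsNilpotent (LieModule.toEnd ℂ 𝔩 V x) := by
  set T := LieModule.toEnd ℂ 𝔩 V x with hT
  set S := LieModule.toEnd ℂ 𝔩 V (σ x) with hS
  have hI := isInternal_of_locFinite (h.locFinite x)
  have hmT : ∀ μ, Set.MapsTo T (T.maxGenEigenspace μ) (T.maxGenEigenspace μ) := fun μ =>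
    Module.End.mapsTo_maxGenEigenspace_of_comm rfl μ
  have hSμ : ∀ μ, ∀ v ∈ T.maxGenEigenspace μ, S v = starRingEnd ℂ μ • v := fun μ v hv =>
    h.conj x μ v hv
  have hm : ∀ μ, Set.MapsTo (T ∘ₗ S) (T.maxGenEigenspace μ) (T.maxGenEigenspace μ) := by
    intro μ v hv
    change T (S v) ∈ _
    rw [hSμ μ v hv, map_smul]
    exact Submodule.smul_mem _ _ (hmT μ hv)
  have hfin : {μ | T.maxGenEigenspace μ ≠ ⊥}.Finite :=
    WellFoundedGT.finite_ne_bot_of_iSupIndep (Module.End.independent_maxGenEigenspace T)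
  have htr := LinearMap.trace_eq_sum_trace_restrict' hI hfin hm
  rw [LieModule.traceForm_apply_apply] at hx
  rw [hx] at htr
  have hterm : ∀ μ, LinearMap.trace ℂ _ ((T ∘ₗ S).restrict (hm μ)) =
      ((Complex.normSq μ * Module.finrank ℂ (T.maxGenEigenspace μ) : ℝ) : ℂ) := by
    intro μ
    let R : Module.End ℂ (T.maxGenEigenspace μ) := T.restrict (hmT μ)
    have e : ((T ∘ₗ S).restrict (hm μ)) = starRingEnd ℂ μ • (LinearMap.id ∘ₗ R) := by
      ext v
      change T (S v) = starRingEnd ℂ μ • T v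
      rw [hSμ μ v v.2, map_smul]
    rw [e, map_smul, LinearMap.trace_comp_eq_mul_of_commute_of_isNilpotent μ]
    · rw [← Module.End.one_eq_id, LinearMap.trace_one]
      push_cast
      rw [← Complex.mul_conj, smul_eq_mul]
      ring
    · exact Commute.one_left _
    · have := Module.End.isNilpotent_restrict_maxGenEigenspace_sub_algebraMap T μ
      exact this
  rw [Finset.sum_congr rfl fun μ _ => hterm μ, ← Complex.ofReal_sum] at htr
  have hz := (Finset.sum_eq_zero_iff_of_nonneg fun μ _ =>
    mul_nonneg (Complex.normSq_nonneg μ) (Nat.cast_nonneg _)).1 (Complex.ofReal_eq_zero.1 htr.symm)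
  have hbot : ∀ μ, μ ≠ 0 → T.maxGenEigenspace μ = ⊥ := by
    intro μ hμ
    by_contra hne
    have := hz μ (by simpa using hne)
    rcases mul_eq_zero.1 this with h1 | h1
    · exact hμ (Complex.normSq_eq_zero.1 h1)
    · have h2 : Module.finrank ℂ (T.maxGenEigenspace μ) = 0 := by exact_mod_cast h1
      exact hne (Submodule.finrank_eq_zero.1 h2)
  have htop : T.maxGenEigenspace 0 = ⊤ := by
    rw [eq_top_iff, ← (h.locFinite x).iSup_eq_top]
    refine iSup_le fun μ => ?_
    by_cases hμ : μ = 0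
    · rw [hμ]
    · change T.maxGenEigenspace μ ≤ _
      rw [hbot μ hμ]; exact bot_le
  refine ⟨Module.finrank ℂ V, ?_⟩
  rw [Module.End.maxGenEigenspace_eq_genEigenspace_finrank] at htop
  ext v
  have hv : v ∈ T.genEigenspace 0 (Module.finrank ℂ V) := htop ▸ Submodule.mem_top
  rw [Module.End.mem_genEigenspace_nat] at hv
  simpa using hv

lemma traceForm_eq_zero_of_isNilpotent_ideal [FiniteDimensional ℂ V] (R : LieIdeal ℂ 𝔩)
    (hR : ∀ x ∈ R, IsNilpotent (LieModule.toEnd ℂ 𝔩 V x)) {x : 𝔩} (hx : x ∈ R) (y : 𝔩) :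
    LieModule.traceForm ℂ 𝔩 V x y = 0 := by
  have hnil : LieModule.IsNilpotent R V := by
    rw [LieModule.isNilpotent_iff_forall' (R := ℂ)]
    rintro ⟨x, hx⟩
    exact hR x hx
  obtain ⟨k, hk⟩ := (LieModule.isNilpotent_iff ℂ R V).1 hnil
  rw [LieModule.traceForm_apply_apply, ← isNilpotent_iff_eq_zero]
  refine LinearMap.isNilpotent_trace_of_isNilpotent ⟨k, ?_⟩
  set Z := LieModule.toEnd ℂ 𝔩 V x ∘ₗ LieModule.toEnd ℂ 𝔩 V y with hZ
  have key : ∀ n v, ((Z : Module.End ℂ V) ^ n) v ∈ R.lcs V n := by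
    intro n
    induction n with
    | zero => intro v; simp
    | succ n ih =>
      intro v
      rw [pow_succ', Module.End.mul_apply, LieIdeal.lcs_succ]
      exact LieSubmodule.lie_mem_lie hx ((R.lcs V n).lie_mem (ih v))
  ext v
  have h1 := key k v
  rw [← LieSubmodule.mem_toSubmodule, LieIdeal.coe_lcs_eq, hk] at h1
  simpa using h1

end Good

section Casimir

lemma sum_dualBasis_skew {𝔪 W : Type} [AddCommGroup 𝔪] [Module ℂ 𝔪] [AddCommGroup W] [Module ℂ W]
    {n : ℕ} (B : LinearMap.BilinForm ℂ 𝔪) (hB : B.Nondegenerate)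
    (b : Module.Basis (Fin n) ℂ 𝔪) (A : 𝔪 →ₗ[ℂ] 𝔪) (hA : ∀ x y, B (A x) y = - B x (A y))
    (β : 𝔪 →ₗ[ℂ] 𝔪 →ₗ[ℂ] W) :
    ∑ i, (β (A (b i)) (B.dualBasis hB b i) + β (b i) (A (B.dualBasis hB b i))) = 0 := by
  set b' := B.dualBasis hB b with hb'
  have h1 : ∀ x, x = ∑ j, B (b' j) x • b j := by
    intro x
    conv_lhs => rw [← b.sum_repr x]
    refine Finset.sum_congr rfl fun j _ => ?_
    congr 1
    have := congrArg (B (b' j)) (b.sum_repr x)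
    rw [← this, map_sum]
    simp only [map_smul, hb', LinearMap.BilinForm.apply_dualBasis_left, smul_eq_mul, mul_ite,
      mul_one, mul_zero, Finset.sum_ite_eq', Finset.mem_univ, if_true]
  have h2 : ∀ x, x = ∑ j, B x (b j) • b' j := by
    intro x
    conv_lhs => rw [← b'.sum_repr x]
    simp [hb', LinearMap.BilinForm.dualBasis_repr_apply]
  have e1 : ∀ i, β (A (b i)) (b' i) = ∑ j, B (b' j) (A (b i)) • β (b j) (b' i) := by
    intro i
    conv_lhs => rw [h1 (A (b i))]
    simp
  have e2 : ∀ i, β (b i) (A (b' i)) = -∑ j, B (b' i) (A (b j)) • β (b i) (b' j) := by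
    intro i
    conv_lhs => rw [h2 (A (b' i))]
    simp [hA]
  rw [Finset.sum_add_distrib, Finset.sum_congr rfl fun i _ => e1 i,
    Finset.sum_congr rfl fun i _ => e2 i, Finset.sum_neg_distrib, Finset.sum_comm, add_neg_cancel]

variable {𝔩 : Type} [LieRing 𝔩] [LieAlgebra ℂ 𝔩] {σ : 𝔩 → 𝔩}

/-- A Lie algebra with conjugation having a good module with nondegenerate trace form. -/
def IsRedLie (σ : 𝔩 → 𝔩) : Prop :=
  ∃ (E : Type) (_ : AddCommGroup E) (_ : Module ℂ E) (_ : LieRingModule 𝔩 E)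
    (_ : LieModule ℂ 𝔩 E), FiniteDimensional ℂ E ∧ IsGood σ E ∧
      (LieModule.traceForm ℂ 𝔩 E).Nondegenerate

/-- The span of all brackets. -/
def lieSpan (𝔩 V : Type) [LieRing 𝔩] [LieAlgebra ℂ 𝔩] [AddCommGroup V] [Module ℂ V]
    [LieRingModule 𝔩 V] : Submodule ℂ V :=
  Submodule.span ℂ (Set.range fun p : 𝔩 × V => ⁅p.1, p.2⁆)

lemma lie_mem_lieSpan {V : Type} [AddCommGroup V] [Module ℂ V]
    [LieRingModule 𝔩 V] (x : 𝔩) (v : V) : ⁅x, v⁆ ∈ lieSpan 𝔩 V :=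
  Submodule.subset_span ⟨(x, v), rfl⟩

lemma map_mem_lieSpan {V W : Type} [AddCommGroup V] [Module ℂ V]
    [LieRingModule 𝔩 V] [AddCommGroup W] [Module ℂ W] [LieRingModule 𝔩 W]
    (u : V →ₗ[ℂ] W) (hl : ∀ (x : 𝔩) v, u ⁅x, v⁆ = ⁅x, u v⁆) {v : V}
    (hv : v ∈ lieSpan 𝔩 V) : u v ∈ lieSpan 𝔩 W := by
  refine Submodule.span_induction (p := fun v _ => u v ∈ lieSpan 𝔩 W) ?_ ?_ ?_ ?_ hv
  · rintro _ ⟨p, rfl⟩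
    rw [hl]
    exact Submodule.subset_span ⟨(p.1, u p.2), rfl⟩
  · simp
  · intro a b _ _ ha hb; rw [map_add]; exact add_mem ha hb
  · intro c a _ ha; rw [map_smul]; exact Submodule.smul_mem _ _ ha

variable [FiniteDimensional ℂ 𝔩]
variable {V : Type} [AddCommGroup V] [Module ℂ V] [LieRingModule 𝔩 V] [LieModule ℂ 𝔩 V]

lemma IsRedLie.exists_ideal [FiniteDimensional ℂ V] (hσ : IsRedLie σ) (hV : IsGood σ V) :
    ∃ 𝔪 : LieIdeal ℂ 𝔩, (∀ x : 𝔩, ∃ y ∈ 𝔪, ∀ v : V, ⁅x, v⁆ = ⁅y, v⁆) ∧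
      ∀ x ∈ 𝔪, (∀ y ∈ 𝔪, LieModule.traceForm ℂ 𝔩 V x y = 0) → x = 0 := by
  obtain ⟨E, _, _, _, _, _, hE, hnd⟩ := hσ
  set B := LieModule.traceForm ℂ 𝔩 E with hB
  have hsymm : B.IsSymm := LinearMap.BilinForm.isSymm_iff.2 (LieModule.traceForm_isSymm ℂ 𝔩 E)
  have hinv : ∀ x y z, B ⁅x, y⁆ z = B x ⁅y, z⁆ := LieModule.traceForm_apply_lie_apply ℂ 𝔩 E
  have hzero : ∀ R : LieIdeal ℂ 𝔩, (∀ x ∈ R, B x (σ x) = 0) → ∀ x ∈ R, x = 0 := by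
    intro R hR x hx
    exact hnd.1 x fun y => traceForm_eq_zero_of_isNilpotent_ideal R
      (fun x hx => hE.isNilpotent_of_trace_eq_zero (hR x hx)) hx y
  let K : LieIdeal ℂ 𝔩 := LieModule.ker ℂ 𝔩 V
  have memK : ∀ x, x ∈ K ↔ ∀ v : V, ⁅x, v⁆ = 0 := fun x => by
    change x ∈ LieModule.ker ℂ 𝔩 V ↔ _
    rw [LieModule.mem_ker]
  let 𝔪 : LieIdeal ℂ 𝔩 :=
    { B.orthogonal K.toSubmodule with
      lie_mem := by
        intro x m hm
        simp only [AddSubsemigroup.mem_carrier, AddSubmonoid.mem_toSubsemigroup,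
          Submodule.mem_toAddSubmonoid, LinearMap.BilinForm.mem_orthogonal_iff] at hm ⊢
        intro n hn
        change B n ⁅x, m⁆ = 0
        rw [← hinv]
        exact hm _ (lie_mem_left ℂ 𝔩 K n x hn) }
  have mem𝔪 : ∀ x, x ∈ 𝔪 ↔ ∀ n ∈ K, B n x = 0 := fun x => Iff.rfl
  have hσK : ∀ x, IsNilpotent (LieModule.toEnd ℂ 𝔩 V x) → σ x ∈ K := fun x hx =>
    (memK _).2 (hV.lie_sigma_eq_zero hx)
  have hdisj : ∀ x ∈ K ⊓ 𝔪, x = 0 := hzero _ fun x hx => by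
    obtain ⟨h1, h2⟩ := (LieSubmodule.mem_inf _ _ _).1 hx
    rw [hsymm.eq]
    refine (mem𝔪 x).1 h2 _ (hσK x ⟨1, ?_⟩)
    ext v
    simpa using (memK x).1 h1 v
  have hcompl : IsCompl K.toSubmodule (B.orthogonal K.toSubmodule) := by
    rw [LinearMap.BilinForm.isCompl_orthogonal_iff_disjoint hsymm.isRefl, Submodule.disjoint_def]
    exact fun x h1 h2 => hdisj x ((LieSubmodule.mem_inf _ _ _).2 ⟨h1, h2⟩)
  have hsplit : ∀ x : 𝔩, ∃ k ∈ K, ∃ y ∈ 𝔪, k + y = x := fun x =>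
    Submodule.mem_sup.1 (hcompl.sup_eq_top ▸ Submodule.mem_top : x ∈ K.toSubmodule ⊔ _)
  refine ⟨𝔪, fun x => ?_, fun x hx h0 => ?_⟩
  · obtain ⟨k, hk, y, hy, rfl⟩ := hsplit x
    exact ⟨y, hy, fun v => by rw [add_lie, (memK k).1 hk v, zero_add]⟩
  · let S : LieIdeal ℂ 𝔩 :=
      { 𝔪.toSubmodule ⊓ LinearMap.ker (LieModule.traceForm ℂ 𝔩 V) with
        lie_mem := by
          rintro y m ⟨hm, hm'⟩
          refine ⟨𝔪.lie_mem hm, LinearMap.mem_ker.2 (LinearMap.ext fun z => ?_)⟩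
          rw [← lie_skew, map_neg, LinearMap.neg_apply, LieModule.traceForm_apply_lie_apply,
            LinearMap.mem_ker.1 hm']
          simp }
    refine hzero S ?_ x ⟨hx, LinearMap.mem_ker.2 (LinearMap.ext fun z => ?_)⟩
    · rintro x ⟨h1, h2⟩
      rw [hsymm.eq]
      refine (mem𝔪 x).1 h1 _ (hσK x (hV.isNilpotent_of_trace_eq_zero ?_))
      rw [LinearMap.mem_ker.1 h2]; rfl
    · obtain ⟨k, hk, y, hy, rfl⟩ := hsplit z
      rw [map_add, h0 y hy, LieModule.traceForm_comm, LieModule.traceForm_apply_apply,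
        show LieModule.toEnd ℂ 𝔩 V k = 0 from LinearMap.ext fun v => (memK k).1 hk v]
      simp

lemma IsRedLie.exists_casimir [FiniteDimensional ℂ V] (hσ : IsRedLie σ) (hV : IsGood σ V)
    (hnt : ∃ (x : 𝔩) (v : V), ⁅x, v⁆ ≠ 0) :
    ∃ C : Module.End ℂ V, (∀ (x : 𝔩) v, C ⁅x, v⁆ = ⁅x, C v⁆) ∧ ¬ IsNilpotent C ∧
      ∃ (n : ℕ) (b b' : Fin n → 𝔩), ∀ v, C v = ∑ i, ⁅b i, ⁅b' i, v⁆⁆ := by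
  obtain ⟨𝔪, h1, h2⟩ := hσ.exists_ideal hV
  let n := Module.finrank ℂ 𝔪.toSubmodule
  let b : Module.Basis (Fin n) ℂ 𝔪.toSubmodule := Module.finBasis ℂ 𝔪.toSubmodule
  let B : LinearMap.BilinForm ℂ 𝔪.toSubmodule :=
    (LieModule.traceForm ℂ 𝔩 V).restrict 𝔪.toSubmodule
  have hBs : B.IsSymm := LinearMap.BilinForm.IsSymm.restrict
    (LinearMap.BilinForm.isSymm_iff.2 (LieModule.traceForm_isSymm ℂ 𝔩 V)) _
  have hB : B.Nondegenerate := by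
    have hrefl : LinearMap.IsRefl B := hBs.isRefl
    refine hrefl.nondegenerate_iff_separatingLeft.2 fun x hx => ?_
    exact Subtype.ext (h2 x x.2 fun y hy => hx ⟨y, hy⟩)
  let b' := B.dualBasis hB b
  let β : 𝔪.toSubmodule →ₗ[ℂ] 𝔪.toSubmodule →ₗ[ℂ] Module.End ℂ V :=
    (LinearMap.mul ℂ (Module.End ℂ V)).compl₁₂
      ((LieModule.toEnd ℂ 𝔩 V : 𝔩 →ₗ[ℂ] Module.End ℂ V) ∘ₗ 𝔪.toSubmodule.subtype)
      ((LieModule.toEnd ℂ 𝔩 V : 𝔩 →ₗ[ℂ] Module.End ℂ V) ∘ₗ 𝔪.toSubmodule.subtype)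
  have hβ : ∀ x y v, β x y v = ⁅(x : 𝔩), ⁅(y : 𝔩), v⁆⁆ := fun x y v => rfl
  refine ⟨∑ i, β (b i) (b' i), fun x v => ?_, ?_, n, fun i => b i, fun i => b' i, fun v => ?_⟩
  · let A : 𝔪.toSubmodule →ₗ[ℂ] 𝔪.toSubmodule :=
      LinearMap.restrict (LieAlgebra.ad ℂ 𝔩 x) (p := 𝔪.toSubmodule) (q := 𝔪.toSubmodule)
        (fun y hy => 𝔪.lie_mem hy)
    have hA : ∀ y, (A y : 𝔩) = ⁅x, (y : 𝔩)⁆ := fun y => rfl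
    have hsk := sum_dualBasis_skew B hB b A (fun y z => by
      change LieModule.traceForm ℂ 𝔩 V ⁅x, (y : 𝔩)⁆ z = - LieModule.traceForm ℂ 𝔩 V y ⁅x, (z : 𝔩)⁆
      rw [← lie_skew, map_neg, LinearMap.neg_apply, LieModule.traceForm_apply_lie_apply]) β
    have := LinearMap.congr_fun hsk v
    simp only [LinearMap.sum_apply, LinearMap.add_apply, hβ, hA, LinearMap.zero_apply] at this
    simp only [LinearMap.sum_apply, hβ, lie_sum]
    rw [← sub_eq_zero, ← neg_eq_zero, ← this, ← Finset.sum_sub_distrib, ← Finset.sum_neg_distrib]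
    refine Finset.sum_congr rfl fun i _ => ?_
    change -(⁅(b i : 𝔩), ⁅(b' i : 𝔩), ⁅x, v⁆⁆⁆ - ⁅x, ⁅(b i : 𝔩), ⁅(b' i : 𝔩), v⁆⁆⁆) =
      ⁅⁅x, (b i : 𝔩)⁆, ⁅(b' i : 𝔩), v⁆⁆ + ⁅(b i : 𝔩), ⁅⁅x, (b' i : 𝔩)⁆, v⁆⁆
    rw [lie_lie x (b i : 𝔩), lie_lie x (b' i : 𝔩), lie_sub]
    abel
  · intro hnil
    have htr := LinearMap.isNilpotent_trace_of_isNilpotent hnil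
    rw [isNilpotent_iff_eq_zero, map_sum] at htr
    have : ∀ i, LinearMap.trace ℂ V (β (b i) (b' i)) = 1 := fun i => by
      have := LinearMap.BilinForm.apply_dualBasis_right hB hBs b i i
      rw [if_pos rfl] at this
      rw [← this]
      exact (LieModule.traceForm_apply_apply ℂ 𝔩 V _ _).symm
    simp only [this, Finset.sum_const, Finset.card_univ, Fintype.card_fin, nsmul_eq_mul,
      mul_one, Nat.cast_eq_zero] at htr
    have hbot : 𝔪.toSubmodule = ⊥ := Submodule.finrank_eq_zero.1 htr
    obtain ⟨x, v, hxv⟩ := hnt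
    obtain ⟨y, hy, hxy⟩ := h1 x
    have : y ∈ 𝔪.toSubmodule := hy
    rw [hbot, Submodule.mem_bot] at this
    rw [hxy, this, zero_lie] at hxv
    exact hxv rfl
  · simp [LinearMap.sum_apply, hβ]

lemma IsRedLie.decomp (hσ : IsRedLie σ) : ∀ (n : ℕ) (V : Type) [AddCommGroup V] [Module ℂ V]
    [LieRingModule 𝔩 V] [LieModule ℂ 𝔩 V] [FiniteDimensional ℂ V], IsGood σ V →
    Module.finrank ℂ V = n →
    (∀ v : V, ∃ v₀, (∀ x : 𝔩, ⁅x, v₀⁆ = 0) ∧ v - v₀ ∈ lieSpan 𝔩 V) ∧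
    (∀ v ∈ lieSpan 𝔩 V, (∀ x : 𝔩, ⁅x, v⁆ = 0) → v = 0) := by
  intro n
  induction n using Nat.strong_induction_on with
  | _ n ih =>
  intro V _ _ _ _ _ hV hn
  by_cases hnt : ∃ (x : 𝔩) (v : V), ⁅x, v⁆ ≠ 0
  swap
  · push Not at hnt
    refine ⟨fun v => ⟨v, fun x => hnt x v, by simp⟩, fun v hv _ => ?_⟩
    have : lieSpan 𝔩 V ≤ ⊥ := Submodule.span_le.2 (by
      rintro _ ⟨p, rfl⟩
      exact hnt p.1 p.2)
    simpa using this hv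
  obtain ⟨C, hC, hnil, k, b, b', hCb⟩ := hσ.exists_casimir hV hnt
  have hev : ∀ᶠ n in Filter.atTop, IsCompl (LinearMap.ker (C ^ n)) (LinearMap.range (C ^ n)) :=
    LinearMap.eventually_isCompl_ker_pow_range_pow C
  obtain ⟨N, hN⟩ := Filter.eventually_atTop.1 hev
  have hcompl := hN (N + 1) (Nat.le_succ N)
  have hCn : ∀ (n : ℕ) (x : 𝔩) v, (C ^ n) ⁅x, v⁆ = ⁅x, (C ^ n) v⁆ := by
    intro n
    induction n with
    | zero => simp
    | succ n ihn => intro x v; rw [pow_succ', Module.End.mul_apply, Module.End.mul_apply, ihn, hC]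
  let V₀ : LieSubmodule ℂ 𝔩 V :=
    { LinearMap.ker (C ^ (N + 1)) with
      lie_mem := by
        intro x m hm
        have hm' : (C ^ (N + 1)) m = 0 := hm
        change (C ^ (N + 1)) ⁅x, m⁆ = 0
        rw [hCn, hm', lie_zero] }
  have hmem : ∀ v, v ∈ V₀ ↔ (C ^ (N + 1)) v = 0 := fun v => Iff.rfl
  have hlt : Module.finrank ℂ V₀ < n := by
    rw [← hn]
    refine Submodule.finrank_lt (s := V₀.toSubmodule) fun h => hnil ⟨N + 1, ?_⟩
    exact LinearMap.ext fun v => (hmem v).1 (h ▸ Submodule.mem_top : v ∈ V₀.toSubmodule)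
  have hV₀ : IsGood σ V₀ := hV.of_injective V₀.toSubmodule.subtype
    Subtype.val_injective (fun x v => rfl)
  obtain ⟨i1, i2⟩ := ih _ hlt V₀ hV₀ rfl
  have hCspan : ∀ v, (C ^ (N + 1)) v ∈ lieSpan 𝔩 V := fun v => by
    rw [pow_succ', Module.End.mul_apply, hCb]
    exact Submodule.sum_mem _ fun i _ => lie_mem_lieSpan _ _
  have hCinv : ∀ v, (∀ x : 𝔩, ⁅x, v⁆ = 0) → v ∈ V₀ := fun v hv => by
    rw [hmem, pow_succ, Module.End.mul_apply, hCb]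
    simp [hv]
  refine ⟨fun v => ?_, fun v hv hinv => ?_⟩
  · obtain ⟨a, ha, _, ⟨c, rfl⟩, rfl⟩ := Submodule.mem_sup.1
      (hcompl.sup_eq_top ▸ Submodule.mem_top : v ∈ LinearMap.ker (C ^ (N + 1)) ⊔ _)
    obtain ⟨v₀, h1, h2⟩ := i1 ⟨a, ha⟩
    refine ⟨v₀, fun x => congrArg Subtype.val (h1 x), ?_⟩
    have := map_mem_lieSpan (V := V₀) V₀.toSubmodule.subtype (fun x v => rfl) h2
    have e : a + (C ^ (N + 1)) c - (v₀ : V) = (a - v₀) + (C ^ (N + 1)) c := by abel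
    rw [e]
    exact add_mem this (hCspan c)
  · obtain ⟨P, hP, hPV⟩ : ∃ P : V →ₗ[ℂ] V₀, (∀ v : V₀, P v = v) ∧
        ∀ c, P ((C ^ (N + 1)) c) = 0 := by
      refine ⟨Submodule.projectionOnto _ _ hcompl, fun v => ?_, fun c => ?_⟩
      · exact Submodule.projectionOnto_apply_left hcompl v
      · exact (Submodule.projectionOnto_apply_eq_zero_iff hcompl).2 ⟨c, rfl⟩
    have hPl : ∀ (x : 𝔩) v, P ⁅x, v⁆ = ⁅x, P v⁆ := by
      intro x v
      obtain ⟨a, ha, _, ⟨c, rfl⟩, rfl⟩ := Submodule.mem_sup.1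
        (hcompl.sup_eq_top ▸ Submodule.mem_top : v ∈ LinearMap.ker (C ^ (N + 1)) ⊔ _)
      have e1 := hP ⟨a, ha⟩
      have e2 := hP ⁅x, (⟨a, ha⟩ : V₀)⁆
      rw [lie_add, map_add, map_add, ← hCn, hPV, hPV, add_zero, add_zero]
      exact e2.trans (congrArg _ e1.symm)
    have hv0 := hCinv v hinv
    have e := hP ⟨v, hv0⟩
    have := i2 _ (map_mem_lieSpan P hPl hv) (fun x => by rw [← hPl, hinv, map_zero])
    rw [this] at e
    exact congrArg Subtype.val e.symm

lemma IsRedLie.exists_invariant_lift (hσ : IsRedLie σ) (hV : IsGood σ V) {W : Type}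
    [AddCommGroup W] [Module ℂ W] [LieRingModule 𝔩 W] [LieModule ℂ 𝔩 W] (u : V →ₗ[ℂ] W)
    (hl : ∀ (x : 𝔩) v, u ⁅x, v⁆ = ⁅x, u v⁆) (v : V) (hw : ∀ x : 𝔩, ⁅x, u v⁆ = 0) :
    ∃ v', u v' = u v ∧ ∀ x : 𝔩, ⁅x, v'⁆ = 0 := by
  obtain ⟨E, hfd, hv, hE⟩ := hV.locFin v
  let E' : LieSubmodule ℂ 𝔩 V := { E with lie_mem := fun {x m} hm => hE x m hm }
  have : FiniteDimensional ℂ E' := hfd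
  have hE' : IsGood σ E' := hV.of_injective E'.toSubmodule.subtype
    Subtype.val_injective (fun x v => rfl)
  let F : LieSubmodule ℂ 𝔩 W := { E.map u with
    lie_mem := by
      rintro x _ ⟨m, hm, rfl⟩
      exact ⟨_, hE x m hm, hl x m⟩ }
  let u' : E' →ₗ[ℂ] F := u.restrict (p := E) (q := E.map u) fun x hx => ⟨x, hx, rfl⟩
  have hu' : Function.Surjective u' := by
    rintro ⟨_, ⟨m, hm, rfl⟩⟩
    exact ⟨⟨m, hm⟩, rfl⟩
  have hl' : ∀ (x : 𝔩) v, u' ⁅x, v⁆ = ⁅x, u' v⁆ := fun x v => Subtype.ext (hl x v)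
  have hF : IsGood σ F := hE'.of_surjective u' hu' hl'
  have : FiniteDimensional ℂ F := inferInstanceAs (FiniteDimensional ℂ (E.map u))
  obtain ⟨v₀, h0, h1⟩ := (hσ.decomp _ E' hE' rfl).1 ⟨v, hv⟩
  have h2 := (hσ.decomp _ F hF rfl).2 _ (map_mem_lieSpan u' hl' h1) (fun x => by
    rw [← hl', lie_sub, h0, sub_zero, hl']
    exact Subtype.ext (hw x))
  refine ⟨v₀, ?_, fun x => congrArg Subtype.val (h0 x)⟩
  rw [map_sub, sub_eq_zero] at h2
  exact (congrArg Subtype.val h2).symm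

end Casimir

section Hom

variable {𝔩 : Type} [LieRing 𝔩] [LieAlgebra ℂ 𝔩] {σ : 𝔩 → 𝔩}
variable {V : Type} [AddCommGroup V] [Module ℂ V] [LieRingModule 𝔩 V] [LieModule ℂ 𝔩 V]
variable {W : Type} [AddCommGroup W] [Module ℂ W] [LieRingModule 𝔩 W] [LieModule ℂ 𝔩 W]

lemma IsGood.exists_fd_ge (h : IsGood σ V) (S : Submodule ℂ V) (hS : S.FG) :
    ∃ E : Submodule ℂ V, FiniteDimensional ℂ E ∧ S ≤ E ∧ ∀ (x : 𝔩), ∀ w ∈ E, ⁅x, w⁆ ∈ E := by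
  refine Submodule.fg_induction (motive := fun S _ => ∃ E : Submodule ℂ V, FiniteDimensional ℂ E ∧
    S ≤ E ∧ ∀ (x : 𝔩), ∀ w ∈ E, ⁅x, w⁆ ∈ E) ?_ ?_ S hS
  · intro v
    obtain ⟨E, h1, h2, h3⟩ := h.locFin v
    exact ⟨E, h1, by simpa using h2, h3⟩
  · rintro S T _ _ ⟨E, h1, h2, h3⟩ ⟨F, k1, k2, k3⟩
    refine ⟨E ⊔ F, inferInstance, sup_le_sup h2 k2, fun x w hw => ?_⟩
    obtain ⟨a, ha, b, hb, rfl⟩ := Submodule.mem_sup.1 hw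
    rw [lie_add]
    exact Submodule.add_mem_sup (h3 x a ha) (k3 x b hb)

lemma IsGood.hom [FiniteDimensional ℂ W] (hV : IsGood σ V) (hW : IsGood σ W) :
    IsGood σ (W →ₗ[ℂ] V) where
  locFin φ := by
    obtain ⟨E, h1, h2, h3⟩ := hV.exists_fd_ge (LinearMap.range φ)
      (Module.Finite.iff_fg.1 inferInstance)
    refine ⟨LinearMap.range (LinearMap.lcomp ℂ V (LinearMap.id : W →ₗ[ℂ] W) ∘ₗ
      LinearMap.compRight ℂ (M := W) E.subtype), inferInstance, ⟨φ.codRestrict E fun w =>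
        h2 ⟨w, rfl⟩, rfl⟩, ?_⟩
    rintro x _ ⟨ψ, rfl⟩
    refine ⟨LinearMap.codRestrict E (⁅x, E.subtype ∘ₗ ψ⁆ : W →ₗ[ℂ] V) fun w => ?_, rfl⟩
    rw [LieHom.lie_apply]
    exact sub_mem (h3 x _ (ψ w).2) (ψ _).2
  conj x μ φ hφ := by
    ext w
    have hw : w ∈ ⨆ α, (LieModule.toEnd ℂ 𝔩 W x).maxGenEigenspace α := by
      rw [(hW.locFinite x).iSup_eq_top]; trivial
    refine Submodule.iSup_induction _ (motive := fun w => (⁅σ x, φ⁆ : W →ₗ[ℂ] V) w =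
      (starRingEnd ℂ μ • φ) w) hw ?_ (by simp) (fun a b ha hb => by simp only [map_add, ha, hb])
    intro α w hw
    have key : φ w ∈ (LieModule.toEnd ℂ 𝔩 V x).maxGenEigenspace (μ + α) := by
      rw [Module.End.mem_maxGenEigenspace] at hφ hw ⊢
      obtain ⟨k, hk⟩ := hφ
      obtain ⟨l, hl⟩ := hw
      refine ⟨k + l, pow_bilin_eq_zero (LinearMap.id : (W →ₗ[ℂ] V) →ₗ[ℂ] W →ₗ[ℂ] V) _ _ _
        (fun u v => ?_) _ k l le_rfl φ w hk hl⟩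
      simp only [LinearMap.sub_apply, LieModule.toEnd_apply_apply, LinearMap.id_apply,
        LieHom.lie_apply,
        LinearMap.smul_apply, Module.End.one_apply, map_sub, map_smul, add_smul, LinearMap.add_apply]
      abel
    rw [LieHom.lie_apply, hV.conj x _ _ key, hW.conj x _ _ hw]
    simp [add_smul]

lemma IsRedLie.exists_section [FiniteDimensional ℂ 𝔩] [FiniteDimensional ℂ W] (hσ : IsRedLie σ)
    (hV : IsGood σ V)
    (hW : IsGood σ W) (u : V →ₗ[ℂ] W) (hu : Function.Surjective u)
    (hl : ∀ (x : 𝔩) v, u ⁅x, v⁆ = ⁅x, u v⁆) :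
    ∃ s : W →ₗ[ℂ] V, (∀ w, u (s w) = w) ∧ ∀ (x : 𝔩) w, s ⁅x, w⁆ = ⁅x, s w⁆ := by
  obtain ⟨s, hs⟩ := u.exists_rightInverse_of_surjective (LinearMap.range_eq_top.2 hu)
  obtain ⟨s', h1, h2⟩ := hσ.exists_invariant_lift (hV.hom hW) (LinearMap.compRight ℂ (M := W) u)
    (fun x φ => by
      ext w
      simp [LieHom.lie_apply, LinearMap.compRight_apply, hl]) s (fun x => by
      rw [LinearMap.compRight_apply, hs]
      ext w
      simp [LieHom.lie_apply])
  refine ⟨s', fun w => ?_, fun x w => ?_⟩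
  · have := LinearMap.congr_fun h1 w
    rw [LinearMap.compRight_apply, LinearMap.compRight_apply, hs] at this
    exact this
  · have := LinearMap.congr_fun (h2 x) w
    rw [LieHom.lie_apply, LinearMap.zero_apply, sub_eq_zero] at this
    exact this.symm

end Hom

/-! ### The Chevalley–Eilenberg complex on alternating maps -/

section CE

variable {𝔫 : Type} [AddCommGroup 𝔫] [Module ℂ 𝔫]
variable {𝔫' : Type} [AddCommGroup 𝔫'] [Module ℂ 𝔫']
variable {M : Type} [AddCommGroup M] [Module ℂ M]
variable {M' : Type} [AddCommGroup M'] [Module ℂ M']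

open AlternatingMap

/-- Contraction of an alternating map with a vector. -/
def iota {p : ℕ} (x : 𝔫) : (𝔫 [⋀^Fin (p + 1)]→ₗ[ℂ] M) →ₗ[ℂ] 𝔫 [⋀^Fin p]→ₗ[ℂ] M where
  toFun c := c.curryLeft x
  map_add' _ _ := rfl
  map_smul' _ _ := rfl

lemma iota_apply {p : ℕ} (x : 𝔫) (c : 𝔫 [⋀^Fin (p + 1)]→ₗ[ℂ] M) (v : Fin p → 𝔫) :
    iota x c v = c (Fin.cons x v) := rfl

lemma curryLeft_eq_iota {p : ℕ} (x : 𝔫) (c : 𝔫 [⋀^Fin (p + 1)]→ₗ[ℂ] M) :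
    c.curryLeft x = iota x c := rfl

lemma iota_add_left {p : ℕ} (x y : 𝔫) (c : 𝔫 [⋀^Fin (p + 1)]→ₗ[ℂ] M) :
    iota (x + y) c = iota x c + iota y c := c.curryLeft.map_add x y

lemma iota_smul_left {p : ℕ} (t : ℂ) (x : 𝔫) (c : 𝔫 [⋀^Fin (p + 1)]→ₗ[ℂ] M) :
    iota (t • x) c = t • iota x c := c.curryLeft.map_smul t x

lemma iota_neg_left {p : ℕ} (x : 𝔫) (c : 𝔫 [⋀^Fin (p + 1)]→ₗ[ℂ] M) :
    iota (-x) c = -iota x c := c.curryLeft.map_neg x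

lemma iota_sub_left {p : ℕ} (x y : 𝔫) (c : 𝔫 [⋀^Fin (p + 1)]→ₗ[ℂ] M) :
    iota (x - y) c = iota x c - iota y c := c.curryLeft.map_sub x y

lemma iota_zero_left {p : ℕ} (c : 𝔫 [⋀^Fin (p + 1)]→ₗ[ℂ] M) :
    iota 0 c = 0 := c.curryLeft.map_zero

lemma iota_self {p : ℕ} (x : 𝔫) (c : 𝔫 [⋀^Fin (p + 2)]→ₗ[ℂ] M) :
    iota x (iota x c) = 0 := c.curryLeft_same x

lemma iota_iota {p : ℕ} (x y : 𝔫) (c : 𝔫 [⋀^Fin (p + 2)]→ₗ[ℂ] M) :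
    iota x (iota y c) = -iota y (iota x c) := by
  have h := iota_self (x + y) c
  simp only [iota_add_left, map_add, iota_self, zero_add, add_zero] at h
  exact eq_neg_of_add_eq_zero_left (by rw [add_comm]; exact h)

lemma alt_ext {p : ℕ} {c c' : 𝔫 [⋀^Fin (p + 1)]→ₗ[ℂ] M} (h : ∀ x, iota x c = iota x c') :
    c = c' := by
  ext v
  have := congrArg (fun b => b (Fin.tail v)) (h (v 0))
  simpa [iota_apply] using this

lemma alt_ext_zero {c c' : 𝔫 [⋀^Fin 0]→ₗ[ℂ] M} (h : c ![] = c' ![]) : c = c' := by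
  ext v
  rw [Subsingleton.elim v ![], h]

/-- The alternating map `∑ (-1)^i f (v i) (v without i)`. -/
def wedge {p : ℕ} : (𝔫 →ₗ[ℂ] 𝔫 [⋀^Fin p]→ₗ[ℂ] M) →ₗ[ℂ] 𝔫 [⋀^Fin (p + 1)]→ₗ[ℂ] M :=
  alternatizeUncurryFinLM

lemma wedge_apply {p : ℕ} (f : 𝔫 →ₗ[ℂ] 𝔫 [⋀^Fin p]→ₗ[ℂ] M) (v : Fin (p + 1) → 𝔫) :
    wedge f v = ∑ i : Fin (p + 1), (-1) ^ (i : ℕ) • f (v i) (Fin.removeNth i v) :=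
  alternatizeUncurryFin_apply f v

lemma iota_wedge {p : ℕ} (x : 𝔫) (f : 𝔫 →ₗ[ℂ] 𝔫 [⋀^Fin (p + 1)]→ₗ[ℂ] M) :
    iota x (wedge f) = f x - wedge (iota x ∘ₗ f) := by
  ext v
  rw [iota_apply, wedge_apply, Fin.sum_univ_succ, AlternatingMap.sub_apply, wedge_apply,
    sub_eq_add_neg, ← Finset.sum_neg_distrib]
  congr 1
  · simp
  · refine Finset.sum_congr rfl fun i _ => ?_
    rw [Fin.cons_succ, LinearMap.comp_apply, iota_apply, Fin.val_succ, pow_succ, mul_neg_one,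
      neg_smul]
    congr 3
    funext k
    refine Fin.cases ?_ (fun k => ?_) k
    · simp [Fin.removeNth]
    · simp [Fin.removeNth]

lemma iota_wedge_zero (x : 𝔫) (f : 𝔫 →ₗ[ℂ] 𝔫 [⋀^Fin 0]→ₗ[ℂ] M) :
    iota x (wedge f) = f x := by
  refine alt_ext_zero ?_
  rw [iota_apply, wedge_apply]
  simp

/-- Insertion of an endomorphism in each argument. -/
def substD (D : 𝔫 →ₗ[ℂ] 𝔫) : (p : ℕ) → (𝔫 [⋀^Fin p]→ₗ[ℂ] M) →ₗ[ℂ] 𝔫 [⋀^Fin p]→ₗ[ℂ] M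
  | 0 => 0
  | _ + 1 => wedge ∘ₗ LinearMap.lcomp ℂ _ D ∘ₗ curryLeftLinearMap

lemma substD_zero (D : 𝔫 →ₗ[ℂ] 𝔫) (c : 𝔫 [⋀^Fin 0]→ₗ[ℂ] M) : substD D 0 c = 0 := rfl

lemma iota_substD_one (D : 𝔫 →ₗ[ℂ] 𝔫) (x : 𝔫) (c : 𝔫 [⋀^Fin 1]→ₗ[ℂ] M) :
    iota x (substD D 1 c) = iota (D x) c := iota_wedge_zero _ _

lemma iota_substD {p : ℕ} (D : 𝔫 →ₗ[ℂ] 𝔫) (x : 𝔫) (c : 𝔫 [⋀^Fin (p + 1)]→ₗ[ℂ] M) :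
    iota x (substD D (p + 1) c) = substD D p (iota x c) + iota (D x) c := by
  cases p with
  | zero => exact (iota_substD_one D x c).trans (zero_add _).symm
  | succ p =>
    have : iota x (substD D (p + 2) c) = _ := iota_wedge _ _
    rw [this, sub_eq_add_neg, ← map_neg]
    refine (add_comm _ _).trans (congrArg₂ (· + ·) (congrArg wedge ?_) rfl)
    ext1 y
    exact (neg_eq_iff_eq_neg.2 (iota_iota _ _ _))

lemma substD_add (D D' : 𝔫 →ₗ[ℂ] 𝔫) : ∀ (p : ℕ) (c : 𝔫 [⋀^Fin p]→ₗ[ℂ] M),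
    substD (D + D') p c = substD D p c + substD D' p c
  | 0, _ => (add_zero _).symm
  | _ + 1, c => by
    have : c.curryLeft ∘ₗ (D + D') = c.curryLeft ∘ₗ D + c.curryLeft ∘ₗ D' :=
      LinearMap.comp_add _ _ _
    exact (congrArg wedge this).trans (map_add _ _ _)

lemma substD_smul (t : ℂ) (D : 𝔫 →ₗ[ℂ] 𝔫) : ∀ (p : ℕ) (c : 𝔫 [⋀^Fin p]→ₗ[ℂ] M),
    substD (t • D) p c = t • substD D p c
  | 0, _ => (smul_zero _).symm
  | _ + 1, c => by
    have : c.curryLeft ∘ₗ (t • D) = t • (c.curryLeft ∘ₗ D) := LinearMap.comp_smul _ _ _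
    exact (congrArg wedge this).trans (map_smul _ _ _)

/-- The Lie derivative attached to a pair of endomorphisms. -/
def lieDer (A : M →ₗ[ℂ] M) (D : 𝔫 →ₗ[ℂ] 𝔫) (p : ℕ) :
    (𝔫 [⋀^Fin p]→ₗ[ℂ] M) →ₗ[ℂ] 𝔫 [⋀^Fin p]→ₗ[ℂ] M :=
  A.compAlternatingMapₗ (S := ℂ) - substD D p

lemma lieDer_zero (A : M →ₗ[ℂ] M) (D : 𝔫 →ₗ[ℂ] 𝔫) (c : 𝔫 [⋀^Fin 0]→ₗ[ℂ] M) :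
    lieDer A D 0 c ![] = A (c ![]) := by
  simp [lieDer, substD_zero]

lemma iota_compAlt {p : ℕ} (A : M →ₗ[ℂ] M') (x : 𝔫) (c : 𝔫 [⋀^Fin (p + 1)]→ₗ[ℂ] M) :
    iota x (A.compAlternatingMap c) = A.compAlternatingMap (iota x c) := rfl

lemma iota_lieDer {p : ℕ} (A : M →ₗ[ℂ] M) (D : 𝔫 →ₗ[ℂ] 𝔫) (x : 𝔫)
    (c : 𝔫 [⋀^Fin (p + 1)]→ₗ[ℂ] M) :
    iota x (lieDer A D (p + 1) c) = lieDer A D p (iota x c) - iota (D x) c := by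
  simp only [lieDer, LinearMap.sub_apply, map_sub, iota_substD]
  rw [sub_sub]
  exact congrArg₂ (· - ·) (iota_compAlt A x c) rfl

lemma lieDer_comm (A A' : M →ₗ[ℂ] M) (D D' : 𝔫 →ₗ[ℂ] 𝔫) : ∀ (p : ℕ)
    (c : 𝔫 [⋀^Fin p]→ₗ[ℂ] M),
    lieDer (A * A' - A' * A) (D * D' - D' * D) p c
      = lieDer A D p (lieDer A' D' p c) - lieDer A' D' p (lieDer A D p c)
  | 0, c => alt_ext_zero (by simp [lieDer_zero])
  | p + 1, c => by
    refine alt_ext fun x => ?_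
    simp only [iota_lieDer, map_sub, lieDer_comm A A' D D' p, LinearMap.sub_apply,
      Module.End.mul_apply, iota_sub_left]
    abel

lemma lieDer_add (A A' : M →ₗ[ℂ] M) (D D' : 𝔫 →ₗ[ℂ] 𝔫) : ∀ (p : ℕ)
    (c : 𝔫 [⋀^Fin p]→ₗ[ℂ] M),
    lieDer (A + A') (D + D') p c = lieDer A D p c + lieDer A' D' p c
  | 0, c => alt_ext_zero (by simp [lieDer_zero])
  | p + 1, c => by
    refine alt_ext fun x => ?_
    simp only [iota_lieDer, lieDer_add A A' D D' p, map_add, LinearMap.add_apply, iota_add_left]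
    abel

lemma lieDer_smul (t : ℂ) (A : M →ₗ[ℂ] M) (D : 𝔫 →ₗ[ℂ] 𝔫) : ∀ (p : ℕ)
    (c : 𝔫 [⋀^Fin p]→ₗ[ℂ] M), lieDer (t • A) (t • D) p c = t • lieDer A D p c
  | 0, c => alt_ext_zero (by simp [lieDer_zero])
  | p + 1, c => by
    refine alt_ext fun x => ?_
    simp only [iota_lieDer, lieDer_smul t A D p, map_smul, LinearMap.smul_apply, iota_smul_left,
      smul_sub]

lemma lieDer_apply (A : M →ₗ[ℂ] M) (D : 𝔫 →ₗ[ℂ] 𝔫) : ∀ (p : ℕ)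
    (c : 𝔫 [⋀^Fin p]→ₗ[ℂ] M) (v : Fin p → 𝔫),
    lieDer A D p c v = A (c v) - ∑ i, c (Function.update v i (D (v i)))
  | 0, c, v => by
    rw [Subsingleton.elim v ![], lieDer_zero]
    simp
  | p + 1, c, v => by
    have h := congrArg (fun b => b (Fin.tail v)) (iota_lieDer A D (v 0) c)
    simp only [iota_apply, AlternatingMap.sub_apply, Fin.cons_self_tail,
      lieDer_apply A D p] at h
    rw [h, Fin.sum_univ_succ, sub_sub]
    refine congrArg _ ((add_comm _ _).trans (congrArg₂ (· + ·) ?_ ?_))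
    · refine congrArg c ?_
      funext k
      refine Fin.cases ?_ (fun k => ?_) k <;> simp [Fin.tail]
    · refine Finset.sum_congr rfl fun i _ => congrArg c ?_
      rw [Fin.cons_update, Fin.cons_self_tail]
      rfl

lemma iota_compLinear {p : ℕ} (φ : 𝔫' →ₗ[ℂ] 𝔫) (x : 𝔫') (c : 𝔫 [⋀^Fin (p + 1)]→ₗ[ℂ] M) :
    iota x (c.compLinearMap φ) = (iota (φ x) c).compLinearMap φ :=
  curryLeft_compLinearMap φ c x

/-- Compatibility of Lie derivatives with a change of algebra and of module. -/
lemma lieDer_map (A : M →ₗ[ℂ] M) (D : 𝔫 →ₗ[ℂ] 𝔫) (A' : M' →ₗ[ℂ] M') (D' : 𝔫' →ₗ[ℂ] 𝔫')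
    (φ : 𝔫' →ₗ[ℂ] 𝔫) (u : M →ₗ[ℂ] M') (hφ : ∀ x, φ (D' x) = D (φ x))
    (hu : ∀ m, u (A m) = A' (u m)) : ∀ (p : ℕ) (c : 𝔫 [⋀^Fin p]→ₗ[ℂ] M),
    u.compAlternatingMap ((lieDer A D p c).compLinearMap φ)
      = lieDer A' D' p (u.compAlternatingMap (c.compLinearMap φ))
  | 0, c => alt_ext_zero (by
      rw [lieDer_zero]
      simp only [LinearMap.compAlternatingMap_apply, AlternatingMap.compLinearMap_apply]
      rw [← hu, Subsingleton.elim (fun i => φ ((![] : Fin 0 → 𝔫') i)) ![], lieDer_zero])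
  | p + 1, c => by
    refine alt_ext fun x => ?_
    simp only [iota_lieDer, iota_compAlt, iota_compLinear, hφ, ← lieDer_map A D A' D' φ u hφ hu p]
    ext v
    simp

end CE

section CEd

variable {𝔫 : Type} [LieRing 𝔫] [LieAlgebra ℂ 𝔫]
variable {𝔫' : Type} [LieRing 𝔫'] [LieAlgebra ℂ 𝔫']
variable {M' : Type} [AddCommGroup M'] [Module ℂ M'] [LieRingModule 𝔫' M'] [LieModule ℂ 𝔫' M']
variable {M : Type} [AddCommGroup M] [Module ℂ M] [LieRingModule 𝔫 M] [LieModule ℂ 𝔫 M]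

/-- The bilinear map antisymmetrized by the Chevalley–Eilenberg differential. -/
def ceForm (p : ℕ) : 𝔫 →ₗ[ℂ] (𝔫 [⋀^Fin p]→ₗ[ℂ] M) →ₗ[ℂ] 𝔫 [⋀^Fin p]→ₗ[ℂ] M :=
  LinearMap.mk₂ ℂ (fun x c => (LieModule.toEnd ℂ 𝔫 M x).compAlternatingMap c
      - (2⁻¹ : ℂ) • substD (LieAlgebra.ad ℂ 𝔫 x) p c)
    (fun x y c => by
      rw [map_add, map_add, substD_add, smul_add, sub_add_sub_comm]
      rfl)
    (fun t x c => by
      rw [map_smul, map_smul, substD_smul, smul_comm, smul_sub]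
      rfl)
    (fun x c c' => by
      rw [map_add, smul_add, sub_add_sub_comm]
      exact congrArg₂ (· - ·) (((LieModule.toEnd ℂ 𝔫 M x).compAlternatingMapₗ (S := ℂ)).map_add c c')
        rfl)
    (fun t x c => by
      rw [map_smul, smul_comm, smul_sub]
      exact congrArg₂ (· - ·) (((LieModule.toEnd ℂ 𝔫 M x).compAlternatingMapₗ (S := ℂ)).map_smul t c)
        rfl)

/-- The Chevalley–Eilenberg differential on alternating maps. -/
def dCE (p : ℕ) : (𝔫 [⋀^Fin p]→ₗ[ℂ] M) →ₗ[ℂ] 𝔫 [⋀^Fin (p + 1)]→ₗ[ℂ] M :=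
  wedge ∘ₗ (ceForm p).flip

/-- The Lie derivative along an element of the Lie algebra. -/
def lieD (x : 𝔫) (p : ℕ) : (𝔫 [⋀^Fin p]→ₗ[ℂ] M) →ₗ[ℂ] 𝔫 [⋀^Fin p]→ₗ[ℂ] M :=
  lieDer (LieModule.toEnd ℂ 𝔫 M x) (LieAlgebra.ad ℂ 𝔫 x) p

lemma lieD_zero (x : 𝔫) (c : 𝔫 [⋀^Fin 0]→ₗ[ℂ] M) : lieD x 0 c ![] = ⁅x, c ![]⁆ :=
  lieDer_zero _ _ _

lemma iota_dCE_zero (x : 𝔫) (c : 𝔫 [⋀^Fin 0]→ₗ[ℂ] M) :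
    iota x (dCE 0 c) = lieD x 0 c := by
  refine (iota_wedge_zero _ _).trans (alt_ext_zero ?_)
  rw [lieD_zero]
  simp [ceForm, substD_zero]

/-- Cartan's formula. -/
lemma iota_dCE {p : ℕ} (x : 𝔫) (c : 𝔫 [⋀^Fin (p + 1)]→ₗ[ℂ] M) :
    iota x (dCE (p + 1) c) = lieD x (p + 1) c - dCE p (iota x c) := by
  refine (iota_wedge _ _).trans ?_
  have key : iota x ∘ₗ (ceForm (p + 1)).flip c = (ceForm p).flip (iota x c)
      + (2⁻¹ : ℂ) • (c.curryLeft ∘ₗ LieAlgebra.ad ℂ 𝔫 x) := by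
    ext1 y
    have h1 : iota x (ceForm (p + 1) y c) = (LieModule.toEnd ℂ 𝔫 M y).compAlternatingMap (iota x c)
        - (2⁻¹ : ℂ) • iota x (substD (LieAlgebra.ad ℂ 𝔫 y) (p + 1) c) := rfl
    have h2 : ceForm p y (iota x c) = (LieModule.toEnd ℂ 𝔫 M y).compAlternatingMap (iota x c)
        - (2⁻¹ : ℂ) • substD (LieAlgebra.ad ℂ 𝔫 y) p (iota x c) := rfl
    rw [LinearMap.comp_apply, LinearMap.flip_apply, LinearMap.add_apply, LinearMap.flip_apply,
      h1, h2, iota_substD, LinearMap.smul_apply, LinearMap.comp_apply, curryLeft_eq_iota,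
      LieAlgebra.ad_apply, LieAlgebra.ad_apply, ← lie_skew x y, iota_neg_left]
    module
  rw [key, map_add, map_smul, LinearMap.flip_apply]
  have h3 : ceForm (p + 1) x c = (LieModule.toEnd ℂ 𝔫 M x).compAlternatingMap c
        - (2⁻¹ : ℂ) • substD (LieAlgebra.ad ℂ 𝔫 x) (p + 1) c := rfl
  have h4 : lieD x (p + 1) c = (LieModule.toEnd ℂ 𝔫 M x).compAlternatingMap c
        - substD (LieAlgebra.ad ℂ 𝔫 x) (p + 1) c := rfl
  have h5 : wedge (c.curryLeft ∘ₗ LieAlgebra.ad ℂ 𝔫 x)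
        = substD (LieAlgebra.ad ℂ 𝔫 x) (p + 1) c := rfl
  have h6 : dCE p (iota x c) = wedge ((ceForm p).flip (iota x c)) := rfl
  rw [h3, h4, h5, h6]
  module

/-- A derivation of the pair `(𝔫, M)` commutes with the differential. -/
lemma dCE_lieDer (A : M →ₗ[ℂ] M) (D : 𝔫 →ₗ[ℂ] 𝔫) (hD : ∀ x y, D ⁅x, y⁆ = ⁅D x, y⁆ + ⁅x, D y⁆)
    (hA : ∀ (x : 𝔫) m, A ⁅x, m⁆ = ⁅D x, m⁆ + ⁅x, A m⁆) : ∀ (p : ℕ) (c : 𝔫 [⋀^Fin p]→ₗ[ℂ] M),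
    dCE p (lieDer A D p c) = lieDer A D (p + 1) (dCE p c) := by
  have hL : ∀ (p : ℕ) (x : 𝔫) (c : 𝔫 [⋀^Fin p]→ₗ[ℂ] M),
      lieD (D x) p c = lieDer A D p (lieD x p c) - lieD x p (lieDer A D p c) := by
    intro p x c
    rw [lieD, lieD, ← lieDer_comm]
    congr 2
    · ext m
      simp [hA]
    · ext y
      simp [hD]
  intro p
  induction p with
  | zero =>
    intro c
    refine alt_ext fun x => ?_
    rw [iota_lieDer, iota_dCE_zero, iota_dCE_zero, iota_dCE_zero, hL]
    abel
  | succ p ih =>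
    intro c
    refine alt_ext fun x => ?_
    simp only [iota_lieDer, iota_dCE, hL, map_sub, ih]
    abel

lemma dCE_lieD (x : 𝔫) (p : ℕ) (c : 𝔫 [⋀^Fin p]→ₗ[ℂ] M) :
    dCE p (lieD x p c) = lieD x (p + 1) (dCE p c) :=
  dCE_lieDer _ _ (fun y z => by simp) (fun y m => by simp) p c

lemma dCE_dCE (p : ℕ) (c : 𝔫 [⋀^Fin p]→ₗ[ℂ] M) : dCE (p + 1) (dCE p c) = 0 := by
  induction p with
  | zero =>
    refine alt_ext fun x => ?_
    rw [iota_dCE, iota_dCE_zero, dCE_lieD, sub_self, map_zero]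
  | succ p ih =>
    refine alt_ext fun x => ?_
    rw [iota_dCE, iota_dCE, map_sub, ih, dCE_lieD, sub_zero, sub_self, map_zero]

/-- Functoriality of the Chevalley–Eilenberg differential. -/
lemma dCE_map (φ : 𝔫' →ₗ⁅ℂ⁆ 𝔫) (u : M →ₗ[ℂ] M') (hu : ∀ (x : 𝔫') m, u ⁅φ x, m⁆ = ⁅x, u m⁆)
    (p : ℕ) : ∀ c : 𝔫 [⋀^Fin p]→ₗ[ℂ] M,
    u.compAlternatingMap ((dCE p c).compLinearMap (φ : 𝔫' →ₗ[ℂ] 𝔫))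
      = dCE p (u.compAlternatingMap (c.compLinearMap (φ : 𝔫' →ₗ[ℂ] 𝔫))) := by
  have hL : ∀ (p : ℕ) (x : 𝔫') (c : 𝔫 [⋀^Fin p]→ₗ[ℂ] M),
      u.compAlternatingMap ((lieD (φ x) p c).compLinearMap (φ : 𝔫' →ₗ[ℂ] 𝔫))
        = lieD x p (u.compAlternatingMap (c.compLinearMap (φ : 𝔫' →ₗ[ℂ] 𝔫))) :=
    fun p x c => lieDer_map _ _ _ _ _ _ (fun y => by simp) (fun m => hu x m) p c
  induction p with
  | zero =>
    intro c
    refine alt_ext fun x => ?_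
    rw [iota_compAlt, iota_compLinear, iota_dCE_zero, iota_dCE_zero]
    exact hL 0 x c
  | succ p ih =>
    intro c
    refine alt_ext fun x => ?_
    rw [iota_compAlt, iota_compLinear, iota_dCE, iota_dCE, iota_compAlt, iota_compLinear, ← ih,
      ← hL]
    ext v
    simp

/-- Cartan's formula for the differential on arbitrary cochains. -/
lemma ceD_cons (p : ℕ) (c : (Fin (p + 1) → 𝔫) → M) (x : 𝔫) (v : Fin (p + 1) → 𝔫) :
    ceD (p + 1) c (Fin.cons x v) = ⁅x, c v⁆ - ∑ k, c (Function.update v k ⁅x, v k⁆)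
      - ceD p (fun w => c (Fin.cons x w)) v := by
  have hrem : ∀ i : Fin (p + 1), (fun k => (Fin.cons x v : Fin (p + 2) → 𝔫) (i.succ.succAbove k))
      = Fin.cons x (fun k => v (i.succAbove k)) := by
    intro i
    funext k
    refine Fin.cases ?_ (fun k => ?_) k <;> simp
  simp only [ceD]
  rw [Fin.sum_univ_succ, Fin.sum_univ_succ (n := p + 1) (f := fun i => ∑ j, _)]
  have h0 : (fun k => (Fin.cons x v : Fin (p + 2) → 𝔫) ((0 : Fin (p + 2)).succAbove k)) = v := by
    funext k
    simp
  have h1 : ∑ j : Fin (p + 2), (if h : (0 : Fin (p + 2)) < j then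
      ((-1 : ℤ) ^ (((0 : Fin (p + 2)) : ℕ) + 1)) •
        c (Function.update (fun k => (Fin.cons x v : Fin (p + 2) → 𝔫) ((0 : Fin (p + 2)).succAbove k))
            (j.pred (Fin.pos_iff_ne_zero.mp (lt_of_le_of_lt (Fin.zero_le 0) h)))
            ⁅(Fin.cons x v : Fin (p + 2) → 𝔫) 0, (Fin.cons x v : Fin (p + 2) → 𝔫) j⁆)
      else 0) = - ∑ k, c (Function.update v k ⁅x, v k⁆) := by
    rw [Fin.sum_univ_succ, dif_neg (lt_irrefl _), zero_add, ← Finset.sum_neg_distrib]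
    refine Finset.sum_congr rfl fun j _ => ?_
    rw [dif_pos (Fin.succ_pos j), h0]
    simp
  rw [h1]
  have h2 : ∀ i : Fin (p + 1), ∑ j : Fin (p + 2), (if h : i.succ < j then
      ((-1 : ℤ) ^ ((i.succ : ℕ) + 1)) •
        c (Function.update (fun k => (Fin.cons x v : Fin (p + 2) → 𝔫) (i.succ.succAbove k))
            (j.pred (Fin.pos_iff_ne_zero.mp (lt_of_le_of_lt (Fin.zero_le i.succ) h)))
            ⁅(Fin.cons x v : Fin (p + 2) → 𝔫) i.succ, (Fin.cons x v : Fin (p + 2) → 𝔫) j⁆)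
      else 0) = - ∑ j : Fin (p + 1), (if h : i < j then
      ((-1 : ℤ) ^ ((i : ℕ) + 1)) •
        c (Fin.cons x (Function.update (fun k => v (i.succAbove k))
            (j.pred (Fin.pos_iff_ne_zero.mp (lt_of_le_of_lt (Fin.zero_le i) h)))
            ⁅v i, v j⁆))
      else 0) := by
    intro i
    rw [Fin.sum_univ_succ, dif_neg (by simp), zero_add, ← Finset.sum_neg_distrib]
    refine Finset.sum_congr rfl fun j _ => ?_
    by_cases h : i < j
    · rw [dif_pos h, dif_pos (Fin.succ_lt_succ_iff.2 h), Fin.val_succ, pow_succ _ ((i : ℕ) + 1),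
        mul_neg_one, neg_smul, hrem, Fin.cons_succ, Fin.cons_succ, Fin.cons_update]
      congr 4
      simp
    · rw [dif_neg h, dif_neg (by simpa using h), neg_zero]
  rw [Finset.sum_congr rfl fun i _ => h2 i, h0]
  simp only [hrem, Fin.val_succ, pow_succ, mul_neg_one, neg_smul, Finset.sum_neg_distrib,
    Fin.cons_succ, Fin.cons_zero, Fin.val_zero, pow_zero, one_smul]
  abel

/-- The differential on alternating maps is the differential on cochains. -/
lemma ceD_eq_dCE (p : ℕ) : ∀ (c : 𝔫 [⋀^Fin p]→ₗ[ℂ] M) (v : Fin (p + 1) → 𝔫),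
    ceD p c v = dCE p c v := by
  induction p with
  | zero =>
    intro c v
    have h := congrArg (fun b => b ![]) (iota_dCE_zero (v 0) c)
    rw [iota_apply, lieD_zero] at h
    have hv : v = Fin.cons (v 0) ![] := by
      funext k
      refine Fin.cases ?_ (fun k => k.elim0) k
      rfl
    rw [hv, h]
    simp [ceD, Subsingleton.elim (fun _ => v 0) (![] : Fin 0 → 𝔫)]
  | succ p ih =>
    intro c v
    have h := congrArg (fun b => b (Fin.tail v)) (iota_dCE (v 0) c)
    rw [← Fin.cons_self_tail v, ceD_cons]
    rw [iota_apply] at h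
    rw [h, AlternatingMap.sub_apply, ← ih, lieD, lieDer_apply]
    rfl

end CEd

section AltMore

variable {𝔫 : Type} [AddCommGroup 𝔫] [Module ℂ 𝔫]
variable {𝔫' : Type} [AddCommGroup 𝔫'] [Module ℂ 𝔫']
variable {M : Type} [AddCommGroup M] [Module ℂ M]

lemma sub_compLinear {p : ℕ} (c c' : 𝔫 [⋀^Fin p]→ₗ[ℂ] M) (i : 𝔫' →ₗ[ℂ] 𝔫) :
    (c - c').compLinearMap i = c.compLinearMap i - c'.compLinearMap i := rfl

lemma neg_compLinear {p : ℕ} (c : 𝔫 [⋀^Fin p]→ₗ[ℂ] M) (i : 𝔫' →ₗ[ℂ] 𝔫) :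
    (-c).compLinearMap i = -c.compLinearMap i := rfl

lemma compLinear_eq_of_iota (π : 𝔫 →ₗ[ℂ] 𝔫) : ∀ (p : ℕ) (c : 𝔫 [⋀^Fin (p + 1)]→ₗ[ℂ] M),
    (∀ y, iota (y - π y) c = 0) → c.compLinearMap π = c
  | 0, c, h => by
    refine alt_ext fun y => ?_
    rw [iota_compLinear]
    refine Eq.trans ?_ (sub_eq_zero.1 ((iota_sub_left y (π y) c).symm.trans (h y))).symm
    refine alt_ext_zero ?_
    rw [AlternatingMap.compLinearMap_apply]
    exact congrArg _ (Subsingleton.elim _ _)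
  | p + 1, c, h => by
    refine alt_ext fun y => ?_
    rw [iota_compLinear, compLinear_eq_of_iota π p]
    · exact (sub_eq_zero.1 ((iota_sub_left y (π y) c).symm.trans (h y))).symm
    · intro z
      rw [iota_iota, h, map_zero, neg_zero]

/-- An alternating map vanishes if its restriction to a hyperplane and that of its contraction with
a complementary vector vanish. -/
lemma alt_eq_zero_of_hyperplane (i : 𝔫' →ₗ[ℂ] 𝔫) (pr : 𝔫 →ₗ[ℂ] 𝔫') (ξ : 𝔫 →ₗ[ℂ] ℂ) (x : 𝔫)
    (h : ∀ y, y = i (pr y) + ξ y • x) (p : ℕ) (c : 𝔫 [⋀^Fin (p + 1)]→ₗ[ℂ] M)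
    (h0 : c.compLinearMap i = 0) (h1 : (iota x c).compLinearMap i = 0) : c = 0 := by
  have key : ∀ (p : ℕ) (c : 𝔫 [⋀^Fin (p + 1)]→ₗ[ℂ] M), c.compLinearMap i = 0 → iota x c = 0 →
      c = 0 := by
    intro p c h0 h1
    rw [← compLinear_eq_of_iota (i ∘ₗ pr) p c, ← AlternatingMap.compLinearMap_assoc, h0,
      AlternatingMap.zero_compLinearMap]
    intro y
    have : y - (i ∘ₗ pr) y = ξ y • x := by
      rw [sub_eq_iff_eq_add', LinearMap.comp_apply]
      exact h y
    rw [this, iota_smul_left, h1, smul_zero]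
  refine key p c h0 ?_
  cases p with
  | zero =>
    refine alt_ext_zero ?_
    have := congrArg (fun b => b ![]) h1
    rw [AlternatingMap.compLinearMap_apply] at this
    rw [← Subsingleton.elim (fun k => i ((![] : Fin 0 → 𝔫') k)) ![], this]
    rfl
  | succ p => exact key p _ h1 (iota_self _ _)

lemma wedge_compLinear_eq_zero {p : ℕ} (i : 𝔫' →ₗ[ℂ] 𝔫) (f : 𝔫 →ₗ[ℂ] 𝔫 [⋀^Fin p]→ₗ[ℂ] M)
    (h : ∀ y, f (i y) = 0) : (wedge f).compLinearMap i = 0 := by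
  ext v
  rw [AlternatingMap.compLinearMap_apply, wedge_apply]
  simp [h]

end AltMore

section Codim

variable {𝔨 : Type} [LieRing 𝔨] [LieAlgebra ℂ 𝔨]
variable {M : Type} [AddCommGroup M] [Module ℂ M] [LieRingModule 𝔨 M] [LieModule ℂ 𝔨 M]

/-- Vanishing of higher cohomology. -/
def IsAcyclicLie (𝔨 M : Type) [LieRing 𝔨] [LieAlgebra ℂ 𝔨] [AddCommGroup M] [Module ℂ M]
    [LieRingModule 𝔨 M] [LieModule ℂ 𝔨 M] : Prop :=
  ∀ (q : ℕ) (c : 𝔨 [⋀^Fin (q + 1)]→ₗ[ℂ] M), dCE (q + 1) c = 0 →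
    ∃ b : 𝔨 [⋀^Fin q]→ₗ[ℂ] M, dCE q b = c

lemma dCE_restrict (𝔨' : LieSubalgebra ℂ 𝔨) (p : ℕ) (c : 𝔨 [⋀^Fin p]→ₗ[ℂ] M) :
    (dCE p c).compLinearMap (𝔨'.incl : 𝔨' →ₗ[ℂ] 𝔨)
      = dCE p (c.compLinearMap (𝔨'.incl : 𝔨' →ₗ[ℂ] 𝔨)) :=
  dCE_map 𝔨'.incl LinearMap.id (fun _ _ => rfl) p c

lemma IsAcyclicLie.of_codim_one (𝔨' : LieSubalgebra ℂ 𝔨) (ξ : 𝔨 →ₗ[ℂ] ℂ)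
    (hξ : ∀ y, y ∈ 𝔨' ↔ ξ y = 0) (hlie : ∀ y z : 𝔨, ξ ⁅y, z⁆ = 0) (x : 𝔨) (hx : ξ x = 1)
    (h : IsAcyclicLie 𝔨' M)
    (hs : ∀ f : M, (∀ y ∈ 𝔨', ⁅y, f⁆ = 0) → ∃ g : M, (∀ y ∈ 𝔨', ⁅y, g⁆ = 0) ∧ ⁅x, g⁆ = f) :
    IsAcyclicLie 𝔨 M := by
  set i : 𝔨' →ₗ[ℂ] 𝔨 := (𝔨'.incl : 𝔨' →ₗ[ℂ] 𝔨) with hi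
  have hpr : ∀ y, (LinearMap.id - ξ.smulRight x : 𝔨 →ₗ[ℂ] 𝔨) y ∈ 𝔨'.toSubmodule := fun y => by
    refine (hξ _).2 ?_
    simp [hx]
  set pr : 𝔨 →ₗ[ℂ] 𝔨' := LinearMap.codRestrict 𝔨'.toSubmodule (LinearMap.id - ξ.smulRight x) hpr
    with hprdef
  have hdec : ∀ y, y = i (pr y) + ξ y • x := fun y => by
    change y = (y - ξ y • x) + ξ y • x
    abel
  have hpri : pr ∘ₗ i = LinearMap.id := by
    ext y
    have : ξ y = 0 := (hξ _).1 y.2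
    change (y : 𝔨) - ξ y • x = y
    rw [this, zero_smul, sub_zero]
  have hres : ∀ (p : ℕ) (b : 𝔨' [⋀^Fin p]→ₗ[ℂ] M),
      (b.compLinearMap pr).compLinearMap i = b := by
    intro p b
    rw [AlternatingMap.compLinearMap_assoc, hpri, AlternatingMap.compLinearMap_id]
  have hlx : ∀ (p : ℕ) (c : 𝔨 [⋀^Fin p]→ₗ[ℂ] M), c.compLinearMap i = 0 →
      (lieD x p c).compLinearMap i = 0 := by
    intro p c hc
    have hst : ∀ y ∈ 𝔨'.toSubmodule, LieAlgebra.ad ℂ 𝔨 x y ∈ 𝔨'.toSubmodule := fun y _ =>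
      (hξ _).2 (hlie _ _)
    have := lieDer_map (LieModule.toEnd ℂ 𝔨 M x) (LieAlgebra.ad ℂ 𝔨 x)
      (LieModule.toEnd ℂ 𝔨 M x) ((LieAlgebra.ad ℂ 𝔨 x).restrict hst) i LinearMap.id
      (fun _ => rfl) (fun _ => rfl) p c
    refine Eq.trans this ?_
    rw [hc]
    exact map_zero _
  intro q c hc
  suffices hmain : ∀ c : 𝔨 [⋀^Fin (q + 1)]→ₗ[ℂ] M, dCE (q + 1) c = 0 → c.compLinearMap i = 0 →
      ∃ b : 𝔨 [⋀^Fin q]→ₗ[ℂ] M, dCE q b = c by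
    obtain ⟨b₁, hb₁⟩ := h q (c.compLinearMap i) (by
      rw [hi, ← dCE_restrict, hc, AlternatingMap.zero_compLinearMap])
    obtain ⟨b, hb⟩ := hmain (c - dCE q (b₁.compLinearMap pr)) (by
        rw [map_sub, hc, dCE_dCE, sub_zero]) (by
        rw [sub_compLinear, hi, dCE_restrict, ← hi, hres, hb₁, sub_self])
    exact ⟨b + b₁.compLinearMap pr, by rw [map_add, hb, sub_add_cancel]⟩
  intro c hc hc0
  have ha : dCE q ((iota x c).compLinearMap i) = 0 := by
    have h1 := iota_dCE x c
    rw [hc, map_zero, eq_comm, sub_eq_zero] at h1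
    rw [hi, ← dCE_restrict, ← hi, ← h1, hlx _ _ hc0]
  suffices hb : ∃ b : 𝔨 [⋀^Fin q]→ₗ[ℂ] M, (dCE q b).compLinearMap i = 0 ∧
      (iota x (dCE q b)).compLinearMap i = (iota x c).compLinearMap i by
    obtain ⟨b, hb0, hb1⟩ := hb
    refine ⟨b, sub_eq_zero.1 (alt_eq_zero_of_hyperplane i pr ξ x hdec q _ ?_ ?_)⟩
    · rw [sub_compLinear, hb0, hc0, sub_zero]
    · rw [map_sub, sub_compLinear, hb1, sub_self]
  cases q with
  | zero =>
    set a := (iota x c).compLinearMap i with hadef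
    obtain ⟨g, hg, hgx⟩ := hs (a ![]) (fun y hy => by
      have := iota_dCE_zero (⟨y, hy⟩ : 𝔨') a
      rw [ha, map_zero] at this
      have h2 := congrArg (fun b => b ![]) this
      rw [lieD_zero] at h2
      exact h2.symm)
    refine ⟨AlternatingMap.constOfIsEmpty ℂ 𝔨 (Fin 0) g, ?_, ?_⟩
    · rw [hi, dCE_restrict, ← hi]
      refine alt_ext fun y => alt_ext_zero ?_
      rw [iota_dCE_zero, lieD_zero, map_zero]
      exact hg y y.2
    · refine alt_ext_zero ?_
      rw [iota_dCE_zero, AlternatingMap.compLinearMap_apply, ← hgx,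
        Subsingleton.elim (fun k => i ((![] : Fin 0 → 𝔨') k)) ![], lieD_zero]
      rfl
  | succ q =>
    obtain ⟨b', hb'⟩ := h q _ ha
    set f : 𝔨 →ₗ[ℂ] 𝔨 [⋀^Fin q]→ₗ[ℂ] M := ξ.smulRight (b'.compLinearMap pr) with hf
    have hfi : ∀ y, f (i y) = 0 := fun y => by
      have : ξ (i y) = 0 := (hξ _).1 y.2
      rw [hf, LinearMap.smulRight_apply, this, zero_smul]
    have hw0 := wedge_compLinear_eq_zero i f hfi
    refine ⟨-wedge f, ?_, ?_⟩
    · rw [hi, dCE_restrict, ← hi, neg_compLinear, hw0, neg_zero, map_zero]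
    · have hix : (iota x (wedge f)).compLinearMap i = b' := by
        have hfx : f x = b'.compLinearMap pr := by
          rw [hf, LinearMap.smulRight_apply, hx, one_smul]
        cases q with
        | zero => rw [iota_wedge_zero, hfx, hres]
        | succ q =>
          rw [iota_wedge, sub_compLinear, wedge_compLinear_eq_zero, sub_zero, hfx,
            hres]
          intro y
          rw [LinearMap.comp_apply, hfi, map_zero]
      rw [iota_dCE, sub_compLinear, hlx _ _ (by
        rw [neg_compLinear, hw0, neg_zero]), zero_sub, hi, dCE_restrict, ← hi,
        map_neg, neg_compLinear, hix, map_neg, neg_neg, hb']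

lemma IsAcyclicLie.of_subsingleton [Subsingleton 𝔨] : IsAcyclicLie 𝔨 M := by
  intro q c _
  refine ⟨0, ?_⟩
  rw [map_zero]
  refine alt_ext fun x => ?_
  rw [Subsingleton.elim x 0, iota_zero_left, iota_zero_left]

end Codim

section AltLie

variable {𝔩 : Type} [LieRing 𝔩] [LieAlgebra ℂ 𝔩]
variable {W : Type} [AddCommGroup W] [Module ℂ W] [LieRingModule 𝔩 W] [LieModule ℂ 𝔩 W]
variable {V : Type} [AddCommGroup V] [Module ℂ V] [LieRingModule 𝔩 V] [LieModule ℂ 𝔩 V]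

lemma toEnd_lie_eq (x y : 𝔩) : LieModule.toEnd ℂ 𝔩 V ⁅x, y⁆
    = LieModule.toEnd ℂ 𝔩 V x * LieModule.toEnd ℂ 𝔩 V y
      - LieModule.toEnd ℂ 𝔩 V y * LieModule.toEnd ℂ 𝔩 V x := by
  ext m
  simp

instance altLieRingModule (p : ℕ) : LieRingModule 𝔩 (W [⋀^Fin p]→ₗ[ℂ] V) where
  bracket x c := lieDer (LieModule.toEnd ℂ 𝔩 V x) (LieModule.toEnd ℂ 𝔩 W x) p c
  add_lie x y c := by rw [map_add, map_add, lieDer_add]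
  lie_add x c c' := map_add _ _ _
  leibniz_lie x y c := by
    rw [toEnd_lie_eq, toEnd_lie_eq, lieDer_comm, sub_add_cancel]

lemma alt_lie_def {p : ℕ} (x : 𝔩) (c : W [⋀^Fin p]→ₗ[ℂ] V) :
    ⁅x, c⁆ = lieDer (LieModule.toEnd ℂ 𝔩 V x) (LieModule.toEnd ℂ 𝔩 W x) p c := rfl

instance altLieModule (p : ℕ) : LieModule ℂ 𝔩 (W [⋀^Fin p]→ₗ[ℂ] V) where
  smul_lie t x c := by simp only [alt_lie_def, map_smul, lieDer_smul]
  lie_smul t x c := map_smul _ _ _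

lemma IsGood.alt {σ : 𝔩 → 𝔩} [FiniteDimensional ℂ W] (hV : IsGood σ V) (hW : IsGood σ W) :
    ∀ p : ℕ, IsGood σ (W [⋀^Fin p]→ₗ[ℂ] V)
  | 0 => by
    refine hV.of_injective (V := W [⋀^Fin 0]→ₗ[ℂ] V)
      { toFun := fun c => c ![], map_add' := fun _ _ => rfl, map_smul' := fun _ _ => rfl }
      (fun c c' h => alt_ext_zero h) (fun x c => ?_)
    exact lieDer_zero _ _ _
  | p + 1 => by
    refine ((IsGood.alt hV hW p).hom hW).of_injective (V := W [⋀^Fin (p + 1)]→ₗ[ℂ] V)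
      AlternatingMap.curryLeftLinearMap (fun c c' h => alt_ext fun x => ?_) (fun x c => ?_)
    · exact LinearMap.congr_fun h x
    · ext1 w
      rw [LieHom.lie_apply]
      exact iota_lieDer _ _ _ _

end AltLie

section Rel

variable {𝔤 : Type} [LieRing 𝔤] [LieAlgebra ℂ 𝔤] (𝔥 : LieSubalgebra ℂ 𝔤)
variable (M : Type) [AddCommGroup M] [Module ℂ M] [LieRingModule 𝔤 M] [LieModule ℂ 𝔤 M]

/-- Relative cochains as alternating maps. -/
def relC (p : ℕ) : Submodule ℂ (𝔤 [⋀^Fin p]→ₗ[ℂ] M) where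
  carrier := {c | (∀ h ∈ 𝔥, lieD h p c = 0) ∧ ∀ v : Fin p → 𝔤, (∃ i, v i ∈ 𝔥) → c v = 0}
  add_mem' := by
    rintro c c' ⟨h1, h2⟩ ⟨h1', h2'⟩
    refine ⟨fun h hh => ?_, fun v hv => ?_⟩
    · rw [map_add, h1 h hh, h1' h hh, add_zero]
    · rw [AlternatingMap.add_apply, h2 v hv, h2' v hv, add_zero]
  zero_mem' := ⟨fun _ _ => map_zero _, fun _ _ => rfl⟩
  smul_mem' := by
    rintro t c ⟨h1, h2⟩
    refine ⟨fun h hh => ?_, fun v hv => ?_⟩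
    · rw [map_smul, h1 h hh, smul_zero]
    · rw [AlternatingMap.smul_apply, h2 v hv, smul_zero]

variable {𝔥 M}

lemma iota_relC {p : ℕ} {c : 𝔤 [⋀^Fin (p + 1)]→ₗ[ℂ] M} (hc : c ∈ relC 𝔥 M (p + 1)) {h : 𝔤}
    (hh : h ∈ 𝔥) : iota h c = 0 := by
  ext v
  exact hc.2 _ ⟨0, hh⟩

lemma mem_relC_of_iota {p : ℕ} {c : 𝔤 [⋀^Fin (p + 1)]→ₗ[ℂ] M}
    (h1 : ∀ h ∈ 𝔥, lieD h (p + 1) c = 0) (h2 : ∀ h ∈ 𝔥, iota h c = 0) : c ∈ relC 𝔥 M (p + 1) := by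
  refine ⟨h1, ?_⟩
  rintro v ⟨i, hi⟩
  rw [← Fin.insertNth_self_removeNth i v, AlternatingMap.map_insertNth]
  have := congrArg (fun b => b (Fin.removeNth i v)) (h2 _ hi)
  refine (congrArg _ this).trans ?_
  exact smul_zero _

lemma dCE_mem_relC {p : ℕ} {c : 𝔤 [⋀^Fin p]→ₗ[ℂ] M} (hc : c ∈ relC 𝔥 M p) :
    dCE p c ∈ relC 𝔥 M (p + 1) := by
  refine mem_relC_of_iota (fun h hh => ?_) (fun h hh => ?_)
  · rw [← dCE_lieD, hc.1 h hh, map_zero]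
  · cases p with
    | zero => rw [iota_dCE_zero, hc.1 h hh]
    | succ p => rw [iota_dCE, hc.1 h hh, iota_relC hc hh, map_zero, sub_zero]

lemma isRelCochain_of_mem_relC {p : ℕ} {c : 𝔤 [⋀^Fin p]→ₗ[ℂ] M} (hc : c ∈ relC 𝔥 M p) :
    IsRelCochain 𝔥 p (c : (Fin p → 𝔤) → M) := by
  refine ⟨⟨fun v i x y => c.map_update_add v i x y, fun v i t x => c.map_update_smul v i t x,
    fun v i j hij hv => c.map_eq_zero_of_eq v hv hij⟩, hc.2, fun x hx v => ?_⟩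
  have := congrArg (fun b => b v) (hc.1 x hx)
  simp only [lieD, lieDer_apply] at this
  exact sub_eq_zero.1 this

lemma exists_relC_of_isRelCochain {p : ℕ} {c : (Fin p → 𝔤) → M} (hc : IsRelCochain 𝔥 p c) :
    ∃ b ∈ relC 𝔥 M p, (b : (Fin p → 𝔤) → M) = c := by
  obtain ⟨⟨ha, hs, halt⟩, hv, he⟩ := hc
  let b : 𝔤 [⋀^Fin p]→ₗ[ℂ] M :=
    { toFun := c
      map_update_add' := by
        intro inst v i x y
        rw [Subsingleton.elim inst (instDecidableEqFin p)]
        exact ha v i x y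
      map_update_smul' := by
        intro inst v i t x
        rw [Subsingleton.elim inst (instDecidableEqFin p)]
        exact hs v i t x
      map_eq_zero_of_eq' := fun v i j hvij hij => halt v i j hij hvij }
  refine ⟨b, ⟨fun h hh => ?_, hv⟩, rfl⟩
  ext v
  rw [lieD, lieDer_apply]
  exact sub_eq_zero.2 (he h hh v)

lemma relC_compLinear {p : ℕ} {c : 𝔤 [⋀^Fin p]→ₗ[ℂ] M} (hc : c ∈ relC 𝔥 M p)
    (π : 𝔤 →ₗ[ℂ] 𝔤) (hπ : ∀ y, y - π y ∈ 𝔥) : c.compLinearMap π = c := by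
  cases p with
  | zero =>
    ext v
    rw [AlternatingMap.compLinearMap_apply]
    exact congrArg _ (Subsingleton.elim _ _)
  | succ p => exact compLinear_eq_of_iota π p c fun y => iota_relC hc (hπ y)

variable {Q : Type} [AddCommGroup Q] [Module ℂ Q] [LieRingModule 𝔤 Q] [LieModule ℂ 𝔤 Q]

lemma map_mem_relC {u : M →ₗ[ℂ] Q} (hl : ∀ (x : 𝔤) m, u ⁅x, m⁆ = ⁅x, u m⁆) {p : ℕ}
    {c : 𝔤 [⋀^Fin p]→ₗ[ℂ] M} (hc : c ∈ relC 𝔥 M p) : u.compAlternatingMap c ∈ relC 𝔥 Q p := by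
  refine ⟨fun h hh => ?_, fun v hv => ?_⟩
  · have := lieDer_map (LieModule.toEnd ℂ 𝔤 M h) (LieAlgebra.ad ℂ 𝔤 h) (LieModule.toEnd ℂ 𝔤 Q h)
      (LieAlgebra.ad ℂ 𝔤 h) LinearMap.id u (fun _ => rfl) (fun m => hl h m) p c
    refine Eq.trans this.symm ?_
    have h0 : lieDer (LieModule.toEnd ℂ 𝔤 M h) (LieAlgebra.ad ℂ 𝔤 h) p c = 0 := hc.1 h hh
    rw [h0]
    ext v
    simp
  · rw [LinearMap.compAlternatingMap_apply, hc.2 v hv, map_zero]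

lemma dCE_comp {u : M →ₗ[ℂ] Q} (hl : ∀ (x : 𝔤) m, u ⁅x, m⁆ = ⁅x, u m⁆) (p : ℕ)
    (c : 𝔤 [⋀^Fin p]→ₗ[ℂ] M) :
    u.compAlternatingMap (dCE p c) = dCE p (u.compAlternatingMap c) :=
  dCE_map (LieHom.id : 𝔤 →ₗ⁅ℂ⁆ 𝔤) u hl p c

lemma mem_relC_of_map {u : M →ₗ[ℂ] Q} (hu : Function.Injective u)
    (hl : ∀ (x : 𝔤) m, u ⁅x, m⁆ = ⁅x, u m⁆) {p : ℕ}
    {c : 𝔤 [⋀^Fin p]→ₗ[ℂ] M} (hc : u.compAlternatingMap c ∈ relC 𝔥 Q p) : c ∈ relC 𝔥 M p := by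
  refine ⟨fun h hh => ?_, fun v hv => ?_⟩
  · have := lieDer_map (LieModule.toEnd ℂ 𝔤 M h) (LieAlgebra.ad ℂ 𝔤 h) (LieModule.toEnd ℂ 𝔤 Q h)
      (LieAlgebra.ad ℂ 𝔤 h) LinearMap.id u (fun _ => rfl) (fun m => hl h m) p c
    have h0 : u.compAlternatingMap (lieD h p c) = 0 := this.trans (hc.1 h hh)
    ext v
    apply hu
    exact (congrArg (fun b => b v) h0).trans (map_zero u).symm
  · apply hu
    rw [map_zero]
    exact hc.2 v hv

variable {σ : 𝔥 → 𝔥} [FiniteDimensional ℂ 𝔤]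

/-- Relative cochains can be lifted along surjections of good modules. -/
lemma exists_relC_lift (hσ : IsRedLie σ) (hM : IsGood σ M) (hg : IsGood σ 𝔤)
    (π : 𝔤 →ₗ[ℂ] 𝔤) (hπ : ∀ y, y - π y ∈ 𝔥) (hπ0 : ∀ y ∈ 𝔥, π y = 0)
    (hπl : ∀ h ∈ 𝔥, ∀ y, π ⁅h, y⁆ = ⁅h, π y⁆) {u : M →ₗ[ℂ] Q} (hu : Function.Surjective u)
    (hl : ∀ (x : 𝔤) m, u ⁅x, m⁆ = ⁅x, u m⁆) {p : ℕ} {c : 𝔤 [⋀^Fin p]→ₗ[ℂ] Q}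
    (hc : c ∈ relC 𝔥 Q p) : ∃ c' ∈ relC 𝔥 M p, u.compAlternatingMap c' = c := by
  obtain ⟨s, hs⟩ := u.exists_rightInverse_of_surjective (LinearMap.range_eq_top.2 hu)
  have hsc : u.compAlternatingMap (s.compAlternatingMap c) = c := by
    ext v
    exact LinearMap.congr_fun hs (c v)
  obtain ⟨c', hc', hinv⟩ := hσ.exists_invariant_lift (hM.alt hg p)
    (u.compAlternatingMapₗ (S := ℂ) : (𝔤 [⋀^Fin p]→ₗ[ℂ] M) →ₗ[ℂ] 𝔤 [⋀^Fin p]→ₗ[ℂ] Q)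
    (fun x c => lieDer_map (LieModule.toEnd ℂ 𝔤 M x) (LieAlgebra.ad ℂ 𝔤 x)
      (LieModule.toEnd ℂ 𝔤 Q x) (LieAlgebra.ad ℂ 𝔤 x) LinearMap.id u (fun _ => rfl) (fun m => hl x m) p c)
    (s.compAlternatingMap c) (fun x => by
      refine Eq.trans (congrArg (fun b => ⁅x, b⁆) hsc) ?_
      exact hc.1 x x.2)
  replace hc' : u.compAlternatingMap c' = c := hc'.trans hsc
  refine ⟨c'.compLinearMap π, ⟨fun h hh => ?_, ?_⟩, ?_⟩
  · have := lieDer_map (LieModule.toEnd ℂ 𝔤 M h) (LieAlgebra.ad ℂ 𝔤 h) (LieModule.toEnd ℂ 𝔤 M h)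
      (LieAlgebra.ad ℂ 𝔤 h) π LinearMap.id (fun y => hπl h hh y) (fun m => rfl) p c'
    refine Eq.trans this.symm ?_
    have h0 : lieDer (LieModule.toEnd ℂ 𝔤 M h) (LieAlgebra.ad ℂ 𝔤 h) p c' = 0 := hinv ⟨h, hh⟩
    rw [h0]
    rfl
  · rintro v ⟨i, hi⟩
    rw [AlternatingMap.compLinearMap_apply]
    exact c'.map_coord_zero i (hπ0 _ hi)
  · have : u.compAlternatingMap (c'.compLinearMap π) = (u.compAlternatingMap c').compLinearMap π :=
      rfl
    rw [this, hc', relC_compLinear hc π hπ]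

/-- Relative acyclicity follows from acyclicity for an ideal complementary to the reductive
subalgebra. -/
lemma exists_relC_primitive (hσ : IsRedLie σ) (hM : IsGood σ M) (hg : IsGood σ 𝔤)
    (𝔫 : LieIdeal ℂ 𝔤) (π : 𝔤 →ₗ[ℂ] 𝔫) (hπ : ∀ y, y - π y ∈ 𝔥) (hπ0 : ∀ y ∈ 𝔥, π y = 0)
    (hπi : ∀ y : 𝔫, π y = y) (hac : IsAcyclicLie 𝔫 M) {p : ℕ} {c : 𝔤 [⋀^Fin (p + 1)]→ₗ[ℂ] M}
    (hc : c ∈ relC 𝔥 M (p + 1)) (hd : dCE (p + 1) c = 0) : ∃ b ∈ relC 𝔥 M p, dCE p b = c := by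
  set i : 𝔫 →ₗ[ℂ] 𝔤 := (𝔫.incl : 𝔫 →ₗ[ℂ] 𝔤) with hi
  have hn : IsGood σ 𝔫 := hg.of_injective i Subtype.val_injective fun _ _ => rfl
  have hdi : ∀ (q : ℕ) (c : 𝔤 [⋀^Fin q]→ₗ[ℂ] M),
      (dCE q c).compLinearMap i = dCE q (c.compLinearMap i) := fun q c =>
    dCE_map 𝔫.incl LinearMap.id (fun _ _ => rfl) q c
  have hLi : ∀ (q : ℕ) (h : 𝔥) (c : 𝔤 [⋀^Fin q]→ₗ[ℂ] M),
      (lieD (h : 𝔤) q c).compLinearMap i = ⁅h, c.compLinearMap i⁆ := fun q h c =>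
    lieDer_map (LieModule.toEnd ℂ 𝔤 M h) (LieAlgebra.ad ℂ 𝔤 h) (LieModule.toEnd ℂ 𝔥 M h)
      (LieModule.toEnd ℂ 𝔥 𝔫 h) i LinearMap.id (fun _ => rfl) (fun _ => rfl) q c
  have hπl : ∀ (h : 𝔥) (y : 𝔤), π ⁅(h : 𝔤), y⁆ = ⁅h, π y⁆ := by
    intro h y
    have h1 : y = (y - π y) + π y := by abel
    conv_lhs => rw [h1]
    rw [lie_add, map_add, hπ0 _ (𝔥.lie_mem h.2 (hπ y)), zero_add]
    exact hπi ⁅(h : 𝔤), π y⁆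
  have hLπ : ∀ (q : ℕ) (h : 𝔥) (b : 𝔫 [⋀^Fin q]→ₗ[ℂ] M),
      ⁅h, b⁆.compLinearMap π = lieD (h : 𝔤) q (b.compLinearMap π) := fun q h b =>
    lieDer_map (LieModule.toEnd ℂ 𝔥 M h) (LieModule.toEnd ℂ 𝔥 𝔫 h) (LieModule.toEnd ℂ 𝔤 M h)
      (LieAlgebra.ad ℂ 𝔤 h) π LinearMap.id (fun y => hπl h y) (fun _ => rfl) q b
  obtain ⟨b₀, hb₀⟩ := hac p (c.compLinearMap i) (by
    rw [← hdi, hd, AlternatingMap.zero_compLinearMap])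
  obtain ⟨b, hb, hinv⟩ := hσ.exists_invariant_lift (hM.alt hn p)
    (dCE p : (𝔫 [⋀^Fin p]→ₗ[ℂ] M) →ₗ[ℂ] _)
    (fun x b => dCE_lieDer (LieModule.toEnd ℂ 𝔥 M x) (LieModule.toEnd ℂ 𝔥 𝔫 x)
      (fun y z => Subtype.ext (leibniz_lie (x : 𝔤) (y : 𝔤) (z : 𝔤)))
      (fun y m => leibniz_lie (x : 𝔤) (y : 𝔤) m) p b) b₀ (fun x => by
      rw [hb₀, ← hLi, hc.1 x x.2, AlternatingMap.zero_compLinearMap])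
  have hbπ : b.compLinearMap π ∈ relC 𝔥 M p := by
    refine ⟨fun h hh => ?_, ?_⟩
    · refine (hLπ p ⟨h, hh⟩ b).symm.trans ?_
      exact (congrArg (fun b => b.compLinearMap π) (hinv ⟨h, hh⟩)).trans
        (AlternatingMap.zero_compLinearMap _)
    · rintro v ⟨k, hk⟩
      rw [AlternatingMap.compLinearMap_apply]
      exact b.map_coord_zero k (hπ0 _ hk)
  refine ⟨b.compLinearMap π, hbπ, ?_⟩
  have hiπ : ∀ y, y - (i ∘ₗ π) y ∈ 𝔥 := hπ
  have hπi' : π ∘ₗ i = LinearMap.id := LinearMap.ext hπi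
  rw [← relC_compLinear (dCE_mem_relC hbπ) (i ∘ₗ π) hiπ, ← relC_compLinear hc (i ∘ₗ π) hiπ,
    ← AlternatingMap.compLinearMap_assoc, ← AlternatingMap.compLinearMap_assoc, hdi,
    AlternatingMap.compLinearMap_assoc, hπi', AlternatingMap.compLinearMap_id, hb, hb₀]

end Rel

/-! ### Regular group cochains -/

section ContractNth

variable {α : Type} (op : α → α → α)

lemma contractNth_zero_cons {p : ℕ} (h : α) (g : Fin (p + 1) → α) :
    Fin.contractNth 0 op (Fin.cons h g : Fin (p + 2) → α) =
      Fin.cons (op h (g 0)) (fun i => g i.succ) := by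
  funext k
  refine Fin.cases ?_ (fun k => ?_) k
  · rw [Fin.contractNth_apply_of_eq _ _ _ _ (by simp)]
    simp only [Fin.castSucc_zero, Fin.cons_zero, Fin.cons_succ]
  · rw [Fin.contractNth_apply_of_gt _ _ _ _ (by simp)]
    simp

lemma contractNth_succ_cons {p : ℕ} (j : Fin (p + 1)) (h : α) (g : Fin (p + 1) → α) :
    Fin.contractNth j.succ op (Fin.cons h g : Fin (p + 2) → α) =
      Fin.cons h (Fin.contractNth j op g) := by
  funext k
  refine Fin.cases ?_ (fun k => ?_) k
  · rw [Fin.contractNth_apply_of_lt _ _ _ _ (by simp)]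
    simp
  · rcases lt_trichotomy (k : ℕ) (j : ℕ) with hk | hk | hk
    · rw [Fin.contractNth_apply_of_lt _ _ _ _ (by simpa using hk), Fin.cons_succ,
        Fin.contractNth_apply_of_lt _ _ _ _ hk, ← Fin.succ_castSucc, Fin.cons_succ]
    · rw [Fin.contractNth_apply_of_eq _ _ _ _ (by simpa using hk), Fin.cons_succ,
        ← Fin.succ_castSucc, Fin.cons_succ, Fin.cons_succ, Fin.contractNth_apply_of_eq _ _ _ _ hk]
    · rw [Fin.contractNth_apply_of_gt _ _ _ _ (by simpa using hk), Fin.cons_succ,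
        Fin.cons_succ, Fin.contractNth_apply_of_gt _ _ _ _ hk]

end ContractNth

namespace AffAlgGroup

variable {H : AffAlgGroup} {𝔩 : Type} [LieRing 𝔩] [LieAlgebra ℂ 𝔩] {d : LieDat H 𝔩}
variable {M N : Type} [AddCommGroup M] [Module ℂ M] [AddCommGroup N] [Module ℂ N]

/-- Coordinates on the powers of a group. -/
def powCoord (H : AffAlgGroup) (p : ℕ) (g : Fin p → H.Gp) (i : Fin p × Fin H.n) : ℂ :=
  (g i.1).1 i.2

/-- Regular group cochains. -/
abbrev grpC (H : AffAlgGroup) (M : Type) [AddCommGroup M] [Module ℂ M] (p : ℕ) :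
    Submodule ℂ ((Fin p → H.Gp) → M) := regMaps (H.powCoord p) M

/-- The inhomogeneous differential. -/
def grpD (ρ : Representation ℂ H.Gp M) (p : ℕ) :
    ((Fin p → H.Gp) → M) →ₗ[ℂ] ((Fin (p + 1) → H.Gp) → M) where
  toFun f g := ρ (g 0) (f fun i => g i.succ) + ∑ j : Fin (p + 1),
    (-1 : ℂ) ^ ((j : ℕ) + 1) • f (Fin.contractNth j (· * ·) g)
  map_add' f f' := by
    funext g
    simp only [Pi.add_apply, map_add, smul_add, Finset.sum_add_distrib]
    abel
  map_smul' c f := by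
    funext g
    simp only [Pi.smul_apply, map_smul, RingHom.id_apply, smul_add, Finset.smul_sum]
    exact congrArg _ (Finset.sum_congr rfl fun j _ => smul_comm _ _ _)

lemma grpD_apply (ρ : Representation ℂ H.Gp M) (p : ℕ) (f : (Fin p → H.Gp) → M)
    (g : Fin (p + 1) → H.Gp) : grpD ρ p f g = ρ (g 0) (f fun i => g i.succ) +
      ∑ j : Fin (p + 1), (-1 : ℂ) ^ ((j : ℕ) + 1) • f (Fin.contractNth j (· * ·) g) := rfl

lemma grpD_grpD (ρ : Representation ℂ H.Gp M) (p : ℕ) (f : (Fin p → H.Gp) → M) :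
    grpD ρ (p + 1) (grpD ρ p f) = 0 := by
  have h := groupCohomology.inhomogeneousCochains.d_comp_d (A := Rep.of ρ) (n := p)
  have h' := congrArg (fun F => F.hom f) h
  exact h'

lemma grpD_map {ρ : Representation ℂ H.Gp M} {ρ' : Representation ℂ H.Gp N} (u : M →ₗ[ℂ] N)
    (hu : ∀ g m, u (ρ g m) = ρ' g (u m)) (p : ℕ) (f : (Fin p → H.Gp) → M)
    (g : Fin (p + 1) → H.Gp) : u (grpD ρ p f g) = grpD ρ' p (fun x => u (f x)) g := by
  simp [grpD_apply, hu]

lemma powCoord_mem {p : ℕ} (k : Fin p) (i : Fin H.n) :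
    (fun g : Fin p → H.Gp => (g k).1 i) ∈ regFun (H.powCoord p) :=
  coord_mem_regFun (κ := H.powCoord p) (k, i)

lemma contractNth_coord_mem {p : ℕ} (j : Fin (p + 1)) (i : Fin p × Fin H.n) :
    (fun g : Fin (p + 1) → H.Gp => H.powCoord p (Fin.contractNth j (· * ·) g) i) ∈
      regFun (H.powCoord (p + 1)) := by
  obtain ⟨k, i⟩ := i
  rcases lt_trichotomy (k : ℕ) (j : ℕ) with hk | hk | hk
  · simp only [powCoord, Fin.contractNth_apply_of_lt _ _ _ _ hk]
    exact powCoord_mem _ _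
  · simp only [powCoord, Fin.contractNth_apply_of_eq _ _ _ _ hk]
    exact mul_coord_mem (fun i => powCoord_mem _ i) (fun i => powCoord_mem _ i) i
  · simp only [powCoord, Fin.contractNth_apply_of_gt _ _ _ _ hk]
    exact powCoord_mem _ _

lemma act_mem_regMaps [LieRingModule 𝔩 M] [LieModule ℂ 𝔩 M] {ρ : Representation ℂ H.Gp M}
    (h : IsRat d ρ) {X σ : Type}
    {κ : X → σ → ℂ} {φ : X → H.Gp} (hφ : ∀ i, (fun x => (φ x).1 i) ∈ regFun κ) {F : X → M}
    (hF : F ∈ regMaps κ M) : (fun x => ρ (φ x) (F x)) ∈ regMaps κ M := by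
  obtain ⟨k, f, m, hf, e⟩ := exists_decomp_of_mem_regMaps hF
  have : (fun x => ρ (φ x) (F x)) = ∑ i, fun x => f i x • ρ (φ x) (m i) := by
    funext x; simp [e]
  rw [this]
  exact Submodule.sum_mem _ fun i _ =>
    regFun_smul_mem_regMaps (hf i) (comp_mem_regMaps (h.reg (m i)) hφ)

lemma grpD_mem [LieRingModule 𝔩 M] [LieModule ℂ 𝔩 M] {ρ : Representation ℂ H.Gp M}
    (h : IsRat d ρ) {p : ℕ} {f : (Fin p → H.Gp) → M} (hf : f ∈ H.grpC M p) :
    grpD ρ p f ∈ H.grpC M (p + 1) := by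
  have : grpD ρ p f = (fun g => ρ (g 0) (f fun i => g i.succ)) + ∑ j : Fin (p + 1),
      (-1 : ℂ) ^ ((j : ℕ) + 1) • fun g => f (Fin.contractNth j (· * ·) g) := by
    funext g; simp [grpD_apply]
  rw [this]
  refine Submodule.add_mem _ (act_mem_regMaps h (fun i => powCoord_mem _ i) ?_)
    (Submodule.sum_mem _ fun j _ => Submodule.smul_mem _ _ ?_)
  · exact comp_mem_regMaps hf fun i => powCoord_mem _ _
  · exact comp_mem_regMaps hf (contractNth_coord_mem j)

/-- Coinduced modules have no higher group cohomology. -/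
lemma exists_grpC_primitive {p : ℕ} {c : (Fin (p + 1) → H.Gp) → Jmod d M}
    (hc : c ∈ H.grpC (Jmod d M) (p + 1)) (hd : grpD (Jmod.rep d M) (p + 1) c = 0) :
    ∃ b ∈ H.grpC (Jmod d M) p, grpD (Jmod.rep d M) p b = c := by
  have hF : (fun q : (Fin p → H.Gp) × H.Gp => Jmod.ev (d := d) 1 (c (Fin.cons q.2 q.1))) ∈
      regMaps (prodCoord (H.powCoord p) (fun g : H.Gp => g.1)) M := by
    refine comp_mem_regMaps (comp_linear_mem_regMaps hc _) ?_
    rintro ⟨k, i⟩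
    refine Fin.cases ?_ (fun k => ?_) k
    · exact coord_mem_regFun (κ := prodCoord (H.powCoord p) (fun g : H.Gp => g.1)) (Sum.inr i)
    · exact coord_mem_regFun (κ := prodCoord (H.powCoord p) (fun g : H.Gp => g.1)) (Sum.inl (k, i))
  obtain ⟨K, hK, e'⟩ : ∃ K ∈ H.grpC (Jmod d M) p, ∀ x y,
      Jmod.val d M (K x) y = Jmod.val d M (c (Fin.cons y x)) 1 := exists_curry_regMaps hF
  refine ⟨K, hK, funext fun g => Jmod.ext fun h => ?_⟩
  have hg := congrArg (fun F => Jmod.val d M (F (Fin.cons h g)) 1) hd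
  rw [grpD_apply, Fin.sum_univ_succ] at hg
  simp only [Fin.cons_zero, Fin.cons_succ, contractNth_zero_cons, contractNth_succ_cons, map_add,
    Pi.add_apply, Jmod.rep_apply, map_sum, map_smul, Finset.sum_apply, Pi.smul_apply, Pi.zero_apply,
    map_zero, one_mul, Fin.val_zero, Fin.val_succ] at hg
  simp only [grpD_apply, map_add, map_sum, map_smul, Pi.add_apply, Finset.sum_apply, Pi.smul_apply,
    Jmod.rep_apply, e']
  rw [← sub_eq_zero, ← neg_eq_zero, ← hg]
  simp only [pow_succ, mul_neg, mul_one, neg_smul, Finset.sum_neg_distrib, pow_zero, one_smul,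
    neg_neg]
  abel

end AffAlgGroup

/-! ### Cochain complexes of abelian groups and dimension shifting -/

lemma nonempty_quotient_equiv {Z Z' : Type} [AddCommGroup Z] [AddCommGroup Z']
    (B : AddSubgroup Z) (B' : AddSubgroup Z') (R : AddSubgroup (Z × Z'))
    (hl : ∀ x, ∃ y, (x, y) ∈ R) (hr : ∀ y, ∃ x, (x, y) ∈ R)
    (h : ∀ x y, (x, y) ∈ R → (x ∈ B ↔ y ∈ B')) : Nonempty ((Z ⧸ B) ≃+ (Z' ⧸ B')) := by
  let f : R →+ Z ⧸ B := (QuotientAddGroup.mk' B).comp ((AddMonoidHom.fst Z Z').comp R.subtype)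
  let f' : R →+ Z' ⧸ B' := (QuotientAddGroup.mk' B').comp ((AddMonoidHom.snd Z Z').comp R.subtype)
  have hf : Function.Surjective f := fun q => by
    obtain ⟨x, rfl⟩ := QuotientAddGroup.mk'_surjective B q
    obtain ⟨y, hy⟩ := hl x
    exact ⟨⟨_, hy⟩, rfl⟩
  have hf' : Function.Surjective f' := fun q => by
    obtain ⟨y, rfl⟩ := QuotientAddGroup.mk'_surjective B' q
    obtain ⟨x, hx⟩ := hr y
    exact ⟨⟨_, hx⟩, rfl⟩
  have hk : f.ker = f'.ker := by
    ext ⟨⟨x, y⟩, hxy⟩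
    rw [AddMonoidHom.mem_ker, AddMonoidHom.mem_ker]
    exact ((QuotientAddGroup.eq_zero_iff x).trans (h x y hxy)).trans
      (QuotientAddGroup.eq_zero_iff y).symm
  exact ⟨(QuotientAddGroup.quotientKerEquivOfSurjective f hf).symm.trans
    ((QuotientAddGroup.quotientAddEquivOfEq hk).trans
      (QuotientAddGroup.quotientKerEquivOfSurjective f' hf'))⟩

/-- A cochain complex of abelian groups in nonnegative degrees. -/
structure Cplx where
  /-- The cochains. -/
  A : ℕ → Type
  [grp : ∀ p, AddCommGroup (A p)]
  /-- The differential. -/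
  d : ∀ p, A p →+ A (p + 1)
  dd : ∀ p x, d (p + 1) (d p x) = 0

namespace Cplx

attribute [instance] Cplx.grp

/-- Cocycles. -/
def Z (C : Cplx) (p : ℕ) : AddSubgroup (C.A p) := (C.d p).ker

lemma mem_Z {C : Cplx} {p : ℕ} {c : C.A p} : c ∈ C.Z p ↔ C.d p c = 0 := Iff.rfl

/-- Coboundaries. -/
def B (C : Cplx) : ∀ p, AddSubgroup (C.A p)
  | 0 => ⊥
  | p + 1 => (C.d p).range

/-- Cohomology. -/
abbrev H (C : Cplx) (p : ℕ) : Type := C.Z p ⧸ (C.B p).addSubgroupOf (C.Z p)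

/-- A short exact sequence of complexes. -/
structure SES (C₁ C₂ C₃ : Cplx) where
  /-- The inclusion. -/
  f : ∀ p, C₁.A p →+ C₂.A p
  /-- The projection. -/
  g : ∀ p, C₂.A p →+ C₃.A p
  hf : ∀ p x, C₂.d p (f p x) = f (p + 1) (C₁.d p x)
  hg : ∀ p x, C₃.d p (g p x) = g (p + 1) (C₂.d p x)
  inj : ∀ p, Function.Injective (f p)
  surj : ∀ p, Function.Surjective (g p)
  gf : ∀ p x, g p (f p x) = 0
  exact : ∀ p y, g p y = 0 → ∃ x, f p x = y

/-- No cohomology in positive degrees. -/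
def Acyclic (C : Cplx) : Prop := ∀ p c, C.d (p + 1) c = 0 → ∃ b, C.d p b = c

variable {C₁ C₂ C₃ : Cplx}

/-- Images of cocycles in a quotient complex. -/
def SES.im (S : SES C₁ C₂ C₃) (p : ℕ) : AddSubgroup (C₃.A p) := (C₂.Z p).map (S.g p)

lemma SES.mem_im {S : SES C₁ C₂ C₃} {p : ℕ} {c : C₃.A p} :
    c ∈ S.im p ↔ ∃ b, C₂.d p b = 0 ∧ S.g p b = c := Iff.rfl

lemma SES.shift (S : SES C₁ C₂ C₃) (h : C₂.Acyclic) (p : ℕ) :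
    Nonempty (C₁.H (p + 1) ≃+ (C₃.Z p ⧸ (S.im p).addSubgroupOf (C₃.Z p))) := by
  let R : AddSubgroup (C₁.Z (p + 1) × C₃.Z p) :=
    { carrier := {x | ∃ b, S.g p b = x.2.1 ∧ C₂.d p b = S.f (p + 1) x.1.1}
      zero_mem' := ⟨0, by simp, by simp⟩
      add_mem' := by
        rintro x y ⟨b, h1, h2⟩ ⟨b', h1', h2'⟩
        exact ⟨b + b', by simp [h1, h1'], by simp [h2, h2']⟩
      neg_mem' := by
        rintro x ⟨b, h1, h2⟩
        exact ⟨-b, by simp [h1], by simp [h2]⟩ }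
  refine nonempty_quotient_equiv _ _ R ?_ ?_ ?_
  · rintro ⟨a, ha⟩
    obtain ⟨b, hb⟩ := h p (S.f (p + 1) a) (by rw [S.hf, mem_Z.1 ha, map_zero])
    exact ⟨⟨S.g p b, by rw [mem_Z, S.hg, hb, S.gf]⟩, b, rfl, hb⟩
  · rintro ⟨c, hc⟩
    obtain ⟨b, rfl⟩ := S.surj p c
    obtain ⟨a, ha⟩ := S.exact (p + 1) (C₂.d p b) (by rw [← S.hg, mem_Z.1 hc])
    exact ⟨⟨a, S.inj _ (by rw [← S.hf, ha, C₂.dd, map_zero])⟩, b, rfl, ha.symm⟩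
  · rintro ⟨a, ha⟩ ⟨c, hc⟩ ⟨b, h1, h2⟩
    rw [AddSubgroup.mem_addSubgroupOf, AddSubgroup.mem_addSubgroupOf]
    dsimp only at h1 h2 ⊢
    constructor
    · rintro ⟨a', rfl⟩
      exact SES.mem_im.2 ⟨b - S.f p a', by rw [map_sub, h2, S.hf, sub_self], by
        rw [map_sub, h1, S.gf, sub_zero]⟩
    · intro hm
      obtain ⟨b', h3, h4⟩ := SES.mem_im.1 hm
      obtain ⟨a', ha'⟩ := S.exact p (b - b') (by rw [map_sub, h1, h4, sub_self])
      exact ⟨a', S.inj _ (by rw [← S.hf, ha', map_sub, h2, h3, sub_zero])⟩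

lemma SES.im_succ (S : SES C₁ C₂ C₃) (h : C₂.Acyclic) (p : ℕ) : S.im (p + 1) = C₃.B (p + 1) := by
  ext c
  rw [SES.mem_im]
  constructor
  · rintro ⟨b, hb, rfl⟩
    obtain ⟨b', rfl⟩ := h p b hb
    exact ⟨S.g p b', S.hg _ _⟩
  · rintro ⟨c', rfl⟩
    obtain ⟨b, rfl⟩ := S.surj p c'
    exact ⟨C₂.d p b, C₂.dd _ _, (S.hg _ _).symm⟩

lemma SES.shift_succ (S : SES C₁ C₂ C₃) (h : C₂.Acyclic) (p : ℕ) :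
    Nonempty (C₁.H (p + 2) ≃+ C₃.H (p + 1)) := by
  have := S.shift h (p + 1)
  rwa [S.im_succ h] at this

/-- A matching of the zero cocycles of two short exact sequences identifies the first cohomology
groups. -/
lemma SES.nonempty_H_one {C₁' C₂' C₃' : Cplx} (S : SES C₁ C₂ C₃) (S' : SES C₁' C₂' C₃')
    (h : C₂.Acyclic) (h' : C₂'.Acyclic) (e₂ : C₂.Z 0 ≃+ C₂'.Z 0) (e₃ : C₃.Z 0 ≃+ C₃'.Z 0)
    (hg : ∀ x y, S.g 0 x.1 = y.1 → S'.g 0 (e₂ x).1 = (e₃ y).1) :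
    Nonempty (C₁.H 1 ≃+ C₁'.H 1) := by
  have hg' : ∀ x y, S'.g 0 (e₂ x).1 = (e₃ y).1 → S.g 0 x.1 = y.1 := fun x y hxy => by
    have hz : S.g 0 x.1 ∈ C₃.Z 0 := by rw [mem_Z, S.hg, mem_Z.1 x.2, map_zero]
    have := hg x ⟨_, hz⟩ rfl
    exact congrArg Subtype.val (e₃.injective (Subtype.ext (this.symm.trans hxy)))
  obtain ⟨a⟩ := S.shift h 0
  obtain ⟨a'⟩ := S'.shift h' 0
  obtain ⟨b⟩ := nonempty_quotient_equiv ((S.im 0).addSubgroupOf (C₃.Z 0))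
    ((S'.im 0).addSubgroupOf (C₃'.Z 0)) e₃.toAddMonoidHom.graph
    (fun x => ⟨e₃ x, AddMonoidHom.mem_graph.2 rfl⟩)
    (fun y => ⟨e₃.symm y, AddMonoidHom.mem_graph.2 (e₃.apply_symm_apply _)⟩) (by
      intro x y hxy
      obtain rfl : e₃ x = y := AddMonoidHom.mem_graph.1 hxy
      rw [AddSubgroup.mem_addSubgroupOf, AddSubgroup.mem_addSubgroupOf, SES.mem_im, SES.mem_im]
      constructor
      · rintro ⟨b, hb, hb'⟩
        exact ⟨e₂ ⟨b, hb⟩, (e₂ ⟨b, hb⟩).2, hg _ _ hb'⟩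
      · rintro ⟨b, hb, hb'⟩
        refine ⟨e₂.symm ⟨b, hb⟩, (e₂.symm ⟨b, hb⟩).2, hg' _ _ ?_⟩
        rw [e₂.apply_symm_apply, hb'])
  exact ⟨(a.trans b).trans a'.symm⟩

lemma nonempty_H_zero {C C' : Cplx} (e : C.Z 0 ≃+ C'.Z 0) : Nonempty (C.H 0 ≃+ C'.H 0) := by
  refine nonempty_quotient_equiv _ _ e.toAddMonoidHom.graph
    (fun x => ⟨e x, AddMonoidHom.mem_graph.2 rfl⟩)
    (fun y => ⟨e.symm y, AddMonoidHom.mem_graph.2 (e.apply_symm_apply _)⟩) ?_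
  intro x y hxy
  obtain rfl : e x = y := AddMonoidHom.mem_graph.1 hxy
  rw [AddSubgroup.mem_addSubgroupOf, AddSubgroup.mem_addSubgroupOf]
  simp [B]

end Cplx

/-! ### Comparison of the two cohomology theories -/

section RelCplx

variable {𝔤 : Type} [LieRing 𝔤] [LieAlgebra ℂ 𝔤] (𝔥 : LieSubalgebra ℂ 𝔤)
variable (M : Type) [AddCommGroup M] [Module ℂ M] [LieRingModule 𝔤 M] [LieModule ℂ 𝔤 M]

/-- The relative Chevalley–Eilenberg complex. -/
def relCplx : Cplx where
  A p := relC 𝔥 M p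
  d p := ((dCE p).restrict fun _ hc => dCE_mem_relC hc).toAddMonoidHom
  dd p x := Subtype.ext (dCE_dCE p x.1)

variable {𝔥 M}

lemma dCE_zero_eq_zero_iff {c : 𝔤 [⋀^Fin 0]→ₗ[ℂ] M} : dCE 0 c = 0 ↔ ∀ x : 𝔤, ⁅x, c ![]⁆ = 0 := by
  have hL : ∀ x : 𝔤, (lieD x 0 c) ![] = ⁅x, c ![]⁆ := fun x => by
    rw [lieD_zero]
  constructor
  · intro h x
    rw [← hL, ← iota_dCE_zero, h, map_zero]
    rfl
  · intro h
    refine alt_ext fun x => alt_ext_zero ?_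
    rw [iota_dCE_zero, hL, h, map_zero]
    rfl

end RelCplx

namespace AffAlgGroup

variable {H : AffAlgGroup} {𝔤 : Type} [LieRing 𝔤] [LieAlgebra ℂ 𝔤] {d : LieDat H 𝔤}
variable {M N : Type} [AddCommGroup M] [Module ℂ M] [AddCommGroup N] [Module ℂ N]
variable [LieRingModule 𝔤 M] [LieModule ℂ 𝔤 M] [LieRingModule 𝔤 N] [LieModule ℂ 𝔤 N]
variable {ρ : Representation ℂ H.Gp M} {ρ' : Representation ℂ H.Gp N}

/-- The complex of regular group cochains. -/
def grpCplx (h : IsRat d ρ) : Cplx where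
  A p := H.grpC M p
  d p := ((grpD ρ p).restrict fun _ hc => grpD_mem h hc).toAddMonoidHom
  dd p x := Subtype.ext (grpD_grpD ρ p x.1)

lemma grpCplx_d_val (h : IsRat d ρ) (p : ℕ) (c : H.grpC M p) :
    ((grpCplx h).d p c : H.grpC M (p + 1)).1 = grpD ρ p c.1 := rfl

lemma IsRat.lie_eq_zero (h : IsRat d ρ) {m : M} (hm : ∀ g, ρ g m = m) (x : 𝔤) : ⁅x, m⁆ = 0 := by
  refine dual_ext fun l => ?_
  rw [h.der, map_zero]
  simp only [hm]
  exact (d.leib x).const _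

lemma grpD_zero_eq_zero_iff {c : (Fin 0 → H.Gp) → M} :
    grpD ρ 0 c = 0 ↔ ∀ g, ρ g (c ![]) = c ![] := by
  have e : ∀ v : Fin 0 → H.Gp, c v = c ![] := fun v => congrArg c (Subsingleton.elim _ _)
  constructor
  · intro h g
    have := congrArg (fun F => F ![g]) h
    simp only [grpD_apply, e] at this
    simpa [add_neg_eq_zero] using this
  · intro h
    funext g
    simp [grpD_apply, e, h]

/-- A short exact sequence of rational modules gives a short exact sequence of complexes of
group cochains. -/
def grpSES {P : Type} [AddCommGroup P] [Module ℂ P] [LieRingModule 𝔤 P] [LieModule ℂ 𝔤 P]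
    {ρ'' : Representation ℂ H.Gp P} (h : IsRat d ρ) (h' : IsRat d ρ') (h'' : IsRat d ρ'')
    (i : M →ₗ[ℂ] N) (q : N →ₗ[ℂ] P) (hi : Function.Injective i) (hq : Function.Surjective q)
    (hiq : ∀ n, q n = 0 ↔ ∃ m, i m = n) (hiρ : ∀ g m, i (ρ g m) = ρ' g (i m))
    (hqρ : ∀ g m, q (ρ' g m) = ρ'' g (q m)) :
    Cplx.SES (grpCplx h) (grpCplx h') (grpCplx h'') where
  f p := (((i.compLeft _).restrict fun _ hc => comp_linear_mem_regMaps hc i :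
    H.grpC M p →ₗ[ℂ] H.grpC N p)).toAddMonoidHom
  g p := (((q.compLeft _).restrict fun _ hc => comp_linear_mem_regMaps hc q :
    H.grpC N p →ₗ[ℂ] H.grpC P p)).toAddMonoidHom
  hf p x := Subtype.ext (funext fun g => (grpD_map i hiρ p x.1 g).symm)
  hg p x := Subtype.ext (funext fun g => (grpD_map q hqρ p x.1 g).symm)
  inj p x y hxy := Subtype.ext (funext fun g => hi (congrFun (congrArg Subtype.val hxy) g))
  surj p y := by
    obtain ⟨F, hF, e⟩ := exists_lift_regMaps y.2 hq
    exact ⟨⟨F, hF⟩, Subtype.ext (funext e)⟩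
  gf p x := Subtype.ext (funext fun g => (hiq _).2 ⟨x.1 g, rfl⟩)
  exact p y hy := by
    choose F hF using fun g => (hiq (y.1 g)).1 (congrFun (congrArg Subtype.val hy) g)
    exact ⟨⟨F, mem_regMaps_of_comp_injective hi (by rw [funext hF]; exact y.2)⟩,
      Subtype.ext (funext hF)⟩

end AffAlgGroup

section RelSES

variable {𝔤 : Type} [LieRing 𝔤] [LieAlgebra ℂ 𝔤] (𝔥 : LieSubalgebra ℂ 𝔤)
variable {M N P : Type} [AddCommGroup M] [Module ℂ M] [LieRingModule 𝔤 M] [LieModule ℂ 𝔤 M]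
variable [AddCommGroup N] [Module ℂ N] [LieRingModule 𝔤 N] [LieModule ℂ 𝔤 N]
variable [AddCommGroup P] [Module ℂ P] [LieRingModule 𝔤 P] [LieModule ℂ 𝔤 P]

/-- A short exact sequence of Lie modules whose relative cochains lift gives a short exact sequence
of relative Chevalley–Eilenberg complexes. -/
def relSES (i : M →ₗ[ℂ] N) (q : N →ₗ[ℂ] P) (hi : Function.Injective i)
    (hiq : ∀ n, q n = 0 ↔ ∃ m, i m = n) (hil : ∀ (x : 𝔤) m, i ⁅x, m⁆ = ⁅x, i m⁆)
    (hql : ∀ (x : 𝔤) m, q ⁅x, m⁆ = ⁅x, q m⁆)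
    (hlift : ∀ p, ∀ c ∈ relC 𝔥 P p, ∃ c' ∈ relC 𝔥 N p, q.compAlternatingMap c' = c) :
    Cplx.SES (relCplx 𝔥 M) (relCplx 𝔥 N) (relCplx 𝔥 P) where
  f p := (((i.compAlternatingMapₗ (S := ℂ)).restrict fun _ hc => map_mem_relC hil hc :
    relC 𝔥 M p →ₗ[ℂ] relC 𝔥 N p)).toAddMonoidHom
  g p := (((q.compAlternatingMapₗ (S := ℂ)).restrict fun _ hc => map_mem_relC hql hc :
    relC 𝔥 N p →ₗ[ℂ] relC 𝔥 P p)).toAddMonoidHom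
  hf p x := Subtype.ext (dCE_comp hil p x.1).symm
  hg p x := Subtype.ext (dCE_comp hql p x.1).symm
  inj p x y hxy := Subtype.ext (AlternatingMap.ext fun v =>
    hi (congrArg (fun c : relC 𝔥 N p => c.1 v) hxy))
  surj p y := by
    obtain ⟨c, hc, e⟩ := hlift p y.1 y.2
    exact ⟨⟨c, hc⟩, Subtype.ext e⟩
  gf p x := Subtype.ext (AlternatingMap.ext fun v => (hiq _).2 ⟨x.1 v, rfl⟩)
  exact p y hy := by
    obtain ⟨s, hs⟩ := i.exists_leftInverse_of_injective (LinearMap.ker_eq_bot.2 hi)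
    have e : i.compAlternatingMap (s.compAlternatingMap y.1) = y.1 := by
      ext v
      obtain ⟨m, hm⟩ := (hiq (y.1 v)).1 (congrArg (fun c : relC 𝔥 P p => c.1 v) hy)
      rw [LinearMap.compAlternatingMap_apply, LinearMap.compAlternatingMap_apply, ← hm]
      exact congrArg i (LinearMap.congr_fun hs m)
    exact ⟨⟨s.compAlternatingMap y.1, mem_relC_of_map hi hil (by rw [e]; exact y.2)⟩, Subtype.ext e⟩

end RelSES

namespace AffAlgGroup

variable {H : AffAlgGroup} {𝔤 : Type} [LieRing 𝔤] [LieAlgebra ℂ 𝔤] {d : LieDat H 𝔤}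
variable {M : Type} [AddCommGroup M] [Module ℂ M] [LieRingModule 𝔤 M] [LieModule ℂ 𝔤 M]
variable {ρ : Representation ℂ H.Gp M}

lemma IsRat.exists_quotient {N : Type} [AddCommGroup N] [Module ℂ N] [LieRingModule 𝔤 N]
    [LieModule ℂ 𝔤 N] {ρ' : Representation ℂ H.Gp N} (h' : IsRat d ρ')
    (i : M →ₗ[ℂ] N) (hiρ : ∀ g m, i (ρ g m) = ρ' g (i m))
    (hil : ∀ (x : 𝔤) m, i ⁅x, m⁆ = ⁅x, i m⁆) :
    ∃ (Q : Type) (_ : AddCommGroup Q) (_ : Module ℂ Q) (_ : LieRingModule 𝔤 Q)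
      (_ : LieModule ℂ 𝔤 Q) (ρQ : Representation ℂ H.Gp Q) (q : N →ₗ[ℂ] Q),
      IsRat d ρQ ∧ Function.Surjective q ∧ (∀ n, q n = 0 ↔ ∃ m, i m = n) ∧
      (∀ g n, q (ρ' g n) = ρQ g (q n)) ∧ ∀ (x : 𝔤) n, q ⁅x, n⁆ = ⁅x, q n⁆ := by
  let W : LieSubmodule ℂ 𝔤 N :=
    { LinearMap.range i with
      lie_mem := by
        rintro x _ ⟨m, rfl⟩
        exact ⟨⁅x, m⁆, hil x m⟩ }
  have hW : ∀ g, W.toSubmodule ≤ W.toSubmodule.comap (ρ' g) := by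
    rintro g _ ⟨m, rfl⟩
    exact ⟨ρ g m, hiρ g m⟩
  let q : N →ₗ[ℂ] N ⧸ W := W.toSubmodule.mkQ
  have hq : Function.Surjective q := W.toSubmodule.mkQ_surjective
  refine ⟨N ⧸ W, inferInstance, inferInstance, inferInstance, inferInstance,
    (ρ'.quotient W.toSubmodule hW : Representation ℂ H.Gp (N ⧸ W)), q,
    h'.of_surjective q hq ?_ ?_, hq, ?_, ?_, ?_⟩
  · exact fun _ _ => rfl
  · exact fun _ _ => rfl
  · intro n
    exact Submodule.Quotient.mk_eq_zero W.toSubmodule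
  · exact fun _ _ => rfl
  · exact fun _ _ => rfl

/-- Zero cocycles of the two theories agree if Lie invariants are invariants. -/
def zeroCocycleEquiv (𝔥 : LieSubalgebra ℂ 𝔤) (h : IsRat d ρ)
    (hinv : ∀ m : M, (∀ x : 𝔤, ⁅x, m⁆ = 0) → ∀ g, ρ g m = m) :
    (grpCplx h).Z 0 ≃+ (relCplx 𝔥 M).Z 0 where
  toFun c := ⟨⟨AlternatingMap.constOfIsEmpty ℂ 𝔤 (Fin 0) (c.1.1 ![]), by
      refine ⟨fun x _ => alt_ext_zero ?_, fun v ⟨i, _⟩ => i.elim0⟩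
      rw [lieD_zero]
      exact h.lie_eq_zero (grpD_zero_eq_zero_iff.1 (congrArg Subtype.val c.2)) x⟩,
    Subtype.ext (dCE_zero_eq_zero_iff.2 fun x =>
      h.lie_eq_zero (grpD_zero_eq_zero_iff.1 (congrArg Subtype.val c.2)) x)⟩
  invFun c := ⟨⟨fun _ => c.1.1 ![], const_mem_regMaps _⟩,
    Subtype.ext (grpD_zero_eq_zero_iff.2 (hinv _
      (dCE_zero_eq_zero_iff.1 (congrArg Subtype.val c.2))))⟩
  left_inv c := Subtype.ext (Subtype.ext (funext fun v =>
    congrArg c.1.1 (Subsingleton.elim _ _)))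
  right_inv c := Subtype.ext (Subtype.ext (alt_ext_zero rfl))
  map_add' c c' := Subtype.ext (Subtype.ext (alt_ext_zero rfl))

/-- Dimension shifting: the comparison follows from equality of invariants, relative acyclicity of
coinduced modules and exactness of relative cochains. -/
theorem nonempty_comparison (𝔥 : LieSubalgebra ℂ 𝔤)
    (hinv : ∀ (M : Type) [AddCommGroup M] [Module ℂ M] [LieRingModule 𝔤 M] [LieModule ℂ 𝔤 M]
      (ρ : Representation ℂ H.Gp M), IsRat d ρ →
      ∀ m : M, (∀ x : 𝔤, ⁅x, m⁆ = 0) → ∀ g, ρ g m = m)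
    (hac : ∀ (M : Type) [AddCommGroup M] [Module ℂ M] (p : ℕ),
      ∀ c ∈ relC 𝔥 (Jmod d M) (p + 1), dCE (p + 1) c = 0 →
        ∃ b ∈ relC 𝔥 (Jmod d M) p, dCE p b = c)
    (hlift : ∀ (M Q : Type) [AddCommGroup M] [Module ℂ M] [LieRingModule 𝔤 M] [LieModule ℂ 𝔤 M]
      [AddCommGroup Q] [Module ℂ Q] [LieRingModule 𝔤 Q] [LieModule ℂ 𝔤 Q]
      (ρ : Representation ℂ H.Gp M) (u : M →ₗ[ℂ] Q), IsRat d ρ → Function.Surjective u →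
      (∀ (x : 𝔤) m, u ⁅x, m⁆ = ⁅x, u m⁆) → ∀ p, ∀ c ∈ relC 𝔥 Q p,
        ∃ c' ∈ relC 𝔥 M p, u.compAlternatingMap c' = c) (p : ℕ) :
    ∀ (M : Type) [AddCommGroup M] [Module ℂ M] [LieRingModule 𝔤 M] [LieModule ℂ 𝔤 M]
      (ρ : Representation ℂ H.Gp M) (h : IsRat d ρ),
      Nonempty ((grpCplx h).H p ≃+ (relCplx 𝔥 M).H p) := by
  induction p with
  | zero =>
    intro M _ _ _ _ ρ h
    exact Cplx.nonempty_H_zero (zeroCocycleEquiv 𝔥 h (hinv M ρ h))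
  | succ p ih =>
    intro M _ _ _ _ ρ h
    obtain ⟨Q, _, _, _, _, ρQ, q, hQ, hq, hiq, hqρ, hql⟩ :=
      (Jmod.isRat (d := d) (M := M)).exists_quotient h.toJ h.toJ_rep h.toJ_lie
    let S := grpSES h Jmod.isRat hQ h.toJ q h.toJ_injective hq hiq h.toJ_rep hqρ
    let S' := relSES 𝔥 h.toJ q h.toJ_injective hiq h.toJ_lie hql
      (hlift _ _ (Jmod.rep d M) q Jmod.isRat hq hql)
    have hS : (grpCplx (Jmod.isRat (d := d) (M := M))).Acyclic := fun p c hc => by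
      obtain ⟨b, hb, e⟩ := exists_grpC_primitive c.2 (congrArg Subtype.val hc)
      exact ⟨⟨b, hb⟩, Subtype.ext e⟩
    have hS' : (relCplx 𝔥 (Jmod d M)).Acyclic := fun p c hc => by
      obtain ⟨b, hb, e⟩ := hac M p c.1 c.2 (congrArg Subtype.val hc)
      exact ⟨⟨b, hb⟩, Subtype.ext e⟩
    cases p with
    | zero =>
      refine S.nonempty_H_one S' hS hS' (zeroCocycleEquiv 𝔥 Jmod.isRat (hinv _ _ Jmod.isRat))
        (zeroCocycleEquiv 𝔥 hQ (hinv _ _ hQ)) fun x y hxy => Subtype.ext (alt_ext_zero ?_)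
      exact congrArg (fun c : H.grpC Q 0 => c.1 ![]) hxy
    | succ p =>
      obtain ⟨a⟩ := S.shift_succ hS p
      obtain ⟨a'⟩ := S'.shift_succ hS' p
      obtain ⟨b⟩ := ih Q ρQ hQ
      exact ⟨(a.trans b).trans a'.symm⟩

end AffAlgGroup

/-! ### Matrix representations and the comparison with the cochains of the statement -/

section AlgRep

variable {G : AffAlgGroup} {m : ℕ}

/-- The representation of the group of points given by an algebraic representation. -/
def AlgRep.rep (r : AlgRep G m) : Representation ℂ G.Gp (Pt m) where
  toFun g :=
    { toFun := matVec m (r.ρ g.1)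
      map_add' := matVec_add _
      map_smul' := fun c w => by
        funext i
        simp only [matVec, Pi.smul_apply, smul_eq_mul, RingHom.id_apply, Finset.mul_sum]
        exact Finset.sum_congr rfl fun k _ => by ring }
  map_one' := by
    refine LinearMap.ext fun w => funext fun i => ?_
    change matVec m (r.ρ G.one) w i = w i
    rw [r.map_one]
    simp [matVec, matEntry, idMatPt]
  map_mul' g h := by
    refine LinearMap.ext fun w => funext fun i => ?_
    change matVec m (r.ρ (G.mul g.1 h.1)) w i = matVec m (r.ρ g.1) (matVec m (r.ρ h.1) w) i
    rw [r.map_mul g.2 h.2]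
    simp only [matVec, matEntry, matMulPt, Equiv.symm_apply_apply, Finset.sum_mul, Finset.mul_sum]
    rw [Finset.sum_comm]
    exact Finset.sum_congr rfl fun k _ => Finset.sum_congr rfl fun l _ => by ring

lemma AlgRep.rep_apply (r : AlgRep G m) (g : G.Gp) (w : Pt m) :
    r.rep g w = matVec m (r.ρ g.1) w := rfl

lemma mem_regMaps_pi {X σ : Type} {κ : X → σ → ℂ} {F : X → Pt m} :
    F ∈ regMaps κ (Pt m) ↔ ∀ i, (fun x => F x i) ∈ regFun κ := by
  constructor
  · exact fun h i => functional_comp_mem_regFun h (LinearMap.proj i)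
  · intro h
    refine mem_regMaps_iff.2 ⟨m, fun i x => F x i, fun i => Pi.single i 1, h, fun x => ?_⟩
    funext j
    simp [Finset.sum_apply, Pi.single_apply]

open AffAlgGroup in
lemma AlgRep.isRat (r : AlgRep G m) {𝔤 : Type} [LieRing 𝔤] [LieAlgebra ℂ 𝔤]
    {e : 𝔤 →ₗ[ℂ] Pt G.n} (h : IsLieAlgebraOf G 𝔤 e) [LieRingModule 𝔤 (Pt m)]
    [LieModule ℂ 𝔤 (Pt m)] (hder : IsDerivedAction r e) : IsRat h.lieDat r.rep where
  reg w := by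
    refine mem_regMaps_pi.2 fun i => ?_
    simp only [AlgRep.rep_apply, matVec]
    obtain ⟨R, hR⟩ := r.regular
    have : (fun x : G.Gp => ∑ k, matEntry (r.ρ x.1) i k * w k) =
        ∑ k, w k • fun x : G.Gp => r.ρ x.1 (finProdFinEquiv (i, k)) := by
      funext x
      simp [matEntry, mul_comm]
    rw [this]
    refine Subalgebra.sum_mem _ fun k _ => Subalgebra.smul_mem _ ?_ _
    exact mem_regFun.2 ⟨R (finProdFinEquiv (i, k)), fun x => hR x.1 x.2 _⟩
  der x w l := by
    obtain ⟨R, hR⟩ := r.regular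
    have key : ∀ i, (⁅x, w⁆ : Pt m) i = h.lieDat.D x (fun g => (r.rep g w) i) := by
      intro i
      rw [hder R hR x w i]
      have : (fun g : G.Gp => (r.rep g w) i) =
          ∑ k, w k • fun g : G.Gp => eval g.1 (R (finProdFinEquiv (i, k))) := by
        funext g
        simp only [AlgRep.rep_apply, matVec, matEntry, hR g.1 g.2, Finset.sum_apply,
          Pi.smul_apply, smul_eq_mul, mul_comm]
      rw [this, map_sum]
      refine Finset.sum_congr rfl fun k _ => ?_
      rw [map_smul, smul_eq_mul, mul_comm]
      refine congrArg _ ?_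
      have hx : e x ∈ tangentAt G.carrier G.one := (h.range_eq _).1 ⟨x, rfl⟩
      exact (ptD_eval hx _).symm
    have hl : ∀ v : Pt m, l v = ∑ i, v i * l (Pi.single i 1) := fun v => by
      conv_lhs => rw [pi_eq_sum_univ' v]
      simp [map_sum]
    rw [hl]
    have : (fun g => l (r.rep g w)) = ∑ i, l (Pi.single i 1) • fun g => (r.rep g w) i := by
      funext g
      rw [hl]
      simp [mul_comm]
    rw [this, map_sum]
    refine Finset.sum_congr rfl fun i _ => ?_
    rw [map_smul, ← key, smul_eq_mul, mul_comm]

end AlgRep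

section Translation

variable {G : AffAlgGroup} {m : ℕ} {𝔤 : Type} [LieRing 𝔤] [LieAlgebra ℂ 𝔤]

open AffAlgGroup

lemma neg_one_pow_zsmul (k : ℕ) (v : Pt m) : ((-1 : ℤ) ^ k) • v = ((-1 : ℂ) ^ k) • v := by
  rcases Nat.even_or_odd k with h | h <;> simp [h.neg_one_pow]

lemma algD_eq_grpD (r : AlgRep G m) (p : ℕ) {c : (Fin p → Pt G.n) → Pt m}
    {f : (Fin p → G.Gp) → Pt m} (h : ∀ g, f g = c fun a => (g a).1) (g : Fin (p + 1) → G.Gp) :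
    algD r p c (fun a => (g a).1) = grpD r.rep p f g := by
  rw [grpD_apply, Fin.sum_univ_castSucc, algD, add_assoc]
  refine congrArg₂ _ ?_ ((add_comm _ _).trans (congrArg₂ _ (Finset.sum_congr rfl fun a _ => ?_) ?_))
  · rw [AlgRep.rep_apply, h]
  · have e : mulInsert G (fun a => (g a).1) a =
        fun k => (Fin.contractNth a.castSucc (· * ·) g k).1 := by
      funext k
      rcases lt_trichotomy (k : ℕ) (a : ℕ) with hk | hk | hk
      · rw [Fin.contractNth_apply_of_lt _ _ _ _ (by simpa using hk)]
        simp [mulInsert, hk]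
      · rw [Fin.contractNth_apply_of_eq _ _ _ _ (by simpa using hk)]
        simp only [mulInsert, hk, lt_irrefl, if_false, if_true]
        rfl
      · rw [Fin.contractNth_apply_of_gt _ _ _ _ (by simpa using hk)]
        simp [mulInsert, hk.not_gt, hk.ne']
    rw [h, e, Fin.val_castSucc]
    rw [neg_one_pow_zsmul]
  · have e : (fun k => (Fin.contractNth (Fin.last p) (· * ·) g k).1) =
        fun a : Fin p => (g a.castSucc).1 := by
      funext k
      rw [Fin.contractNth_apply_of_lt _ _ _ _ (by simp)]
    rw [h, e, Fin.val_last]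
    rw [neg_one_pow_zsmul]

lemma isAlgCochain_iff {p : ℕ} {c : (Fin p → Pt G.n) → Pt m} : IsAlgCochain G m p c ↔
    (fun g : Fin p → G.Gp => c fun a => (g a).1) ∈ G.grpC (Pt m) p := by
  rw [mem_regMaps_pi]
  constructor
  · rintro ⟨P, hP⟩ i
    exact mem_regFun.2 ⟨P i, fun g => hP _ (fun a => (g a).2) i⟩
  · intro h
    choose P hP using fun i => mem_regFun.1 (h i)
    exact ⟨P, fun g hg i => hP i fun a => ⟨g a, hg a⟩⟩

lemma exists_algCochain {p : ℕ} {f : (Fin p → G.Gp) → Pt m} (hf : f ∈ G.grpC (Pt m) p) :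
    ∃ c, IsAlgCochain G m p c ∧ ∀ g, f g = c fun a => (g a).1 := by
  rw [mem_regMaps_pi] at hf
  choose P hP using fun i => mem_regFun.1 (hf i)
  exact ⟨fun g i => eval (fun s : Fin p × Fin G.n => g s.1 s.2) (P i), ⟨P, fun g _ i => rfl⟩,
    fun g => funext fun i => hP i g⟩

variable {d : LieDat G 𝔤} [LieRingModule 𝔤 (Pt m)] [LieModule ℂ 𝔤 (Pt m)]

/-- Restriction of algebraic cocycles to the group of points. -/
def algRestrict (r : AlgRep G m) (h : IsRat d r.rep) (p : ℕ) :
    AddSubgroup (algZ r p × (grpCplx h).Z p) where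
  carrier := {x | ∀ g, x.2.1.1 g = x.1.1 fun a => (g a).1}
  zero_mem' := fun _ => rfl
  add_mem' := fun hx hy g => congrArg₂ (· + ·) (hx g) (hy g)
  neg_mem' := fun hx g => congrArg Neg.neg (hx g)

lemma algRestrict_left (r : AlgRep G m) (h : IsRat d r.rep) (p : ℕ) (x : algZ r p) :
    ∃ y, (x, y) ∈ algRestrict r h p := by
  obtain ⟨c, hc, hd⟩ := x
  refine ⟨⟨⟨_, isAlgCochain_iff.1 hc⟩, Subtype.ext (funext fun g => ?_)⟩, fun g => rfl⟩
  exact (algD_eq_grpD r p (fun _ => rfl) g).symm.trans (hd _ fun a => (g a).2)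

lemma algRestrict_right (r : AlgRep G m) (h : IsRat d r.rep) (p : ℕ) (y : (grpCplx h).Z p) :
    ∃ x, (x, y) ∈ algRestrict r h p := by
  obtain ⟨c, hc, e⟩ := exists_algCochain y.1.2
  have hd : grpD r.rep p y.1.1 = 0 := by
    exact (grpCplx_d_val h p y.1).symm.trans (congrArg Subtype.val (Cplx.mem_Z.1 y.2))
  have hz : c ∈ algZ r p := by
    refine ⟨hc, fun g hg => ?_⟩
    have h2 := algD_eq_grpD r p e fun a => ⟨g a, hg a⟩
    rw [hd] at h2
    exact h2
  exact ⟨⟨c, hz⟩, e⟩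

lemma nonempty_algH (r : AlgRep G m) (h : IsRat d r.rep) (p : ℕ) :
    Nonempty (algH r p ≃+ (grpCplx h).H p) := by
  cases p with
  | zero =>
    obtain ⟨b⟩ := nonempty_quotient_equiv (⊥ : AddSubgroup (algZ r 0))
      (((grpCplx h).B 0).addSubgroupOf _) (algRestrict r h 0) (algRestrict_left r h 0)
      (algRestrict_right r h 0) (by
        intro x y hxy
        rw [AddSubgroup.mem_addSubgroupOf, AddSubgroup.mem_bot, Cplx.B, AddSubgroup.mem_bot]
        constructor
        · rintro rfl
          exact Subtype.ext (funext fun g => hxy g)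
        · intro hy
          refine Subtype.ext (funext fun g => ?_)
          have h1 := hxy ![]
          have h2 : y.1.1 ![] = 0 := congrArg (fun c : G.grpC (Pt m) 0 => c.1 ![]) hy
          rw [Subsingleton.elim g fun a => ((![] : Fin 0 → G.Gp) a).1]
          exact h1.symm.trans h2)
    exact ⟨(QuotientAddGroup.quotientBot (G := algZ r 0)).symm.trans b⟩
  | succ p =>
    refine nonempty_quotient_equiv _ _ (algRestrict r h (p + 1)) (algRestrict_left r h _)
      (algRestrict_right r h _) ?_
    intro x y hxy
    rw [AddSubgroup.mem_addSubgroupOf, AddSubgroup.mem_addSubgroupOf]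
    constructor
    · rintro ⟨f, hf, e⟩
      refine ⟨⟨_, isAlgCochain_iff.1 hf⟩, Subtype.ext (funext fun g => ?_)⟩
      rw [hxy g, e _ fun a => (g a).2]
      exact (algD_eq_grpD r p (fun _ => rfl) g).symm
    · rintro ⟨⟨b, hb⟩, e⟩
      obtain ⟨f, hf, e'⟩ := exists_algCochain hb
      refine ⟨f, hf, fun g hg => ?_⟩
      have h1 := hxy fun a => ⟨g a, hg a⟩
      have h2 := algD_eq_grpD r p e' fun a => ⟨g a, hg a⟩
      rw [h2]
      refine h1.symm.trans ?_
      exact (congrFun (congrArg Subtype.val e) _).symm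

end Translation

section RelTranslation

variable {𝔤 : Type} [LieRing 𝔤] [LieAlgebra ℂ 𝔤] (𝔥 : LieSubalgebra ℂ 𝔤)
variable (M : Type) [AddCommGroup M] [Module ℂ M] [LieRingModule 𝔤 M] [LieModule ℂ 𝔤 M]

/-- The correspondence between functions and alternating maps. -/
def relRestrict (p : ℕ) : AddSubgroup (relZ 𝔥 M p × (relCplx 𝔥 M).Z p) where
  carrier := {x | ∀ v, x.2.1.1 v = x.1.1 v}
  zero_mem' := fun _ => rfl
  add_mem' := fun hx hy g => congrArg₂ (· + ·) (hx g) (hy g)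
  neg_mem' := fun hx g => congrArg Neg.neg (hx g)

lemma relRestrict_left (p : ℕ) (x : relZ 𝔥 M p) : ∃ y, (x, y) ∈ relRestrict 𝔥 M p := by
  obtain ⟨c, hc, hd⟩ := x
  obtain ⟨b, hb, rfl⟩ := exists_relC_of_isRelCochain hc
  refine ⟨⟨⟨b, hb⟩, Subtype.ext (AlternatingMap.ext fun v => ?_)⟩, fun v => rfl⟩
  exact (ceD_eq_dCE p b v).symm.trans (hd v)

lemma relRestrict_right (p : ℕ) (y : (relCplx 𝔥 M).Z p) : ∃ x, (x, y) ∈ relRestrict 𝔥 M p := by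
  obtain ⟨⟨b, hb⟩, hd⟩ := y
  refine ⟨⟨b, isRelCochain_of_mem_relC hb, fun v => ?_⟩, fun v => rfl⟩
  exact (ceD_eq_dCE p b v).trans (congrArg (fun c : relC 𝔥 M (p + 1) => c.1 v) (Cplx.mem_Z.1 hd))

lemma nonempty_relH (p : ℕ) : Nonempty (relH 𝔥 M p ≃+ (relCplx 𝔥 M).H p) := by
  cases p with
  | zero =>
    obtain ⟨b⟩ := nonempty_quotient_equiv (⊥ : AddSubgroup (relZ 𝔥 M 0))
      (((relCplx 𝔥 M).B 0).addSubgroupOf _) (relRestrict 𝔥 M 0) (relRestrict_left 𝔥 M 0)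
      (relRestrict_right 𝔥 M 0) (by
        intro x y hxy
        rw [AddSubgroup.mem_addSubgroupOf, AddSubgroup.mem_bot, Cplx.B, AddSubgroup.mem_bot]
        constructor
        · rintro rfl
          exact Subtype.ext (AlternatingMap.ext fun g => hxy g)
        · intro hy
          refine Subtype.ext (funext fun g => (hxy g).symm.trans ?_)
          exact congrArg (fun c : relC 𝔥 M 0 => c.1 g) hy)
    exact ⟨(QuotientAddGroup.quotientBot (G := relZ 𝔥 M 0)).symm.trans b⟩
  | succ p =>
    refine nonempty_quotient_equiv _ _ (relRestrict 𝔥 M (p + 1)) (relRestrict_left 𝔥 M _)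
      (relRestrict_right 𝔥 M _) ?_
    intro x y hxy
    rw [AddSubgroup.mem_addSubgroupOf, AddSubgroup.mem_addSubgroupOf]
    constructor
    · rintro ⟨f, hf, e⟩
      obtain ⟨b, hb, rfl⟩ := exists_relC_of_isRelCochain hf
      refine ⟨⟨b, hb⟩, Subtype.ext (AlternatingMap.ext fun v => ?_)⟩
      rw [hxy v, e, ceD_eq_dCE]
      rfl
    · rintro ⟨⟨b, hb⟩, e⟩
      refine ⟨b, isRelCochain_of_mem_relC hb, funext fun v => ?_⟩
      rw [ceD_eq_dCE, ← hxy v, ← e]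
      rfl

end RelTranslation

/-! ### Algebraic subgroups and their Lie algebras -/

namespace AffAlgGroup

section Subgroup

variable {G : AffAlgGroup} {K : AlgSubgroup G} {𝔤 : Type} [LieRing 𝔤] [LieAlgebra ℂ 𝔤]

lemma O_restrict {f : G.Gp → ℂ} (hf : f ∈ G.O) : (fun x => f (K.incl x)) ∈ K.toGrp.O := by
  obtain ⟨P, hP⟩ := mem_O.1 hf
  exact mem_O.2 ⟨P, fun x => hP _⟩

lemma O_extend {f : K.toGrp.Gp → ℂ} (hf : f ∈ K.toGrp.O) :
    ∃ F ∈ G.O, ∀ x, f x = F (K.incl x) := by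
  obtain ⟨P, hP⟩ := mem_O.1 hf
  exact ⟨fun g => eval g.1 P, mem_O.2 ⟨P, fun _ => rfl⟩, hP⟩

/-- Compatible tangential data of an algebraic subgroup. -/
structure SubDat (d : LieDat G 𝔤) (K : AlgSubgroup G) (𝔨 : LieSubalgebra ℂ 𝔤) : Type where
  dat : LieDat K.toGrp 𝔨
  compat : ∀ (x : 𝔨), ∀ f ∈ G.O, d.D x f = dat.D x (fun g => f (K.incl g))
  mem : ∀ x : 𝔤, (∀ f ∈ G.O, (∀ g, f (K.incl g) = 0) → d.D x f = 0) → x ∈ 𝔨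

variable {e : 𝔤 →ₗ[ℂ] Pt G.n} {𝔨 : LieSubalgebra ℂ 𝔤}

lemma _root_.IsLieAlgebraOf.mem_tangentAt_iff (h : IsLieAlgebraOf G 𝔤 e) (K : AlgSubgroup G)
    (x : 𝔤) : e x ∈ tangentAt K.carrier G.one ↔
      ∀ f ∈ G.O, (∀ g, f (K.incl g) = 0) → h.lieDat.D x f = 0 := by
  have hx : e x ∈ tangentAt G.carrier G.one := (h.range_eq _).1 ⟨x, rfl⟩
  constructor
  · intro hK f hf h0
    obtain ⟨P, hP⟩ := mem_O.1 hf
    obtain rfl : f = fun g => eval g.1 P := funext hP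
    refine (ptD_eval hx P).trans (hK P fun y hy => ?_)
    exact h0 ⟨y, hy⟩
  · intro hK P hP
    refine (ptD_eval hx P).symm.trans (hK _ (mem_O.2 ⟨P, fun _ => rfl⟩) fun g => ?_)
    exact hP _ g.2

/-- The tangential data of an algebraic subgroup. -/
def _root_.IsLieAlgebraOf.subDat (h : IsLieAlgebraOf G 𝔤 e) (hk : IsLieSubalgebraOf K e 𝔨) :
    SubDat h.lieDat K 𝔨 where
  dat := (K.isLieAlgebraOf h 𝔨 hk).lieDat
  compat x f hf := by
    obtain ⟨P, hP⟩ := mem_O.1 hf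
    obtain rfl : f = fun g => eval g.1 P := funext hP
    have hx : e x ∈ tangentAt G.carrier G.one := (h.range_eq _).1 ⟨x, rfl⟩
    have hx' : e x ∈ tangentAt K.toGrp.carrier K.toGrp.one := (hk x).1 x.2
    exact (ptD_eval hx P).trans (ptD_eval (H := K.toGrp) hx' P).symm
  mem x hx := (hk x).2 ((h.mem_tangentAt_iff K x).2 hx)

variable {d : LieDat G 𝔤}
variable {M : Type} [AddCommGroup M] [Module ℂ M] [LieRingModule 𝔤 M]
variable {ρ : Representation ℂ G.Gp M}

lemma IsRat.restrict (h : IsRat d ρ) (s : SubDat d K 𝔨) : IsRat s.dat (ρ.comp K.incl) where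
  reg m := comp_mem_regMaps (h.reg m) fun i => coord_mem_O (H := K.toGrp) i
  der x m l := by
    rw [LieSubalgebra.coe_bracket_of_module, h.der, s.compat]
    · rfl
    · exact h.coeff_mem m l

/-- The Lie ideal tangent to a normal algebraic subgroup. -/
def normalIdeal (d : LieDat G 𝔤) (hK : K.IsNormal) : LieIdeal ℂ 𝔤 where
  carrier := {x | ∀ f ∈ G.O, (∀ g, f (K.incl g) = 0) → d.D x f = 0}
  zero_mem' f _ _ := by simp
  add_mem' hx hy f hf h0 := by simp [hx f hf h0, hy f hf h0]
  smul_mem' c x hx f hf h0 := by simp [hx f hf h0]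
  lie_mem := by
    intro x y hy f hf h0
    rw [d.bracket x y f hf, ← mixedComm_eq (d.leib x) (d.leib y) hf]
    have : (fun g => d.D y fun z => f (commMap (g, z))) = 0 := by
      funext g
      refine hy _ (O₂_left (commMap_comp_mem hf) g) fun z => ?_
      have hz := K.mul_mem (hK g.1 g.2 z.1 z.2) (K.inv_mem z.2)
      have e : commMap (g, K.incl z) = K.incl ⟨_, hz⟩ := by
        have : commMap (g, K.incl z) = (g * (K.incl z * g⁻¹)) * (K.incl z)⁻¹ := by
          simp [commMap, mul_assoc]
        rw [this]
        rfl
      rw [e]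
      exact h0 _
    exact (congrArg (d.D x) this).trans (map_zero _)

lemma exists_Ad (d : LieDat G 𝔤) (g : G.Gp) (x : 𝔤) :
    ∃ y, ∀ f ∈ G.O, d.D y f = d.D x fun h => f (g * h * g⁻¹) := by
  have hO : ∀ f ∈ G.O, (fun h => f (g * h * g⁻¹)) ∈ G.O := fun f hf =>
    O_mul_left (O_mul_right hf g⁻¹) g
  obtain ⟨y, hy⟩ := d.surj
    { toFun := fun f => d.D x fun h => f (g * h * g⁻¹)
      map_add' := fun f f' => (d.D x).map_add (fun h => f (g * h * g⁻¹)) fun h => f' (g * h * g⁻¹)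
      map_smul' := fun c f => (d.D x).map_smul c fun h => f (g * h * g⁻¹) } (by
    intro f hf f' hf'
    have := d.leib x _ (hO f hf) _ (hO f' hf')
    simp only [mul_one, mul_inv_cancel] at this
    exact this)
  exact ⟨y, hy⟩

lemma IsRat.lie_of_Ad (h : IsRat d ρ) {g : G.Gp} {x y : 𝔤}
    (hy : ∀ f ∈ G.O, d.D y f = d.D x fun h => f (g * h * g⁻¹)) (m : M) :
    ⁅y, ρ g m⁆ = ρ g ⁅x, m⁆ := by
  refine dual_ext fun l => ?_
  rw [h.der, hy _ (h.coeff_mem _ l)]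
  have := h.der x m (l ∘ₗ ρ g)
  rw [LinearMap.comp_apply] at this
  rw [this]
  congr 1
  funext k
  rw [LinearMap.comp_apply, ← Module.End.mul_apply, ← Module.End.mul_apply, ← map_mul, ← map_mul]
  simp

end Subgroup

section FormalCurve

variable {H : AffAlgGroup}

lemma _root_.aeval_pt {n : ℕ} (x : Pt n) (P : MvPolynomial (Fin n) ℂ) :
    aeval x P = eval x P := rfl

lemma mem_carrier_of_eval (H : AffAlgGroup) {x : Pt H.n}
    (h : ∀ p : MvPolynomial (Fin H.n) ℂ, (∀ y ∈ H.carrier, eval y p = 0) → eval x p = 0) :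
    x ∈ H.carrier := by
  obtain ⟨S, hS⟩ := H.isAlgebraic
  rw [hS]
  intro p hp
  refine h p fun y hy => ?_
  rw [hS] at hy
  exact hy p hp

/-- The Taylor expansion at the identity along an invariant vector field. -/
def taylor (δ : (H.Gp → ℂ) →ₗ[ℂ] ℂ) (f : H.Gp → ℂ) : PowerSeries ℂ :=
  PowerSeries.mk fun k => ((linv δ)^[k] f) 1 / (k.factorial : ℂ)

lemma coeff_succ_taylor (δ : (H.Gp → ℂ) →ₗ[ℂ] ℂ) (f : H.Gp → ℂ) (k : ℕ) :
    PowerSeries.coeff (k + 1) (taylor δ f) * ((k : ℂ) + 1) =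
      PowerSeries.coeff k (taylor δ (linv δ f)) := by
  rw [taylor, taylor, PowerSeries.coeff_mk, PowerSeries.coeff_mk, Function.iterate_succ_apply,
    Nat.factorial_succ]
  have h1 : ((k : ℂ) + 1) ≠ 0 := by exact_mod_cast Nat.succ_ne_zero k
  have h2 : (k.factorial : ℂ) ≠ 0 := by exact_mod_cast k.factorial_ne_zero
  push_cast
  field_simp

lemma derivative_taylor (δ : (H.Gp → ℂ) →ₗ[ℂ] ℂ) (f : H.Gp → ℂ) :
    PowerSeries.derivative ℂ (taylor δ f) = taylor δ (linv δ f) := by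
  ext k
  rw [PowerSeries.coeff_derivative, coeff_succ_taylor]

lemma taylor_add (δ : (H.Gp → ℂ) →ₗ[ℂ] ℂ) (f f' : H.Gp → ℂ) :
    taylor δ (f + f') = taylor δ f + taylor δ f' := by
  ext k
  simp only [taylor, PowerSeries.coeff_mk, map_add]
  rw [← Module.End.pow_apply, ← Module.End.pow_apply, ← Module.End.pow_apply, map_add,
    Pi.add_apply, add_div]

lemma constantCoeff_taylor (δ : (H.Gp → ℂ) →ₗ[ℂ] ℂ) (f : H.Gp → ℂ) :
    PowerSeries.coeff 0 (taylor δ f) = f 1 := by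
  simp [taylor]

lemma taylor_mul {δ : (H.Gp → ℂ) →ₗ[ℂ] ℂ} (hδ : IsPointDer δ) {f f' : H.Gp → ℂ} (hf : f ∈ H.O)
    (hf' : f' ∈ H.O) : taylor δ (f * f') = taylor δ f * taylor δ f' := by
  ext k
  induction k generalizing f f' with
  | zero =>
    rw [constantCoeff_taylor, PowerSeries.coeff_mul, Finset.Nat.antidiagonal_zero,
      Finset.sum_singleton, constantCoeff_taylor, constantCoeff_taylor, Pi.mul_apply]
  | succ k ih =>
    have h1 : ((k : ℂ) + 1) ≠ 0 := by exact_mod_cast Nat.succ_ne_zero k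
    apply mul_right_cancel₀ h1
    rw [coeff_succ_taylor, ← PowerSeries.coeff_derivative, Derivation.leibniz,
      linv_mul hδ hf hf', taylor_add, map_add, map_add, ih hf (linv_mem hf' δ),
      ih hf' (linv_mem hf δ), derivative_taylor, derivative_taylor]
    rfl

lemma taylor_const {δ : (H.Gp → ℂ) →ₗ[ℂ] ℂ} (hδ : IsPointDer δ) (a : ℂ) :
    taylor δ (fun _ => a) = PowerSeries.C a := by
  have h0 : linv δ (fun _ : H.Gp => a) = 0 := by
    funext g
    rw [linv_apply, hδ.const]
    rfl
  ext k
  cases k with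
  | zero => simp [constantCoeff_taylor]
  | succ k =>
    have : (linv δ)^[k] (0 : H.Gp → ℂ) = 0 := by
      rw [← Module.End.pow_apply, map_zero]
    simp [taylor, h0, this]

/-- The formal curve through the identity defined by a point derivation. -/
def taylorHom {δ : (H.Gp → ℂ) →ₗ[ℂ] ℂ} (hδ : IsPointDer δ) :
    MvPolynomial (Fin H.n) ℂ →+* PowerSeries ℂ where
  toFun P := taylor δ fun g => eval g.1 P
  map_one' := by
    simpa using taylor_const hδ 1
  map_zero' := by
    simpa using taylor_const hδ 0
  map_add' P Q := by
    rw [← taylor_add]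
    congr 1
    funext g
    simp
  map_mul' P Q := by
    rw [← taylor_mul hδ (mem_O.2 ⟨P, fun _ => rfl⟩) (mem_O.2 ⟨Q, fun _ => rfl⟩)]
    congr 1
    funext g
    simp

lemma taylorHom_apply {δ : (H.Gp → ℂ) →ₗ[ℂ] ℂ} (hδ : IsPointDer δ)
    (P : MvPolynomial (Fin H.n) ℂ) : taylorHom hδ P = taylor δ fun g => eval g.1 P := rfl

lemma pointDer_eq_zero_of_taylor {δ : (H.Gp → ℂ) →ₗ[ℂ] ℂ} (hδ : IsPointDer δ) {ι : Type}
    {F : ι → H.Gp → ℂ} (hF : ∀ j, F j ∈ H.O) (h1 : ∀ g, (∀ j, F j g = 0) → g = 1)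
    (h0 : ∀ j k, ((linv δ)^[k] (F j)) 1 = 0) {f : H.Gp → ℂ} (hf : f ∈ H.O) : δ f = 0 := by
  choose P hP using fun j => mem_O.1 (hF j)
  set J : Ideal (MvPolynomial (Fin H.n) ℂ) :=
    vanishingIdeal ℂ H.carrier ⊔ Ideal.span (Set.range P) with hJ
  have hle : J ≤ RingHom.ker (taylorHom hδ) := by
    refine sup_le (fun Q hQ => ?_) (Ideal.span_le.2 ?_)
    · rw [RingHom.mem_ker, taylorHom_apply]
      have : (fun g : H.Gp => eval g.1 Q) = fun _ => 0 := by
        funext g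
        have := (mem_vanishingIdeal_iff.1 hQ) g.1 g.2
        rwa [aeval_pt] at this
      rw [this, taylor_const hδ, map_zero]
    · rintro _ ⟨j, rfl⟩
      rw [SetLike.mem_coe, RingHom.mem_ker, taylorHom_apply]
      rw [← funext (hP j)]
      ext k
      simp [taylor, h0]
  have hX : ∀ i, MvPolynomial.X i - C ((1 : H.Gp).1 i) ∈ J.radical := by
    intro i
    rw [← vanishingIdeal_zeroLocus_eq_radical (K := ℂ), mem_vanishingIdeal_iff]
    intro x hx
    rw [mem_zeroLocus_iff] at hx
    simp only [aeval_pt] at hx ⊢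
    have hxH : x ∈ H.carrier := H.mem_carrier_of_eval fun p hp =>
      hx p (Ideal.mem_sup_left (mem_vanishingIdeal_iff.2 fun y hy => by rw [aeval_pt, hp y hy]))
    set g : H.Gp := ⟨x, hxH⟩ with hg
    have hg1 : g = 1 := h1 g fun j => by
      rw [hP j g]
      exact hx (P j) (Ideal.mem_sup_right (Ideal.subset_span ⟨j, rfl⟩))
    have hx1 : x = (1 : H.Gp).1 := congrArg Subtype.val hg1
    simp [hx1]
  have hc : ∀ i, δ (fun g => g.1 i) = 0 := by
    intro i
    obtain ⟨N, hN⟩ := hX i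
    have h2 := hle hN
    rw [RingHom.mem_ker, map_pow] at h2
    have h3 := congrArg (PowerSeries.coeff 1) (eq_zero_of_pow_eq_zero h2)
    rw [map_sub, map_sub, taylorHom_apply, taylorHom_apply] at h3
    simp only [eval_X, eval_C, taylor_const hδ] at h3
    simpa [taylor, PowerSeries.coeff_C, linv_one] using h3
  exact (pointDer_ext hδ (ε := 0) (fun f _ f' _ => by simp) (fun i => by simpa using hc i) hf)

end FormalCurve

end AffAlgGroup

/-! ### Functions with vanishing differential on connected groups -/

lemma eval₂_X_mul_of_isHomogeneous {A ι : Type} [CommRing A] [Fintype ι] {k : ℕ}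
    {p : MvPolynomial ι A} (hp : p.IsHomogeneous k) (Φ : A →+* PowerSeries ℂ)
    (u : ι → PowerSeries ℂ) :
    p.eval₂ Φ (fun i => PowerSeries.X * u i) = PowerSeries.X ^ k * p.eval₂ Φ u := by
  rw [eval₂_eq', eval₂_eq', Finset.mul_sum]
  refine Finset.sum_congr rfl fun m hm => ?_
  have hk : ∑ i, m i = k := by
    have := hp (mem_support_iff.1 hm)
    rw [Finsupp.weight_apply, Finsupp.sum_fintype _ _ (by simp)] at this
    simpa using this
  simp only [mul_pow, Finset.prod_mul_distrib, Finset.prod_pow_eq_pow_sum, hk]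
  ring

namespace AffAlgGroup

section Connected

variable {H : AffAlgGroup} {𝔩 : Type} [LieRing 𝔩] [LieAlgebra ℂ 𝔩] (d : LieDat H 𝔩)

/-- Evaluation of regular functions at the identity. -/
def evOne (H : AffAlgGroup) : H.O →+* ℂ where
  toFun f := f.1 1
  map_one' := rfl
  map_zero' := rfl
  map_add' _ _ := rfl
  map_mul' _ _ := rfl

lemma evOne_apply (f : H.O) : evOne H f = f.1 1 := rfl

/-- The Taylor expansion as a ring homomorphism on regular functions. -/
def taylorO {δ : (H.Gp → ℂ) →ₗ[ℂ] ℂ} (hδ : IsPointDer δ) : H.O →+* PowerSeries ℂ where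
  toFun f := taylor δ f.1
  map_one' := (taylor_const hδ 1).trans (map_one _)
  map_zero' := (taylor_const hδ 0).trans (map_zero _)
  map_add' f f' := taylor_add δ f.1 f'.1
  map_mul' f f' := taylor_mul hδ f.2 f'.2

lemma taylorO_apply {δ : (H.Gp → ℂ) →ₗ[ℂ] ℂ} (hδ : IsPointDer δ) (f : H.O) :
    taylorO hδ f = taylor δ f.1 := rfl

lemma constantCoeff_taylorO {δ : (H.Gp → ℂ) →ₗ[ℂ] ℂ} (hδ : IsPointDer δ) :
    (PowerSeries.constantCoeff (R := ℂ)).comp (taylorO hδ) = evOne H := by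
  refine RingHom.ext fun f => ?_
  rw [RingHom.comp_apply, ← PowerSeries.coeff_zero_eq_constantCoeff_apply, taylorO_apply,
    constantCoeff_taylor, evOne_apply]

lemma coeff_one_taylorO {δ : (H.Gp → ℂ) →ₗ[ℂ] ℂ} (hδ : IsPointDer δ) (f : H.O) :
    PowerSeries.coeff 1 (taylorO hδ f) = δ f.1 := by
  simp [taylorO_apply, taylor, linv_one]

lemma exists_surjective_O :
    ∃ ev : MvPolynomial (Fin H.n) ℂ →+* H.O, Function.Surjective ev :=
  ⟨(AlgHom.rangeRestrict (aeval fun s (g : H.Gp) => g.1 s)).toRingHom,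
    AlgHom.rangeRestrict_surjective _⟩

lemma isNoetherianRing_O : IsNoetherianRing H.O := by
  obtain ⟨ev, hev⟩ := exists_surjective_O (H := H)
  exact isNoetherianRing_of_surjective (MvPolynomial (Fin H.n) ℂ) H.O ev hev

/-- The embedding of the Lie algebra in the affine space. -/
def LieDat.coordMap : 𝔩 →ₗ[ℂ] Pt H.n :=
  LinearMap.pi fun i => (LinearMap.applyₗ fun g : H.Gp => g.1 i) ∘ₗ d.D

lemma LieDat.coordMap_apply (x : 𝔩) (i : Fin H.n) : d.coordMap x i = d.D x fun g => g.1 i := rfl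

lemma LieDat.coordMap_injective : Function.Injective d.coordMap := by
  rw [← LinearMap.ker_eq_bot, LinearMap.ker_eq_bot']
  intro x hx
  refine d.inj x fun f hf => ?_
  exact pointDer_ext (d.leib x) (ε := 0) (fun f _ f' _ => by simp)
    (fun i => (d.coordMap_apply x i).symm.trans (congrFun hx i)) hf

lemma LieDat.finiteDimensional (d : LieDat H 𝔩) : FiniteDimensional ℂ 𝔩 :=
  FiniteDimensional.of_injective d.coordMap d.coordMap_injective

lemma LieDat.exists_parameters : ∃ (r : ℕ) (y : Fin r → H.O), (∀ i, evOne H (y i) = 0) ∧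
    (∀ v : Fin r → ℂ, ∃ x, ∀ i, d.D x (y i).1 = v i) ∧
      ∀ x, (∀ i, d.D x (y i).1 = 0) → x = 0 := by
  have := d.finiteDimensional
  let b := Module.finBasis ℂ 𝔩
  obtain ⟨s, hs⟩ := d.coordMap.exists_leftInverse_of_injective
    (LinearMap.ker_eq_bot.2 d.coordMap_injective)
  let z : Fin H.n → H.Gp → ℂ := fun i => (fun g => g.1 i) - fun _ => (1 : H.Gp).1 i
  have hz : ∀ i, z i ∈ H.O := fun i => Subalgebra.sub_mem _ (coord_mem_O i) (const_mem_O _)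
  let c : Fin (Module.finrank ℂ 𝔩) → Fin H.n → ℂ := fun j i => b.coord j (s (Pi.single i 1))
  let y : Fin (Module.finrank ℂ 𝔩) → H.O := fun j =>
    ⟨∑ i, c j i • z i, Subalgebra.sum_mem _ fun i _ => Subalgebra.smul_mem _ (hz i) _⟩
  have hy : ∀ x j, d.D x (y j).1 = b.coord j x := by
    intro x j
    have h1 : d.D x (y j).1 = ∑ i, c j i * d.coordMap x i := by
      rw [map_sum]
      refine Finset.sum_congr rfl fun i _ => ?_
      rw [map_smul, map_sub, (d.leib x).const, sub_zero, smul_eq_mul]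
      rfl
    have h2 : s (d.coordMap x) = x := LinearMap.congr_fun hs x
    rw [h1]
    conv_rhs => rw [← h2, pi_eq_sum_univ' (d.coordMap x), map_sum, map_sum]
    refine Finset.sum_congr rfl fun i _ => ?_
    rw [map_smul, map_smul, smul_eq_mul, mul_comm]
  refine ⟨_, y, fun j => ?_, fun v => ⟨∑ i, v i • b i, fun j => ?_⟩, fun x hx => ?_⟩
  · simp [evOne_apply, y, z]
  · rw [hy]
    simp [Finsupp.single_apply]
  · refine b.ext_elem fun j => ?_
    have := (hy x j).symm.trans (hx j)
    simpa using this

lemma LieDat.ker_evOne_le {r : ℕ} {y : Fin r → H.O} (hy0 : ∀ i, evOne H (y i) = 0)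
    (hy : ∀ x, (∀ i, d.D x (y i).1 = 0) → x = 0) :
    RingHom.ker (evOne H) ≤ Ideal.span (Set.range y) ⊔ RingHom.ker (evOne H) ^ 2 := by
  intro h hh
  by_contra hn
  set Q := Ideal.span (Set.range y) ⊔ RingHom.ker (evOne H) ^ 2 with hQ
  obtain ⟨l, hl, hle⟩ := Submodule.exists_le_ker_of_notMem (p := Q.restrictScalars ℂ) hn
  have hle' : ∀ f ∈ Q, l f = 0 := fun f hf => hle hf
  let E : H.O →ₗ[ℂ] ℂ :=
    { toFun := fun f => l (f - algebraMap ℂ H.O (f.1 1))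
      map_add' := fun f f' => by
        rw [← map_add]
        congr 1
        rw [show (f + f').1 1 = f.1 1 + f'.1 1 from rfl, map_add]
        ring
      map_smul' := fun a f => by
        rw [RingHom.id_apply, ← map_smul]
        congr 1
        rw [show (a • f).1 1 = a * f.1 1 from rfl, map_mul, Algebra.smul_def, Algebra.smul_def]
        ring }
  obtain ⟨δ, hδ⟩ := LinearMap.exists_extend (p := Subalgebra.toSubmodule H.O) E
  have hδ' : ∀ f : H.O, δ f.1 = l (f - algebraMap ℂ H.O (f.1 1)) := fun f =>
    LinearMap.congr_fun hδ f
  have hker : ∀ f : H.O, f - algebraMap ℂ H.O (f.1 1) ∈ RingHom.ker (evOne H) := fun f => by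
    rw [RingHom.mem_ker, map_sub, evOne_apply, evOne_apply]
    exact sub_self _
  have hder : IsPointDer δ := by
    intro f hf f' hf'
    have h1 := hδ' (⟨f, hf⟩ * ⟨f', hf'⟩)
    have h2 := hδ' ⟨f, hf⟩
    have h3 := hδ' ⟨f', hf'⟩
    change δ (f * f') = _ at h1
    change δ f = _ at h2
    change δ f' = _ at h3
    rw [h1, h2, h3, ← smul_eq_mul (f 1), ← smul_eq_mul (f' 1), ← map_smul, ← map_smul, ← map_add,
      ← sub_eq_zero, ← map_sub]
    refine hle' _ (Ideal.mem_sup_right ?_)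
    have h4 := Ideal.mul_mem_mul (hker ⟨f, hf⟩) (hker ⟨f', hf'⟩)
    rw [pow_two]
    convert h4 using 1
    refine Subtype.ext (funext fun g => ?_)
    change (f g * f' g - f 1 * f' 1) - (f 1 * (f' g - f' 1) + f' 1 * (f g - f 1)) =
      (f g - f 1) * (f' g - f' 1)
    ring
  have hEl : ∀ f : H.O, evOne H f = 0 → δ f.1 = l f := fun f hf => by
    rw [hδ', show f.1 1 = 0 from hf, map_zero, sub_zero]
  obtain ⟨x, hx⟩ := d.surj δ hder
  have hx0 : x = 0 := hy x fun i => by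
    rw [hx _ (y i).2, hEl _ (hy0 i)]
    exact hle' _ (Ideal.mem_sup_left (Ideal.subset_span ⟨i, rfl⟩))
  apply hl
  rw [← hEl h hh, ← hx _ h.2, hx0]
  simp

lemma LieDat.mem_ker_pow {F : H.O} (hF : ∀ x, taylorO (d.leib x) F = 0) (k : ℕ) :
    F ∈ RingHom.ker (evOne H) ^ k := by
  obtain ⟨r, y, hy0, hys, hyi⟩ := d.exists_parameters
  set m := RingHom.ker (evOne H) with hm
  set Y := Ideal.span (Set.range y) with hY
  have hYm : Y ≤ m := by
    rw [hY, Ideal.span_le]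
    rintro _ ⟨i, rfl⟩
    exact hy0 i
  have hmY : ∀ k, m ^ k ≤ Y ^ k ⊔ m ^ (k + 1) := by
    intro k
    induction k with
    | zero => simp
    | succ k ih =>
      calc m ^ (k + 1) = m ^ k * m := pow_succ _ _
        _ ≤ (Y ^ k ⊔ m ^ (k + 1)) * m := Ideal.mul_mono_left ih
        _ = Y ^ k * m ⊔ m ^ (k + 2) := by rw [Ideal.sup_mul, ← pow_succ]
        _ ≤ Y ^ k * (Y ⊔ m ^ 2) ⊔ m ^ (k + 2) :=
            sup_le_sup_right (Ideal.mul_mono_right (d.ker_evOne_le hy0 hyi)) _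
        _ ≤ Y ^ (k + 1) ⊔ m ^ (k + 2) := by
            rw [Ideal.mul_sup, ← pow_succ]
            refine sup_le (sup_le le_sup_left (le_sup_of_le_right ?_)) le_sup_right
            rw [pow_add]
            exact Ideal.mul_mono_left (Ideal.pow_right_mono hYm k)
  induction k with
  | zero => simp
  | succ k ih =>
    obtain ⟨a, ha, b, hb, hab⟩ := Submodule.mem_sup.1 (hmY k ih)
    obtain ⟨p, hp, rfl⟩ := (Ideal.mem_span_pow_iff_exists_isHomogeneous y a).1 ha
    have hmap : p.map (evOne H) = 0 := by
      refine MvPolynomial.funext fun v => ?_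
      obtain ⟨x, hx⟩ := hys v
      set Φ := taylorO (d.leib x) with hΦ
      have hΦm : m ≤ (Ideal.span {PowerSeries.X}).comap Φ := by
        intro f hf
        rw [Ideal.mem_comap, Ideal.mem_span_singleton, PowerSeries.X_dvd_iff,
          ← RingHom.comp_apply, constantCoeff_taylorO]
        exact hf
      have hb' : PowerSeries.coeff k (Φ b) = 0 := by
        have h1 := Ideal.le_comap_pow Φ (k + 1) (Ideal.pow_right_mono hΦm (k + 1) hb)
        rw [Ideal.mem_comap, Ideal.span_singleton_pow, Ideal.mem_span_singleton,
          PowerSeries.X_pow_dvd_iff] at h1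
        exact h1 k (Nat.lt_succ_self k)
      have hdvd : ∀ i, ∃ u, Φ (y i) = PowerSeries.X * u := fun i =>
        Ideal.mem_span_singleton.1 (hΦm (hy0 i))
      choose u hu using hdvd
      have hu1 : ∀ i, PowerSeries.constantCoeff (u i) = v i := fun i => by
        rw [← hx i, ← coeff_one_taylorO (d.leib x), ← hΦ, hu i, mul_comm,
          ← PowerSeries.coeff_zero_eq_constantCoeff_apply]
        exact (PowerSeries.coeff_succ_mul_X 0 (u i)).symm
      have h2 : PowerSeries.coeff k (Φ (eval y p)) = 0 := by
        have h3 := congrArg (PowerSeries.coeff k) (hF x)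
        rwa [← hab, map_add, map_add, ← hΦ, hb', add_zero, map_zero] at h3
      rw [← eval₂_id, hom_eval₂] at h2
      simp only [hu, RingHom.comp_id] at h2
      rw [eval₂_X_mul_of_isHomogeneous hp] at h2
      have h4 := PowerSeries.coeff_X_pow_mul (p.eval₂ Φ u) k 0
      rw [zero_add] at h4
      rw [h4, PowerSeries.coeff_zero_eq_constantCoeff_apply, hom_eval₂, constantCoeff_taylorO] at h2
      simp only [hu1] at h2
      rw [← eval₂_eq_eval_map, map_zero]
      exact h2
    rw [← hab]
    refine Ideal.add_mem _ ?_ hb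
    rw [eval_eq', pow_succ']
    refine Ideal.sum_mem _ fun t ht => Ideal.mul_mem_mul ?_ ?_
    · have := congrArg (coeff t) hmap
      rwa [coeff_map, coeff_zero] at this
    · refine Ideal.pow_right_mono hYm k ((Ideal.mem_span_pow_iff_exists_isHomogeneous y _).2
        ⟨monomial t 1, isHomogeneous_monomial _ ?_, ?_⟩)
      · have := hp (mem_support_iff.1 ht)
        rwa [Finsupp.degree_eq_weight_one]
      · rw [eval_monomial, one_mul, Finsupp.prod_fintype _ _ (by simp)]

variable {d} in
lemma exists_local_const {f : H.Gp → ℂ} (hf : f ∈ H.O) (h : ∀ x, linv (d.D x) f = 0) (g : H.Gp) :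
    ∃ r ∈ H.O, r g = 0 ∧ ∀ k, r k * (f k - f g) = f k - f g := by
  have := isNoetherianRing_O (H := H)
  let F : H.O := ⟨fun k => f (g * k) - f g, Subalgebra.sub_mem _ (O_mul_left hf g) (const_mem_O _)⟩
  have hF1 : F.1 1 = 0 := by simp [F]
  have hF : ∀ x, linv (d.D x) F.1 = 0 := by
    intro x
    have : F.1 = (fun k => f (g * k)) - fun _ => f g := rfl
    rw [this, map_sub, ← linv_translate, h x]
    funext k
    change 0 - linv (d.D x) (fun _ => f g) k = 0
    rw [linv_apply, (d.leib x).const, sub_zero]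
  have hT : ∀ x, taylorO (d.leib x) F = 0 := by
    intro x
    ext k
    cases k with
    | zero => rw [taylorO_apply, constantCoeff_taylor, hF1, map_zero]
    | succ k =>
      have : (linv (d.D x))^[k] (0 : H.Gp → ℂ) = 0 := by
        rw [← Module.End.pow_apply, map_zero]
      simp [taylorO_apply, taylor, hF, this]
  have hmem : F ∈ (⨅ i : ℕ, RingHom.ker (evOne H) ^ i • ⊤ : Submodule H.O H.O) := by
    rw [Submodule.mem_iInf]
    intro i
    rw [smul_eq_mul, Ideal.mul_top]
    exact d.mem_ker_pow hT i
  obtain ⟨r, hr⟩ := (Ideal.mem_iInf_smul_pow_eq_bot_iff _ _).1 hmem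
  refine ⟨fun k => r.1.1 (g⁻¹ * k), O_mul_left r.1.2 _, ?_, fun k => ?_⟩
  · have h0 : r.1.1 1 = 0 := r.2
    simpa using h0
  · have := congrArg (fun f : H.O => f.1 (g⁻¹ * k)) hr
    simpa [F] using this

variable {d} in
/-- On a connected group, a regular function with vanishing derivatives is constant. -/
lemma eq_const_of_linv_eq_zero (hH : H.IsConnected) {f : H.Gp → ℂ} (hf : f ∈ H.O)
    (h : ∀ x, linv (d.D x) f = 0) (g : H.Gp) : f g = f 1 := by
  obtain ⟨P, hP⟩ := mem_O.1 hf
  choose r hr hr0 hr1 using exists_local_const hf h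
  choose R hR using fun g => mem_O.1 (hr g)
  have hV := hH {x | ∀ p ∈ ({P - C (f 1)} : Set (MvPolynomial (Fin H.n) ℂ)), eval x p = 0}
    {x | ∀ p ∈ {p | ∃ k : H.Gp, f k = f 1 ∧ p = 1 - R k}, eval x p = 0} ⟨_, rfl⟩ ⟨_, rfl⟩ ?_ ?_
  · rcases hV with hV | hV
    · have := hV g.2 _ rfl
      rw [map_sub, eval_C, ← hP, sub_eq_zero] at this
      exact this
    · have := hV (1 : H.Gp).2 _ ⟨1, rfl, rfl⟩
      rw [map_sub, map_one, ← hR, hr0, sub_zero] at this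
      exact absurd this one_ne_zero
  · intro x hx
    let k : H.Gp := ⟨x, hx⟩
    by_cases hk : f k = f 1
    · left
      rintro _ rfl
      rw [map_sub, eval_C, sub_eq_zero, ← hk]
      exact (hP k).symm
    · right
      rintro _ ⟨j, hj, rfl⟩
      have h1 := hr1 j k
      rw [hj] at h1
      have h2 : r j k = 1 := mul_right_cancel₀ (sub_ne_zero.2 hk) (h1.trans (one_mul _).symm)
      rw [map_sub, map_one, sub_eq_zero, ← h2]
      exact hR j k
  · rw [Set.eq_empty_iff_forall_notMem]
    rintro x ⟨hx, hx1, hx2⟩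
    let k : H.Gp := ⟨x, hx⟩
    have h1 := hx1 _ rfl
    rw [map_sub, eval_C, sub_eq_zero] at h1
    have h2 := hx2 _ ⟨k, (hP k).trans h1, rfl⟩
    rw [map_sub, map_one, sub_eq_zero] at h2
    have h3 := hr0 k
    rw [hR k k] at h3
    exact one_ne_zero (h2.trans h3)

variable {d} in
/-- Over a connected group, Lie algebra invariants are group invariants. -/
lemma IsRat.rep_eq_of_lie_eq_zero {M : Type} [AddCommGroup M] [Module ℂ M] [LieRingModule 𝔩 M]
    {ρ : Representation ℂ H.Gp M} (h : IsRat d ρ) (hH : H.IsConnected) {m : M}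
    (hm : ∀ x : 𝔩, ⁅x, m⁆ = 0) (g : H.Gp) : ρ g m = m := by
  refine dual_ext fun l => ?_
  have := eq_const_of_linv_eq_zero (d := d) hH (h.coeff_mem m l) (fun x => ?_) g
  · simpa using this
  · funext k
    have h1 := h.der x m (l ∘ₗ ρ k)
    rw [hm, map_zero] at h1
    rw [linv_apply, Pi.zero_apply, h1]
    simp

end Connected

end AffAlgGroup

/-! ### Unipotent groups preserving a flag -/

section Flag

variable {E : Type} [AddCommGroup E] [Module ℂ E]

/-- Powers of a unipotent endomorphism depend polynomially on the exponent. -/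
lemma exists_polynomial_pow {u : Module.End ℂ E} (hu : IsNilpotent u) (l : E →ₗ[ℂ] ℂ) (e : E) :
    ∃ q : Polynomial ℂ, ∀ k : ℕ, q.eval (k : ℂ) = l (((1 + u) ^ k : Module.End ℂ E) e) := by
  obtain ⟨K, hK⟩ := hu
  refine ⟨∑ j ∈ Finset.range K, Polynomial.C (l ((u ^ j) e) / (j.factorial : ℂ)) *
    descPochhammer ℂ j, fun k => ?_⟩
  have h1 : ∀ j, l ((u ^ j) e) / (j.factorial : ℂ) * (k.descFactorial j : ℂ) =
      l ((u ^ j) e) * (k.choose j : ℂ) := by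
    intro j
    have : (j.factorial : ℂ) ≠ 0 := Nat.cast_ne_zero.2 (Nat.factorial_ne_zero j)
    rw [Nat.descFactorial_eq_factorial_mul_choose, Nat.cast_mul]
    field_simp
  have h2 : ((1 + u) ^ k : Module.End ℂ E) = ∑ j ∈ Finset.range (k + 1), k.choose j • u ^ j := by
    rw [add_comm, (Commute.one_right u).add_pow]
    refine Finset.sum_congr rfl fun j _ => ?_
    rw [one_pow, mul_one, nsmul_eq_mul, Nat.cast_comm]
  have h3 : l (((1 + u) ^ k : Module.End ℂ E) e) =
      ∑ j ∈ Finset.range (k + 1), l ((u ^ j) e) * (k.choose j : ℂ) := by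
    rw [h2, LinearMap.sum_apply, map_sum]
    refine Finset.sum_congr rfl fun j _ => ?_
    rw [LinearMap.smul_apply, map_nsmul, nsmul_eq_mul, mul_comm]
  rw [h3, Polynomial.eval_finsetSum]
  simp only [Polynomial.eval_mul, Polynomial.eval_C, descPochhammer_eval_eq_descFactorial, h1]
  rcases le_total K (k + 1) with hle | hle
  · refine Finset.sum_subset (Finset.range_subset_range.2 hle) fun j _ hj => ?_
    rw [Finset.mem_range, not_lt] at hj
    rw [pow_eq_zero_of_le hj hK]
    simp
  · refine (Finset.sum_subset (Finset.range_subset_range.2 hle) fun j _ hj => ?_).symm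
    rw [Finset.mem_range, not_lt] at hj
    rw [Nat.choose_eq_zero_of_lt hj]
    simp

/-- A basis adapted to a flag. -/
lemma exists_basis_of_flag [FiniteDimensional ℂ E] {Fl : ℕ → Submodule ℂ E} (h0 : Fl 0 = ⊤)
    {K : ℕ} (hK : Fl K = ⊥) : ∃ (m : ℕ) (b : Module.Basis (Fin m) ℂ E),
      ∀ T : Module.End ℂ E, (∀ k, ∀ w ∈ Fl k, T w ∈ Fl (k + 1)) →
        ∀ j, T (b j) ∈ Submodule.span ℂ (b '' {i | i < j}) := by
  have key : ∀ n ≤ Module.finrank ℂ E, ∃ b : Fin n → E, LinearIndependent ℂ b ∧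
      ∀ T : Module.End ℂ E, (∀ k, ∀ w ∈ Fl k, T w ∈ Fl (k + 1)) →
        ∀ j, T (b j) ∈ Submodule.span ℂ (b '' {i | i < j}) := by
    intro n
    induction n with
    | zero => exact fun _ => ⟨Fin.elim0, linearIndependent_empty_type, fun _ _ j => j.elim0⟩
    | succ n ih =>
      intro hn
      obtain ⟨b, hb, hT⟩ := ih (by omega)
      set S := Submodule.span ℂ (Set.range b) with hS
      have hex : ∃ k, Fl k ≤ S := ⟨K, hK ▸ bot_le⟩
      classical
      have hne : Nat.find hex ≠ 0 := by
        intro h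
        have h1 := Nat.find_spec hex
        rw [h, h0, top_le_iff] at h1
        have h2 := finrank_span_eq_card hb
        rw [← hS, h1, finrank_top, Fintype.card_fin] at h2
        omega
      obtain ⟨j, hj⟩ := Nat.exists_eq_succ_of_ne_zero hne
      have hj1 : Fl (j + 1) ≤ S := by
        have := Nat.find_spec hex
        rwa [hj] at this
      have hj0 : ¬ Fl j ≤ S := Nat.find_min hex (by omega)
      obtain ⟨v, hv, hvS⟩ := SetLike.not_le_iff_exists.1 hj0
      refine ⟨Fin.snoc b v, linearIndependent_finSnoc.2 ⟨hb, hvS⟩, fun T h i => ?_⟩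
      refine Fin.lastCases ?_ (fun i => ?_) i
      · rw [Fin.snoc_last]
        refine Submodule.span_mono ?_ (hj1 (h j v hv))
        rintro _ ⟨i, rfl⟩
        exact ⟨i.castSucc, Fin.castSucc_lt_last i, Fin.snoc_castSucc (α := fun _ => E) _ _ _⟩
      · rw [Fin.snoc_castSucc (α := fun _ => E)]
        refine Submodule.span_mono ?_ (hT T h i)
        rintro _ ⟨k, hk, rfl⟩
        exact ⟨k.castSucc, Fin.castSucc_lt_castSucc_iff.2 hk,
          Fin.snoc_castSucc (α := fun _ => E) _ _ _⟩
  obtain ⟨b, hb, hT⟩ := key _ le_rfl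
  refine ⟨_, Module.Basis.mk hb (hb.span_eq_top_of_card_eq_finrank' (by simp)).ge, ?_⟩
  simpa using hT

end Flag

namespace AffAlgGroup

variable {H : AffAlgGroup}

lemma isConnected_of_pow_polynomial (h : ∀ g : H.Gp, ∃ q : Fin H.n → Polynomial ℂ,
    ∀ (k : ℕ) i, (q i).eval (k : ℂ) = (g ^ k).1 i) : H.IsConnected := by
  have key : ∀ V : Set (Pt H.n), IsAlgebraicSet V → ∀ g : H.Gp,
      {k : ℕ | (g ^ k).1 ∈ V}.Infinite → (1 : H.Gp).1 ∈ V ∧ g.1 ∈ V := by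
    rintro _ ⟨S, rfl⟩ g hinf
    obtain ⟨q, hq⟩ := h g
    have h0 : ∀ k : ℕ, ∀ p ∈ S, eval (g ^ k).1 p = 0 := by
      intro k p hp
      have hev : ∀ k : ℕ, (aeval q p).eval (k : ℂ) = eval (g ^ k).1 p := by
        intro k
        have : (g ^ k).1 = fun i => (q i).eval (k : ℂ) := funext fun i => (hq k i).symm
        rw [this, ← Polynomial.coe_evalRingHom, aeval_def, hom_eval₂,
          ← eval₂_id]
        congr 1
        ext a
        simp
      have hz : aeval q p = 0 := by
        refine Polynomial.eq_zero_of_infinite_isRoot _ ?_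
        refine (hinf.image (f := fun k : ℕ => (k : ℂ)) Nat.cast_injective.injOn).mono ?_
        rintro _ ⟨k, hk, rfl⟩
        exact (hev k).trans (hk p hp)
      rw [← hev, hz, Polynomial.eval_zero]
    refine ⟨fun p hp => ?_, fun p hp => ?_⟩
    · simpa using h0 0 p hp
    · simpa using h0 1 p hp
  intro V W hV hW hVW hdisj
  have key2 : ∀ g : H.Gp, ((1 : H.Gp).1 ∈ V ∧ g.1 ∈ V) ∨ ((1 : H.Gp).1 ∈ W ∧ g.1 ∈ W) := by
    intro g
    have hun : ({k : ℕ | (g ^ k).1 ∈ V} ∪ {k : ℕ | (g ^ k).1 ∈ W}).Infinite := by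
      convert Set.infinite_univ (α := ℕ)
      exact Set.eq_univ_of_forall fun k => hVW (g ^ k).2
    rcases Set.infinite_union.1 hun with hi | hi
    · exact Or.inl (key V hV g hi)
    · exact Or.inr (key W hW g hi)
  have hnot : ¬ ((1 : H.Gp).1 ∈ V ∧ (1 : H.Gp).1 ∈ W) := fun hh =>
    Set.eq_empty_iff_forall_notMem.1 hdisj _ ⟨(1 : H.Gp).2, hh⟩
  rcases key2 1 with ⟨h1, _⟩ | ⟨h1, _⟩
  · left
    intro x hx
    rcases key2 ⟨x, hx⟩ with h2 | h2
    · exact h2.2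
    · exact absurd ⟨h1, h2.1⟩ hnot
  · right
    intro x hx
    rcases key2 ⟨x, hx⟩ with h2 | h2
    · exact absurd ⟨h2.1, h1⟩ hnot
    · exact h2.2

lemma isUnipotent_of_flag {E : Type} [AddCommGroup E] [Module ℂ E] [FiniteDimensional ℂ E]
    (ρ : Representation ℂ H.Gp E) (hreg : ∀ m (l : E →ₗ[ℂ] ℂ), (fun g => l (ρ g m)) ∈ H.O)
    (hinj : ∀ g, ρ g = 1 → g = 1) {Fl : ℕ → Submodule ℂ E} (h0 : Fl 0 = ⊤)
    {K : ℕ} (hK : Fl K = ⊥) (hFl : ∀ g k, ∀ w ∈ Fl k, ρ g w - w ∈ Fl (k + 1)) :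
    H.IsUnipotent := by
  classical
  obtain ⟨m, b, hb⟩ := exists_basis_of_flag h0 hK
  have hcoord : ∀ g i j, j ≤ i → b.coord i (ρ g (b j)) = if i = j then 1 else 0 := by
    intro g i j hij
    have h1 := hb (ρ g - 1) (fun k w hw => hFl g k w hw) j
    have h2 : b.coord i ((ρ g - 1) (b j)) = 0 := by
      refine (Submodule.span_le (p := LinearMap.ker (b.coord i))).2 ?_ h1
      rintro _ ⟨k, hk, rfl⟩
      have hki : k ≠ i := (lt_of_lt_of_le hk hij).ne
      simp [hki]
    have h3 : ρ g (b j) = (ρ g - 1) (b j) + b j := by simp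
    rw [h3, map_add, h2, zero_add]
    simp [Finsupp.single_apply, eq_comm]
  let ψ : H.Gp → Pt (m * m) := fun g idx =>
    b.coord (finProdFinEquiv.symm idx).1 (ρ g (b (finProdFinEquiv.symm idx).2))
  have hψ : ∀ g i j, matEntry (ψ g) i j = b.coord i (ρ g (b j)) := fun g i j => by
    simp only [matEntry, ψ, Equiv.symm_apply_apply]
  let φ : Pt H.n → Pt (m * m) := fun x => if hx : x ∈ H.carrier then ψ ⟨x, hx⟩ else 0
  have hφ : ∀ g : H.Gp, φ g.1 = ψ g := fun g => dif_pos g.2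
  choose P hP using fun idx : Fin (m * m) => mem_O.1
    (hreg (b (finProdFinEquiv.symm idx).2) (b.coord (finProdFinEquiv.symm idx).1))
  refine ⟨m, φ, ⟨P, fun x hx i => ?_⟩, fun x hx y hy hxy => ?_, fun x hx => ?_,
    fun x hx y hy => ?_⟩
  · let g : H.Gp := ⟨x, hx⟩
    rw [hφ g]
    exact hP i g
  · let g : H.Gp := ⟨x, hx⟩
    let k : H.Gp := ⟨y, hy⟩
    rw [hφ g, hφ k] at hxy
    have h1 : ρ g = ρ k := b.ext fun j => b.ext_elem fun i => by
      have := congrArg (fun z => matEntry z i j) hxy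
      simp only [hψ] at this
      exact this
    have h2 : ρ (k⁻¹ * g) = 1 := by rw [map_mul, h1, ← map_mul, inv_mul_cancel, map_one]
    exact congrArg Subtype.val (inv_mul_eq_one.1 (hinj _ h2)).symm
  · let g : H.Gp := ⟨x, hx⟩
    rw [hφ g]
    exact ⟨fun i => by rw [hψ, hcoord g i i le_rfl, if_pos rfl],
      fun i j hij => by rw [hψ, hcoord g i j hij.le, if_neg hij.ne']⟩
  · let g : H.Gp := ⟨x, hx⟩
    let k : H.Gp := ⟨y, hy⟩
    change φ (g * k).1 = _
    rw [hφ, hφ g, hφ k]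
    funext idx
    change b.coord _ (ρ (g * k) (b _)) = ∑ c, _
    simp only [hψ]
    rw [map_mul, Module.End.mul_apply]
    conv_lhs => rw [← b.sum_repr (ρ k (b (finProdFinEquiv.symm idx).2)), map_sum, map_sum]
    refine Finset.sum_congr rfl fun c _ => ?_
    rw [map_smul, map_smul, smul_eq_mul, mul_comm]
    rfl

lemma exists_algSubgroup (N : Subgroup H.Gp) {ι : Type} {F : ι → H.Gp → ℂ}
    (hF : ∀ j, F j ∈ H.O) (hN : ∀ g, g ∈ N ↔ ∀ j, F j g = 0) :
    ∃ K : AlgSubgroup H, ∀ g : H.Gp, g.1 ∈ K.carrier ↔ g ∈ N := by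
  choose P hP using fun j => mem_O.1 (hF j)
  obtain ⟨S, hS⟩ := H.isAlgebraic
  have hmem : ∀ x, x ∈ {x | ∃ g ∈ N, g.1 = x} ↔
      x ∈ {x | ∀ p ∈ S ∪ Set.range P, eval x p = 0} := by
    intro x
    constructor
    · rintro ⟨g, hg, rfl⟩ p (hp | ⟨j, rfl⟩)
      · exact (hS.le g.2 : _) p hp
      · rw [← hP]
        exact (hN g).1 hg j
    · intro hx
      have hx' : x ∈ H.carrier := by
        rw [hS]
        exact fun p hp => hx p (Or.inl hp)
      let g : H.Gp := ⟨x, hx'⟩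
      refine ⟨g, (hN g).2 fun j => ?_, rfl⟩
      rw [hP]
      exact hx _ (Or.inr ⟨j, rfl⟩)
  refine ⟨{ carrier := {x | ∃ g ∈ N, g.1 = x}
            subset := by
              rintro _ ⟨g, _, rfl⟩
              exact g.2
            isAlgebraic := ⟨_, Set.ext hmem⟩
            one_mem := ⟨1, N.one_mem, rfl⟩
            mul_mem := by
              rintro _ _ ⟨g, hg, rfl⟩ ⟨k, hk, rfl⟩
              exact ⟨g * k, N.mul_mem hg hk, rfl⟩
            inv_mem := by
              rintro _ ⟨g, hg, rfl⟩
              exact ⟨g⁻¹, N.inv_mem hg, rfl⟩ }, fun g => ⟨?_, fun hg => ⟨g, hg, rfl⟩⟩⟩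
  rintro ⟨k, hk, e⟩
  rwa [← Subtype.ext e]

end AffAlgGroup

namespace AffAlgGroup

variable {H : AffAlgGroup} {𝔩 : Type} [LieRing 𝔩] [LieAlgebra ℂ 𝔩] {d : LieDat H 𝔩}

/-! ### Faithful finite-dimensional modules -/

lemma IsRat.exists_sub {M : Type} [AddCommGroup M] [Module ℂ M] [LieRingModule 𝔩 M]
    [LieModule ℂ 𝔩 M] {ρ : Representation ℂ H.Gp M} (h : IsRat d ρ) (W : Submodule ℂ M)
    (hW : ∀ g, ∀ m ∈ W, ρ g m ∈ W) :
    ∃ (_ : LieRingModule 𝔩 W) (_ : LieModule ℂ 𝔩 W) (ρW : Representation ℂ H.Gp W),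
      IsRat d ρW ∧ (∀ g (w : W), (ρW g w : M) = ρ g w) ∧
        ∀ (x : 𝔩) (w : W), ((⁅x, w⁆ : W) : M) = ⁅x, (w : M)⁆ := by
  let V : LieSubmodule ℂ 𝔩 M :=
    { W with
      lie_mem := fun {x m} hm => h.lie_mem hW x hm }
  let ρW : Representation ℂ H.Gp V :=
    { toFun := fun g => (ρ g).restrict (p := W) (q := W) (hW g)
      map_one' := LinearMap.ext fun w => Subtype.ext (by simp [LinearMap.restrict_apply])
      map_mul' := fun g k => LinearMap.ext fun w => Subtype.ext (by
        simp [LinearMap.restrict_apply]) }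
  exact ⟨inferInstanceAs (LieRingModule 𝔩 V), inferInstanceAs (LieModule ℂ 𝔩 V), ρW,
    h.of_injective (M := V) (V.toSubmodule.subtype) Subtype.val_injective (fun _ _ => rfl)
      (fun _ _ => rfl), fun _ _ => rfl, fun _ _ => rfl⟩

variable (d) in
/-- A finite-dimensional rational module with the coordinates among its coefficients. -/
lemma exists_faithful : ∃ (E : Type) (_ : AddCommGroup E) (_ : Module ℂ E)
    (_ : LieRingModule 𝔩 E) (_ : LieModule ℂ 𝔩 E) (ρ : Representation ℂ H.Gp E)
    (e : Fin H.n → E) (l : E →ₗ[ℂ] ℂ), FiniteDimensional ℂ E ∧ IsRat d ρ ∧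
      ∀ g i, l (ρ g (e i)) = g.1 i := by
  have hc : ∀ i, (fun g : H.Gp => g.1 i) ∈ H.OM ℂ := fun i =>
    mem_regMaps_complex.2 (coord_mem_O i)
  let c : Fin H.n → Jmod d ℂ := fun i => Jmod.mk _ (hc i)
  choose W hfd hm hW using fun i => (Jmod.isRat (d := d) (M := ℂ)).exists_fd (c i)
  have hst : ∀ g, ∀ m ∈ ⨆ i, W i, Jmod.rep d ℂ g m ∈ ⨆ i, W i := by
    intro g m hm
    induction hm using Submodule.iSup_induction' with
    | mem i m hm => exact Submodule.mem_iSup_of_mem i (hW i g m hm)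
    | zero => rw [map_zero]; exact Submodule.zero_mem _
    | add a b _ _ ha hb => rw [map_add]; exact Submodule.add_mem _ ha hb
  obtain ⟨i₁, i₂, ρ, hρ, hρv, _⟩ := Jmod.isRat.exists_sub (⨆ i, W i) hst
  refine ⟨_, inferInstance, inferInstance, i₁, i₂, ρ, fun i => ⟨c i, Submodule.mem_iSup_of_mem i (hm i)⟩,
    Jmod.ev 1 ∘ₗ (⨆ i, W i).subtype, inferInstance, hρ, fun g i => ?_⟩
  rw [LinearMap.comp_apply, Submodule.subtype_apply, hρv, Jmod.ev_apply, Jmod.rep_apply, one_mul]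
  rfl

section Faithful

variable {E : Type} [AddCommGroup E] [Module ℂ E] [LieRingModule 𝔩 E]
  {ρ : Representation ℂ H.Gp E} {e : Fin H.n → E} {l : E →ₗ[ℂ] ℂ}

lemma eq_one_of_coeff (he : ∀ g i, l (ρ g (e i)) = g.1 i) {g : H.Gp} (hg : ρ g = 1) : g = 1 :=
  Subtype.ext (funext fun i => by rw [← he, hg, ← map_one ρ, he])

lemma IsRat.eq_zero_of_coeff (h : IsRat d ρ) (he : ∀ g i, l (ρ g (e i)) = g.1 i) {x : 𝔩}
    (hx : ∀ v : E, ⁅x, v⁆ = 0) : x = 0 := by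
  refine d.coordMap_injective (funext fun i => ?_)
  have := h.der x (e i) l
  simp only [hx, he, map_zero] at this
  rw [d.coordMap_apply, ← this, map_zero]
  rfl

end Faithful

/-! ### Lie algebras of reductive groups -/

lemma IsRat.iterate_linv_coeff {M : Type} [AddCommGroup M] [Module ℂ M] [LieRingModule 𝔩 M]
    [LieModule ℂ 𝔩 M] {ρ : Representation ℂ H.Gp M} (h : IsRat d ρ) (l : M →ₗ[ℂ] ℂ) (x : 𝔩)
    (k : ℕ) (m : M) : (linv (d.D x))^[k] (fun g => l (ρ g m)) =
      fun g => l (ρ g ((LieModule.toEnd ℂ 𝔩 M x ^ k) m)) := by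
  induction k generalizing m with
  | zero => simp
  | succ k ih =>
    have h1 : linv (d.D x) (fun g => l (ρ g m)) = fun g => l (ρ g ⁅x, m⁆) :=
      funext fun g => (h.dual_lie_rep l x m g).symm
    rw [Function.iterate_succ_apply, h1, ih, pow_succ]
    rfl

/-- The Lie algebra of a reductive group has a faithful module with nondegenerate trace form. -/
theorem isRedLie_of_isReductive (hH : H.IsReductive) (d : LieDat H 𝔩) : IsRedLie d.sig := by
  obtain ⟨E, _, _, _, _, ρ, e, l₀, _, h, he⟩ := exists_faithful d
  have hgood : IsGood d.sig E := h.isGood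
  set B := LieModule.traceForm ℂ 𝔩 E with hB
  have hinv : ∀ x y z, B ⁅x, y⁆ z = B x ⁅y, z⁆ := LieModule.traceForm_apply_lie_apply ℂ 𝔩 E
  have hsymm : ∀ x y, B x y = B y x := fun x y => LieModule.traceForm_comm ℂ 𝔩 E x y
  let R : LieIdeal ℂ 𝔩 :=
    { carrier := {x | ∀ y, B x y = 0}
      add_mem' := fun {a b} ha hb y => by rw [map_add, LinearMap.add_apply, ha, hb, add_zero]
      zero_mem' := fun y => by rw [map_zero, LinearMap.zero_apply]
      smul_mem' := fun c a ha y => by rw [map_smul, LinearMap.smul_apply, ha, smul_zero]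
      lie_mem := fun {x m} hm y => by
        rw [← lie_skew, map_neg, LinearMap.neg_apply, hinv, hm, neg_zero] }
  have memR : ∀ x, x ∈ R ↔ ∀ y, B x y = 0 := fun x => Iff.rfl
  have hnilp : ∀ x ∈ R, IsNilpotent (LieModule.toEnd ℂ 𝔩 E x) := fun x hx =>
    hgood.isNilpotent_of_trace_eq_zero (hx _)
  have hnil : LieModule.IsNilpotent R E := by
    rw [LieModule.isNilpotent_iff_forall' (R := ℂ)]
    rintro ⟨x, hx⟩
    exact hnilp x hx
  obtain ⟨K, hK⟩ := (LieModule.isNilpotent_iff ℂ R E).1 hnil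
  let Fl : ℕ → Submodule ℂ E := fun k => (LieModule.lowerCentralSeries ℂ R E k).toSubmodule
  have hFl0 : Fl 0 = ⊤ := rfl
  have hFlK : Fl K = ⊥ := by
    change (LieModule.lowerCentralSeries ℂ R E K).toSubmodule = ⊥
    rw [hK]; rfl
  have hFls : ∀ k, Fl (k + 1) = Submodule.span ℂ {v | ∃ x ∈ R, ∃ m ∈ Fl k, ⁅x, m⁆ = v} := by
    intro k
    change (LieModule.lowerCentralSeries ℂ R E (k + 1)).toSubmodule = _
    rw [LieModule.lowerCentralSeries_succ, LieSubmodule.lieIdeal_oper_eq_linear_span']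
    congr 1
    ext v
    constructor
    · rintro ⟨⟨x, hx⟩, _, m, hm, rfl⟩
      exact ⟨x, hx, m, hm, rfl⟩
    · rintro ⟨x, hx, m, hm, rfl⟩
      exact ⟨⟨x, hx⟩, LieSubmodule.mem_top _, m, hm, rfl⟩
  have hlie : ∀ k, ∀ x ∈ R, ∀ m ∈ Fl k, ⁅x, m⁆ ∈ Fl (k + 1) := fun k x hx m hm => by
    rw [hFls]
    exact Submodule.subset_span ⟨x, hx, m, hm, rfl⟩
  have hanti : ∀ k, Fl (k + 1) ≤ Fl k := fun k =>
    LieModule.antitone_lowerCentralSeries ℂ R E (Nat.le_succ k)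
  have hAd : ∀ g : H.Gp, ∀ x ∈ R, ∃ y ∈ R, ∀ m, ⁅y, ρ g m⁆ = ρ g ⁅x, m⁆ := by
    intro g x hx
    obtain ⟨y, hy⟩ := exists_Ad d g x
    refine ⟨y, fun z => ?_, fun m => h.lie_of_Ad hy m⟩
    obtain ⟨w, hw⟩ := exists_Ad d g⁻¹ z
    have h1 : ∀ m, ⁅y, m⁆ = ρ g ⁅x, ρ g⁻¹ m⁆ := fun m => by
      rw [← h.lie_of_Ad hy, ← Module.End.mul_apply, ← map_mul, mul_inv_cancel, map_one]; rfl
    have h2 : ∀ m, ⁅z, m⁆ = ρ g ⁅w, ρ g⁻¹ m⁆ := fun m => by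
      rw [h.lie_of_Ad hw, ← Module.End.mul_apply, ← map_mul, mul_inv_cancel, map_one]; rfl
    have h3 : LieModule.toEnd ℂ 𝔩 E y ∘ₗ LieModule.toEnd ℂ 𝔩 E z =
        ρ g * (LieModule.toEnd ℂ 𝔩 E x * LieModule.toEnd ℂ 𝔩 E w * ρ g⁻¹) := by
      refine LinearMap.ext fun m => ?_
      simp only [LinearMap.comp_apply, Module.End.mul_apply, LieModule.toEnd_apply_apply]
      rw [h1, h2, ← Module.End.mul_apply (ρ g⁻¹), ← map_mul, inv_mul_cancel, map_one]
      rfl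
    rw [hB, LieModule.traceForm_apply_apply, h3, LinearMap.trace_mul_comm, mul_assoc, ← map_mul ρ,
      inv_mul_cancel, map_one, mul_one]
    exact hx w
  have hst : ∀ k, ∀ g, ∀ m ∈ Fl k, ρ g m ∈ Fl k := by
    intro k
    induction k with
    | zero => exact fun g m _ => hFl0 ▸ Submodule.mem_top
    | succ k ih =>
      intro g m hm
      rw [hFls] at hm
      induction hm using Submodule.span_induction with
      | mem m hm =>
        obtain ⟨x, hx, m, hm, rfl⟩ := hm
        obtain ⟨y, hy, hyx⟩ := hAd g x hx
        rw [← hyx]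
        exact hlie k y hy _ (ih g m hm)
      | zero => rw [map_zero]; exact Submodule.zero_mem _
      | add a b _ _ ha hb => rw [map_add]; exact Submodule.add_mem _ ha hb
      | smul c a _ ha => rw [map_smul]; exact Submodule.smul_mem _ _ ha
  let N : Subgroup H.Gp :=
    { carrier := {g | ∀ k, ∀ m ∈ Fl k, ρ g m - m ∈ Fl (k + 1)}
      one_mem' := fun k m _ => by simp
      mul_mem' := fun {a b} ha hb k m hm => by
        have : ρ (a * b) m - m = (ρ a (ρ b m - m) - (ρ b m - m)) + (ρ b m - m) + (ρ a m - m) := by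
          rw [map_mul, Module.End.mul_apply, map_sub]; abel
        rw [this]
        exact Submodule.add_mem _ (Submodule.add_mem _ (hanti _ (ha _ _ (hb k m hm))) (hb k m hm))
          (ha k m hm)
      inv_mem' := fun {a} ha k m hm => by
        have : ρ a⁻¹ m - m = - ρ a⁻¹ (ρ a m - m) := by
          rw [map_sub, ← Module.End.mul_apply, ← map_mul, inv_mul_cancel, map_one,
            Module.End.one_apply]
          abel
        rw [this]
        exact Submodule.neg_mem _ (hst _ _ _ (ha k m hm)) }
  let ι := {j : ℕ × E × (E →ₗ[ℂ] ℂ) // j.2.1 ∈ Fl j.1 ∧ ∀ v ∈ Fl (j.1 + 1), j.2.2 v = 0}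
  let F : ι → H.Gp → ℂ := fun j g => j.1.2.2 (ρ g j.1.2.1 - j.1.2.1)
  have hF' : ∀ j, F j = (fun g => j.1.2.2 (ρ g j.1.2.1)) - fun _ => j.1.2.2 j.1.2.1 := fun j =>
    funext fun g => map_sub _ _ _
  have hF : ∀ j, F j ∈ H.O := fun j => by
    rw [hF']
    exact Subalgebra.sub_mem _ (h.coeff_mem _ _) (const_mem_O _)
  have hN : ∀ g, g ∈ N ↔ ∀ j, F j g = 0 := by
    intro g
    constructor
    · rintro hg ⟨⟨k, m, l⟩, hm, hl⟩
      exact hl _ (hg k m hm)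
    · intro hg k m hm
      by_contra hn
      obtain ⟨l, hl, hle⟩ := Submodule.exists_le_ker_of_notMem hn
      exact hl (hg ⟨⟨k, m, l⟩, hm, fun v hv => hle hv⟩)
  obtain ⟨S, hS⟩ := exists_algSubgroup N hF hN
  have hSN : ∀ g : S.toGrp.Gp, S.incl g ∈ N := fun g => (hS (S.incl g)).1 g.2
  have hnormal : S.IsNormal := by
    intro g hg x hx
    let a : H.Gp := ⟨g, hg⟩
    let b : H.Gp := ⟨x, S.subset hx⟩
    have hb : b ∈ N := (hS b).1 hx
    refine (hS (a * (b * a⁻¹))).2 fun k m hm => ?_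
    have : ρ (a * (b * a⁻¹)) m - m = ρ a (ρ b (ρ a⁻¹ m) - ρ a⁻¹ m) := by
      rw [map_sub, ← Module.End.mul_apply (ρ a) (ρ a⁻¹), ← map_mul, mul_inv_cancel, map_one,
        map_mul, map_mul]
      rfl
    rw [this]
    exact hst _ _ _ (hb k _ (hst _ _ _ hm))
  have hconn : S.toGrp.IsConnected := by
    refine isConnected_of_pow_polynomial fun g => ?_
    set u : Module.End ℂ E := ρ (S.incl g) - 1 with hu
    have hnu : IsNilpotent u := by
      refine ⟨K, LinearMap.ext fun v => ?_⟩
      have : ∀ k, (u ^ k) v ∈ Fl k := by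
        intro k
        induction k with
        | zero => exact hFl0 ▸ Submodule.mem_top
        | succ k ih =>
          rw [pow_succ', Module.End.mul_apply]
          exact hSN g k _ ih
      have := this K
      rwa [hFlK, Submodule.mem_bot] at this
    choose q hq using fun i => exists_polynomial_pow hnu l₀ (e i)
    refine ⟨q, fun k i => ?_⟩
    have h1 : (1 + u : Module.End ℂ E) = ρ (S.incl g) := by rw [hu]; abel
    refine (hq i k).trans ?_
    rw [h1, ← map_pow, ← map_pow]
    exact he (S.incl (g ^ k)) i
  have hunip : S.toGrp.IsUnipotent := by
    refine isUnipotent_of_flag (ρ.comp S.incl) (fun m l => O_restrict (h.coeff_mem m l))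
      (fun g hg => ?_) hFl0 hFlK fun g k w hw => hSN g k w hw
    have := eq_one_of_coeff he (g := S.incl g) hg
    exact Subtype.ext (congrArg (fun k : H.Gp => k.1) this)
  have hone := hH S hnormal hconn hunip
  have hN1 : ∀ g, g ∈ N → g = 1 := fun g hg => by
    have := (hS g).2 hg
    rw [hone] at this
    exact Subtype.ext this
  have hR : ∀ x ∈ R, x = 0 := by
    intro x hx
    refine d.inj x fun f hf => pointDer_eq_zero_of_taylor (d.leib x) hF
      (fun g hg => hN1 g ((hN g).2 hg)) (fun j k => ?_) hf
    obtain ⟨⟨n, m, l⟩, hm, hl⟩ := j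
    cases k with
    | zero => simp [F]
    | succ k =>
      have h1 : linv (d.D x) (F ⟨⟨n, m, l⟩, hm, hl⟩) = fun g => l (ρ g ⁅x, m⁆) := by
        rw [hF', map_sub]
        funext g
        have h2 : linv (d.D x) (fun _ => l m) g = 0 := by
          rw [linv_apply, (d.leib x).const]
        rw [Pi.sub_apply, h2, sub_zero]
        exact (h.dual_lie_rep l x m g).symm
      rw [Function.iterate_succ_apply, h1, h.iterate_linv_coeff]
      have h2 : (LieModule.toEnd ℂ 𝔩 E x ^ k) ⁅x, m⁆ ∈ Fl (n + 1) := by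
        induction k with
        | zero => exact hlie n x hx m hm
        | succ k ih =>
          rw [pow_succ', Module.End.mul_apply]
          exact hanti _ (hlie _ x hx _ ih)
      change l (ρ 1 _) = 0
      rw [map_one]
      exact hl _ h2
  exact ⟨E, _, _, _, _, inferInstance, hgood, fun x hx => hR x hx,
    fun x hx => hR x fun y => by rw [hsymm]; exact hx y⟩

end AffAlgGroup

namespace AffAlgGroup

section Equivariance

variable {H : AffAlgGroup} {𝔩 : Type} [LieRing 𝔩] [LieAlgebra ℂ 𝔩] {d : LieDat H 𝔩}
variable {M N : Type} [AddCommGroup M] [Module ℂ M] [LieRingModule 𝔩 M] [LieModule ℂ 𝔩 M]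
  [AddCommGroup N] [Module ℂ N] [LieRingModule 𝔩 N] [LieModule ℂ 𝔩 N]
  {ρ : Representation ℂ H.Gp M} {ρ' : Representation ℂ H.Gp N}

lemma IsRat.der_sum (h : IsRat d ρ) (x : 𝔩) (l : M →ₗ[ℂ] ℂ) {k : ℕ} {c : Fin k → H.Gp → ℂ}
    (hc : ∀ i, c i ∈ H.O) (v : Fin k → M) :
    d.D x (fun g => l (ρ g (∑ i, c i g • v i))) =
      l (∑ i, d.D x (c i) • v i) + l ⁅x, ∑ i, c i 1 • v i⁆ := by
  have h1 : (fun g => l (ρ g (∑ i, c i g • v i))) = ∑ i, c i * fun g => l (ρ g (v i)) := by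
    funext g
    rw [Finset.sum_apply, map_sum, map_sum]
    exact Finset.sum_congr rfl fun i _ => by simp
  rw [h1, map_sum, lie_sum, map_sum, map_sum, ← Finset.sum_add_distrib]
  refine Finset.sum_congr rfl fun i _ => ?_
  rw [(d.leib x) _ (hc i) _ (h.coeff_mem (v i) l), ← h.der, lie_smul, map_smul, map_smul]
  simp only [smul_eq_mul, map_one, Module.End.one_apply]
  ring

/-- Over a connected group, Lie-equivariant maps are equivariant. -/
lemma IsRat.map_rep_of_map_lie (h : IsRat d ρ) (h' : IsRat d ρ') (hH : H.IsConnected)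
    (u : M →ₗ[ℂ] N) (hu : ∀ (x : 𝔩) m, u ⁅x, m⁆ = ⁅x, u m⁆) (g : H.Gp) (m : M) :
    u (ρ g m) = ρ' g (u m) := by
  have hreg : ∀ m, ∃ (k : ℕ) (c : Fin k → H.Gp → ℂ) (v : Fin k → M), (∀ i, c i ∈ H.O) ∧
      ∀ g, ρ g⁻¹ m = ∑ i, c i g • v i := by
    intro m
    obtain ⟨k, c, v, hc, hv⟩ := exists_decomp_of_mem_regMaps (h.reg m)
    exact ⟨k, fun i g => c i g⁻¹, v, fun i => O_inv (hc i), fun g => hv g⁻¹⟩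
  have hder : ∀ (x : 𝔩) (m : M) (l : N →ₗ[ℂ] ℂ),
      d.D x (fun k => l (ρ' k (u (ρ k⁻¹ m)))) = 0 := by
    intro x m l
    obtain ⟨k, c, v, hc, hv⟩ := hreg m
    have hm : ∑ i, c i 1 • v i = m := by rw [← hv]; simp
    have h1 : ∑ i, d.D x (c i) • v i = - ⁅x, m⁆ := by
      refine dual_ext fun l => ?_
      have h2 := h.der_sum x l hc v
      have h3 : (fun g => l (ρ g (∑ i, c i g • v i))) = fun _ => l m := by
        funext g
        rw [← hv, ← Module.End.mul_apply, ← map_mul, mul_inv_cancel, map_one]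
        rfl
      rw [h3, (d.leib x).const, hm] at h2
      rw [map_neg]
      exact eq_neg_of_add_eq_zero_left h2.symm
    have h2 : ∀ g, u (ρ g⁻¹ m) = ∑ i, c i g • u (v i) := fun g => by
      rw [hv, map_sum]; simp
    have h3 : (∑ i, d.D x (c i) • u (v i)) + ⁅x, ∑ i, c i 1 • u (v i)⁆ = 0 := by
      have h4 := congrArg u h1
      rw [map_sum, map_neg] at h4
      simp only [map_smul] at h4
      rw [h4, ← h2, inv_one, map_one, Module.End.one_apply, ← hu, neg_add_cancel]
    simp only [h2]
    rw [h'.der_sum x l hc, ← map_add, h3, map_zero]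
  have hconst : ∀ l : N →ₗ[ℂ] ℂ, l (ρ' g (u (ρ g⁻¹ (ρ g m)))) = l (ρ' 1 (u (ρ 1⁻¹ (ρ g m)))) := by
    intro l
    refine eq_const_of_linv_eq_zero (d := d) hH (f := fun k => l (ρ' k (u (ρ k⁻¹ (ρ g m))))) ?_
      (fun x => ?_) g
    · obtain ⟨k, c, v, hc, hv⟩ := hreg (ρ g m)
      have : (fun k => l (ρ' k (u (ρ k⁻¹ (ρ g m))))) =
          ∑ i, c i * fun k => l (ρ' k (u (v i))) := by
        funext k
        rw [hv, Finset.sum_apply, map_sum, map_sum, map_sum]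
        exact Finset.sum_congr rfl fun i _ => by simp
      rw [this]
      exact Subalgebra.sum_mem _ fun i _ => Subalgebra.mul_mem _ (hc i) (h'.coeff_mem _ l)
    · funext k
      rw [linv_apply]
      refine Eq.trans ?_ (hder x (ρ k⁻¹ (ρ g m)) (l ∘ₗ ρ' k))
      congr 1
      funext j
      simp only [mul_inv_rev, map_mul]
      rfl
  refine dual_ext fun l => ?_
  have := hconst l
  rw [← Module.End.mul_apply (ρ g⁻¹), ← map_mul, inv_mul_cancel, inv_one, map_one, map_one] at this
  exact this.symm

end Equivariance

end AffAlgGroup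

namespace AffAlgGroup

section Unipotent

variable {H : AffAlgGroup}

/-- A faithful regular matrix representation by upper unitriangular matrices. -/
structure IsUniMat {m : ℕ} (T : Fin m → Fin m → H.Gp → ℂ) : Prop where
  mem : ∀ a b, T a b ∈ H.O
  mul : ∀ a b g h, T a b (g * h) = ∑ c, T a c g * T c b h
  one : ∀ a b, T a b 1 = if a = b then 1 else 0
  diag : ∀ a g, T a a g = 1
  lower : ∀ a b g, b < a → T a b g = 0
  inj : ∀ g, (∀ a b, T a b g = T a b 1) → g = 1

lemma IsUnipotent.exists_isUniMat (hH : H.IsUnipotent) :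
    ∃ (m : ℕ) (T : Fin m → Fin m → H.Gp → ℂ), IsUniMat T := by
  obtain ⟨m, φ, ⟨P, hP⟩, hinj, htri, hmul⟩ := hH
  have hm : ∀ a b (g h : H.Gp), matEntry (φ (g * h).1) a b =
      ∑ c, matEntry (φ g.1) a c * matEntry (φ h.1) c b := by
    intro a b g h
    rw [mul_val, hmul _ g.2 _ h.2, matEntry, matMulPt, Equiv.symm_apply_apply]
  refine ⟨m, fun a b g => matEntry (φ g.1) a b, ⟨fun a b => ?_, hm, fun a b => ?_,
    fun a g => (htri _ g.2).1 a, fun a b g => (htri _ g.2).2 a b, fun g hg => ?_⟩⟩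
  · exact mem_O.2 ⟨P (finProdFinEquiv (a, b)), fun x => hP x.1 x.2 _⟩
  · let A : Matrix (Fin m) (Fin m) ℂ := fun a b => matEntry (φ (1 : H.Gp).1) a b
    have h1 : A * A = A := by
      ext a b
      rw [Matrix.mul_apply]
      exact (hm a b 1 1).symm.trans (by rw [mul_one])
    have h2 : A.det = 1 := by
      rw [Matrix.det_of_isUpperTriangular fun a b hab => (htri _ (1 : H.Gp).2).2 a b hab]
      exact Finset.prod_eq_one fun a _ => (htri _ (1 : H.Gp).2).1 a
    have h3 : IsUnit A := (Matrix.isUnit_iff_isUnit_det A).2 (h2 ▸ isUnit_one)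
    have h4 : A = 1 := h3.mul_left_cancel (h1.trans (mul_one A).symm)
    have := congrFun (congrFun h4 a) b
    rwa [Matrix.one_apply] at this
  · refine Subtype.ext (hinj g.2 (1 : H.Gp).2 (funext fun idx => ?_))
    have := hg (finProdFinEquiv.symm idx).1 (finProdFinEquiv.symm idx).2
    simpa only [matEntry, Prod.mk.eta, Equiv.apply_symm_apply] using this

variable {𝔩 : Type} [LieRing 𝔩] [LieAlgebra ℂ 𝔩] {d : LieDat H 𝔩}
variable {m : ℕ} {T : Fin m → Fin m → H.Gp → ℂ}

lemma IsUniMat.der_eq_zero (hT : IsUniMat T) (x : 𝔩) {a b : Fin m} (h : b ≤ a) :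
    d.D x (T a b) = 0 := by
  rcases h.lt_or_eq with h | rfl
  · rw [show T a b = 0 from funext fun g => hT.lower a b g h, map_zero]
  · rw [show T b b = fun _ => 1 from funext fun g => hT.diag b g, (d.leib x).const]

lemma IsUniMat.linv_eq (hT : IsUniMat T) (x : 𝔩) (a b : Fin m) (g : H.Gp) :
    linv (d.D x) (T a b) g = ∑ c, T a c g * d.D x (T c b) := by
  have : (fun h => T a b (g * h)) = ∑ c, T a c g • T c b := by
    funext h
    rw [hT.mul, Finset.sum_apply]
    rfl
  rw [linv_apply, this, map_sum]
  exact Finset.sum_congr rfl fun c _ => by rw [map_smul, smul_eq_mul]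

lemma IsUniMat.eq_zero_of_der (hT : IsUniMat T) {x : 𝔩} (hx : ∀ a b, d.D x (T a b) = 0) :
    x = 0 := by
  have hlinv : ∀ a b, linv (d.D x) (T a b - fun _ => T a b 1) = 0 := by
    intro a b
    funext g
    rw [map_sub, Pi.sub_apply, hT.linv_eq, linv_apply (d.D _) (fun _ => T a b 1),
      (d.leib _).const, sub_zero]
    exact Finset.sum_eq_zero fun c _ => by rw [hx, mul_zero]
  refine d.inj _ fun f hf => pointDer_eq_zero_of_taylor (d.leib _)
    (F := fun j : Fin m × Fin m => T j.1 j.2 - fun _ => T j.1 j.2 1)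
    (fun j => Subalgebra.sub_mem _ (hT.mem _ _) (const_mem_O _)) (fun g hg => ?_) (fun j k => ?_) hf
  · exact hT.inj g fun a b => sub_eq_zero.1 (hg (a, b))
  · cases k with
    | zero => simp
    | succ k =>
      rw [Function.iterate_succ_apply, hlinv]
      have : ∀ k, (linv (d.D x))^[k] 0 = 0 := fun k => by
        induction k with
        | zero => rfl
        | succ k ih => rw [Function.iterate_succ_apply, map_zero, ih]
      rw [this, Pi.zero_apply]

/-- The conjugate semisimple part vanishes on the Lie algebra of a unipotent group. -/
lemma IsUniMat.sig_eq_zero (hT : IsUniMat T) (x : 𝔩) : d.sig x = 0 := by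
  let t : Fin m → Fin m → Jmod d ℂ := fun a b =>
    Jmod.mk (T a b) (mem_regMaps_complex.2 (hT.mem a b))
  have ht : ∀ a b, Jmod.val d ℂ (t a b) = T a b := fun a b => rfl
  have hlie : ∀ a b, ⁅x, t a b⁆ = ∑ c, d.D x (T c b) • t a c := by
    intro a b
    refine Jmod.val_injective (funext fun g => ?_)
    rw [Jmod.lie_val_complex, ht, hT.linv_eq, map_sum, Finset.sum_apply]
    refine Finset.sum_congr rfl fun c _ => ?_
    rw [map_smul, Pi.smul_apply, ht, smul_eq_mul, mul_comm]
  have hnil : ∀ (n : ℕ) a (b : Fin m), b.1 < n → (LieModule.toEnd ℂ 𝔩 (Jmod d ℂ) x ^ n) (t a b) = 0 := by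
    intro n
    induction n with
    | zero => intro a b hb; omega
    | succ n ih =>
      intro a b hb
      rw [pow_succ, Module.End.mul_apply, LieModule.toEnd_apply_apply, hlie, map_sum]
      refine Finset.sum_eq_zero fun c _ => ?_
      rw [map_smul]
      rcases lt_or_ge c b with h | h
      · rw [ih a c (by have : c.1 < b.1 := h; omega), smul_zero]
      · rw [hT.der_eq_zero x h, zero_smul]
  have hsig : ∀ a b, ⁅d.sig x, t a b⁆ = 0 := by
    intro a b
    have := (Jmod.isRat (d := d) (M := ℂ)).isGood.conj x 0 (t a b) ?_
    · rw [this, map_zero, zero_smul]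
    · rw [Module.End.mem_maxGenEigenspace]
      exact ⟨b.1 + 1, by rw [zero_smul, sub_zero]; exact hnil _ a b (Nat.lt_succ_self _)⟩
  refine hT.eq_zero_of_der (d := d) fun a b => ?_
  have h1 := congrFun (congrArg (Jmod.val d ℂ) (hsig a b)) 1
  rw [Jmod.lie_val_complex, ht, linv_apply] at h1
  simpa only [one_mul, map_zero, Pi.zero_apply] using h1

variable {M : Type} [AddCommGroup M] [Module ℂ M] [LieRingModule 𝔩 M] [LieModule ℂ 𝔩 M]
  {ρ : Representation ℂ H.Gp M}

lemma IsRat.isNilpotent_toEnd (h : IsRat d ρ) (hH : H.IsUnipotent) [FiniteDimensional ℂ M] (x : 𝔩) :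
    IsNilpotent (LieModule.toEnd ℂ 𝔩 M x) := by
  obtain ⟨m, T, hT⟩ := hH.exists_isUniMat
  refine h.isGood.isNilpotent_of_trace_eq_zero ?_
  rw [hT.sig_eq_zero, map_zero]

lemma IsRat.exists_pow_eq_zero (h : IsRat d ρ) (hH : H.IsUnipotent) (x : 𝔩) (v : M) :
    ∃ k, (LieModule.toEnd ℂ 𝔩 M x ^ k) v = 0 := by
  obtain ⟨W, _, hv, hW⟩ := h.exists_fd v
  obtain ⟨i₁, i₂, ρW, hρ, _, hl⟩ := h.exists_sub W hW
  obtain ⟨k, hk⟩ := hρ.isNilpotent_toEnd hH x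
  have : ∀ k, ∀ w : W, (((LieModule.toEnd ℂ 𝔩 W x ^ k) w : W) : M) =
      (LieModule.toEnd ℂ 𝔩 M x ^ k) (w : M) := by
    intro k
    induction k with
    | zero => intro w; rfl
    | succ k ih =>
      intro w
      rw [pow_succ, Module.End.mul_apply, ih, pow_succ, Module.End.mul_apply]
      exact congrArg _ (hl x w)
  exact ⟨k, by rw [← this k ⟨v, hv⟩, hk]; rfl⟩

/-- A connected unipotent group has nonzero fixed vectors. -/
lemma IsRat.exists_fixed (h : IsRat d ρ) (hH : H.IsUnipotent) (hc : H.IsConnected)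
    [FiniteDimensional ℂ M] [Nontrivial M] : ∃ v : M, v ≠ 0 ∧ ∀ g, ρ g v = v := by
  have hnil : LieModule.IsNilpotent 𝔩 M := by
    have := d.finiteDimensional
    rw [LieModule.isNilpotent_iff_forall' (R := ℂ)]
    exact h.isNilpotent_toEnd hH
  have := LieModule.nontrivial_max_triv_of_isNilpotent ℂ 𝔩 M
  obtain ⟨v, hv⟩ := exists_ne (0 : LieModule.maxTrivSubmodule ℂ 𝔩 M)
  exact ⟨v, fun h => hv (Subtype.ext h), h.rep_eq_of_lie_eq_zero hc
    ((LieModule.mem_maxTrivSubmodule ℂ 𝔩 M v.1).1 v.2)⟩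

end Unipotent

end AffAlgGroup

namespace AffAlgGroup

variable {G : AffAlgGroup} {U L : AlgSubgroup G}

lemma incl_injective (K : AlgSubgroup G) : Function.Injective K.incl := fun _ _ h =>
  Subtype.ext (congrArg (fun k : G.Gp => k.1) h)

/-- The projection of a semidirect product `U ⋊ L` onto `L`. -/
structure IsLeviProj (U L : AlgSubgroup G) (P : G.Gp →* L.toGrp.Gp) : Prop where
  left : ∀ g, ∃ u, g = U.incl u * L.incl (P g)
  on_L : ∀ l, P (L.incl l) = l
  on_U : ∀ u, P (U.incl u) = 1

lemma IsLeviProj.right {P : G.Gp →* L.toGrp.Gp} (hP : IsLeviProj U L P) (g : G.Gp) :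
    ∃ u, g = L.incl (P g) * U.incl u := by
  obtain ⟨u, hu⟩ := hP.left g⁻¹
  refine ⟨u⁻¹, ?_⟩
  rw [map_inv, map_inv, ← inv_inj, mul_inv_rev, inv_inv, inv_inv] at hu
  rw [map_inv]
  exact hu

lemma exists_isLeviProj (hU : U.IsNormal) (hi : U.carrier ∩ L.carrier = {G.one})
    (hd : ∀ x ∈ G.carrier, ∃ u ∈ U.carrier, ∃ l ∈ L.carrier, x = G.mul u l) :
    ∃ P : G.Gp →* L.toGrp.Gp, IsLeviProj U L P := by
  have hd' : ∀ g : G.Gp, ∃ (l : L.toGrp.Gp) (u : U.toGrp.Gp), g = U.incl u * L.incl l := by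
    intro g
    obtain ⟨u, hu, l, hl, h⟩ := hd g.1 g.2
    exact ⟨⟨l, hl⟩, ⟨u, hu⟩, Subtype.ext h⟩
  have huniq : ∀ (u u' : U.toGrp.Gp) (l l' : L.toGrp.Gp),
      U.incl u * L.incl l = U.incl u' * L.incl l' → l = l' := by
    intro u u' l l' h
    have h1 : U.incl (u'⁻¹ * u) = L.incl (l' * l⁻¹) := by
      rw [map_mul, map_mul, map_inv, map_inv]
      rw [inv_mul_eq_iff_eq_mul, ← mul_assoc, ← h, mul_inv_cancel_right]
    have h2 : (L.incl (l' * l⁻¹)).1 ∈ U.carrier ∩ L.carrier :=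
      ⟨h1 ▸ (u'⁻¹ * u).2, (l' * l⁻¹).2⟩
    rw [hi] at h2
    have h3 : L.incl (l' * l⁻¹) = L.incl 1 := by
      rw [map_one]; exact Subtype.ext h2
    exact (mul_inv_eq_one.1 (incl_injective L h3)).symm
  choose P u hPu using hd'
  have hconj : ∀ (g : G.Gp) (v : U.toGrp.Gp), ∃ w : U.toGrp.Gp, g * U.incl v = U.incl w * g := by
    intro g v
    let w : U.toGrp.Gp := ⟨_, hU g.1 g.2 v.1 v.2⟩
    have : U.incl w = g * (U.incl v * g⁻¹) := Subtype.ext rfl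
    exact ⟨w, by rw [this]; group⟩
  refine ⟨MonoidHom.mk' P fun g h => ?_, ⟨fun g => ⟨u g, hPu g⟩, fun l => ?_, fun v => ?_⟩⟩
  · obtain ⟨w, hw⟩ := hconj (L.incl (P g)) (u h)
    refine huniq (u (g * h)) (u g * w) _ _ ?_
    rw [← hPu, map_mul, map_mul, mul_assoc, ← mul_assoc (U.incl w), ← hw, mul_assoc, ← hPu,
      ← mul_assoc, ← hPu]
  · exact huniq (u (L.incl l)) 1 _ _ ((hPu _).symm.trans (by rw [map_one, one_mul]))
  · exact huniq (u (U.incl v)) v _ _ ((hPu _).symm.trans (by rw [map_one, mul_one]))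

variable {𝔤 : Type} [LieRing 𝔤] [LieAlgebra ℂ 𝔤] {d : LieDat G 𝔤} {𝔫 𝔥 : LieSubalgebra ℂ 𝔤}

/-- The coefficients of a rational module composed with the projection onto `L` are regular. -/
lemma IsLeviProj.coeff_mem {P : G.Gp →* L.toGrp.Gp} (hP : IsLeviProj U L P) (hU : U.IsNormal)
    (sU : SubDat d U 𝔫) (sL : SubDat d L 𝔥) (hUc : U.toGrp.IsConnected)
    (hUu : U.toGrp.IsUnipotent) (hLc : L.toGrp.IsConnected) (hL : IsRedLie sL.dat.sig) :
    ∀ (n : ℕ) (E : Type) [AddCommGroup E] [Module ℂ E] [LieRingModule 𝔤 E] [LieModule ℂ 𝔤 E]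
      [FiniteDimensional ℂ E] (ρ : Representation ℂ G.Gp E), IsRat d ρ → Module.finrank ℂ E = n →
      ∀ e (l : E →ₗ[ℂ] ℂ), (fun g => l (ρ (L.incl (P g)) e)) ∈ G.O := by
  intro n
  induction n using Nat.strong_induction_on with
  | _ n ih =>
  intro E _ _ _ _ _ ρ h hn e l
  rcases subsingleton_or_nontrivial E with hs | hs
  · have : (fun g => l (ρ (L.incl (P g)) e)) = fun _ => 0 := funext fun g => by
      rw [Subsingleton.elim (ρ (L.incl (P g)) e) 0, map_zero]
    rw [this]
    exact const_mem_O 0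
  let F : Submodule ℂ E :=
    { carrier := {v | ∀ u, ρ (U.incl u) v = v}
      add_mem' := fun {a b} ha hb u => by rw [map_add, ha, hb]
      zero_mem' := fun u => map_zero _
      smul_mem' := fun c a ha u => by rw [map_smul, ha] }
  have hF : ∀ g, ∀ m ∈ F, ρ g m ∈ F := by
    intro g m hm u
    let w : U.toGrp.Gp := ⟨_, hU (g⁻¹).1 (g⁻¹).2 u.1 u.2⟩
    have hw : U.incl w = g⁻¹ * (U.incl u * g⁻¹⁻¹) := Subtype.ext rfl
    have : U.incl u * g = g * U.incl w := by rw [hw]; group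
    rw [← Module.End.mul_apply, ← map_mul, this, map_mul, Module.End.mul_apply, hm w]
  have hFreg : ∀ m ∈ F, ∀ g, ρ (L.incl (P g)) m = ρ g m := by
    intro m hm g
    obtain ⟨u, hu⟩ := hP.left g
    conv_rhs => rw [hu, map_mul, Module.End.mul_apply]
    exact (hF _ m hm u).symm
  obtain ⟨v, hv, hvU⟩ := (h.restrict sU).exists_fixed hUu hUc
  obtain ⟨i₁, i₂, ρF, hρF, hρFv, hlF⟩ := h.exists_sub F hF
  obtain ⟨Q, _, _, _, _, ρQ, q, hQ, hq, hqF, hqρ, hql⟩ :=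
    h.exists_quotient (ρ := ρF) F.subtype (fun g m => hρFv g m) (fun x m => hlF x m)
  have : FiniteDimensional ℂ Q := Module.Finite.of_surjective q hq
  have hlt : Module.finrank ℂ Q < n := by
    have h1 := LinearMap.finrank_range_add_finrank_ker q
    rw [LinearMap.range_eq_top.2 hq, finrank_top, hn] at h1
    have h2 : 0 < Module.finrank ℂ (LinearMap.ker q) := by
      have : Nontrivial (LinearMap.ker q) :=
        ⟨⟨v, (hqF v).2 ⟨⟨v, hvU⟩, rfl⟩⟩, 0, fun h => hv (congrArg Subtype.val h)⟩
      exact Module.finrank_pos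
    omega
  have := sL.dat.finiteDimensional
  obtain ⟨s, hs1, hs2⟩ := hL.exists_section (h.restrict sL).isGood (hQ.restrict sL).isGood q hq
    (fun x m => hql x m)
  have hsL : ∀ (k : L.toGrp.Gp) (w : Q), s (ρQ (L.incl k) w) = ρ (L.incl k) (s w) := fun k w =>
    (hQ.restrict sL).map_rep_of_map_lie (h.restrict sL) hLc s hs2 k w
  obtain ⟨f, hf⟩ := (hqF (e - s (q e))).1 (by rw [map_sub, hs1, sub_self])
  have hsplit : (fun g => l (ρ (L.incl (P g)) e)) =
      (fun g => (l ∘ₗ s) (ρQ (L.incl (P g)) (q e))) + fun g => l (ρ g f) := by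
    funext g
    have h1 : e = s (q e) + f := by
      have : (f : E) = e - s (q e) := hf
      rw [this]; abel
    rw [Pi.add_apply, LinearMap.comp_apply, hsL, ← hFreg f f.2, ← map_add, ← map_add, ← h1]
  rw [hsplit]
  exact Subalgebra.add_mem _ (ih _ hlt Q ρQ hQ rfl (q e) (l ∘ₗ s)) (h.coeff_mem _ l)

/-- The projection onto `L` is regular. -/
lemma IsLeviProj.coord_mem {P : G.Gp →* L.toGrp.Gp} (hP : IsLeviProj U L P) (hU : U.IsNormal)
    (sU : SubDat d U 𝔫) (sL : SubDat d L 𝔥) (hUc : U.toGrp.IsConnected)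
    (hUu : U.toGrp.IsUnipotent) (hLc : L.toGrp.IsConnected) (hL : IsRedLie sL.dat.sig)
    (i : Fin G.n) : (fun g => (L.incl (P g)).1 i) ∈ G.O := by
  obtain ⟨E, _, _, _, _, ρ, e, l, _, h, he⟩ := exists_faithful d
  have := hP.coeff_mem hU sU sL hUc hUu hLc hL _ E ρ h rfl (e i) l
  simpa only [he] using this

end AffAlgGroup

namespace AffAlgGroup

variable {G : AffAlgGroup} {U L : AlgSubgroup G}
variable {𝔤 : Type} [LieRing 𝔤] [LieAlgebra ℂ 𝔤] {d : LieDat G 𝔤} {𝔫 𝔥 : LieSubalgebra ℂ 𝔤}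

lemma IsLeviProj.comp_mem {P : G.Gp →* L.toGrp.Gp}
    (hreg : ∀ i, (fun g => (L.incl (P g)).1 i) ∈ G.O) {f : L.toGrp.Gp → ℂ} (hf : f ∈ L.toGrp.O) :
    (fun g => f (P g)) ∈ G.O := by
  obtain ⟨F, hF, hfF⟩ := O_extend hf
  simp only [hfF]
  exact O_comp hreg hF

/-- The infinitesimal version of a Levi decomposition: projection onto the nilradical part. -/
lemma IsLeviProj.exists_lieProj {P : G.Gp →* L.toGrp.Gp} (hP : IsLeviProj U L P)
    (sU : SubDat d U 𝔫) (sL : SubDat d L 𝔥)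
    (hreg : ∀ i, (fun g => (L.incl (P g)).1 i) ∈ G.O) :
    ∃ π : 𝔤 →ₗ[ℂ] 𝔤, (∀ y, π y ∈ 𝔫) ∧ (∀ y, y - π y ∈ 𝔥) ∧ (∀ y ∈ 𝔥, π y = 0) ∧
      ∀ y ∈ 𝔫, π y = y := by
  have hex : ∀ x : 𝔤, ∃ y : 𝔥, ∀ f ∈ L.toGrp.O, sL.dat.D y f = d.D x (fun g => f (P g)) := by
    intro x
    exact sL.dat.surj
      { toFun := fun f => d.D x fun g => f (P g)
        map_add' := fun f f' => map_add (d.D x) (fun g => f (P g)) (fun g => f' (P g))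
        map_smul' := fun c f => map_smul (d.D x) c (fun g => f (P g)) }
      (fun f hf f' hf' => by
        have := d.leib x _ (comp_mem hreg hf) _ (comp_mem hreg hf')
        simp only [map_one] at this
        exact this)
  choose p hp using hex
  have hpu : ∀ (x : 𝔤) (y : 𝔥), (∀ f ∈ L.toGrp.O, sL.dat.D y f = d.D x (fun g => f (P g))) →
      p x = y := by
    intro x y hy
    refine sub_eq_zero.1 (sL.dat.inj _ fun f hf => ?_)
    rw [map_sub, LinearMap.sub_apply, hp x f hf, hy f hf, sub_self]
  let pl : 𝔤 →ₗ[ℂ] 𝔤 :=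
    { toFun := fun x => (p x : 𝔤)
      map_add' := fun x y => congrArg Subtype.val (hpu (x + y) (p x + p y) fun f hf => by
        rw [map_add, LinearMap.add_apply, hp x f hf, hp y f hf, map_add, LinearMap.add_apply])
      map_smul' := fun c x => congrArg Subtype.val (hpu (c • x) (c • p x) fun f hf => by
        rw [map_smul, LinearMap.smul_apply, hp x f hf, map_smul, LinearMap.smul_apply]) }
  refine ⟨LinearMap.id - pl, fun y => sU.mem _ fun f hf h0 => ?_, fun y => ?_, fun y hy => ?_,
    fun y hy => ?_⟩
  · have h1 : d.D (pl y) f = d.D y (fun g => f (L.incl (P g))) :=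
      (sL.compat (p y) f hf).trans (hp y _ (O_restrict hf))
    rw [LinearMap.sub_apply, LinearMap.id_apply, map_sub, LinearMap.sub_apply, h1, sub_eq_zero]
    choose a ha using hP.left
    have hareg : ∀ i, (fun g => (U.incl (a g)).1 i) ∈ G.O := by
      have : ∀ g, U.incl (a g) = g * (L.incl (P g))⁻¹ := fun g => by
        rw [eq_mul_inv_iff_mul_eq, ← ha]
      simp only [this]
      exact mul_coord_mem coord_mem_O (inv_coord_mem hreg)
    obtain ⟨k, u, v, hu, hv, huv⟩ := exists_mul_decomp hf
    have ha1 : U.incl (a 1) = 1 := by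
      have := ha 1
      rw [map_one, map_one, mul_one] at this
      exact this.symm
    have hP1 : L.incl (P 1) = 1 := by rw [map_one, map_one]
    have h2 : f = ∑ i, (fun g => u i (U.incl (a g))) * fun g => v i (L.incl (P g)) := by
      funext g
      conv_lhs => rw [ha g, huv]
      rw [Finset.sum_apply]
      rfl
    have h3 : ∀ g, f (L.incl (P g)) = (∑ i, u i 1 • fun g => v i (L.incl (P g))) g := fun g => by
      rw [← one_mul (L.incl (P g)), huv, Finset.sum_apply]
      rfl
    have h4 : (∑ i, v i 1 • fun g => u i (U.incl (a g))) = 0 := by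
      funext g
      rw [Finset.sum_apply, Pi.zero_apply, ← h0 (a g), ← mul_one (U.incl (a g)), huv]
      exact Finset.sum_congr rfl fun i _ => mul_comm _ _
    have h5 := congrArg (d.D y) h4
    rw [map_zero, map_sum] at h5
    rw [funext h3, map_sum]
    conv_lhs => rw [h2, map_sum]
    rw [← add_zero (∑ i, (d.D y) (u i 1 • _)), ← h5, ← Finset.sum_add_distrib]
    refine Finset.sum_congr rfl fun i _ => ?_
    rw [d.leib y _ (O_comp hareg (hu i)) _ (O_comp hreg (hv i)), map_smul, map_smul, smul_eq_mul,
      smul_eq_mul, ha1, hP1]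
  · have : y - (LinearMap.id - pl : 𝔤 →ₗ[ℂ] 𝔤) y = p y := sub_sub_cancel y (pl y)
    rw [this]
    exact (p y).2
  · have : p y = ⟨y, hy⟩ := hpu y ⟨y, hy⟩ fun f hf => by
      have := sL.compat ⟨y, hy⟩ _ (comp_mem hreg hf)
      simp only [hP.on_L] at this
      exact this.symm
    exact sub_eq_zero.2 (congrArg Subtype.val this).symm
  · have : p y = 0 := hpu y 0 fun f hf => by
      have := sU.compat ⟨y, hy⟩ _ (comp_mem hreg hf)
      simp only [hP.on_U, (sU.dat.leib _).const] at this
      rw [this, map_zero, LinearMap.zero_apply]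
    have h0 : pl y = 0 := congrArg Subtype.val this
    rw [LinearMap.sub_apply, h0, sub_zero, LinearMap.id_apply]

/-- The ambient Lie algebra is a good module over the Lie algebra of a subgroup. -/
lemma SubDat.isGood (sL : SubDat d L 𝔥) : IsGood sL.dat.sig 𝔤 := by
  obtain ⟨E, _, _, _, _, ρ, e, l, _, h, he⟩ := exists_faithful d
  have hE := (h.restrict sL).isGood
  refine (hE.hom hE).of_injective
    (LieModule.toEnd ℂ 𝔤 E : 𝔤 →ₗ[ℂ] (E →ₗ[ℂ] E)) (fun x y hxy => ?_) (fun x y => ?_)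
  · refine sub_eq_zero.1 (h.eq_zero_of_coeff he fun v => ?_)
    have := LinearMap.congr_fun hxy v
    rw [sub_lie, sub_eq_zero]
    exact this
  · refine LinearMap.ext fun v => ?_
    rw [LieHom.lie_apply]
    exact lie_lie (x : 𝔤) y v

end AffAlgGroup

section Triangular

variable {𝔨 J : Type} [LieRing 𝔨] [LieAlgebra ℂ 𝔨] [AddCommGroup J] [Module ℂ J]
  [LieRingModule 𝔨 J] [LieModule ℂ 𝔨 J]

/-- Acyclicity from a codimension one ideal and an operator dual to a complementary element. -/
lemma IsAcyclicLie.of_dual_operator (𝔨' : LieSubalgebra ℂ 𝔨) (ξ : 𝔨 →ₗ[ℂ] ℂ)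
    (hξ : ∀ y, y ∈ 𝔨' ↔ ξ y = 0) (hlie : ∀ y z : 𝔨, ξ ⁅y, z⁆ = 0) (x : 𝔨) (hx : ξ x = 1)
    (τ : Module.End ℂ J) (hτ : ∀ (y : 𝔨) F, ⁅y, τ F⁆ = τ ⁅y, F⁆ + ξ y • F)
    (hnil : ∀ F, ∃ k, (LieModule.toEnd ℂ 𝔨 J x ^ k) F = 0) (h : IsAcyclicLie 𝔨' J) :
    IsAcyclicLie 𝔨 J := by
  refine h.of_codim_one 𝔨' ξ hξ hlie x hx fun f hf => ?_
  have hpow : ∀ (j : ℕ) F, ⁅x, (τ ^ (j + 1)) F⁆ = (τ ^ (j + 1)) ⁅x, F⁆ + (j + 1 : ℂ) • (τ ^ j) F := by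
    intro j
    induction j with
    | zero => intro F; simp [hτ, hx]
    | succ j ih =>
      intro F
      rw [pow_succ' τ (j + 1), Module.End.mul_apply, hτ, ih, hx, map_add, map_smul, one_smul,
        ← Module.End.mul_apply, ← Module.End.mul_apply, ← pow_succ', ← pow_succ', add_assoc]
      congr 1
      push_cast
      module
  have hinv : ∀ (j : ℕ) F, (∀ y ∈ 𝔨', ⁅y, F⁆ = 0) → ∀ y ∈ 𝔨', ⁅y, (τ ^ j) F⁆ = 0 := by
    intro j F hF y hy
    induction j with
    | zero => simpa using hF y hy
    | succ j ih =>
      rw [pow_succ', Module.End.mul_apply, hτ, ih, map_zero, zero_add, (hξ y).1 hy, zero_smul]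
  have key : ∀ (k : ℕ) (F : J), (∀ y ∈ 𝔨', ⁅y, F⁆ = 0) → (LieModule.toEnd ℂ 𝔨 J x ^ k) F = 0 →
      ∀ j : ℕ, ∃ g, (∀ y ∈ 𝔨', ⁅y, g⁆ = 0) ∧ ⁅x, g⁆ = (τ ^ j) F := by
    intro k
    induction k with
    | zero =>
      intro F _ h0 j
      have h0 : F = 0 := h0
      exact ⟨0, fun y _ => lie_zero y, by rw [h0, lie_zero, map_zero]⟩
    | succ k ih =>
      intro F hF h0 j
      have hxF : ∀ y ∈ 𝔨', ⁅y, ⁅x, F⁆⁆ = 0 := fun y hy => by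
        rw [leibniz_lie, hF y hy, lie_zero, hF _ ((hξ _).2 (hlie y x)), add_zero]
      obtain ⟨g', hg', hxg'⟩ := ih ⁅x, F⁆ hxF (by
        rw [pow_succ, Module.End.mul_apply] at h0
        exact h0) (j + 1)
      have hj : (j + 1 : ℂ) ≠ 0 := Nat.cast_add_one_ne_zero j
      refine ⟨(j + 1 : ℂ)⁻¹ • ((τ ^ (j + 1)) F - g'), fun y hy => ?_, ?_⟩
      · rw [lie_smul, lie_sub, hinv _ F hF y hy, hg' y hy, sub_zero, smul_zero]
      · rw [lie_smul, lie_sub, hpow, hxg', add_sub_cancel_left, inv_smul_smul₀ hj]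
  obtain ⟨k, hk⟩ := hnil f
  obtain ⟨g, hg, hxg⟩ := key k f hf hk 0
  exact ⟨g, hg, hxg⟩

/-- Acyclicity of a module with a triangular family of operators dual to the Lie algebra. -/
theorem IsAcyclicLie.of_triangular [Nontrivial J] {m : ℕ} (τ : Fin m → Fin m → Module.End ℂ J)
    (hdiag : ∀ a, τ a a = 1) (hlow : ∀ a b, b < a → τ a b = 0) :
    ∀ (n : ℕ) (𝔨 : Type) [LieRing 𝔨] [LieAlgebra ℂ 𝔨] [LieRingModule 𝔨 J] [LieModule ℂ 𝔨 J]
      [FiniteDimensional ℂ 𝔨] (Y : Fin m → Fin m → 𝔨 →ₗ[ℂ] ℂ),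
      (∀ a b, b ≤ a → Y a b = 0) → (∀ y, (∀ a b, Y a b y = 0) → y = 0) →
      (∀ (y : 𝔨) a b F, ⁅y, τ a b F⁆ = τ a b ⁅y, F⁆ + ∑ c, Y c b y • τ a c F) →
      (∀ (y : 𝔨) F, ∃ k, (LieModule.toEnd ℂ 𝔨 J y ^ k) F = 0) →
      Module.finrank ℂ 𝔨 = n → IsAcyclicLie 𝔨 J := by
  classical
  intro n
  induction n with
  | zero =>
    intro 𝔨 _ _ _ _ _ Y _ _ _ _ hn
    have : Subsingleton 𝔨 := Module.finrank_zero_iff.1 hn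
    exact .of_subsingleton
  | succ n ih =>
    intro 𝔨 _ _ _ _ _ Y hYlow hYinj hτ hnil hn
    have hex : ∃ k, ∃ (a b : Fin m) (y : 𝔨), b.1 = a.1 + k ∧ Y a b y ≠ 0 := by
      have : Nontrivial 𝔨 := Module.nontrivial_of_finrank_pos (R := ℂ) (by omega)
      obtain ⟨y, hy⟩ := exists_ne (0 : 𝔨)
      have : ∃ a b, Y a b y ≠ 0 := by
        by_contra! h
        exact hy (hYinj y h)
      obtain ⟨a, b, hab⟩ := this
      have hlt : a < b := by
        by_contra hle
        exact hab (by rw [hYlow a b (not_lt.1 hle)]; rfl)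
      exact ⟨b.1 - a.1, a, b, y, by have : a.1 < b.1 := hlt; omega, hab⟩
    obtain ⟨a, b, y₀, hk, hy₀⟩ := Nat.find_spec hex
    have hmin := fun k (hk : k < Nat.find hex) => Nat.find_min hex hk
    set ξ := Y a b with hξdef
    have hcomm : ∀ (y : 𝔨) F, ⁅y, τ a b F⁆ = τ a b ⁅y, F⁆ + ξ y • F := by
      intro y F
      rw [hτ, Finset.sum_eq_single a]
      · rw [hdiag]; rfl
      · intro c _ hca
        rcases lt_or_gt_of_ne hca with h | h
        · rw [hlow a c h, LinearMap.zero_apply, smul_zero]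
        · suffices Y c b y = 0 by rw [this, zero_smul]
          rcases le_or_gt b c with h' | h'
          · rw [hYlow c b h']; rfl
          · by_contra hne
            have h1 : a.1 < c.1 := h
            have h2 : c.1 < b.1 := h'
            exact hmin (b.1 - c.1) (by omega) ⟨c, b, y, by omega, hne⟩
      · intro h; exact absurd (Finset.mem_univ a) h
    have hlie : ∀ y z : 𝔨, ξ ⁅y, z⁆ = 0 := by
      intro y z
      obtain ⟨F, hF⟩ := exists_ne (0 : J)
      have h1 := hcomm ⁅y, z⁆ F
      rw [lie_lie, hcomm z F, hcomm y F, lie_add, lie_add, hcomm, hcomm, lie_smul, lie_smul, lie_lie,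
        map_sub] at h1
      have h2 : ξ ⁅y, z⁆ • F = 0 := by
        rw [← sub_eq_zero] at h1
        rw [← neg_eq_zero, ← h1]
        abel
      exact (smul_eq_zero.1 h2).resolve_right hF
    let 𝔨' : LieSubalgebra ℂ 𝔨 :=
      { LinearMap.ker ξ with
        lie_mem' := fun {y z} _ _ => hlie y z }
    have hmem : ∀ y, y ∈ 𝔨' ↔ ξ y = 0 := fun y => Iff.rfl
    have hfin : Module.finrank ℂ 𝔨' = n := by
      have h1 := LinearMap.finrank_range_add_finrank_ker ξ
      have h2 : LinearMap.range ξ = ⊤ := LinearMap.range_eq_top.2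
        (LinearMap.surjective (fun h0 => hy₀ (by rw [h0]; rfl)))
      rw [h2, finrank_top, Module.finrank_self, hn] at h1
      have h3 : Module.finrank ℂ 𝔨' = Module.finrank ℂ (LinearMap.ker ξ) := rfl
      omega
    have h' : IsAcyclicLie 𝔨' J := by
      refine ih 𝔨' (fun a b => Y a b ∘ₗ (𝔨'.incl : 𝔨' →ₗ[ℂ] 𝔨)) (fun a b hab => ?_) (fun y hy => ?_)
        (fun y a b F => hτ y a b F) (fun y F => ?_) hfin
      · rw [hYlow a b hab, LinearMap.zero_comp]
      · exact Subtype.ext (hYinj y hy)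
      · exact hnil y F
    refine h'.of_dual_operator 𝔨' ξ hmem hlie ((ξ y₀)⁻¹ • y₀) ?_ (τ a b) hcomm (hnil _)
    rw [map_smul, smul_eq_mul, inv_mul_cancel₀ hy₀]

end Triangular

namespace AffAlgGroup

variable {G : AffAlgGroup} {U L : AlgSubgroup G}
variable {𝔤 : Type} [LieRing 𝔤] [LieAlgebra ℂ 𝔤] {d : LieDat G 𝔤} {𝔫 : LieSubalgebra ℂ 𝔤}

/-- Matrix functions on the unipotent factor extended to the whole group. -/
lemma IsLeviProj.exists_extension {P : G.Gp →* L.toGrp.Gp} (hP : IsLeviProj U L P)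
    (sU : SubDat d U 𝔫) (hreg : ∀ i, (fun g => (L.incl (P g)).1 i) ∈ G.O)
    {m : ℕ} {T : Fin m → Fin m → U.toGrp.Gp → ℂ} (hT : IsUniMat T) :
    ∃ t : Fin m → Fin m → Jmod d ℂ, (∀ a g, Jmod.val d ℂ (t a a) g = 1) ∧
      (∀ a b, b < a → t a b = 0) ∧
      ∀ (y : 𝔫) a b, ⁅(y : 𝔤), t a b⁆ = ∑ c, sU.dat.D y (T c b) • t a c := by
  choose u hu using hP.right
  have hu' : ∀ g, U.incl (u g) = (L.incl (P g))⁻¹ * g := fun g => by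
    rw [eq_inv_mul_iff_mul_eq, ← hu]
  have hureg : ∀ i, (fun g => (U.incl (u g)).1 i) ∈ G.O := by
    simp only [hu']
    exact mul_coord_mem (inv_coord_mem hreg) coord_mem_O
  have hmem : ∀ a b, (fun g => T a b (u g)) ∈ G.O := by
    intro a b
    obtain ⟨F, hF, hTF⟩ := O_extend (hT.mem a b)
    simp only [hTF]
    exact O_comp hureg hF
  have humul : ∀ g v, u (g * U.incl v) = u g * v := by
    intro g v
    refine incl_injective U ?_
    rw [hu', map_mul P, hP.on_U, mul_one, map_mul, hu', mul_assoc]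
  let t : Fin m → Fin m → Jmod d ℂ := fun a b =>
    Jmod.mk (fun g => T a b (u g)) (mem_regMaps_complex.2 (hmem a b))
  have ht : ∀ a b, Jmod.val d ℂ (t a b) = fun g => T a b (u g) := fun _ _ => rfl
  refine ⟨t, fun a g => hT.diag a _, fun a b h => Jmod.ext fun g => ?_, fun y a b => ?_⟩
  · rw [ht, map_zero]
    exact hT.lower a b _ h
  · refine Jmod.ext fun g => ?_
    rw [Jmod.lie_val_complex, ht, linv_apply, sU.compat y _ (O_mul_left (hmem a b) g)]
    simp only [humul]
    have := hT.linv_eq (d := sU.dat) y a b (u g)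
    rw [linv_apply] at this
    rw [this, map_sum, Finset.sum_apply]
    refine Finset.sum_congr rfl fun c _ => ?_
    rw [map_smul, Pi.smul_apply, ht, smul_eq_mul, mul_comm]

end AffAlgGroup

namespace AffAlgGroup

variable {G : AffAlgGroup} {U L : AlgSubgroup G}
variable {𝔤 : Type} [LieRing 𝔤] [LieAlgebra ℂ 𝔤] {d : LieDat G 𝔤} {𝔫 : LieSubalgebra ℂ 𝔤}

/-- Regular functions form an acyclic module over the Lie algebra of the unipotent factor. -/
lemma IsLeviProj.isAcyclicLie_jmod {P : G.Gp →* L.toGrp.Gp} (hP : IsLeviProj U L P)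
    (sU : SubDat d U 𝔫) (hreg : ∀ i, (fun g => (L.incl (P g)).1 i) ∈ G.O)
    (hUu : U.toGrp.IsUnipotent) (M : Type) [AddCommGroup M] [Module ℂ M] :
    IsAcyclicLie 𝔫 (Jmod d M) := by
  rcases subsingleton_or_nontrivial (Jmod d M) with hs | hs
  · intro p c _
    exact ⟨0, Subsingleton.elim (h := ⟨fun a b => by ext v; exact Subsingleton.elim _ _⟩) _ _⟩
  obtain ⟨m, T, hT⟩ := hUu.exists_isUniMat
  obtain ⟨t, ht1, ht0, ht⟩ := hP.exists_extension sU hreg hT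
  have := sU.dat.finiteDimensional
  refine IsAcyclicLie.of_triangular (fun a b => Jmod.act (t a b)) (fun a => ?_) (fun a b h => ?_) _
    𝔫 (fun a b => sU.dat.D.flip (T a b)) (fun a b h => ?_) (fun y hy => ?_) (fun y a b F => ?_)
    (fun y F => ?_) rfl
  · refine LinearMap.ext fun F => Jmod.ext fun g => ?_
    rw [Jmod.act_val, ht1, one_smul]
    rfl
  · rw [ht0 a b h, map_zero]
  · refine LinearMap.ext fun y => ?_
    exact hT.der_eq_zero y h
  · exact hT.eq_zero_of_der (d := sU.dat) hy
  · have h1 := Jmod.lie_act (y : 𝔤) (t a b) F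
    rw [ht y a b, map_sum, LinearMap.sum_apply, add_comm] at h1
    simp only [map_smul, LinearMap.smul_apply] at h1
    exact h1
  · exact ((Jmod.isRat).restrict sU).exists_pow_eq_zero hUu y F

end AffAlgGroup

/-- **Van Est theorem for algebraic group cohomology.** For a
connected algebraic group `G` with Levi subgroup `G_red` and a
finite-dimensional algebraic `G`-module `𝔞`, for every `p ≥ 0` there is an
isomorphism `H^p_alg(G, 𝔞) ≅ H^p(𝔤, 𝔤_red, 𝔞)` with the relative Lie algebra
cohomology of the pair `(𝔤, 𝔤_red)`. -/
theorem van_est_algebraic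
    (G : AffAlgGroup) (hG : G.IsConnected) (LD : LeviDecomposition G)
    (𝔤 : Type) [LieRing 𝔤] [LieAlgebra ℂ 𝔤] (e𝔤 : 𝔤 →ₗ[ℂ] Pt G.n)
    (h𝔤 : IsLieAlgebraOf G 𝔤 e𝔤)
    (𝔥 : LieSubalgebra ℂ 𝔤) (h𝔥 : IsLieSubalgebraOf LD.L e𝔤 𝔥)
    (m : ℕ) (r : AlgRep G m) [LieRingModule 𝔤 (Pt m)] [LieModule ℂ 𝔤 (Pt m)]
    (hder : IsDerivedAction r e𝔤)
    (p : ℕ) :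
    Nonempty (algH r p ≃+ relH 𝔥 (Pt m) p) := by
  obtain ⟨hUn, hUc, hUu, -⟩ := LD.Gu_radical
  have hfd := h𝔤.lieDat.finiteDimensional
  let 𝔫 : LieIdeal ℂ 𝔤 := AffAlgGroup.normalIdeal h𝔤.lieDat hUn
  have hn : IsLieSubalgebraOf LD.Gu e𝔤 (LieIdeal.toLieSubalgebra ℂ 𝔤 𝔫) := fun x =>
    (h𝔤.mem_tangentAt_iff LD.Gu x).symm
  have sU := h𝔤.subDat hn
  have sL := h𝔤.subDat h𝔥
  have hσ := AffAlgGroup.isRedLie_of_isReductive LD.L_reductive sL.dat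
  obtain ⟨P, hP⟩ := AffAlgGroup.exists_isLeviProj hUn LD.inter LD.decomp
  have hreg := hP.coord_mem hUn sU sL hUc hUu LD.L_connected hσ
  obtain ⟨π, hπn, hπ, hπ0, hπi⟩ := hP.exists_lieProj sU sL hreg
  have hπl : ∀ h ∈ 𝔥, ∀ y, π ⁅h, y⁆ = ⁅h, π y⁆ := by
    intro h hh y
    have h1 : ⁅h, y⁆ = ⁅h, π y⁆ + ⁅h, y - π y⁆ := by rw [← lie_add, add_sub_cancel]
    rw [h1, map_add, hπ0 _ (𝔥.lie_mem hh (hπ y)), add_zero]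
    exact hπi _ (𝔫.lie_mem (hπn y))
  obtain ⟨a⟩ := nonempty_algH r (r.isRat h𝔤 hder) p
  obtain ⟨c⟩ := nonempty_relH 𝔥 (Pt m) p
  obtain ⟨b⟩ := AffAlgGroup.nonempty_comparison (d := h𝔤.lieDat) 𝔥
    (fun M _ _ _ _ ρ h v hv g => h.rep_eq_of_lie_eq_zero hG hv g)
    (fun M _ _ q c hc hd => exists_relC_primitive hσ
      ((AffAlgGroup.Jmod.isRat).restrict sL).isGood sL.isGood 𝔫
      (LinearMap.codRestrict (𝔫 : Submodule ℂ 𝔤) π hπn) hπ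
      (fun y hy => Subtype.ext (hπ0 y hy)) (fun y => Subtype.ext (hπi y y.2))
      (hP.isAcyclicLie_jmod sU hreg hUu M) hc hd)
    (fun M Q _ _ _ _ _ _ _ _ ρ u hρ hu hl q c hc =>
      exists_relC_lift hσ (hρ.restrict sL).isGood sL.isGood π hπ hπ0 hπl hu hl hc)
    p (Pt m) r.rep (r.isRat h𝔤 hder)
  exact ⟨a.trans (b.trans c.symm)⟩
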